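/- Let X be a metrizable space. The hyperspace Fin(X) of nonempty finite subsets of X with the Vietoris topology is homeomorphic to ℓ₂^f(ℵ₀) (the linear span of the canonical orthonormal basis in separable Hilbert space ℓ₂, i.e., the space of finitely supported square-summable sequences with the subspace topology) if and only if X is non-degenerate, connected, locally path-connected, strongly countable-dimensional, and σ-compact. -/

import Mathlib

open Set Metric Filter TopologicalSpace

/-- The hyperspace of nonempty finite subsets of a metric space `X`, equipped with
the Hausdorff metric induced by the metric of `X` (which induces the Vietoris topology). -/
def FinHyp (X : Type*) [MetricSpace X] : Type _ :=
  {A : TopologicalSpace.NonemptyCompacts X // (A : Set X).Finite}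

noncomputable instance (X : Type*) [MetricSpace X] : MetricSpace (FinHyp X) :=
  Subtype.metricSpace

/-- The underlying set of a member of the hyperspace of nonempty finite subsets. -/
def FinHyp.toSet {X : Type*} [MetricSpace X] (A : FinHyp X) : Set X := A.1

/-- A closed subset `A` of a space `Y` is a strong `Z`-set provided that for every open
cover `𝒰` of `Y` there is a continuous map `f : Y → Y` which is `𝒰`-close to the identity
and whose image has closure disjoint from `A`. -/
def IsStrongZSet {Y : Type*} [TopologicalSpace Y] (A : Set Y) : Prop :=
  IsClosed A ∧
    ∀ 𝒰 : Set (Set Y), (∀ U ∈ 𝒰, IsOpen U) → ⋃₀ 𝒰 = Set.univ →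
      ∃ f : Y → Y, Continuous f ∧ (∀ y, ∃ U ∈ 𝒰, y ∈ U ∧ f y ∈ U) ∧
        closure (Set.range f) ∩ A = ∅

/-- `ℓ₂^f(ι)`: the linear span of the canonical orthonormal basis in the Hilbert space
`ℓ₂(ι)`, i.e. the subspace of finitely supported square-summable families, with the
subspace topology inherited from `ℓ₂(ι)`. -/
def l2Fin (ι : Type*) : Type _ :=
  {f : lp (fun _ : ι => ℝ) 2 // (Function.support (⇑f : ι → ℝ)).Finite}

noncomputable instance (ι : Type*) : TopologicalSpace (l2Fin ι) :=
  instTopologicalSpaceSubtype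

/-- A normal space `Y` has covering dimension `≤ n` if every finite open cover of `Y`
admits a finite open refinement in which every point belongs to at most `n + 1` members. -/
def CovDimLE (Y : Type*) [TopologicalSpace Y] (n : ℕ) : Prop :=
  ∀ 𝒰 : Finset (Set Y), (∀ U ∈ 𝒰, IsOpen U) → ⋃₀ (𝒰 : Set (Set Y)) = Set.univ →
    ∃ 𝒱 : Finset (Set Y), (∀ V ∈ 𝒱, IsOpen V) ∧ ⋃₀ (𝒱 : Set (Set Y)) = Set.univ ∧
      (∀ V ∈ 𝒱, ∃ U ∈ 𝒰, V ⊆ U) ∧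
      ∀ y : Y, {V : Set Y | V ∈ 𝒱 ∧ y ∈ V}.ncard ≤ n + 1

/-- A space is strongly countable-dimensional if it is a countable union of
finite-dimensional (in the sense of covering dimension) closed subsets. -/
def StronglyCountableDimensional (Y : Type*) [TopologicalSpace Y] : Prop :=
  ∃ C : ℕ → Set Y, (∀ n, IsClosed (C n)) ∧ (∀ n, ∃ m, CovDimLE ↥(C n) m) ∧
    ⋃ n, C n = Set.univ

open scoped Topology

namespace CurtisNhu

/-! ### Compact sets embeddable in Euclidean spaces -/

/-- A compact set admitting a continuous injection into a finite-dimensional Euclidean space. -/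
def EmbCompact {Z : Type*} [TopologicalSpace Z] (K : Set Z) : Prop :=
  IsCompact K ∧ ∃ (k : ℕ) (ψ : Z → Fin k → ℝ), ContinuousOn ψ K ∧ InjOn ψ K

/-- A countable union of compact sets embeddable in Euclidean spaces. -/
def SFD (Z : Type*) [TopologicalSpace Z] : Prop :=
  ∃ K : ℕ → Set Z, (∀ n, EmbCompact (K n)) ∧ ⋃ n, K n = univ

section Emb

variable {Z W : Type*} [TopologicalSpace Z] [TopologicalSpace W]

theorem EmbCompact.of_fintype {ι : Type*} [Finite ι] {K : Set Z} (hK : IsCompact K)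
    (ψ : Z → ι → ℝ) (h1 : ContinuousOn ψ K) (h2 : InjOn ψ K) : EmbCompact K := by
  have := Fintype.ofFinite ι
  let e := Fintype.equivFin ι
  refine ⟨hK, Fintype.card ι, fun z j => ψ z (e.symm j), ?_, ?_⟩
  · exact continuousOn_pi.2 fun j => (continuousOn_pi.1 h1) (e.symm j)
  · intro x hx y hy hxy
    refine h2 hx hy (funext fun i => ?_)
    simpa using congrFun hxy (e i)

theorem EmbCompact.mono {K L : Set Z} (hK : EmbCompact K) (hL : IsCompact L) (h : L ⊆ K) :
    EmbCompact L := by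
  obtain ⟨_, k, ψ, h1, h2⟩ := hK
  exact ⟨hL, k, ψ, h1.mono h, h2.mono h⟩

theorem embCompact_empty : EmbCompact (∅ : Set Z) :=
  ⟨isCompact_empty, 0, fun _ => 0, by simp, by simp⟩

theorem EmbCompact.image [T2Space Z] {K : Set W} (hK : EmbCompact K) {φ : W → Z}
    (h1 : ContinuousOn φ K) (h2 : InjOn φ K) : EmbCompact (φ '' K) := by
  obtain ⟨hc, k, ψ, h3, h4⟩ := hK
  have hne : K = ∅ ∨ Nonempty W := by
    rcases K.eq_empty_or_nonempty with h | ⟨x, _⟩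
    · exact Or.inl h
    · exact Or.inr ⟨x⟩
  rcases hne with rfl | hne
  · simpa using embCompact_empty
  have hinv : ∀ x ∈ K, Function.invFunOn φ K (φ x) = x := fun x hx =>
    h2.leftInvOn_invFunOn hx
  have hcinv : ContinuousOn (Function.invFunOn φ K) (φ '' K) := by
    rw [continuousOn_iff_isClosed]
    intro t ht
    refine ⟨φ '' (t ∩ K), ((hc.inter_left ht).image_of_continuousOn
      (h1.mono inter_subset_right)).isClosed, ?_⟩
    ext y; constructor
    · rintro ⟨hy, x, hx, rfl⟩
      refine ⟨⟨x, ⟨?_, hx⟩, rfl⟩, ⟨x, hx, rfl⟩⟩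
      have : Function.invFunOn φ K (φ x) ∈ t := hy
      rwa [hinv x hx] at this
    · rintro ⟨⟨x, ⟨hxt, hx⟩, rfl⟩, _⟩
      refine ⟨?_, ⟨x, hx, rfl⟩⟩
      change Function.invFunOn φ K (φ x) ∈ t
      rwa [hinv x hx]
  refine ⟨hc.image_of_continuousOn h1, k, ψ ∘ Function.invFunOn φ K,
    h3.comp hcinv ?_, ?_⟩
  · rintro _ ⟨x, hx, rfl⟩; rwa [hinv x hx]
  · rintro _ ⟨x, hx, rfl⟩ _ ⟨y, hy, rfl⟩ hxy
    simp only [Function.comp, hinv x hx, hinv y hy] at hxy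
    rw [h4 hx hy hxy]

theorem EmbCompact.pi {ι : Type*} [Finite ι] {K : Set Z} (hK : EmbCompact K) :
    EmbCompact (Set.pi (univ : Set ι) fun _ => K) := by
  obtain ⟨hc, k, ψ, h1, h2⟩ := hK
  refine EmbCompact.of_fintype (ι := ι × Fin k) (isCompact_univ_pi fun _ => hc)
    (fun z p => ψ (z p.1) p.2) ?_ ?_
  · refine continuousOn_pi.2 fun p => ?_
    refine (continuousOn_pi.1 h1 p.2).comp (continuous_apply p.1).continuousOn ?_
    intro z hz; exact hz p.1 (mem_univ _)
  · intro x hx y hy hxy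
    funext i
    refine h2 (hx i (mem_univ _)) (hy i (mem_univ _)) (funext fun j => ?_)
    exact congrFun hxy (i, j)

theorem EmbCompact.prod {K : Set Z} {L : Set W} (hK : EmbCompact K) (hL : EmbCompact L) :
    EmbCompact (K ×ˢ L) := by
  obtain ⟨hc, k, ψ, h1, h2⟩ := hK
  obtain ⟨hc', k', ψ', h1', h2'⟩ := hL
  refine EmbCompact.of_fintype (ι := Fin k ⊕ Fin k') (hc.prod hc')
    (fun z => Sum.elim (ψ z.1) (ψ' z.2)) ?_ ?_
  · refine continuousOn_pi.2 ?_
    rintro (p | p)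
    · exact (continuousOn_pi.1 h1 p).comp continuousOn_fst fun z hz => hz.1
    · exact (continuousOn_pi.1 h1' p).comp continuousOn_snd fun z hz => hz.2
  · intro x hx y hy hxy
    refine Prod.ext (h2 hx.1 hy.1 (funext fun i => ?_)) (h2' hx.2 hy.2 (funext fun i => ?_))
    · exact congrFun hxy (Sum.inl i)
    · exact congrFun hxy (Sum.inr i)

/-- Tietze extension of a coordinate map. -/
theorem exists_continuous_extension_pi [NormalSpace Z] {K : Set Z} (hK : IsClosed K) {ι : Type*}
    {ψ : Z → ι → ℝ} (h : ContinuousOn ψ K) :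
    ∃ ψ' : Z → ι → ℝ, Continuous ψ' ∧ ∀ z ∈ K, ψ' z = ψ z := by
  have h' : ∀ i, ∃ g : C(Z, ℝ), g.restrict K = ⟨fun z : K => ψ z i,
      continuousOn_iff_continuous_domRestrict.1 (continuousOn_pi.1 h i)⟩ := fun i =>
    ContinuousMap.exists_restrict_eq hK _
  choose g hg using h'
  refine ⟨fun z i => g i z, continuous_pi fun i => (g i).continuous, fun z hz => ?_⟩
  funext i
  exact congrArg (fun f : C(K, ℝ) => f ⟨z, hz⟩) (hg i)

theorem EmbCompact.union [MetrizableSpace Z] {K L : Set Z} (hK : EmbCompact K)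
    (hL : EmbCompact L) : EmbCompact (K ∪ L) := by
  let := metrizableSpaceMetric Z
  rcases K.eq_empty_or_nonempty with rfl | hne
  · simpa using hL
  obtain ⟨hc, k, ψ, h1, h2⟩ := hK
  obtain ⟨hc', k', ψ', h1', h2'⟩ := hL
  obtain ⟨φ, hφ, hφ'⟩ := exists_continuous_extension_pi hc.isClosed h1
  obtain ⟨χ, hχ, hχ'⟩ := exists_continuous_extension_pi hc'.isClosed h1'
  refine EmbCompact.of_fintype (ι := Unit ⊕ Fin k ⊕ Fin k') (hc.union hc')
    (fun z => Sum.elim (fun _ => infDist z K) (Sum.elim (φ z) (χ z))) ?_ ?_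
  · refine (continuous_pi ?_).continuousOn
    rintro (_ | p | p)
    · exact continuous_infDist_pt K
    · exact (continuous_apply p).comp hφ
    · exact (continuous_apply p).comp hχ
  · intro x hx y hy hxy
    have e0 : infDist x K = infDist y K := congrFun hxy (Sum.inl ())
    have e1 : φ x = φ y := funext fun i => congrFun hxy (Sum.inr (Sum.inl i))
    have e2 : χ x = χ y := funext fun i => congrFun hxy (Sum.inr (Sum.inr i))
    have hmem : ∀ z, z ∈ K ↔ infDist z K = 0 := fun z => hc.isClosed.mem_iff_infDist_zero hne
    by_cases hxK : x ∈ K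
    · have hyK : y ∈ K := by rw [hmem, ← e0, ← hmem]; exact hxK
      exact h2 hxK hyK (by rw [← hφ' x hxK, ← hφ' y hyK, e1])
    · have hyK : y ∉ K := by rw [hmem, ← e0, ← hmem]; exact hxK
      have hx' := hx.resolve_left hxK
      have hy' := hy.resolve_left hyK
      exact h2' hx' hy' (by rw [← hχ' x hx', ← hχ' y hy', e2])

/-! ### The class of countable unions of such sets -/

theorem SFD.of_countable {ι : Type*} [Countable ι] (K : ι → Set Z) (hK : ∀ i, EmbCompact (K i))
    (h : ⋃ i, K i = univ) : SFD Z := by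
  rcases isEmpty_or_nonempty ι with hι | hι
  · refine ⟨fun _ => ∅, fun _ => embCompact_empty, ?_⟩
    simpa using h
  · obtain ⟨f, hf⟩ := exists_surjective_nat ι
    refine ⟨fun n => K (f n), fun n => hK _, ?_⟩
    rw [← h]; exact hf.iUnion_comp K

theorem SFD.of_images [T2Space Z] {ι : Type*} [Countable ι] {W : ι → Type*}
    [∀ i, TopologicalSpace (W i)] (hW : ∀ i, SFD (W i)) (φ : ∀ i, W i → Z)
    (hc : ∀ i, Continuous (φ i)) (hi : ∀ i, Function.Injective (φ i))
    (hU : ∀ z, ∃ i w, φ i w = z) : SFD Z := by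
  choose K hK hKU using hW
  refine SFD.of_countable (fun p : ι × ℕ => φ p.1 '' K p.1 p.2)
    (fun p => (hK _ _).image (hc _).continuousOn (hi _).injOn) ?_
  refine eq_univ_of_forall fun z => ?_
  obtain ⟨i, w, rfl⟩ := hU z
  have : w ∈ ⋃ n, K i n := by rw [hKU]; trivial
  obtain ⟨n, hn⟩ := mem_iUnion.1 this
  exact mem_iUnion.2 ⟨(i, n), w, hn, rfl⟩

theorem SFD.homeomorph [T2Space Z] (hW : SFD W) (e : W ≃ₜ Z) : SFD Z :=
  SFD.of_images (ι := Unit) (fun _ => hW) (fun _ => e) (fun _ => e.continuous)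
    (fun _ => e.injective) fun z => ⟨(), e.symm z, by simp⟩

theorem SFD.prod (hZ : SFD Z) (hW : SFD W) : SFD (Z × W) := by
  obtain ⟨K, hK, hKU⟩ := hZ
  obtain ⟨L, hL, hLU⟩ := hW
  refine SFD.of_countable (fun p : ℕ × ℕ => K p.1 ×ˢ L p.2) (fun p => (hK _).prod (hL _)) ?_
  refine eq_univ_of_forall fun z => ?_
  have h1 : z.1 ∈ ⋃ n, K n := by rw [hKU]; trivial
  have h2 : z.2 ∈ ⋃ n, L n := by rw [hLU]; trivial
  obtain ⟨n, hn⟩ := mem_iUnion.1 h1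
  obtain ⟨m, hm⟩ := mem_iUnion.1 h2
  exact mem_iUnion.2 ⟨(n, m), hn, hm⟩

theorem SFD.subtype [T2Space Z] (hZ : SFD Z) {C : Set Z} (hC : IsClosed C) : SFD C := by
  obtain ⟨K, hK, hKU⟩ := hZ
  refine ⟨fun n => Subtype.val ⁻¹' K n, fun n => ?_, ?_⟩
  · obtain ⟨hc, k, ψ, h1, h2⟩ := hK n
    refine ⟨hC.isClosedEmbedding_subtypeVal.isCompact_preimage hc, k, fun z => ψ z, ?_, ?_⟩
    · exact h1.comp continuous_subtype_val.continuousOn fun z hz => hz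
    · intro x hx y hy hxy
      exact Subtype.ext (h2 hx hy hxy)
  · rw [← preimage_iUnion, hKU, preimage_univ]

theorem sfd_real : SFD ℝ := by
  refine ⟨fun n => Icc (-n) n, fun n => EmbCompact.of_fintype (ι := Unit) isCompact_Icc
    (fun x _ => x) (continuous_pi fun _ => continuous_id).continuousOn ?_, ?_⟩
  · intro x _ y _ hxy; exact congrFun hxy ()
  · refine eq_univ_of_forall fun x => ?_
    obtain ⟨n, hn⟩ := exists_nat_ge |x|
    exact mem_iUnion.2 ⟨n, abs_le.1 hn⟩

/-- An increasing exhaustion by embeddable compact sets. -/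
theorem SFD.exists_monotone [MetrizableSpace Z] (hZ : SFD Z) :
    ∃ K : ℕ → Set Z, Monotone K ∧ (∀ n, EmbCompact (K n)) ∧ ⋃ n, K n = univ := by
  obtain ⟨K, hK, hU⟩ := hZ
  refine ⟨partialSups K, (partialSups K).monotone, fun n => ?_, ?_⟩
  · induction n with
    | zero => simpa using hK 0
    | succ n ih => rw [partialSups_add_one]; exact ih.union (hK _)
  · rw [eq_univ_iff_forall] at hU ⊢
    intro z
    obtain ⟨n, hn⟩ := mem_iUnion.1 (hU z)
    exact mem_iUnion.2 ⟨n, le_partialSups K n hn⟩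

theorem SFD.pi [MetrizableSpace Z] {ι : Type*} [Finite ι] (hZ : SFD Z) : SFD (ι → Z) := by
  obtain ⟨K, hm, hK, hU⟩ := hZ.exists_monotone
  refine ⟨fun n => Set.pi univ fun _ => K n, fun n => (hK n).pi, eq_univ_of_forall fun z => ?_⟩
  have : ∀ i, ∃ n, z i ∈ K n := fun i => mem_iUnion.1 (by rw [hU]; trivial)
  choose n hn using this
  have := Fintype.ofFinite ι
  refine mem_iUnion.2 ⟨Finset.univ.sup n, fun i _ => hm (Finset.le_sup (Finset.mem_univ i)) (hn i)⟩

end Emb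

end CurtisNhu

namespace CurtisNhu

/-! ### Finitely supported families with the `ℓ₁`-norm -/

/-- Finitely supported families with the `ℓ₁`-norm. -/
def L1 (ι V : Type*) [Zero V] : Type _ := ι →₀ V

namespace L1

variable {ι κ V : Type*} [NormedAddCommGroup V]

noncomputable instance : AddCommGroup (L1 ι V) := inferInstanceAs (AddCommGroup (ι →₀ V))

instance : FunLike (L1 ι V) ι V := inferInstanceAs (FunLike (ι →₀ V) ι V)

noncomputable instance [NormedSpace ℝ V] : Module ℝ (L1 ι V) :=
  inferInstanceAs (Module ℝ (ι →₀ V))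

noncomputable instance : Norm (L1 ι V) := ⟨fun x => Finsupp.sum x fun _ v => ‖v‖⟩

theorem norm_def (x : L1 ι V) : ‖x‖ = Finsupp.sum x fun _ v => ‖v‖ := rfl

theorem norm_eq_sum (x : L1 ι V) {s : Finset ι} (hs : ∀ i ∉ s, x i = 0) :
    ‖x‖ = ∑ i ∈ s, ‖x i‖ := by
  refine Finsupp.sum_of_support_subset (f := (x : ι →₀ V)) (s := s) ?_ _ (by simp)
  intro i hi
  by_contra h
  exact (Finsupp.mem_support_iff.1 hi) (hs i h)

theorem add_apply (x y : L1 ι V) (i : ι) : (x + y) i = x i + y i := Finsupp.add_apply _ _ _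
theorem sub_apply (x y : L1 ι V) (i : ι) : (x - y) i = x i - y i := Finsupp.sub_apply _ _ _
theorem neg_apply (x : L1 ι V) (i : ι) : (-x) i = - x i := Finsupp.neg_apply _ _
theorem zero_apply (i : ι) : (0 : L1 ι V) i = 0 := Finsupp.zero_apply
theorem smul_apply [NormedSpace ℝ V] (c : ℝ) (x : L1 ι V) (i : ι) : (c • x) i = c • x i :=
  Finsupp.smul_apply c x i

@[ext] theorem ext {x y : L1 ι V} (h : ∀ i, x i = y i) : x = y := Finsupp.ext h

/-- The finite support of a member of `L1`. -/
def supp (x : L1 ι V) : Finset ι := Finsupp.support x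

theorem mem_supp {x : L1 ι V} {i : ι} : i ∈ x.supp ↔ x i ≠ 0 := Finsupp.mem_support_iff

theorem notMem_supp {x : L1 ι V} {i : ι} : i ∉ x.supp ↔ x i = 0 := Finsupp.notMem_support_iff

noncomputable instance : NormedAddCommGroup (L1 ι V) :=
  AddGroupNorm.toNormedAddCommGroup
    { toFun := fun x => ‖x‖
      map_zero' := by simp [norm_def, Finsupp.sum_zero_index]; exact Finsupp.sum_zero_index
      add_le' := fun x y => by
        classical
        have hx : ∀ i ∉ x.supp ∪ y.supp, x i = 0 := fun i hi => by
          rw [Finset.notMem_union] at hi; exact notMem_supp.1 hi.1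
        have hy : ∀ i ∉ x.supp ∪ y.supp, y i = 0 := fun i hi => by
          rw [Finset.notMem_union] at hi; exact notMem_supp.1 hi.2
        rw [norm_eq_sum x hx, norm_eq_sum y hy, norm_eq_sum (x + y) (s := x.supp ∪ y.supp),
          ← Finset.sum_add_distrib]
        · exact Finset.sum_le_sum fun i _ => by rw [add_apply]; exact norm_add_le _ _
        · intro i hi; rw [add_apply, hx i hi, hy i hi, add_zero]
      neg' := fun x => by
        rw [norm_eq_sum (-x) (s := x.supp), norm_eq_sum x (s := x.supp)]
        · simp [neg_apply]
        · intro i hi; exact notMem_supp.1 hi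
        · intro i hi; rw [neg_apply, notMem_supp.1 hi, neg_zero]
      eq_zero_of_map_eq_zero' := fun x hx => by
        rw [norm_eq_sum x (s := x.supp) (fun i hi => notMem_supp.1 hi)] at hx
        rw [Finset.sum_eq_zero_iff_of_nonneg (fun i _ => norm_nonneg _)] at hx
        ext i
        rw [zero_apply]
        by_cases hi : i ∈ x.supp
        · exact norm_eq_zero.1 (hx i hi)
        · exact notMem_supp.1 hi }

theorem norm_eq_sum_supp (x : L1 ι V) : ‖x‖ = ∑ i ∈ x.supp, ‖x i‖ :=
  norm_eq_sum x fun _ hi => notMem_supp.1 hi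

noncomputable instance [NormedSpace ℝ V] : NormedSpace ℝ (L1 ι V) where
  norm_smul_le c x := by
    rw [norm_eq_sum (c • x) (s := x.supp), norm_eq_sum_supp x, Finset.mul_sum]
    · refine Finset.sum_le_sum fun i _ => ?_
      rw [smul_apply]; exact norm_smul_le _ _
    · intro i hi; rw [smul_apply, notMem_supp.1 hi, smul_zero]

theorem norm_apply_le (x : L1 ι V) (i : ι) : ‖x i‖ ≤ ‖x‖ := by
  by_cases hi : i ∈ x.supp
  · rw [norm_eq_sum_supp x]
    exact Finset.single_le_sum (f := fun i => ‖x i‖) (fun _ _ => norm_nonneg _) hi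
  · rw [notMem_supp.1 hi, norm_zero]; exact norm_nonneg _

theorem sum_norm_le (x : L1 ι V) (s : Finset ι) : ∑ i ∈ s, ‖x i‖ ≤ ‖x‖ := by
  classical
  rw [norm_eq_sum x (s := x.supp ∪ s)]
  · exact Finset.sum_le_sum_of_subset_of_nonneg Finset.subset_union_right
      fun _ _ _ => norm_nonneg _
  · intro i hi; rw [Finset.notMem_union] at hi; exact notMem_supp.1 hi.1

theorem continuous_apply (i : ι) : Continuous fun x : L1 ι V => x i := by
  refine (LipschitzWith.of_dist_le_mul (K := 1) fun x y => ?_).continuous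
  rw [dist_eq_norm, dist_eq_norm, ← sub_apply]
  simpa using norm_apply_le (x - y) i

/-- The family with a single possibly nonzero member. -/
noncomputable def single (i : ι) (v : V) : L1 ι V := Finsupp.single i v

theorem single_apply_self (i : ι) (v : V) : single i v i = v := Finsupp.single_eq_same

theorem single_apply_ne {i j : ι} (h : j ≠ i) (v : V) : single i v j = 0 :=
  Finsupp.single_eq_of_ne h

theorem norm_single (i : ι) (v : V) : ‖single i v‖ = ‖v‖ := by
  rw [norm_eq_sum (single i v) (s := {i}), Finset.sum_singleton, single_apply_self]
  intro j hj
  exact single_apply_ne (by simpa using hj) v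

theorem single_sub (i : ι) (v w : V) : single i (v - w) = single i v - single i w :=
  Finsupp.single_sub i v w

theorem isometry_single (i : ι) : Isometry (single i : V → L1 ι V) :=
  Isometry.of_dist_eq fun v w => by
    rw [dist_eq_norm, dist_eq_norm, ← single_sub, norm_single]

/-- Build a member of `L1` from a function with finite support. -/
noncomputable def mk (x : ι → V) (h : (Function.support x).Finite) : L1 ι V :=
  Finsupp.ofSupportFinite x h

theorem mk_apply (x : ι → V) (h : (Function.support x).Finite) (i : ι) : mk x h i = x i := rfl

theorem finite_support (x : L1 ι V) : (Function.support fun i => x i).Finite :=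
  x.supp.finite_toSet.subset fun i hi => by
    simpa [mem_supp] using hi

/-- A criterion for continuity of maps into `L1`: coordinatewise continuity together with uniformly
small tails. -/
theorem continuousAt_of_tail {A : Type*} [TopologicalSpace A] {f : A → L1 ι V} {a : A}
    (h1 : ∀ i, ContinuousAt (fun b => f b i) a)
    (h2 : ∀ ε > 0, ∃ s : Finset ι, ∀ᶠ b in 𝓝 a, ∀ t : Finset ι, Disjoint s t →
      ∑ i ∈ t, ‖f b i‖ ≤ ε) : ContinuousAt f a := by
  classical
  rw [ContinuousAt, Metric.tendsto_nhds]
  intro ε hε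
  obtain ⟨s, hs⟩ := h2 (ε / 8) (by positivity)
  have h3 : Tendsto (fun b => ∑ i ∈ s, ‖f b i - f a i‖) (𝓝 a) (𝓝 (∑ i ∈ s, ‖f a i - f a i‖)) :=
    tendsto_finsetSum _ fun i _ => ((h1 i).sub continuousAt_const).norm
  have h4 : ∀ᶠ b in 𝓝 a, ∑ i ∈ s, ‖f b i - f a i‖ < ε / 2 := by
    refine h3.eventually_lt_const ?_
    simp only [sub_self, norm_zero, Finset.sum_const_zero]; positivity
  have hsa := hs.self_of_nhds
  filter_upwards [hs, h4] with b hb hb'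
  rw [dist_eq_norm]
  set u := ((f b).supp ∪ (f a).supp) \ s
  rw [norm_eq_sum (f b - f a) (s := s ∪ u), Finset.sum_union Finset.disjoint_sdiff]
  · have e1 : ∑ i ∈ u, ‖(f b - f a) i‖ ≤ ∑ i ∈ u, ‖f b i‖ + ∑ i ∈ u, ‖f a i‖ := by
      rw [← Finset.sum_add_distrib]
      exact Finset.sum_le_sum fun i _ => by rw [sub_apply]; exact norm_sub_le _ _
    have e2 := hb u Finset.disjoint_sdiff
    have e3 := hsa u Finset.disjoint_sdiff
    simp only [sub_apply] at e1 ⊢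
    linarith
  · intro i hi
    rw [sub_apply]
    by_cases h : i ∈ (f b).supp ∨ i ∈ (f a).supp
    · refine absurd ?_ hi
      simp only [u, Finset.mem_sdiff, Finset.mem_union]
      tauto
    · push Not at h
      rw [notMem_supp.1 h.1, notMem_supp.1 h.2, sub_zero]

theorem tail_small (x : L1 ι V) {ε : ℝ} (hε : 0 < ε) :
    ∃ s : Finset ι, ∀ᶠ y in 𝓝 x, ∀ t : Finset ι, Disjoint s t → ∑ i ∈ t, ‖y i‖ ≤ ε := by
  refine ⟨x.supp, ?_⟩
  filter_upwards [Metric.ball_mem_nhds x hε] with y hy t ht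
  have h : ∑ i ∈ t, ‖y i‖ = ∑ i ∈ t, ‖(y - x) i‖ := by
    refine Finset.sum_congr rfl fun i hi => ?_
    rw [sub_apply, notMem_supp.1 (Finset.disjoint_right.1 ht hi), sub_zero]
  rw [h]
  refine (sum_norm_le _ _).trans ?_
  rw [mem_ball, dist_eq_norm] at hy
  exact hy.le

section Equivs

variable [NormedSpace ℝ V]

/-- Reindexing. -/
noncomputable def congr (e : ι ≃ κ) : L1 ι V ≃ₜ L1 κ V where
  toFun x := mk (fun k => x (e.symm k)) (by
    refine (x.finite_support.image e).subset fun k hk => ?_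
    exact ⟨e.symm k, hk, by simp⟩)
  invFun x := mk (fun k => x (e k)) (by
    refine (x.finite_support.image e.symm).subset fun k hk => ?_
    exact ⟨e k, hk, by simp⟩)
  left_inv x := by ext i; simp [mk_apply]
  right_inv x := by ext i; simp [mk_apply]
  continuous_toFun := by
    refine continuous_iff_continuousAt.2 fun x => continuousAt_of_tail (fun i => ?_) fun ε hε => ?_
    · exact (continuous_apply (e.symm i)).continuousAt
    · obtain ⟨s, hs⟩ := tail_small x hε
      refine ⟨s.map e.toEmbedding, ?_⟩
      filter_upwards [hs] with y hy t ht
      have := hy (t.map e.symm.toEmbedding) (by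
        rw [Finset.disjoint_left] at ht ⊢
        intro i hi hi'
        refine ht (Finset.mem_map_of_mem _ hi) ?_
        obtain ⟨k, hk, rfl⟩ := Finset.mem_map.1 hi'
        simpa using hk)
      simpa [mk_apply] using this
  continuous_invFun := by
    refine continuous_iff_continuousAt.2 fun x => continuousAt_of_tail (fun i => ?_) fun ε hε => ?_
    · exact (continuous_apply (e i)).continuousAt
    · obtain ⟨s, hs⟩ := tail_small x hε
      refine ⟨s.map e.symm.toEmbedding, ?_⟩
      filter_upwards [hs] with y hy t ht
      have := hy (t.map e.toEmbedding) (by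
        rw [Finset.disjoint_left] at ht ⊢
        intro i hi hi'
        refine ht (Finset.mem_map_of_mem _ hi) ?_
        obtain ⟨k, hk, rfl⟩ := Finset.mem_map.1 hi'
        simpa using hk)
      simpa [mk_apply] using this

theorem congr_zero (e : ι ≃ κ) : congr (V := V) e 0 = 0 := by ext i; rfl

/-- Families indexed by a sum type. -/
noncomputable def sumEquiv : L1 ι V × L1 κ V ≃ₜ L1 (ι ⊕ κ) V where
  toFun p := mk (Sum.elim (fun i => p.1 i) (fun j => p.2 j)) (by
    refine ((p.1.finite_support.image Sum.inl).union (p.2.finite_support.image Sum.inr)).subset ?_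
    rintro (i | i) hi
    · exact Or.inl ⟨i, hi, rfl⟩
    · exact Or.inr ⟨i, hi, rfl⟩)
  invFun x := (mk (fun i => x (Sum.inl i)) (by
      exact (x.finite_support.preimage (Sum.inl_injective.injOn))),
    mk (fun i => x (Sum.inr i)) (by
      exact (x.finite_support.preimage (Sum.inr_injective.injOn))))
  left_inv p := by
    refine Prod.ext ?_ ?_ <;> · ext i; simp [mk_apply]
  right_inv x := by ext (i | i) <;> rfl
  continuous_toFun := by
    classical
    refine continuous_iff_continuousAt.2 fun p => continuousAt_of_tail ?_ fun ε hε => ?_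
    · rintro (i | i)
      · exact ((continuous_apply i).comp continuous_fst).continuousAt
      · exact ((continuous_apply i).comp continuous_snd).continuousAt
    · obtain ⟨s, hs⟩ := tail_small p.1 (half_pos hε)
      obtain ⟨s', hs'⟩ := tail_small p.2 (half_pos hε)
      refine ⟨s.disjSum s', ?_⟩
      filter_upwards [continuous_fst.continuousAt.eventually hs,
        continuous_snd.continuousAt.eventually hs'] with q hq hq' t ht
      have h1 := hq t.toLeft (by
        rw [Finset.disjoint_left] at ht ⊢
        intro i hi hi'
        exact ht (Finset.inl_mem_disjSum.2 hi) (Finset.mem_toLeft.1 hi'))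
      have h2 := hq' t.toRight (by
        rw [Finset.disjoint_left] at ht ⊢
        intro i hi hi'
        exact ht (Finset.inr_mem_disjSum.2 hi) (Finset.mem_toRight.1 hi'))
      rw [← Finset.toLeft_disjSum_toRight (u := t), Finset.sum_disjSum]
      simp only [mk_apply, Sum.elim_inl, Sum.elim_inr]
      linarith
  continuous_invFun := by
    refine Continuous.prodMk ?_ ?_
    · refine continuous_iff_continuousAt.2 fun x =>
        continuousAt_of_tail (fun i => ?_) fun ε hε => ?_
      · exact (continuous_apply (Sum.inl i)).continuousAt
      · obtain ⟨s, hs⟩ := tail_small x hε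
        refine ⟨s.toLeft, ?_⟩
        filter_upwards [hs] with y hy t ht
        have := hy (t.map ⟨Sum.inl, Sum.inl_injective⟩) (by
          rw [Finset.disjoint_left] at ht ⊢
          intro i hi hi'
          obtain ⟨k, hk, rfl⟩ := Finset.mem_map.1 hi'
          exact ht (Finset.mem_toLeft.2 hi) hk)
        rw [Finset.sum_map] at this
        exact this
    · refine continuous_iff_continuousAt.2 fun x =>
        continuousAt_of_tail (fun i => ?_) fun ε hε => ?_
      · exact (continuous_apply (Sum.inr i)).continuousAt
      · obtain ⟨s, hs⟩ := tail_small x hε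
        refine ⟨s.toRight, ?_⟩
        filter_upwards [hs] with y hy t ht
        have := hy (t.map ⟨Sum.inr, Sum.inr_injective⟩) (by
          rw [Finset.disjoint_left] at ht ⊢
          intro i hi hi'
          obtain ⟨k, hk, rfl⟩ := Finset.mem_map.1 hi'
          exact ht (Finset.mem_toRight.2 hi) hk)
        rw [Finset.sum_map] at this
        exact this

theorem sumEquiv_zero : sumEquiv (ι := ι) (κ := κ) (V := V) (0, 0) = 0 := by
  ext (i | i) <;> rfl

/-- `L1 ℕ V` is homeomorphic to its square. -/
noncomputable def sqEquiv : L1 ℕ V × L1 ℕ V ≃ₜ L1 ℕ V :=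
  sumEquiv.trans (congr Equiv.natSumNatEquivNat)

theorem sqEquiv_zero : sqEquiv (V := V) (0, 0) = 0 := by
  rw [sqEquiv, Homeomorph.trans_apply, sumEquiv_zero, congr_zero]

/-- Families of families are families indexed by a product. -/
noncomputable def prodEquiv : L1 ι (L1 κ V) ≃ₜ L1 (ι × κ) V :=
  let e : L1 ι (L1 κ V) ≃ L1 (ι × κ) V :=
    { toFun := fun x => mk (fun p => x p.1 p.2) (by
        refine (x.supp.finite_toSet.biUnion fun i _ =>
          ((x i).finite_support.image fun j => (i, j))).subset fun p hp => ?_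
        refine mem_biUnion (x := p.1) ?_ ⟨p.2, hp, rfl⟩
        refine Finset.mem_coe.2 (mem_supp.2 fun h => hp ?_)
        change x p.1 p.2 = 0
        rw [h, zero_apply])
      invFun := fun x => mk (fun i => mk (fun j => x (i, j))
          (x.finite_support.preimage (fun a _ b _ h => (Prod.ext_iff.1 h).2))) (by
        refine (x.finite_support.image Prod.fst).subset fun i hi => ?_
        by_contra h
        refine hi ?_
        ext j
        by_contra h'
        exact h ⟨(i, j), h', rfl⟩)
      left_inv := fun x => by ext i j; rfl
      right_inv := fun x => by ext p; rfl }
  have he : Isometry e := by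
    classical
    have hn : ∀ x : L1 ι (L1 κ V), ‖e x‖ = ‖x‖ := fun x => by
      rw [norm_eq_sum (e x) (s := x.supp ×ˢ x.supp.biUnion fun i => (x i).supp),
        Finset.sum_product, norm_eq_sum_supp x]
      · refine Finset.sum_congr rfl fun i hi => ?_
        refine (norm_eq_sum (x i) fun j hj => ?_).symm
        by_contra h
        exact hj (Finset.mem_biUnion.2 ⟨i, hi, mem_supp.2 h⟩)
      · rintro ⟨i, j⟩ hp
        change x i j = 0
        by_cases hi : i ∈ x.supp
        · by_contra h
          exact hp (Finset.mem_product.2 ⟨hi, Finset.mem_biUnion.2 ⟨i, hi, mem_supp.2 h⟩⟩)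
        · rw [notMem_supp.1 hi, zero_apply]
    refine Isometry.of_dist_eq fun x y => ?_
    rw [dist_eq_norm, dist_eq_norm, ← hn (x - y)]
    congr 1
    ext p
    rw [sub_apply]
    change x p.1 p.2 - y p.1 p.2 = (x - y) p.1 p.2
    rw [sub_apply, sub_apply]
  (IsometryEquiv.mk e he).toHomeomorph

end Equivs

theorem sfd (hV : SFD V) : SFD (L1 ℕ V) := by
  refine SFD.of_images (ι := ℕ) (W := fun n => Fin n → V) (fun n => hV.pi)
    (fun n v => ∑ i : Fin n, single (i : ℕ) (v i)) (fun n => ?_) (fun n => ?_) fun x => ?_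
  · exact continuous_finset_sum _ fun i _ =>
      (isometry_single _).continuous.comp (_root_.continuous_apply i)
  · have key : ∀ (v : Fin n → V) (i : Fin n), (∑ i : Fin n, single (i : ℕ) (v i)) (i : ℕ) = v i := by
      intro v i
      have : (∑ i : Fin n, single (i : ℕ) (v i)) (i : ℕ) = ∑ j : Fin n, (single (j : ℕ) (v j)) (i : ℕ) :=
        Finsupp.finset_sum_apply (N := V) Finset.univ (fun i : Fin n => single (i : ℕ) (v i)) (i : ℕ)
      rw [this, Finset.sum_eq_single i]
      · exact single_apply_self _ _
      · intro j _ hj; exact single_apply_ne (fun h => hj (Fin.ext h.symm)) _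
      · simp
    intro v w hvw
    funext i
    rw [← key v, ← key w]
    exact congrArg (fun x : L1 ℕ V => x i) hvw
  · refine ⟨x.supp.sup id + 1, fun i => x i, ?_⟩
    ext j
    have : (∑ i : Fin (x.supp.sup id + 1), single (i : ℕ) (x i)) j
        = ∑ i : Fin (x.supp.sup id + 1), (single (i : ℕ) (x i)) j :=
      Finsupp.finset_sum_apply (N := V) Finset.univ _ j
    rw [this]
    by_cases hj : j < x.supp.sup id + 1
    · rw [Finset.sum_eq_single ⟨j, hj⟩]
      · exact single_apply_self _ _
      · intro i _ hi; exact single_apply_ne (fun h => hi (Fin.ext h.symm)) _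
      · simp
    · rw [Finset.sum_eq_zero]
      · by_contra h
        have := Finset.le_sup (f := id) (mem_supp.2 (Ne.symm h))
        simp only [id] at this; omega
      · intro i _; exact single_apply_ne (by omega) _

end L1

/-! ### Finitely supported sequences with the product topology -/

/-- Finitely supported sequences, with the topology of pointwise convergence. -/
def FS (E : Type*) [Zero E] : Type _ := {x : ℕ → E // (Function.support x).Finite}

namespace FS

variable {E : Type*} [Zero E] [TopologicalSpace E]

instance : TopologicalSpace (FS E) := inferInstanceAs (TopologicalSpace (Subtype _))

instance [MetrizableSpace E] : MetrizableSpace (FS E) := by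
  letI := metrizableSpaceMetric E
  letI : MetricSpace (ℕ → E) := UniformSpace.metricSpace (ℕ → E)
  exact inferInstanceAs (MetrizableSpace (Subtype _))

instance : Zero (FS E) := ⟨⟨0, by simp⟩⟩

/-- Splitting off the first coordinate. -/
def uncons : FS E ≃ₜ E × FS E where
  toFun x := (x.1 0, ⟨fun n => x.1 (n + 1), x.2.preimage (add_left_injective 1).injOn⟩)
  invFun p := ⟨fun n => Nat.casesOn n p.1 p.2.1, by
    refine ((p.2.2.image (· + 1)).union (finite_singleton 0)).subset fun n hn => ?_
    cases n with
    | zero => exact Or.inr rfl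
    | succ n => exact Or.inl ⟨n, hn, rfl⟩⟩
  left_inv x := by
    refine Subtype.ext (funext fun n => ?_)
    cases n <;> rfl
  right_inv p := rfl
  continuous_toFun := by
    refine ((continuous_apply 0).comp continuous_subtype_val).prodMk
      (Continuous.subtype_mk (continuous_pi fun n => ?_) _)
    exact (continuous_apply _).comp continuous_subtype_val
  continuous_invFun := by
    refine Continuous.subtype_mk (continuous_pi fun n => ?_) _
    cases n with
    | zero => exact continuous_fst
    | succ n => exact (continuous_apply _).comp (continuous_subtype_val.comp continuous_snd)

theorem sfd [MetrizableSpace E] (hE : SFD E) : SFD (FS E) := by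
  refine SFD.of_images (ι := ℕ) (W := fun n => Fin n → E) (fun n => hE.pi)
    (fun n v => ⟨fun i => if h : i < n then v ⟨i, h⟩ else 0, ?_⟩) (fun n => ?_) (fun n => ?_)
    fun x => ?_
  · refine (finite_lt_nat n).subset fun i hi => ?_
    by_contra h
    exact hi (dif_neg h)
  · refine Continuous.subtype_mk (continuous_pi fun i => ?_) _
    by_cases h : i < n
    · simp only [h, dif_pos]; exact continuous_apply _
    · simp only [h, dif_neg, not_false_eq_true]; exact continuous_const
  · intro v w hvw
    funext i
    have := congrFun (congrArg Subtype.val hvw) i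
    simpa using this
  · obtain ⟨N, hN⟩ := x.2.bddAbove
    refine ⟨N + 1, fun i => x.1 i, Subtype.ext (funext fun i => ?_)⟩
    by_cases h : i < N + 1
    · simp [h]
    · simp only [h, dif_neg, not_false_eq_true]
      by_contra h'
      have := hN (Ne.symm h')
      omega

end FS

end CurtisNhu

namespace CurtisNhu

/-! ### Nerve maps into topological semilattices -/

namespace Nerve

variable {ι M : Type*} [TopologicalSpace M] (f : PartitionOfUnity ι M univ)

/-- The sum of squares of the members of a partition of unity. -/
noncomputable def q (m : M) : ℝ := ∑ᶠ i, f i m ^ 2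

theorem q_eq {m : M} {I : Finset ι} (hI : f.finsupport m ⊆ I) : q f m = ∑ i ∈ I, f i m ^ 2 := by
  refine finsum_eq_sum_of_support_subset _ fun i hi => ?_
  refine hI ((f.mem_finsupport m).2 fun h => hi ?_)
  simp only at h
  simp [h]

theorem continuous_q : Continuous (q f) := by
  refine continuous_finsum (fun i => by fun_prop) (f.locallyFinite.subset fun i m hm => ?_)
  intro h
  apply hm
  simp only [h]; norm_num

theorem q_pos (m : M) : 0 < q f m := by
  obtain ⟨i, hi⟩ := f.exists_pos (mem_univ m)
  rw [q_eq f (Finset.Subset.refl _)]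
  refine Finset.sum_pos' (fun _ _ => sq_nonneg _) ⟨i, (f.mem_finsupport m).2 hi.ne', by positivity⟩

theorem exists_q_le (m : M) : ∃ k, q f m ≤ f k m := by
  have hne : (f.finsupport m).Nonempty := by
    obtain ⟨i, hi⟩ := f.exists_pos (mem_univ m)
    exact ⟨i, (f.mem_finsupport m).2 hi.ne'⟩
  obtain ⟨k, hk, hmax⟩ := Finset.exists_max_image (f.finsupport m) (fun i => f i m) hne
  refine ⟨k, ?_⟩
  rw [q_eq f (Finset.Subset.refl _)]
  calc ∑ i ∈ f.finsupport m, f i m ^ 2 ≤ ∑ i ∈ f.finsupport m, f k m * f i m :=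
        Finset.sum_le_sum fun i hi => by
          rw [sq]; exact mul_le_mul_of_nonneg_right (hmax i hi) (f.nonneg i m)
    _ = f k m := by rw [← Finset.mul_sum, f.sum_finsupport (mem_univ m), mul_one]

/-- The activity of an index. -/
noncomputable def act (i : ι) (m : M) : ℝ := max 0 (min 1 (2 * f i m / q f m - 1))

/-- The path parameter between two indices. -/
noncomputable def par (i j : ι) (m : M) : ℝ := act f i m * min 1 (2 * f j m / q f m)

theorem act_nonneg (i : ι) (m : M) : 0 ≤ act f i m := le_max_left _ _

theorem act_le_one (i : ι) (m : M) : act f i m ≤ 1 := max_le zero_le_one (min_le_left _ _)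

theorem continuous_act (i : ι) : Continuous (act f i) := by
  have := continuous_q f
  have h : ∀ m, q f m ≠ 0 := fun m => (q_pos f m).ne'
  unfold act
  fun_prop (disch := assumption)

theorem continuous_par (i j : ι) : Continuous (par f i j) := by
  have := continuous_q f
  have h : ∀ m, q f m ≠ 0 := fun m => (q_pos f m).ne'
  have := continuous_act f i
  unfold par
  fun_prop (disch := assumption)

theorem act_eq_one {i : ι} {m : M} (h : q f m ≤ f i m) : act f i m = 1 := by
  have hq := q_pos f m
  have : 1 ≤ 2 * f i m / q f m - 1 := by
    rw [le_sub_iff_add_le, le_div_iff₀ hq]; linarith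
  rw [act, min_eq_left this, max_eq_right zero_le_one]

theorem act_eq_zero {i : ι} {m : M} (h : 2 * f i m ≤ q f m) : act f i m = 0 := by
  have hq := q_pos f m
  have : 2 * f i m / q f m - 1 ≤ 0 := by
    rw [sub_nonpos, div_le_one hq]; exact h
  rw [act, max_eq_left ((min_le_right _ _).trans this)]

theorem lt_of_act_pos {i : ι} {m : M} (h : 0 < act f i m) : q f m < 2 * f i m := by
  by_contra! h'
  rw [act_eq_zero f h'] at h
  exact lt_irrefl _ h

theorem par_eq_one {i j : ι} {m : M} (h : act f i m = 1) (h' : q f m ≤ 2 * f j m) :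
    par f i j m = 1 := by
  rw [par, h, min_eq_left, one_mul]
  rwa [le_div_iff₀ (q_pos f m), one_mul]

theorem par_eq_zero {i j : ι} {m : M} (h : f j m = 0) : par f i j m = 0 := by
  simp [par, h]

theorem par_eq_zero' {i j : ι} {m : M} (h : act f i m = 0) : par f i j m = 0 := by
  simp [par, h]

end Nerve

open Nerve in
theorem exists_nerve_map {ι M Y : Type*} [TopologicalSpace M] [TopologicalSpace Y]
    [SemilatticeSup Y] [ContinuousSup Y] (f : PartitionOfUnity ι M univ) (v : ι → Y)
    (γ : ι → ι → ℝ → Y) (hγ : ∀ i j, Continuous (γ i j)) (hγ0 : ∀ i j, γ i j 0 = v i)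
    (hγ1 : ∀ i j, γ i j 1 = v j) (h : ι → ℝ → M → Y)
    (hh : ∀ i, Continuous fun p : ℝ × M => h i p.1 p.2) (hh0 : ∀ i m, h i 0 m = v i) :
    ∃ (F : M → Y) (μ : ι → M → ℝ), Continuous F ∧ (∀ i m, 0 ≤ μ i m) ∧ (∀ i m, μ i m ≤ 1) ∧
      (∀ i, Continuous (μ i)) ∧
      (∀ m, ∃ i, μ i m = 1) ∧ (∀ i m, 0 < μ i m → 0 < f i m) ∧
      (∀ i m, 0 < μ i m → h i (μ i m) m ≤ F m) ∧
      ∀ m, ∃ (P Q : Finset ι) (hP : P.Nonempty) (hQ : Q.Nonempty) (s : ι → ι → ℝ),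
        (∀ i ∈ P, 0 < f i m) ∧ (∀ j ∈ Q, 0 < f j m) ∧
        F m = P.sup' hP fun i => v i ⊔ h i (μ i m) m ⊔ Q.sup' hQ fun j => γ i j (s i j) := by
  classical
  have hQ : ∀ m, (f.finsupport m).Nonempty := fun m => by
    obtain ⟨i, hi⟩ := f.exists_pos (mem_univ m)
    exact ⟨i, (f.mem_finsupport m).2 hi.ne'⟩
  have hmemk : ∀ m, ∀ I, f.finsupport m ⊆ I → ∃ k ∈ I, q f m ≤ f k m := fun m I hI => by
    obtain ⟨k, hk⟩ := exists_q_le f m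
    exact ⟨k, hI ((f.mem_finsupport m).2 ((q_pos f m).trans_le hk).ne'), hk⟩
  have hJ : ∀ m I, f.finsupport m ⊆ I → (I.filter fun i => q f m ≤ 2 * f i m).Nonempty :=
    fun m I hI => by
      obtain ⟨k, hkI, hk⟩ := hmemk m I hI
      exact ⟨k, Finset.mem_filter.2 ⟨hkI, by have := q_pos f m; linarith⟩⟩
  let c : (I : Finset ι) → I.Nonempty → ι → M → Y := fun I hI i m =>
    v i ⊔ h i (act f i m) m ⊔ I.sup' hI fun j => γ i j (par f i j m)
  have hcc : ∀ I hI i, Continuous (c I hI i) := fun I hI i => by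
    refine (continuous_const.sup ((hh i).comp ((continuous_act f i).prodMk continuous_id))).sup ?_
    exact Continuous.finset_sup'_apply hI fun j _ => (hγ i j).comp (continuous_par f i j)
  let F : M → Y := fun m => ((f.finsupport m).filter fun i => q f m ≤ 2 * f i m).sup'
    (hJ m _ (Finset.Subset.refl _)) fun i => c _ (hQ m) i m
  have hpos : ∀ m i, q f m ≤ 2 * f i m → 0 < f i m := fun m i hi => by
    have := q_pos f m; linarith
  have hFI : ∀ m I (hI : f.finsupport m ⊆ I), F m =
      (I.filter fun i => q f m ≤ 2 * f i m).sup' (hJ m I hI)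
        fun i => c I ((hQ m).mono hI) i m := by
    intro m I hI
    have hc : ∀ i, c I ((hQ m).mono hI) i m = c _ (hQ m) i m := fun i => by
      apply le_antisymm
      · refine sup_le le_sup_left (Finset.sup'_le _ _ fun j hj => ?_)
        by_cases hj' : j ∈ f.finsupport m
        · exact le_sup_of_le_right
            (Finset.le_sup' (f := fun j => γ i j (par f i j m)) hj')
        · have : f j m = 0 := by
            by_contra h0; exact hj' ((f.mem_finsupport m).2 h0)
          rw [par_eq_zero f this, hγ0]
          exact le_sup_of_le_left le_sup_left
      · exact sup_le le_sup_left (le_sup_of_le_right (Finset.sup'_mono _ hI _))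
    have hf : (I.filter fun i => q f m ≤ 2 * f i m) =
        (f.finsupport m).filter fun i => q f m ≤ 2 * f i m := by
      ext i
      simp only [Finset.mem_filter]
      refine ⟨fun hi => ⟨(f.mem_finsupport m).2 (hpos m i hi.2).ne', hi.2⟩, fun hi => ⟨hI hi.1, hi.2⟩⟩
    simp only [hc, hf]
    rfl
  have hFc : Continuous F := by
    refine continuous_iff_continuousAt.2 fun m₀ => ?_
    set I := f.fintsupport m₀
    have hI0 : f.finsupport m₀ ⊆ I := f.finsupport_subset_fintsupport m₀
    have hIne : I.Nonempty := (hQ m₀).mono hI0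
    let G : Finset ι → M → Y := fun P m =>
      if hP : P.Nonempty then P.sup' hP fun i => c I hIne i m else F m₀
    have hG : ∀ P, Continuous (G P) := fun P => by
      by_cases hP : P.Nonempty
      · simp only [G, hP, dif_pos]
        exact Continuous.finset_sup'_apply hP fun i _ => hcc I hIne i
      · simp only [G, hP, dif_neg, not_false_eq_true]; exact continuous_const
    let PP : Finset (Finset ι) := I.powerset.filter fun P =>
      (∀ i ∈ I, q f m₀ < 2 * f i m₀ → i ∈ P) ∧ ∀ i ∈ P, q f m₀ ≤ 2 * f i m₀
    have hG0 : ∀ P ∈ PP, G P m₀ = F m₀ := by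
      intro P hP
      obtain ⟨hPI, hP1, hP2⟩ := Finset.mem_filter.1 hP
      rw [Finset.mem_powerset] at hPI
      obtain ⟨k, hkI, hk⟩ := hmemk m₀ I hI0
      have hkP : k ∈ P := hP1 k hkI (by have := q_pos f m₀; linarith)
      have hPne : P.Nonempty := ⟨k, hkP⟩
      rw [hFI m₀ I hI0]
      simp only [G, hPne, dif_pos]
      apply le_antisymm
      · refine Finset.sup'_le _ _ fun i hi => ?_
        exact Finset.le_sup' (f := fun i => c I hIne i m₀) (Finset.mem_filter.2 ⟨hPI hi, hP2 i hi⟩)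
      · refine Finset.sup'_le _ _ fun i hi => ?_
        obtain ⟨hiI, hiq⟩ := Finset.mem_filter.1 hi
        by_cases hiP : i ∈ P
        · exact Finset.le_sup' (f := fun i => c I hIne i m₀) hiP
        · have hieq : 2 * f i m₀ ≤ q f m₀ := by
            by_contra! hlt; exact hiP (hP1 i hiI hlt)
          have h0 := act_eq_zero f hieq
          have hv : v i ≤ c I hIne k m₀ := by
            refine le_sup_of_le_right ?_
            refine le_trans (le_of_eq ?_)
              (Finset.le_sup' (f := fun j => γ k j (par f k j m₀)) hiI)
            simp only [par_eq_one f (act_eq_one f hk) hiq, hγ1]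
          refine le_trans ?_ (Finset.le_sup' (f := fun i => c I hIne i m₀) hkP)
          refine sup_le (sup_le hv ?_) (Finset.sup'_le _ _ fun j _ => ?_)
          · rw [h0, hh0]; exact hv
          · rw [par_eq_zero' f h0, hγ0]; exact hv
    have hev1 : ∀ᶠ m in 𝓝 m₀, f.finsupport m ⊆ I := f.eventually_finsupport_subset m₀
    have hev2 : ∀ᶠ m in 𝓝 m₀, ∀ i ∈ I, q f m₀ < 2 * f i m₀ → q f m < 2 * f i m := by
      refine (Finset.eventually_all I).2 fun i _ => ?_
      by_cases hlt : q f m₀ < 2 * f i m₀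
      · filter_upwards [(continuous_q f).continuousAt.eventually_lt
          ((continuous_const.mul (f i).continuous).continuousAt) hlt] with m hm _ using hm
      · exact Eventually.of_forall fun m h' => absurd h' hlt
    have hev3 : ∀ᶠ m in 𝓝 m₀, ∀ i ∈ I, 2 * f i m₀ < q f m₀ → 2 * f i m < q f m := by
      refine (Finset.eventually_all I).2 fun i _ => ?_
      by_cases hlt : 2 * f i m₀ < q f m₀
      · filter_upwards [((continuous_const.mul (f i).continuous).continuousAt).eventually_lt
          (continuous_q f).continuousAt hlt] with m hm _ using hm
      · exact Eventually.of_forall fun m h' => absurd h' hlt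
    intro U hU
    have hevG : ∀ᶠ m in 𝓝 m₀, ∀ P ∈ PP, G P m ∈ U := by
      refine (Finset.eventually_all PP).2 fun P hP => ?_
      exact (hG P).continuousAt.eventually_mem (by rw [hG0 P hP]; exact hU)
    change ∀ᶠ m in 𝓝 m₀, F m ∈ U
    filter_upwards [hev1, hev2, hev3, hevG] with m h1 h2 h3 h4
    have hmem : (I.filter fun i => q f m ≤ 2 * f i m) ∈ PP := by
      refine Finset.mem_filter.2 ⟨Finset.mem_powerset.2 (Finset.filter_subset _ _), ?_, ?_⟩
      · exact fun i hi hlt => Finset.mem_filter.2 ⟨hi, (h2 i hi hlt).le⟩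
      · intro i hi
        obtain ⟨hiI, hiq⟩ := Finset.mem_filter.1 hi
        by_contra! hlt
        exact absurd hiq (not_le.2 (h3 i hiI hlt))
    have := h4 _ hmem
    simp only [G, hJ m I h1, dif_pos] at this
    change F m ∈ U
    rw [hFI m I h1]
    exact this
  refine ⟨F, act f, hFc, act_nonneg f, act_le_one f, continuous_act f, fun m => ?_,
    fun i m hi => ?_, fun i m hi => ?_, fun m => ?_⟩
  · obtain ⟨k, hk⟩ := exists_q_le f m
    exact ⟨k, act_eq_one f hk⟩
  · exact hpos m i (lt_of_act_pos f hi).le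
  · have hlt := (lt_of_act_pos f hi).le
    refine le_trans (le_sup_of_le_left le_sup_right)
      (Finset.le_sup' (f := fun i => c _ (hQ m) i m) (Finset.mem_filter.2
        ⟨(f.mem_finsupport m).2 (hpos m i hlt).ne', hlt⟩))
  · refine ⟨_, _, hJ m _ (Finset.Subset.refl _), hQ m, fun i j => par f i j m, fun i hi => ?_,
      fun j hj => ?_, rfl⟩
    · exact hpos m i (Finset.mem_filter.1 hi).2
    · exact lt_of_le_of_ne (f.nonneg j m) (Ne.symm ((f.mem_finsupport m).1 hj))

end CurtisNhu

namespace CurtisNhu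

/-- A metric on a semilattice for which the join is nonexpanding. -/
class SupMetric (Y : Type*) [MetricSpace Y] [SemilatticeSup Y] : Prop where
  dist_sup_le : ∀ a b c d : Y, dist (a ⊔ b) (c ⊔ d) ≤ max (dist a c) (dist b d)

section

variable {Y : Type*} [MetricSpace Y] [SemilatticeSup Y] [SupMetric Y]

instance : ContinuousSup Y := ⟨by
  refine (LipschitzWith.of_dist_le_mul (K := 1) fun p q => ?_).continuous
  rw [NNReal.coe_one, one_mul, Prod.dist_eq]
  exact SupMetric.dist_sup_le _ _ _ _⟩

theorem dist_sup_lt {a b c : Y} {r : ℝ} (ha : dist a c < r) (hb : dist b c < r) :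
    dist (a ⊔ b) c < r := by
  have := SupMetric.dist_sup_le a b c c
  rw [sup_idem] at this
  exact this.trans_lt (max_lt ha hb)

/-- A gauge: a positive function measuring how far the points are from the ideal boundary, with
small sublevel sets dense up to `ε` and with path-connected intersections with balls. -/
structure Gauge (ε : ℝ) (g : Y → ℝ) : Prop where
  continuous : Continuous g
  pos : ∀ y, 0 < g y
  le_one : ∀ y, g y ≤ 1
  sup_le : ∀ a b, g (a ⊔ b) ≤ max (g a) (g b)
  dense : ∀ y, ∀ τ > 0, ∃ y', dist y' y < ε ∧ g y' < τ
  path : ∀ y₀ R τ a b, dist a y₀ < R → dist b y₀ < R → g a < τ → g b < τ →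
    ∃ γ : ℝ → Y, Continuous γ ∧ γ 0 = a ∧ γ 1 = b ∧ ∀ t, dist (γ t) y₀ < R ∧ g (γ t) < τ

theorem Gauge.ball_path {ε : ℝ} {g : Y → ℝ} (hg : Gauge ε g) {y₀ a b : Y} {R : ℝ}
    (ha : dist a y₀ < R) (hb : dist b y₀ < R) :
    ∃ γ : ℝ → Y, Continuous γ ∧ γ 0 = a ∧ γ 1 = b ∧ ∀ t, dist (γ t) y₀ < R := by
  obtain ⟨γ, h1, h2, h3, h4⟩ := hg.path y₀ R 2 a b ha hb
    ((hg.le_one a).trans_lt one_lt_two) ((hg.le_one b).trans_lt one_lt_two)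
  exact ⟨γ, h1, h2, h3, fun t => (h4 t).1⟩

/-- How far `y` is from violating `dist y (c m) < ε` or `g y < τ m`. -/
def slack {M : Type*} (ε : ℝ) (c : M → Y) (τ : M → ℝ) (g : Y → ℝ) (m : M) (y : Y) : ℝ :=
  min (ε - dist y (c m)) (τ m - g y)

section Slack

variable {M : Type*} {ε : ℝ} {c : M → Y} {τ : M → ℝ} {g : Y → ℝ}

theorem lt_slack {m : M} {y : Y} {T : ℝ} :
    T < slack ε c τ g m y ↔ dist y (c m) < ε - T ∧ g y < τ m - T := by
  rw [slack, lt_min_iff]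
  constructor <;> rintro ⟨h1, h2⟩ <;> constructor <;> linarith

theorem continuous_slack [TopologicalSpace M] (hc : Continuous c) (hτ : Continuous τ)
    (hg : Continuous g) : Continuous fun p : M × Y => slack ε c τ g p.1 p.2 := by
  unfold slack
  exact ((continuous_const.sub (continuous_snd.dist (hc.comp continuous_fst))).min
    ((hτ.comp continuous_fst).sub (hg.comp continuous_snd)))

theorem slack_le (m n : M) (y : Y) :
    slack ε c τ g n y ≤ slack ε c τ g m y + (dist (c m) (c n) + |τ m - τ n|) := by
  unfold slack
  rw [← min_add_add_right]
  refine min_le_min ?_ ?_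
  · have := dist_triangle y (c n) (c m)
    rw [dist_comm (c n)] at this
    have := abs_nonneg (τ m - τ n)
    linarith
  · have := neg_abs_le (τ m - τ n)
    have := dist_nonneg (x := c m) (y := c n)
    linarith

theorem lt_slack_sup (hg : Gauge ε g) {m : M} {a b : Y} {T : ℝ} (ha : T < slack ε c τ g m a)
    (hb : T < slack ε c τ g m b) : T < slack ε c τ g m (a ⊔ b) := by
  rw [lt_slack] at *
  exact ⟨dist_sup_lt ha.1 hb.1, (hg.sup_le a b).trans_lt (max_lt ha.2 hb.2)⟩

theorem le_slack_sup (hg : Gauge ε g) {m : M} {a b : Y} {T : ℝ} (ha : T ≤ slack ε c τ g m a)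
    (hb : T ≤ slack ε c τ g m b) : T ≤ slack ε c τ g m (a ⊔ b) := by
  refine le_of_forall_lt fun S hS => lt_slack_sup hg (hS.trans_le ha) (hS.trans_le hb)

theorem slack_path (hg : Gauge ε g) {m : M} {a b : Y} {T : ℝ} (ha : T < slack ε c τ g m a)
    (hb : T < slack ε c τ g m b) :
    ∃ γ : ℝ → Y, Continuous γ ∧ γ 0 = a ∧ γ 1 = b ∧ ∀ t, T < slack ε c τ g m (γ t) := by
  rw [lt_slack] at *
  obtain ⟨γ, h1, h2, h3, h4⟩ := hg.path (c m) (ε - T) (τ m - T) a b ha.1 hb.1 ha.2 hb.2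
  exact ⟨γ, h1, h2, h3, fun t => lt_slack.2 (h4 t)⟩

end Slack

theorem exists_controlled_path {M : Type*} {ε : ℝ} {c : M → Y} {τ : M → ℝ} {g : Y → ℝ}
    (hg : Gauge ε g) (m : M) (T : ℝ) (a b : Y) (ha : T < slack ε c τ g m a) :
    ∃ γ : ℝ → Y, Continuous γ ∧ γ 0 = a ∧ γ 1 = b ∧
      (T < slack ε c τ g m b → ∀ t, T < slack ε c τ g m (γ t)) ∧
      ((∀ y, dist y a ≤ 2 * dist a b → T < slack ε c τ g m y) →
        ∀ t, dist (γ t) a ≤ 2 * dist a b) := by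
  rcases eq_or_ne a b with rfl | hab
  · exact ⟨fun _ => a, continuous_const, rfl, rfl, fun h _ => h, fun _ _ => by simp⟩
  have hpos : 0 < dist a b := dist_pos.2 hab
  by_cases h1 : ∀ y, dist y a ≤ 2 * dist a b → T < slack ε c τ g m y
  · obtain ⟨γ, e1, e2, e3, e4⟩ := hg.ball_path (y₀ := a) (a := a) (b := b) (R := 2 * dist a b)
      (by rw [dist_self]; positivity) (by rw [dist_comm]; linarith)
    exact ⟨γ, e1, e2, e3, fun _ t => h1 _ (e4 t).le, fun _ t => (e4 t).le⟩
  by_cases h2 : T < slack ε c τ g m b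
  · obtain ⟨γ, e1, e2, e3, e4⟩ := slack_path hg ha h2
    exact ⟨γ, e1, e2, e3, fun _ => e4, fun h => absurd h h1⟩
  · obtain ⟨γ, e1, e2, e3, e4⟩ := hg.ball_path (y₀ := a) (a := a) (b := b) (R := 2 * dist a b)
      (by rw [dist_self]; positivity) (by rw [dist_comm]; linarith)
    exact ⟨γ, e1, e2, e3, fun h => absurd h h2, fun h => absurd h h1⟩

/-- Controlled extension of maps into a gauged semilattice. -/
theorem exists_extension {M : Type*} [MetricSpace M] {ε : ℝ} {c : M → Y} {τ : M → ℝ} {g : Y → ℝ}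
    (hg : Gauge ε g) (hc : Continuous c) (hτ : Continuous τ) {ρ' ρ₁ ρ : M → ℝ}
    (hρ' : Continuous ρ') (hρ₁ : Continuous ρ₁) (h01 : ∀ m, ρ' m < ρ₁ m) (h12 : ∀ m, ρ₁ m < ρ m)
    {A : Set M} (hA : IsClosed A) {f : M → Y} (hf : ContinuousOn f A)
    (hfA : ∀ a ∈ A, ρ a ≤ slack ε c τ g a (f a)) (hex : ∀ m, ∃ y, ρ m ≤ slack ε c τ g m y) :
    ∃ F : M → Y, Continuous F ∧ EqOn F f A ∧ (∀ m, ρ' m ≤ slack ε c τ g m (F m)) ∧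
      ∀ a ∈ A, ∀ r δ : ℝ, 0 < r → 0 < δ → (∀ a' ∈ A, dist a' a < 4 * δ → dist (f a') (f a) < r) →
        (∀ m', dist m' a < 4 * δ → ∀ y, dist y (f a) < 5 * r → ρ₁ m' ≤ slack ε c τ g m' y) →
        ∀ m, dist m a < δ → dist (F m) (f a) < 5 * r := by
  classical
  let N := {m : M // m ∉ A}
  let d : N → ℝ := fun n => if A.Nonempty then infDist n.1 A else 1
  have hd : ∀ n, 0 < d n := fun n => by
    by_cases hne : A.Nonempty
    · simp only [d, hne, if_true]
      exact (hA.notMem_iff_infDist_pos hne).1 n.2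
    · simp [d, hne]
  let s := slack ε c τ g
  let D : M → ℝ := fun m => ρ₁ m - ρ' m
  have hD : ∀ m, 0 < D m := fun m => sub_pos.2 (h01 m)
  let U : N → Set N := fun n => {m | dist m n < d n / 8 ∧
    dist (c m) (c n) + |τ m - τ n| < D n / 16 ∧ |ρ₁ m - ρ₁ n| < D n / 16 ∧
    |ρ' m - ρ' n| < D n / 16}
  have hUo : ∀ n, IsOpen (U n) := fun n => by
    refine IsOpen.and ?_ (IsOpen.and ?_ (IsOpen.and ?_ ?_))
    · exact isOpen_lt (by fun_prop) continuous_const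
    · exact isOpen_lt (((hc.comp continuous_subtype_val).dist continuous_const).add
        (((hτ.comp continuous_subtype_val).sub continuous_const).abs)) continuous_const
    · exact isOpen_lt (((hρ₁.comp continuous_subtype_val).sub continuous_const).abs)
        continuous_const
    · exact isOpen_lt (((hρ'.comp continuous_subtype_val).sub continuous_const).abs)
        continuous_const
  have hUn : ∀ n, n ∈ U n := fun n => by
    have := hD n; have := hd n
    refine ⟨?_, ?_, ?_, ?_⟩ <;> simp <;> positivity
  obtain ⟨p, hp⟩ := PartitionOfUnity.exists_isSubordinate (s := (univ : Set N)) isClosed_univ U hUo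
    (fun n _ => mem_iUnion.2 ⟨n, hUn n⟩)
  have hpU : ∀ n m, 0 < p n m → m ∈ U n := fun n m h =>
    hp n (subset_tsupport _ (Function.mem_support.2 h.ne'))
  let near : N → Prop := fun n => ∃ a ∈ A, dist a n < 2 * infDist n.1 A ∧ ρ₁ n ≤ s n (f a)
  have hv : ∀ n : N, ∃ y, ρ₁ n ≤ s n y ∧
      (near n → ∃ a ∈ A, dist a n < 2 * infDist n.1 A ∧ y = f a) := fun n => by
    by_cases h : near n
    · obtain ⟨a, ha, h1, h2⟩ := h
      exact ⟨f a, h2, fun _ => ⟨a, ha, h1, rfl⟩⟩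
    · obtain ⟨y, hy⟩ := hex n
      exact ⟨y, (h12 n).le.trans hy, fun h' => absurd h' h⟩
  choose v hv1 hv2 using hv
  let T : N → ℝ := fun n => ρ₁ n - 3 / 4 * D n
  have hTv : ∀ n, T n < s n (v n) := fun n => by
    have := hD n
    exact lt_of_lt_of_le (by simp only [T]; linarith) (hv1 n)
  have hγ := fun i j : N => exists_controlled_path hg i.1 (T i) (v i) (v j) (hTv i)
  choose γ hγc hγ0 hγ1 hγs hγb using hγ
  obtain ⟨F₀, μ, hF₀, -, -, -, -, -, -, hFP⟩ := exists_nerve_map p v γ hγc hγ0 hγ1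
    (fun i _ _ => v i) (fun i => continuous_const) (fun i _ => rfl)
  -- estimates for active pairs
  have hact : ∀ (m i j : N), m ∈ U i → m ∈ U j → T i < s i (v j) := by
    rintro m i j ⟨-, h2, h3, h4⟩ ⟨-, k2, k3, k4⟩
    have e1 := hv1 j
    have e2 : s j (v j) ≤ s m (v j) + _ := slack_le m.1 j.1 (v j)
    have e3 : s m (v j) ≤ s i (v j) + _ := slack_le i.1 m.1 (v j)
    rw [dist_comm, abs_sub_comm] at e3
    rw [abs_lt] at h3 h4 k3 k4
    have := hD i.1
    simp only [T, D] at *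
    linarith
  have hact2 : ∀ (m i : N) y, m ∈ U i → T i < s i y → ρ' m ≤ s m y := by
    rintro m i y ⟨-, h2, h3, h4⟩ hy
    have e2 : s i y ≤ s m y + _ := slack_le m.1 i.1 y
    rw [abs_lt] at h3 h4
    have := hD i.1
    simp only [T, D] at *
    linarith
  let F : M → Y := fun m => if h : m ∈ A then f m else F₀ ⟨m, h⟩
  have hFA : EqOn F f A := fun m hm => by simp [F, hm]
  have hFN : ∀ m : N, F m = F₀ m := fun m => by simp [F, m.2]
  have hFs : ∀ m, ρ' m ≤ s m (F m) := fun m => by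
    by_cases hm : m ∈ A
    · rw [hFA hm]; exact ((h01 m).trans (h12 m)).le.trans (hfA m hm)
    · have e := hFN ⟨m, hm⟩
      simp only at e
      rw [e]
      obtain ⟨P, Q, hP, hQ, σ, hP1, hQ1, hPQ⟩ := hFP ⟨m, hm⟩
      rw [hPQ]
      refine Finset.sup'_induction hP _ (p := fun y => ρ' m ≤ s m y)
        (fun a ha b hb => le_slack_sup hg ha hb) fun i hi => ?_
      have hmi := hpU i _ (hP1 i hi)
      have h1 : ρ' m ≤ s m (v i) := hact2 ⟨m, hm⟩ i _ hmi (hTv i)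
      refine le_slack_sup hg (le_slack_sup hg h1 h1) ?_
      refine Finset.sup'_induction hQ _ (p := fun y => ρ' m ≤ s m y)
        (fun a ha b hb => le_slack_sup hg ha hb) fun j hj => ?_
      exact hact2 ⟨m, hm⟩ i _ hmi (hγs i j (hact _ i j hmi (hpU j _ (hQ1 j hj))) _)
  have hest : ∀ a ∈ A, ∀ r δ : ℝ, 0 < r → 0 < δ →
      (∀ a' ∈ A, dist a' a < 4 * δ → dist (f a') (f a) < r) →
      (∀ m', dist m' a < 4 * δ → ∀ y, dist y (f a) < 5 * r → ρ₁ m' ≤ s m' y) →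
      ∀ m, dist m a < δ → dist (F m) (f a) < 5 * r := by
    intro a ha r δ hr hδ H1 H2 m hma
    by_cases hm : m ∈ A
    · rw [hFA hm]
      have := H1 m hm (by linarith)
      linarith
    · have e := hFN ⟨m, hm⟩
      simp only at e
      rw [e]
      have hne : A.Nonempty := ⟨a, ha⟩
      have hnear : ∀ i : N, 0 < p i ⟨m, hm⟩ → dist i.1 a < 2 * δ ∧ dist (v i) (f a) < r := by
        intro i hi
        obtain ⟨h1, -⟩ := hpU i _ hi
        have hdi : d i = infDist i.1 A := by simp [d, hne]
        rw [hdi] at h1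
        have h1' : dist m i.1 < infDist i.1 A / 8 := h1
        have h2 : infDist i.1 A ≤ dist i.1 a := infDist_le_dist_of_mem ha
        have h3 := dist_triangle i.1 m a
        rw [dist_comm i.1 m] at h3
        have h4 := (hd i); rw [hdi] at h4
        have hia : dist i.1 a < 8 / 7 * δ := by linarith
        have hin : ∀ a', dist a' i.1 < 2 * infDist i.1 A → dist a' a < 4 * δ := fun a' h' => by
          have := dist_triangle a' i.1 a
          linarith
        have hni : near i := by
          obtain ⟨a', ha', hlt⟩ := (infDist_lt_iff hne).1 (show infDist i.1 A < 2 * infDist i.1 A by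
            linarith)
          rw [dist_comm] at hlt
          have hh := H1 a' ha' (hin a' hlt)
          exact ⟨a', ha', hlt, H2 i.1 (by linarith) _ (by linarith)⟩
        obtain ⟨a', ha', h5, h6⟩ := hv2 i hni
        refine ⟨by linarith, ?_⟩
        rw [h6]
        exact H1 a' ha' (hin a' h5)
      obtain ⟨P, Q, hP, hQ, σ, hP1, hQ1, hPQ⟩ := hFP ⟨m, hm⟩
      rw [hPQ]
      refine Finset.sup'_induction hP _ (p := fun y => dist y (f a) < 5 * r)
        (fun a ha b hb => dist_sup_lt ha hb) fun i hi => ?_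
      obtain ⟨hi1, hi2⟩ := hnear i (hP1 i hi)
      have h1 : dist (v i) (f a) < 5 * r := by linarith
      refine dist_sup_lt (dist_sup_lt h1 h1) ?_
      refine Finset.sup'_induction hQ _ (p := fun y => dist y (f a) < 5 * r)
        (fun a ha b hb => dist_sup_lt ha hb) fun j hj => ?_
      obtain ⟨hj1, hj2⟩ := hnear j (hQ1 j hj)
      have hij : dist (v i) (v j) < 2 * r := by
        have := dist_triangle_right (v i) (v j) (f a)
        linarith
      have hb : ∀ y, dist y (v i) ≤ 2 * dist (v i) (v j) → dist y (f a) < 5 * r := fun y hy => by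
        have := dist_triangle y (v i) (f a)
        linarith
      refine hb _ (hγb i j (fun y hy => ?_) _)
      refine lt_of_lt_of_le ?_ (H2 i.1 (by linarith) y (hb y hy))
      have := hD i.1
      simp only [T]; linarith
  refine ⟨F, continuous_iff_continuousAt.2 fun m => ?_, hFA, hFs, hest⟩
  by_cases hm : m ∈ A
  · rw [ContinuousAt, Metric.tendsto_nhds]
    intro e he
    have hs : Continuous fun p : M × Y => s p.1 p.2 := continuous_slack hc hτ hg.continuous
    have hlt : ρ₁ m < s m (f m) := (h12 m).trans_le (hfA m hm)
    have hev : ∀ᶠ p : M × Y in 𝓝 (m, f m), ρ₁ p.1 < s p.1 p.2 :=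
      (hρ₁.comp continuous_fst).continuousAt.eventually_lt hs.continuousAt hlt
    obtain ⟨η, hη, hev⟩ := Metric.eventually_nhds_iff.1 hev
    set r := min η e / 5 with hr
    have hr0 : 0 < r := by positivity
    obtain ⟨δ, hδ, hfδ⟩ := Metric.continuousWithinAt_iff.1 (hf m hm) r hr0
    have h5 : 5 * r = min η e := by rw [hr]; ring
    filter_upwards [Metric.ball_mem_nhds m (show 0 < min δ η / 4 by positivity)] with x hx
    rw [hFA hm]
    have h4 : 4 * (min δ η / 4) = min δ η := by ring
    refine (hest m hm r (min δ η / 4) hr0 (by positivity) (fun a' ha' h' => ?_)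
      (fun m' hm' y hy => ?_) x hx).trans_le (h5.trans_le (min_le_right _ _))
    · rw [h4] at h'
      exact hfδ ha' (h'.trans_le (min_le_left _ _))
    · rw [h4] at hm'
      rw [h5] at hy
      refine (hev (y := (m', y)) ?_).le
      rw [Prod.dist_eq]
      exact max_lt (hm'.trans_le (min_le_right _ _)) (hy.trans_le (min_le_left _ _))
  · have hopen : IsOpen (Aᶜ) := hA.isOpen_compl
    have h1 : ContinuousOn F Aᶜ := by
      rw [continuousOn_iff_continuous_domRestrict]
      refine hF₀.congr fun n => (hFN n).symm
    exact h1.continuousAt (hopen.mem_nhds hm)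

end

end CurtisNhu

namespace CurtisNhu

/-- Data making `O` a factor of a stable product over `T`. -/
structure StableData {T O L : Type*} [TopologicalSpace T] [TopologicalSpace O]
    [NormedAddCommGroup L] (p : O → T) (i : O → L) (θ : ℕ → T × L → O)
    (σ : T → O) : Prop where
  ind : Topology.IsInducing fun o => (p o, i o)
  inj : Function.Injective fun o => (p o, i o)
  cont : ∀ n, Continuous (θ n)
  fib : ∀ n t l, p (θ n (t, l)) = t
  step : ∀ n t l, θ (n + 1) (t, i (θ n (t, l))) = θ n (t, l)
  local_bound : ∀ o, ∃ (K : ℝ) (N : ℕ) (δ : ℝ), 0 < δ ∧ 0 ≤ K ∧ ∀ᶠ o' in 𝓝 o, ∀ n ≥ N,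
    ∀ x, ‖x‖ < δ → ‖i (θ n (p o', i o' + x)) - i o'‖ ≤ K * ‖x‖
  sec : ∀ t, p (σ t) = t
  sec_cont : Continuous σ
  start : ∀ t, θ 0 (t, i (σ t)) = σ t

namespace StableData

variable {T O L : Type*} [TopologicalSpace T] [TopologicalSpace O]
    [NormedAddCommGroup L] [NormedSpace ℝ L] {p : O → T} {i : O → L} {θ : ℕ → T × L → O}
    {σ : T → O} (H : StableData p i θ σ)

include H in
theorem cont_p : Continuous p := continuous_fst.comp H.ind.continuous

include H in
theorem cont_i : Continuous i := continuous_snd.comp H.ind.continuous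

include H in
theorem eq_of {o o' : O} (h : p o = p o') (h' : i o = i o') : o = o' :=
  H.inj (Prod.ext h h')

variable (i θ σ) in
/-- The decoding recursion. -/
noncomputable def e (t : T) (z : ℕ → L) : ℕ → L
  | 0 => i (σ t) + z 0
  | n + 1 => i (θ n (t, e t z n)) + (2⁻¹ : ℝ) ^ (n + 1) • z (n + 1)

variable (i θ σ) in
/-- The points of `O` produced by the decoding recursion. -/
noncomputable def pt (t : T) (z : ℕ → L) (n : ℕ) : O := θ n (t, e i θ σ t z n)

include H in
theorem continuous_e (n : ℕ) : Continuous fun q : T × L1 ℕ L => e i θ σ q.1 (fun k => q.2 k) n := by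
  induction n with
  | zero =>
    exact (H.cont_i.comp (H.sec_cont.comp continuous_fst)).add
      ((L1.continuous_apply 0).comp continuous_snd)
  | succ n ih =>
    exact (H.cont_i.comp ((H.cont n).comp (continuous_fst.prodMk ih))).add
      (((L1.continuous_apply (n + 1)).comp continuous_snd).const_smul _)

include H in
theorem continuous_pt (n : ℕ) :
    Continuous fun q : T × L1 ℕ L => pt i θ σ q.1 (fun k => q.2 k) n :=
  (H.cont n).comp (continuous_fst.prodMk (H.continuous_e n))

include H in
theorem pt_succ_eq {t : T} {z : ℕ → L} {n : ℕ} (hz : z (n + 1) = 0) :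
    pt i θ σ t z (n + 1) = pt i θ σ t z n := by
  rw [pt, e, hz, smul_zero, add_zero]
  exact H.step n t _

include H in
theorem pt_eq_of_le {t : T} {z : ℕ → L} {m : ℕ} (hz : ∀ k > m, z k = 0) :
    ∀ n ≥ m, pt i θ σ t z n = pt i θ σ t z m := by
  intro n hn
  induction n, hn using Nat.le_induction with
  | base => rfl
  | succ n hn ih => rw [H.pt_succ_eq (hz _ (by omega)), ih]

/-- A bound for the support of a finitely supported sequence. -/
noncomputable def bd (z : L1 ℕ L) : ℕ := z.supp.sup id

theorem apply_eq_zero_of_bd_lt {z : L1 ℕ L} {k : ℕ} (h : bd z < k) : z k = 0 := by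
  by_contra h'
  have := Finset.le_sup (f := id) (L1.mem_supp.2 h')
  simp only [id] at this
  exact absurd h (not_lt.2 this)

variable (i θ σ) in
/-- The limit of the decoding recursion. -/
noncomputable def lim (t : T) (z : L1 ℕ L) : O := pt i θ σ t (fun k => z k) (bd z)

include H in
theorem lim_eq {t : T} {z : L1 ℕ L} {n : ℕ} (hn : bd z ≤ n) :
    pt i θ σ t (fun k => z k) n = lim i θ σ t z :=
  H.pt_eq_of_le (fun _ hk => apply_eq_zero_of_bd_lt hk) n hn

include H in
theorem e_eq {t : T} {z : L1 ℕ L} {n : ℕ} (hn : bd z < n) :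
    e i θ σ t (fun k => z k) n = i (lim i θ σ t z) := by
  obtain ⟨n, rfl⟩ : ∃ k, n = k + 1 := ⟨n - 1, by omega⟩
  rw [e, apply_eq_zero_of_bd_lt hn, smul_zero, add_zero, ← H.lim_eq (n := n) (by omega)]
  rfl

include H in
theorem p_pt (t : T) (z : ℕ → L) (n : ℕ) : p (pt i θ σ t z n) = t := H.fib _ _ _

include H in
theorem p_lim (t : T) (z : L1 ℕ L) : p (lim i θ σ t z) = t := H.fib _ _ _

/-- The decoding map. -/
noncomputable def dec (q : T × L1 ℕ L) : O × L1 ℕ L :=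
  (lim i θ σ q.1 q.2, L1.mk (fun n => (2 : ℝ) ^ n •
    (e i θ σ q.1 (fun k => q.2 k) n - i (lim i θ σ q.1 q.2))) (by
      refine (finite_le_nat (bd q.2)).subset fun n hn => ?_
      by_contra h
      refine hn ?_
      simp only [H.e_eq (not_le.1 h), sub_self, smul_zero]))

variable (p i θ σ) in
/-- The coordinates of the encoding. -/
noncomputable def encSeq (o : O) (x : ℕ → L) : ℕ → L
  | 0 => i o + x 0 - i (σ (p o))
  | n + 1 => (2 : ℝ) ^ (n + 1) • (i o - i (θ n (p o, i o + (2⁻¹ : ℝ) ^ n • x n))) + x (n + 1)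

include H in
theorem encSeq_finite (o : O) (x : L1 ℕ L) :
    (Function.support (encSeq p i θ σ o fun k => x k)).Finite := by
  obtain ⟨K, N, δ, hδ, hK, h⟩ := H.local_bound o
  have h := h.self_of_nhds
  refine (finite_le_nat (max N (bd x) + 1)).subset fun n hn => ?_
  by_contra h'
  simp only [mem_ofPred_eq, not_le] at h'
  obtain ⟨n, rfl⟩ : ∃ k, n = k + 1 := ⟨n - 1, by omega⟩
  refine hn ?_
  have hx : x n = 0 := apply_eq_zero_of_bd_lt (by omega)
  have hx' : x (n + 1) = 0 := apply_eq_zero_of_bd_lt (by omega)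
  have := h n (by omega) 0 (by simpa using hδ)
  rw [norm_zero, mul_zero, norm_le_zero_iff, add_zero, sub_eq_zero] at this
  simp only [encSeq, hx, hx', smul_zero, add_zero, this, sub_self]

/-- The encoding map. -/
noncomputable def enc (q : O × L1 ℕ L) : T × L1 ℕ L :=
  (p q.1, L1.mk (encSeq p i θ σ q.1 fun k => q.2 k) (H.encSeq_finite q.1 q.2))

theorem pow_smul_pow (n : ℕ) (x : L) : (2⁻¹ : ℝ) ^ n • (2 : ℝ) ^ n • x = x := by
  rw [smul_smul, ← mul_pow]; norm_num

theorem pow_smul_pow' (n : ℕ) (x : L) : (2 : ℝ) ^ n • (2⁻¹ : ℝ) ^ n • x = x := by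
  rw [smul_smul, ← mul_pow]; norm_num

include H in
theorem e_encSeq (o : O) (x : ℕ → L) (n : ℕ) :
    e i θ σ (p o) (encSeq p i θ σ o x) n = i o + (2⁻¹ : ℝ) ^ n • x n := by
  induction n with
  | zero => simp [e, encSeq]
  | succ n ih =>
    rw [e, ih, encSeq, smul_add, pow_smul_pow]; abel

theorem dec_enc (q : O × L1 ℕ L) : H.dec (H.enc q) = q := by
  obtain ⟨o, x⟩ := q
  have he := fun n => H.e_encSeq o (fun k => x k) n
  have hlim : lim i θ σ (p o) (H.enc (o, x)).2 = o := by
    set z := (H.enc (o, x)).2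
    have h1 : i (lim i θ σ (p o) z) = i o := by
      rw [← H.e_eq (n := max (bd z) (bd x) + 1) (by omega)]
      refine (he _).trans ?_
      rw [apply_eq_zero_of_bd_lt (z := x) (by omega), smul_zero, add_zero]
    exact H.eq_of (H.p_lim _ _) h1
  refine Prod.ext hlim (L1.ext fun n => ?_)
  change (2 : ℝ) ^ n • (e i θ σ (p o) (encSeq p i θ σ o fun k => x k) n -
    i (lim i θ σ (p o) (H.enc (o, x)).2)) = x n
  rw [hlim, he, add_sub_cancel_left, pow_smul_pow']

theorem enc_dec (q : T × L1 ℕ L) : H.enc (H.dec q) = q := by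
  obtain ⟨t, z⟩ := q
  refine Prod.ext (H.p_lim t z) (L1.ext fun n => ?_)
  have hx : ∀ n, i (lim i θ σ t z) + (2⁻¹ : ℝ) ^ n • (H.dec (t, z)).2 n
      = e i θ σ t (fun k => z k) n := fun n => by
    change _ + (2⁻¹ : ℝ) ^ n • ((2 : ℝ) ^ n • (e i θ σ t (fun k => z k) n - i (lim i θ σ t z))) = _
    rw [pow_smul_pow]; simp
  change encSeq p i θ σ (lim i θ σ t z) (fun k => (H.dec (t, z)).2 k) n = z n
  cases n with
  | zero =>
    have := hx 0
    rw [pow_zero, one_smul] at this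
    simp only [encSeq, this, H.p_lim]
    simp [e]
  | succ n =>
    simp only [encSeq, hx, H.p_lim]
    change (2 : ℝ) ^ (n + 1) • (i (lim i θ σ t z) - i (θ n (t, e i θ σ t (fun k => z k) n))) + (2 : ℝ) ^ (n + 1) • (e i θ σ t (fun k => z k) (n + 1) -
      i (lim i θ σ t z)) = _
    rw [← smul_add, e]
    have : i (lim i θ σ t z) - i (θ n (t, e i θ σ t (fun k => z k) n)) +
        (i (θ n (t, e i θ σ t (fun k => z k) n)) + (2⁻¹ : ℝ) ^ (n + 1) • z (n + 1) -
        i (lim i θ σ t z)) = (2⁻¹ : ℝ) ^ (n + 1) • z (n + 1) := by abel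
    rw [this, pow_smul_pow']

theorem continuous_enc : Continuous H.enc := by
  refine (H.cont_p.comp continuous_fst).prodMk (continuous_iff_continuousAt.2 fun q => ?_)
  refine L1.continuousAt_of_tail (fun n => Continuous.continuousAt ?_) fun ε hε => ?_
  · cases n with
    | zero =>
      exact ((H.cont_i.comp continuous_fst).add ((L1.continuous_apply 0).comp continuous_snd)).sub
        (H.cont_i.comp (H.sec_cont.comp (H.cont_p.comp continuous_fst)))
    | succ n =>
      refine Continuous.add (Continuous.const_smul ((H.cont_i.comp continuous_fst).sub
        (H.cont_i.comp ((H.cont n).comp ((H.cont_p.comp continuous_fst).prodMk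
        ((H.cont_i.comp continuous_fst).add (Continuous.const_smul
        ((L1.continuous_apply n).comp continuous_snd) _)))))) _)
        ((L1.continuous_apply (n + 1)).comp continuous_snd)
  · obtain ⟨o, x⟩ := q
    obtain ⟨K, N, δ, hδ, hK, h⟩ := H.local_bound o
    set η := min δ (ε / (2 * K + 1)) with hη
    have hη0 : 0 < η := by positivity
    refine ⟨Finset.range (max N (bd x) + 2), ?_⟩
    filter_upwards [continuous_fst.continuousAt.eventually h,
      continuous_snd.continuousAt.eventually (Metric.ball_mem_nhds x hη0)] with q h1 h2 t ht
    have h2 : ‖q.2 - x‖ < η := by rw [← dist_eq_norm]; exact h2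
    have hmem : ∀ n ∈ t, max N (bd x) + 2 ≤ n := fun n hn => by
      by_contra! hlt
      exact Finset.disjoint_left.1 ht (Finset.mem_range.2 hlt) hn
    have hq : ∀ n, max N (bd x) + 1 ≤ n → q.2 n = (q.2 - x) n := fun n hn => by
      rw [L1.sub_apply, apply_eq_zero_of_bd_lt (z := x) (by omega), sub_zero]
    have hle : ∀ n ∈ t, ‖encSeq p i θ σ q.1 (fun k => q.2 k) n‖ ≤
        2 * K * ‖(q.2 - x) (n - 1)‖ + ‖(q.2 - x) n‖ := fun n hn => by
      have hn' := hmem n hn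
      obtain ⟨n, rfl⟩ : ∃ k, n = k + 1 := ⟨n - 1, by omega⟩
      rw [encSeq]
      refine (norm_add_le _ _).trans (add_le_add ?_ (le_of_eq (by rw [hq _ (by omega)])))
      have hx : ‖(2⁻¹ : ℝ) ^ n • q.2 n‖ = (2⁻¹ : ℝ) ^ n * ‖q.2 n‖ := by
        rw [norm_smul, norm_pow, norm_inv]; norm_num
      have hx' : ‖(2⁻¹ : ℝ) ^ n • q.2 n‖ < δ := by
        rw [hx, hq _ (by omega)]
        have : (2⁻¹ : ℝ) ^ n ≤ 1 := pow_le_one₀ (by norm_num) (by norm_num)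
        have h3 := L1.norm_apply_le (q.2 - x) n
        have h4 : (2⁻¹ : ℝ) ^ n * ‖(q.2 - x) n‖ ≤ 1 * ‖(q.2 - x) n‖ :=
          mul_le_mul_of_nonneg_right this (norm_nonneg _)
        have := min_le_left δ (ε / (2 * K + 1))
        linarith
      have := h1 n (by omega) _ hx'
      rw [norm_smul, norm_sub_rev, norm_pow, Real.norm_ofNat, Nat.add_sub_cancel, ← hq n (by omega)]
      calc (2 : ℝ) ^ (n + 1) * _ ≤ (2 : ℝ) ^ (n + 1) * (K * ((2⁻¹ : ℝ) ^ n * ‖q.2 n‖)) := by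
            rw [← hx]; gcongr
        _ = 2 * K * ‖q.2 n‖ := by
            rw [pow_succ, inv_pow]; field_simp
    calc ∑ n ∈ t, ‖encSeq p i θ σ q.1 (fun k => q.2 k) n‖
        ≤ ∑ n ∈ t, (2 * K * ‖(q.2 - x) (n - 1)‖ + ‖(q.2 - x) n‖) := Finset.sum_le_sum hle
      _ = 2 * K * ∑ n ∈ t, ‖(q.2 - x) (n - 1)‖ + ∑ n ∈ t, ‖(q.2 - x) n‖ := by
          rw [Finset.sum_add_distrib, Finset.mul_sum]
      _ ≤ 2 * K * ‖q.2 - x‖ + ‖q.2 - x‖ := by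
          refine add_le_add (mul_le_mul_of_nonneg_left ?_ (by positivity)) (L1.sum_norm_le _ _)
          have hinj : Set.InjOn (fun n => n - 1) (t : Set ℕ) := fun a ha b hb hab => by
            have := hmem a ha; have := hmem b hb
            simp only at hab; omega
          rw [← Finset.sum_image (f := fun n => ‖(q.2 - x) n‖) (g := fun n => n - 1) hinj]
          exact L1.sum_norm_le _ _
      _ = (2 * K + 1) * ‖q.2 - x‖ := by ring
      _ ≤ (2 * K + 1) * (ε / (2 * K + 1)) := by
          gcongr
          exact h2.le.trans (min_le_right _ _)
      _ = ε := by field_simp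

include H in
/-- Near a given point the tail of the decoding recursion is controlled. -/
theorem tail_control (t : T) (z : L1 ℕ L) (r : ℝ) (hr : 0 < r) :
    ∃ (K : ℝ) (M : ℕ), 0 ≤ K ∧ bd z ≤ M ∧ ∀ᶠ q : T × L1 ℕ L in 𝓝 (t, z),
      (∀ n ≥ M, ‖i (pt i θ σ q.1 (fun k => q.2 k) n) - i (lim i θ σ t z)‖ < r) ∧
      ∀ n ≥ M, ‖i (pt i θ σ q.1 (fun k => q.2 k) (n + 1)) - i (pt i θ σ q.1 (fun k => q.2 k) n)‖
        ≤ K * ((2⁻¹ : ℝ) ^ (n + 1) * ‖(q.2 - z) (n + 1)‖) := by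
  set o := lim i θ σ t z with ho
  obtain ⟨K, N, δ, hδ, hK, h⟩ := H.local_bound o
  rw [H.ind.nhds_eq_comap, nhds_prod_eq] at h
  obtain ⟨W, hW, hWh⟩ := Filter.mem_comap.1 h
  obtain ⟨W₁, hW₁, W₂, hW₂, hWW⟩ := Filter.mem_prod_iff.1 hW
  obtain ⟨r', hr', hball⟩ := Metric.mem_nhds_iff.1 hW₂
  have hmain : ∀ o' : O, p o' ∈ W₁ → ‖i o' - i o‖ < r' → ∀ n ≥ N, ∀ x, ‖x‖ < δ →
      ‖i (θ n (p o', i o' + x)) - i o'‖ ≤ K * ‖x‖ := fun o' h1 h2 =>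
    hWh (show o' ∈ (fun o => (p o, i o)) ⁻¹' W from hWW ⟨h1, hball (by
      rw [mem_ball, dist_eq_norm]; exact h2)⟩)
  set M := max N (bd z) with hM
  set R := min r r' with hR
  have hR0 : 0 < R := by positivity
  have hpo : p o = t := H.p_lim t z
  rw [hpo] at hW₁
  set η := min δ (R / 2 / (K + 1)) with hη
  have hη0 : 0 < η := by positivity
  have hev : ∀ᶠ q : T × L1 ℕ L in 𝓝 (t, z),
      ‖i (pt i θ σ q.1 (fun k => q.2 k) M) - i o‖ < R / 2 := by
    have hc := (H.cont_i.comp (H.continuous_pt M)).continuousAt (x := (t, z))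
    have : i (pt i θ σ t (fun k => z k) M) = i o := by
      rw [H.lim_eq (n := M) (le_max_right _ _)]
    have h2 := hc.eventually_mem (Metric.ball_mem_nhds _ (half_pos hR0))
    filter_upwards [h2] with q hq
    rw [mem_ball, dist_eq_norm] at hq
    simp only [Function.comp, this] at hq
    exact hq
  refine ⟨K, M, hK, le_max_right _ _, ?_⟩
  filter_upwards [hev, continuous_fst.continuousAt.eventually hW₁,
    continuous_snd.continuousAt.eventually (Metric.ball_mem_nhds z hη0)] with q h1 h2 h3
  have h3 : ‖q.2 - z‖ < η := by rw [← dist_eq_norm]; exact h3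
  have h2 : q.1 ∈ W₁ := h2
  set P := fun n => pt i θ σ q.1 (fun k => q.2 k) n with hP
  have hq : ∀ n, M < n → q.2 n = (q.2 - z) n := fun n hn => by
    rw [L1.sub_apply, apply_eq_zero_of_bd_lt (z := z) (by omega), sub_zero]
  have hnorm : ∀ n, ‖(2⁻¹ : ℝ) ^ n • (q.2 - z) n‖ = (2⁻¹ : ℝ) ^ n * ‖(q.2 - z) n‖ := fun n => by
    rw [norm_smul, norm_pow, norm_inv]; norm_num
  have hnle : ∀ n, (2⁻¹ : ℝ) ^ n * ‖(q.2 - z) n‖ ≤ ‖(q.2 - z) n‖ := fun n =>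
    mul_le_of_le_one_left (norm_nonneg _) (pow_le_one₀ (by norm_num) (by norm_num))
  have hstep : ∀ n ≥ M, ‖i (P n) - i o‖ < r' →
      ‖i (P (n + 1)) - i (P n)‖ ≤ K * ((2⁻¹ : ℝ) ^ (n + 1) * ‖(q.2 - z) (n + 1)‖) := by
    intro n hn hlt
    have hpP : p (P n) = q.1 := H.p_pt _ _ _
    have := hmain (P n) (by rw [hpP]; exact h2) hlt (n + 1) (by omega)
      ((2⁻¹ : ℝ) ^ (n + 1) • (q.2 - z) (n + 1)) (by
        rw [hnorm]
        have := hnle (n + 1)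
        have := L1.norm_apply_le (q.2 - z) (n + 1)
        have := min_le_left δ (R / 2 / (K + 1))
        linarith)
    rw [hnorm, hpP, ← hq _ (by omega)] at this
    rw [← hq _ (by omega)]
    exact this
  have hsum : ∀ k, ‖i (P (M + k)) - i o‖ < R / 2 + K * ∑ j ∈ Finset.range k, ‖(q.2 - z) (M + j + 1)‖
      ∧ ‖i (P (M + k)) - i o‖ < R := by
    have hbound : ∀ k, R / 2 + K * ∑ j ∈ Finset.range k, ‖(q.2 - z) (M + j + 1)‖ ≤ R := fun k => by
      have e1 : ∑ j ∈ Finset.range k, ‖(q.2 - z) (M + j + 1)‖ ≤ ‖q.2 - z‖ := by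
        exact (Finset.sum_map (Finset.range k)
          ((addLeftEmbedding M).trans (addRightEmbedding 1))
          (fun n => ‖(q.2 - z) n‖)).symm.trans_le (L1.sum_norm_le _ _)
      have e2 : K * ∑ j ∈ Finset.range k, ‖(q.2 - z) (M + j + 1)‖ ≤ K * (R / 2 / (K + 1)) := by
        gcongr
        exact e1.trans (h3.le.trans (min_le_right _ _))
      have e3 : K * (R / 2 / (K + 1)) ≤ R / 2 := by
        rw [mul_div_assoc', div_le_iff₀ (by positivity)]
        nlinarith
      linarith
    intro k
    induction k with
    | zero =>
      refine ⟨by simpa using h1, by simpa using h1.trans (half_lt_self hR0)⟩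
    | succ k ih =>
      have h4 := hstep (M + k) (by omega) (ih.2.trans_le (min_le_right _ _))
      have h5 := hnle (M + k + 1)
      have h6 : K * ((2⁻¹ : ℝ) ^ (M + k + 1) * ‖(q.2 - z) (M + k + 1)‖) ≤
        K * ‖(q.2 - z) (M + k + 1)‖ := mul_le_mul_of_nonneg_left h5 hK
      have h7 := norm_sub_le_norm_sub_add_norm_sub (i (P (M + k + 1))) (i (P (M + k))) (i o)
      have h8 : ‖i (P (M + (k + 1))) - i o‖ <
          R / 2 + K * ∑ j ∈ Finset.range (k + 1), ‖(q.2 - z) (M + j + 1)‖ := by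
        rw [Finset.sum_range_succ, mul_add]
        have := ih.1
        rw [← add_assoc M k 1]
        linarith
      exact ⟨h8, h8.trans_le (hbound _)⟩
  have hall : ∀ n ≥ M, ‖i (P n) - i o‖ < R := fun n hn => by
    obtain ⟨k, rfl⟩ := Nat.exists_eq_add_of_le hn
    exact (hsum k).2
  exact ⟨fun n hn => (hall n hn).trans_le (min_le_left _ _),
    fun n hn => hstep n hn ((hall n hn).trans_le (min_le_right _ _))⟩

include H in
theorem continuous_lim : Continuous fun q : T × L1 ℕ L => lim i θ σ q.1 q.2 := by
  refine H.ind.continuous_iff.2 (Continuous.prodMk ?_ ?_)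
  · simp only [H.p_lim]; exact continuous_fst
  · refine continuous_iff_continuousAt.2 fun q => ?_
    rw [ContinuousAt, Metric.tendsto_nhds]
    intro r hr
    obtain ⟨K, M, -, -, hev⟩ := H.tail_control q.1 q.2 r hr
    filter_upwards [hev] with q' hq'
    rw [dist_eq_norm, ← H.lim_eq (n := max M (bd q'.2)) (le_max_right _ _)]
    exact hq'.1 _ (le_max_left _ _)

theorem continuous_dec : Continuous H.dec := by
  refine H.continuous_lim.prodMk (continuous_iff_continuousAt.2 fun q => ?_)
  refine L1.continuousAt_of_tail (fun n => Continuous.continuousAt ?_) fun ε hε => ?_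
  · exact ((H.continuous_e n).sub (H.cont_i.comp H.continuous_lim)).const_smul _
  obtain ⟨t, z⟩ := q
  obtain ⟨K, M, hK, hM, hev⟩ := H.tail_control t z 1 one_pos
  refine ⟨Finset.range (M + 1), ?_⟩
  have hη0 : 0 < ε / (2 * K + 1) := by positivity
  filter_upwards [hev, continuous_snd.continuousAt.eventually
    (Metric.ball_mem_nhds z hη0)] with q h1 h3 u hu
  have h3 : ‖q.2 - z‖ < ε / (2 * K + 1) := by rw [← dist_eq_norm]; exact h3
  set P := fun n => pt i θ σ q.1 (fun k => q.2 k) n with hP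
  set o := lim i θ σ q.1 q.2 with ho
  set w : ℕ → ℝ := fun n => 2 ^ n * ‖i (P n) - i o‖ with hw
  have hq : ∀ n, M < n → q.2 n = (q.2 - z) n := fun n hn => by
    rw [L1.sub_apply, apply_eq_zero_of_bd_lt (z := z) (by omega), sub_zero]
  have hwstep : ∀ n ≥ M, w n ≤ 1 / 2 * w (n + 1) + 1 / 2 * K * ‖(q.2 - z) (n + 1)‖ := by
    intro n hn
    have h4 := h1.2 n hn
    have h5 := norm_sub_le_norm_sub_add_norm_sub (i (P n)) (i (P (n + 1))) (i o)
    rw [norm_sub_rev (i (P n)) (i (P (n + 1)))] at h5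
    calc w n ≤ 2 ^ n * (K * ((2⁻¹ : ℝ) ^ (n + 1) * ‖(q.2 - z) (n + 1)‖) +
          ‖i (P (n + 1)) - i o‖) := by
          simp only [hw]; gcongr; linarith
      _ = 1 / 2 * w (n + 1) + 1 / 2 * K * ‖(q.2 - z) (n + 1)‖ := by
          simp only [hw, pow_succ, inv_pow]; field_simp; ring
  have hmem : ∀ n ∈ u, M < n := fun n hn => by
    by_contra! hlt
    exact Finset.disjoint_left.1 hu (Finset.mem_range.2 (by omega)) hn
  set B := max (max M (bd q.2)) (u.sup id) + 1 with hB
  have hwB : w B = 0 := by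
    simp only [hw, hP]
    rw [H.lim_eq (n := B) (by omega)]
    simp [ho]
  have hsumw : ∑ n ∈ Finset.Ico M B, w n ≤ K * ‖q.2 - z‖ := by
    have e1 : ∑ n ∈ Finset.Ico M B, w n ≤
        ∑ n ∈ Finset.Ico M B, (1 / 2 * w (n + 1) + 1 / 2 * K * ‖(q.2 - z) (n + 1)‖) :=
      Finset.sum_le_sum fun n hn => hwstep n (Finset.mem_Ico.1 hn).1
    rw [Finset.sum_add_distrib, ← Finset.mul_sum, ← Finset.mul_sum] at e1
    have e2 : ∑ n ∈ Finset.Ico M B, w (n + 1) = ∑ n ∈ Finset.Ico M B, w n + w B - w M := by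
      have h6 : M ≤ B := by omega
      have := Finset.sum_Ico_sub w h6
      rw [Finset.sum_sub_distrib] at this
      linarith
    have e3 : ∑ n ∈ Finset.Ico M B, ‖(q.2 - z) (n + 1)‖ ≤ ‖q.2 - z‖ := by
      exact (Finset.sum_map (Finset.Ico M B) (addRightEmbedding 1)
        (fun n => ‖(q.2 - z) n‖)).symm.trans_le (L1.sum_norm_le _ _)
    have e4 : 0 ≤ w M := by positivity
    have e5 : 1 / 2 * K * ∑ n ∈ Finset.Ico M B, ‖(q.2 - z) (n + 1)‖ ≤ 1 / 2 * K * ‖q.2 - z‖ := by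
      gcongr
    rw [e2, hwB] at e1
    linarith
  have hle : ∀ n ∈ u, ‖(H.dec q).2 n‖ ≤ 2 * w (n - 1) + ‖(q.2 - z) n‖ := by
    intro n hn
    have := hmem n hn
    obtain ⟨n, rfl⟩ : ∃ k, n = k + 1 := ⟨n - 1, by omega⟩
    change ‖(2 : ℝ) ^ (n + 1) • (e i θ σ q.1 (fun k => q.2 k) (n + 1) - i o)‖ ≤ _
    have e1 : e i θ σ q.1 (fun k => q.2 k) (n + 1) - i o =
        (i (P n) - i o) + (2⁻¹ : ℝ) ^ (n + 1) • q.2 (n + 1) := by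
      rw [e]; simp only [hP, pt]; abel
    rw [e1, smul_add, pow_smul_pow', ← hq _ this, Nat.add_sub_cancel]
    refine (norm_add_le _ _).trans (add_le_add (le_of_eq ?_) le_rfl)
    rw [norm_smul, norm_pow, Real.norm_ofNat]; simp only [hw]; ring
  calc ∑ n ∈ u, ‖(H.dec q).2 n‖ ≤ ∑ n ∈ u, (2 * w (n - 1) + ‖(q.2 - z) n‖) :=
        Finset.sum_le_sum hle
    _ = 2 * ∑ n ∈ u, w (n - 1) + ∑ n ∈ u, ‖(q.2 - z) n‖ := by
        rw [Finset.sum_add_distrib, Finset.mul_sum]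
    _ ≤ 2 * (K * ‖q.2 - z‖) + ‖q.2 - z‖ := by
        refine add_le_add (mul_le_mul_of_nonneg_left (le_trans ?_ hsumw) (by norm_num))
          (L1.sum_norm_le _ _)
        have hinj : Set.InjOn (fun n => n - 1) (u : Set ℕ) := fun a ha b hb hab => by
          have := hmem a ha; have := hmem b hb
          simp only at hab; omega
        rw [← Finset.sum_image (f := w) (g := fun n => n - 1) hinj]
        refine Finset.sum_le_sum_of_subset_of_nonneg (fun n hn => ?_) fun n _ _ => by positivity
        obtain ⟨k, hk, rfl⟩ := Finset.mem_image.1 hn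
        have h6 := hmem k hk
        have h7 := Finset.le_sup (f := id) hk
        simp only [id] at h7
        exact Finset.mem_Ico.2 ⟨by omega, by omega⟩
    _ = (2 * K + 1) * ‖q.2 - z‖ := by ring
    _ ≤ (2 * K + 1) * (ε / (2 * K + 1)) := by gcongr
    _ = ε := by field_simp

/-- The stable product homeomorphism. -/
noncomputable def homeo : T × L1 ℕ L ≃ₜ O × L1 ℕ L where
  toFun := H.dec
  invFun := H.enc
  left_inv := H.enc_dec
  right_inv := H.dec_enc
  continuous_toFun := H.continuous_dec
  continuous_invFun := H.continuous_enc

theorem homeo_fib (q : T × L1 ℕ L) : p (H.homeo q).1 = q.1 := H.p_lim _ _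

theorem homeo_zero (t : T) : H.homeo (t, 0) = (σ t, 0) := by
  have h : H.enc (σ t, 0) = (t, 0) := by
    refine Prod.ext (H.sec t) (L1.ext fun n => ?_)
    change encSeq p i θ σ (σ t) (fun k => (0 : L1 ℕ L) k) n = (0 : L1 ℕ L) n
    have hθ : ∀ n, θ n (t, i (σ t)) = σ t := fun n => by
      induction n with
      | zero => exact H.start t
      | succ n ih =>
        have := H.step n t (i (σ t))
        rwa [ih] at this
    cases n with
    | zero => simp [encSeq, L1.zero_apply, H.sec]
    | succ n => simp [encSeq, L1.zero_apply, H.sec, hθ]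
  rw [← h]
  exact H.dec_enc _

end StableData

end CurtisNhu

namespace CurtisNhu

section

variable {Y : Type*} [MetricSpace Y] [SemilatticeSup Y] [SupMetric Y]

/-- A pointwise solvable slack condition admits a continuous positive lower bound. -/
theorem exists_pos_slack_bound {M : Type*} [MetricSpace M] {ε : ℝ} {c : M → Y} {τ : M → ℝ}
    {g : Y → ℝ} (hgc : Continuous g) (hc : Continuous c) (hτ : Continuous τ)
    (hex : ∀ m, ∃ y, 0 < slack ε c τ g m y) :
    ∃ ρ : M → ℝ, Continuous ρ ∧ (∀ m, 0 < ρ m) ∧ ∀ m, ∃ y, ρ m ≤ slack ε c τ g m y := by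
  have hs := continuous_slack (ε := ε) hc hτ hgc
  obtain ⟨ρ, hρ⟩ := exists_continuous_forall_mem_convex_of_local_const
    (t := fun m => {r : ℝ | 0 < r ∧ ∃ y, r ≤ slack ε c τ g m y}) (fun m => by
      refine OrdConnected.convex ⟨fun a ha b hb x hx => ⟨ha.1.trans_le hx.1, ?_⟩⟩
      obtain ⟨y, hy⟩ := hb.2
      exact ⟨y, hx.2.trans hy⟩) (fun m => by
      obtain ⟨y, hy⟩ := hex m
      refine ⟨slack ε c τ g m y / 2, ?_⟩
      have h1 : Continuous fun m' => slack ε c τ g m' y :=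
        hs.comp (continuous_id.prodMk continuous_const)
      filter_upwards [h1.continuousAt.eventually (lt_mem_nhds (half_lt_self hy))] with m' hm'
      exact ⟨half_pos hy, y, hm'.le⟩)
  exact ⟨ρ, ρ.continuous, fun m => (hρ m).1, fun m => (hρ m).2⟩

theorem exists_stable_product {T V : Type*} [MetricSpace T] [NormedAddCommGroup V]
    [NormedSpace ℝ V] {ε : ℝ} {c : T → Y} {τ : T → ℝ} {g : Y → ℝ} (hg : Gauge ε g)
    (hc : Continuous c) (hτ : Continuous τ) {i : Y → V} (hi : Isometry i)
    (hcl : IsClosed (range i)) {σ : T → Y} (hσ : Continuous σ)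
    (hσ' : ∀ t, 0 < slack ε c τ g t (σ t)) :
    ∃ h : T × L1 ℕ V ≃ₜ {q : T × Y // 0 < slack ε c τ g q.1 q.2} × L1 ℕ V,
      (∀ q, (h q).1.1.1 = q.1) ∧ ∀ t, h (t, 0) = (⟨(t, σ t), hσ' t⟩, 0) := by
  have hs := continuous_slack (ε := ε) hc hτ hg.continuous
  set s : T → ℝ := fun t => slack ε c τ g t (σ t) with hs_def
  have hsc : Continuous s := hs.comp (continuous_id.prodMk hσ)
  set ρ : ℕ → T → ℝ := fun n t => s t / (n + 1) with hρ_def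
  have hρc : ∀ n, Continuous (ρ n) := fun n => hsc.div_const _
  have hρ_lt : ∀ n t, ρ (n + 1) t < ρ n t := fun n t => by
    simp only [hρ_def]
    push_cast
    exact div_lt_div_of_pos_left (hσ' t) (by positivity) (by linarith)
  have hρ_anti : ∀ t, Antitone fun n => ρ n t := fun t =>
    antitone_nat_of_succ_le fun n => (hρ_lt n t).le
  have hρ_pos : ∀ n t, 0 < ρ n t := fun n t => div_pos (hσ' t) (by positivity)
  set ji : T × Y → T × V := Prod.map id i with hji
  have hji_iso : Isometry ji := Isometry.prodMap isometry_id hi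
  have hji_ce : Topology.IsClosedEmbedding ji := by
    refine ⟨hji_iso.isEmbedding, ?_⟩
    rw [hji, range_prodMap, range_id]
    exact isClosed_univ.prod hcl
  set A : ℕ → Set (T × V) := fun n => ji '' {q | ρ n q.1 ≤ slack ε c τ g q.1 q.2} with hA_def
  have hA : ∀ n, IsClosed (A n) := fun n =>
    hji_ce.isClosedMap _ (isClosed_le ((hρc n).comp continuous_fst) hs)
  have key : ∀ n, ∃ F : T × V → Y, Continuous F ∧
      (∀ t y, ρ n t ≤ slack ε c τ g t y → F (t, i y) = y) ∧
      (∀ m, ρ (n + 1) m.1 ≤ slack ε c τ g m.1 (F m)) ∧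
      ∀ t y, ρ n t ≤ slack ε c τ g t y → ∀ r, 0 < r →
        (∀ t', dist t' t < 8 * r → ∀ y', dist y' y < 40 * r →
          ρ n t' ≤ slack ε c τ g t' y') →
        ∀ m, dist m (t, i y) < 2 * r → dist (F m) y < 40 * r := by
    intro n
    by_cases hT : Nonempty T
    swap
    · refine ⟨fun m => (hT ⟨m.1⟩).elim, ?_, fun t => (hT ⟨t⟩).elim, fun m => (hT ⟨m.1⟩).elim,
        fun t => (hT ⟨t⟩).elim⟩
      exact continuous_iff_continuousAt.2 fun m => (hT ⟨m.1⟩).elim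
    obtain ⟨t₀⟩ := hT
    haveI : Nonempty Y := ⟨σ t₀⟩
    set f : T × V → Y := fun m => Function.invFun i m.2 with hf_def
    have hf : ∀ t y, f (t, i y) = y := fun t y => Function.leftInverse_invFun hi.injective y
    have hfc : ContinuousOn f (A n) := by
      refine LipschitzOnWith.continuousOn (K := 1) (LipschitzOnWith.of_dist_le_mul ?_)
      rintro _ ⟨⟨t, y⟩, -, rfl⟩ _ ⟨⟨t', y'⟩, -, rfl⟩
      simp only [hji, Prod.map, id, hf, NNReal.coe_one, one_mul]
      rw [← hi.dist_eq]
      exact le_max_right _ _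
    obtain ⟨F, hF, hFA, hFs, hest⟩ := exists_extension (M := T × V) (ε := ε) (c := c ∘ Prod.fst)
      (τ := τ ∘ Prod.fst) (g := g) hg (hc.comp continuous_fst) (hτ.comp continuous_fst)
      (ρ' := fun m => ρ (n + 1) m.1) (ρ₁ := fun m => (ρ (n + 1) m.1 + ρ n m.1) / 2)
      (ρ := fun m => ρ n m.1) ((hρc _).comp continuous_fst)
      ((((hρc _).comp continuous_fst).add ((hρc _).comp continuous_fst)).div_const _)
      (fun m => by have := hρ_lt n m.1; linarith) (fun m => by have := hρ_lt n m.1; linarith)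
      (hA n) hfc (by
        rintro _ ⟨⟨t, y⟩, h, rfl⟩
        change ρ n t ≤ slack ε c τ g t (f (t, i y))
        rw [hf]; exact h)
      (fun m => ⟨σ m.1, (hρ_anti m.1 (Nat.zero_le n)).trans (by simp [hρ_def, hs_def, slack])⟩)
    refine ⟨F, hF, fun t y h => ?_, hFs, fun t y h r hr hb m hm => ?_⟩
    · exact (hFA (show (t, i y) ∈ A n from ⟨(t, y), h, rfl⟩)).trans (hf t y)
    · have := hest (t, i y) ⟨(t, y), h, rfl⟩ (8 * r) (2 * r) (by positivity) (by positivity)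
        (by
          rintro _ ⟨⟨t', y'⟩, -, rfl⟩ hd
          simp only [hji, Prod.map, id] at hd ⊢
          rw [hf, hf, ← hi.dist_eq]
          exact (le_max_right _ _).trans_lt (hd.trans_eq (by ring)))
        (by
          intro m' hm' y' hy'
          rw [hf] at hy'
          have h1 := hb m'.1 ((le_max_left _ _).trans_lt (hm'.trans_eq (by ring))) y'
            (hy'.trans_eq (by ring))
          have h2 := hρ_lt n m'.1
          refine le_trans ?_ h1
          linarith) m hm
      rw [hf] at this
      exact this.trans_eq (by ring)
  choose F hF hFA hFs hest using key
  set O := {q : T × Y // 0 < slack ε c τ g q.1 q.2}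
  have H : StableData (T := T) (O := O) (L := V) (fun o => o.1.1) (fun o => i o.1.2)
      (fun n m => ⟨(m.1, F n m), (hρ_pos _ _).trans_le (hFs n m)⟩)
      (fun t => ⟨(t, σ t), hσ' t⟩) :=
    { ind := hji_iso.isEmbedding.isInducing.comp Topology.IsInducing.subtypeVal
      inj := hji_iso.injective.comp Subtype.val_injective
      cont := fun n => (continuous_fst.prodMk (hF n)).subtype_mk _
      fib := fun n t l => rfl
      step := fun n t l => by
        refine Subtype.ext (Prod.ext rfl ?_)
        exact hFA (n + 1) t _ (hFs n (t, l))
      local_bound := by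
        rintro ⟨⟨t₀, y₀⟩, h₀⟩
        simp only at h₀
        obtain ⟨N, hN⟩ := exists_nat_gt (s t₀ / slack ε c τ g t₀ y₀)
        have h1 : ρ N t₀ < slack ε c τ g t₀ y₀ := by
          simp only [hρ_def]
          rw [div_lt_iff₀ h₀] at hN
          rw [div_lt_iff₀ (by positivity)]
          nlinarith
        have h2 : ∀ᶠ q : T × Y in 𝓝 (t₀, y₀), ρ N q.1 < slack ε c τ g q.1 q.2 :=
          (isOpen_lt ((hρc N).comp continuous_fst) hs).mem_nhds h1
        obtain ⟨R, hR, hball⟩ := Metric.eventually_nhds_iff.1 h2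
        refine ⟨40, N, R / 80, by positivity, by norm_num, ?_⟩
        have hev : ∀ᶠ o' : O in 𝓝 ⟨(t₀, y₀), h₀⟩, dist o'.1 (t₀, y₀) < R / 2 :=
          continuous_subtype_val.continuousAt.eventually (Metric.ball_mem_nhds _ (half_pos hR))
        filter_upwards [hev] with o' ho' n hn x hx
        obtain ⟨⟨t, y⟩, h⟩ := o'
        have hty := max_lt_iff.1 ho'
        simp only at hty
        simp only
        have hmem : ∀ t' y', dist t' t < R / 2 → dist y' y < R / 2 →
            ρ n t' ≤ slack ε c τ g t' y' := fun t' y' h3 h4 => by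
          refine (hρ_anti t' hn).trans (@hball (t', y') (max_lt ?_ ?_)).le
          · have := dist_triangle t' t t₀; simp only; linarith [hty.1]
          · have := dist_triangle y' y y₀; simp only; linarith [hty.2]
        have hself := hmem t y (by rw [dist_self]; positivity) (by rw [dist_self]; positivity)
        rcases eq_or_ne x 0 with rfl | hx0
        · rw [add_zero, hFA n t y hself]; simp
        · have hx1 : 0 < ‖x‖ := norm_pos_iff.2 hx0
          rw [← dist_eq_norm, hi.dist_eq]
          refine (hest n t y hself ‖x‖ hx1 (fun t' ht' y' hy' => hmem t' y' (by linarith)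
            (by linarith)) _ ?_).le
          rw [Prod.dist_eq, dist_self, dist_eq_norm, add_sub_cancel_left]
          exact max_lt (by positivity) (by linarith)
      sec := fun t => rfl
      sec_cont := (continuous_id.prodMk hσ).subtype_mk _
      start := fun t => by
        refine Subtype.ext (Prod.ext rfl ?_)
        exact hFA 0 t _ (by simp [hρ_def, hs_def]) }
  exact ⟨H.homeo, H.homeo_fib, H.homeo_zero⟩

end

end CurtisNhu

namespace CurtisNhu

/-- The Dugundji extension theorem for metric spaces. -/
theorem exists_dugundji_extension {M E : Type*} [MetricSpace M] [NormedAddCommGroup E]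
    [NormedSpace ℝ E] {A : Set M} (hA : IsClosed A) {φ : M → E} (hφ : ContinuousOn φ A) :
    ∃ ζ : M → E, Continuous ζ ∧ EqOn ζ φ A := by
  classical
  rcases A.eq_empty_or_nonempty with rfl | hne
  · exact ⟨fun _ => 0, continuous_const, fun _ h => h.elim⟩
  have hpos : ∀ x : (Aᶜ : Set M), 0 < infDist (x : M) A := fun x =>
    (hA.notMem_iff_infDist_pos hne).1 x.2
  obtain ⟨ζ, hζ⟩ := exists_continuous_forall_mem_convex_of_local_const
    (t := fun x : (Aᶜ : Set M) => convexHull ℝ (φ '' {a | a ∈ A ∧ dist (x : M) a < 2 * infDist (x : M) A}))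
    (fun x => convex_convexHull ℝ _) (fun x => by
      obtain ⟨a, ha, hxa⟩ := (infDist_lt_iff hne (x := (x : M)) (r := 2 * infDist (x : M) A)).1
        (by linarith [hpos x])
      refine ⟨φ a, ?_⟩
      have h1 : Continuous fun y : (Aᶜ : Set M) => dist (y : M) a :=
        continuous_subtype_val.dist continuous_const
      have h2 : Continuous fun y : (Aᶜ : Set M) => 2 * infDist (y : M) A :=
        continuous_const.mul ((continuous_infDist_pt A).comp continuous_subtype_val)
      filter_upwards [(isOpen_lt h1 h2).mem_nhds hxa] with y hy
      exact subset_convexHull ℝ _ ⟨a, ⟨ha, hy⟩, rfl⟩)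
  refine ⟨fun x => if h : x ∈ A then φ x else ζ ⟨x, h⟩, ?_, fun x hx => dif_pos hx⟩
  refine continuous_iff_continuousAt.2 fun x => ?_
  by_cases hx : x ∈ A
  · rw [ContinuousAt, dif_pos hx, Metric.tendsto_nhds]
    intro r hr
    obtain ⟨δ, hδ, hb⟩ := Metric.continuousOn_iff.1 hφ x hx r hr
    filter_upwards [Metric.ball_mem_nhds x (show 0 < δ / 3 by positivity)] with y hy
    rw [mem_ball] at hy
    split_ifs with h
    · exact hb y h (by linarith)
    · have : convexHull ℝ (φ '' {a | a ∈ A ∧ dist y a < 2 * infDist y A}) ⊆ ball (φ x) r := by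
        refine convexHull_min ?_ (convex_ball _ _)
        rintro _ ⟨a, ⟨ha, hya⟩, rfl⟩
        refine hb a ha ?_
        have h1 := infDist_le_dist_of_mem (x := y) hx
        have h2 := dist_triangle a y x
        rw [dist_comm a y] at h2
        linarith
      exact this (hζ ⟨y, h⟩)
  · have hopen : IsOpen (Aᶜ) := hA.isOpen_compl
    have hc : ContinuousOn (fun x => if h : x ∈ A then φ x else ζ ⟨x, h⟩) Aᶜ := by
      rw [continuousOn_iff_continuous_domRestrict]
      refine ζ.continuous.congr fun y => ?_
      change ζ y = if h : (y : M) ∈ A then φ y else ζ ⟨y, h⟩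
      rw [dif_neg y.2]
    exact hc.continuousAt (hopen.mem_nhds hx)

theorem continuousOn_comp_invFunOn {Z Y W : Type*} [TopologicalSpace Z] [TopologicalSpace Y]
    [TopologicalSpace W] [T2Space Z] [T2Space Y] [Nonempty Z] {D : Set Z} (hD : IsCompact D) {e : Z → Y}
    (he : ContinuousOn e D) (hinj : InjOn e D) {φ : Z → W} (hφ : ContinuousOn φ D) :
    ContinuousOn (fun y => φ (Function.invFunOn e D y)) (e '' D) := by
  rw [continuousOn_iff_isClosed]
  intro t ht
  refine ⟨e '' (D ∩ φ ⁻¹' t), ?_, ?_⟩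
  · have h1 : IsClosed (D ∩ φ ⁻¹' t) := hφ.preimage_isClosed_of_isClosed hD.isClosed ht
    have h2 : IsCompact (D ∩ φ ⁻¹' t) := hD.of_isClosed_subset h1 inter_subset_left
    exact (h2.image_of_continuousOn (he.mono inter_subset_left)).isClosed
  · ext y
    constructor
    · rintro ⟨hy, z, hz, rfl⟩
      refine ⟨⟨z, ⟨hz, ?_⟩, rfl⟩, z, hz, rfl⟩
      rw [mem_preimage, hinj.leftInvOn_invFunOn hz] at hy
      exact hy
    · rintro ⟨⟨z, ⟨hz, hzt⟩, rfl⟩, -⟩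
      refine ⟨?_, z, hz, rfl⟩
      rw [mem_preimage, hinj.leftInvOn_invFunOn hz]
      exact hzt

/-- Maps of finite-dimensional compacta can be approximated by injective maps, relatively to a
closed set on which they are already injective. -/
def EmbApprox (Y : Type*) [MetricSpace Y] : Prop :=
  ∀ (k : ℕ) (K L : Set (Fin k → ℝ)) (F : (Fin k → ℝ) → Y) (δ : ℝ), IsCompact K → IsClosed L →
    L ⊆ K → ContinuousOn F K → InjOn F L → 0 < δ →
    ∃ F' : (Fin k → ℝ) → Y, ContinuousOn F' K ∧ InjOn F' K ∧ EqOn F' F L ∧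
      ∀ x ∈ K, dist (F' x) (F x) < δ

theorem EmbApprox.of_embCompact {Y Z : Type*} [MetricSpace Y] (hY : EmbApprox Y) [MetricSpace Z]
    [Nonempty Z] {K L : Set Z} {F : Z → Y} {δ : ℝ} (hK : EmbCompact K) (hL : IsClosed L) (hLK : L ⊆ K)
    (hF : ContinuousOn F K) (hFL : InjOn F L) (hδ : 0 < δ) :
    ∃ F' : Z → Y, ContinuousOn F' K ∧ InjOn F' K ∧ EqOn F' F L ∧ ∀ x ∈ K, dist (F' x) (F x) < δ := by
  obtain ⟨hKc, k, ψ, hψ, hψi⟩ := hK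
  have hLc : IsCompact L := hKc.of_isClosed_subset hL hLK
  have hinv : ∀ x ∈ K, Function.invFunOn ψ K (ψ x) = x := fun x hx => hψi.leftInvOn_invFunOn hx
  obtain ⟨F', h1, h2, h3, h4⟩ := hY k (ψ '' K) (ψ '' L) (fun v => F (Function.invFunOn ψ K v)) δ
    (hKc.image_of_continuousOn hψ) (hLc.image_of_continuousOn (hψ.mono hLK)).isClosed
    (image_mono hLK) (continuousOn_comp_invFunOn hKc hψ hψi hF) (by
      rintro _ ⟨x, hx, rfl⟩ _ ⟨y, hy, rfl⟩ h
      simp only [hinv x (hLK hx), hinv y (hLK hy)] at h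
      rw [hFL hx hy h]) hδ
  refine ⟨F' ∘ ψ, h1.comp hψ (mapsTo_image _ _), h2.comp hψi (mapsTo_image _ _), fun x hx => ?_,
    fun x hx => ?_⟩
  · have := h3 ⟨x, hx, rfl⟩
    simp only [hinv x (hLK hx)] at this
    exact this
  · have := h4 _ ⟨x, hx, rfl⟩
    rwa [hinv x hx] at this

/-- The semilattices to which the recognition argument applies. -/
structure GoodSpace (Y : Type*) [MetricSpace Y] [SemilatticeSup Y] [SupMetric Y] : Prop where
  nonempty : Nonempty Y
  sfd : SFD Y
  embApprox : EmbApprox Y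
  gauge : ∀ ε > 0, ∃ g : Y → ℝ, Gauge ε g

section

variable {Y : Type*} [MetricSpace Y] [SemilatticeSup Y] [SupMetric Y]

theorem exists_slack_extension {M : Type*} [MetricSpace M] {ε : ℝ} (hε : 0 < ε) {c : M → Y}
    {τ : M → ℝ} {g : Y → ℝ} (hg : Gauge ε g) (hc : Continuous c) (hτ : Continuous τ)
    (hτ0 : ∀ m, 0 < τ m) {A : Set M} (hA : IsCompact A) {f : M → Y} (hf : ContinuousOn f A)
    (hfA : ∀ a ∈ A, 0 < slack ε c τ g a (f a)) :
    ∃ F : M → Y, Continuous F ∧ EqOn F f A ∧ ∀ m, 0 < slack ε c τ g m (F m) := by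
  obtain ⟨ρ, hρ, hρ0, hρs⟩ := exists_pos_slack_bound hg.continuous hc hτ (fun m => by
    obtain ⟨y, h1, h2⟩ := hg.dense (c m) (τ m) (hτ0 m)
    exact ⟨y, lt_slack.2 ⟨by linarith, by linarith⟩⟩)
  obtain ⟨b, hb0, hb⟩ : ∃ b > 0, ∀ a ∈ A, b ≤ slack ε c τ g a (f a) := by
    rcases A.eq_empty_or_nonempty with rfl | hne
    · exact ⟨1, one_pos, fun _ h => h.elim⟩
    · have h1 : ContinuousOn (fun a => slack ε c τ g a (f a)) A :=
        (continuous_slack hc hτ hg.continuous).comp_continuousOn (continuousOn_id.prodMk hf)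
      obtain ⟨a, ha, hmin⟩ := hA.exists_isMinOn hne h1
      exact ⟨_, hfA a ha, fun a' ha' => hmin ha'⟩
  have hm0 : ∀ m, 0 < min (ρ m) b := fun m => lt_min (hρ0 m) hb0
  have hmc : Continuous fun m => min (ρ m) b := hρ.min continuous_const
  obtain ⟨F, hF, hFA, hFs, -⟩ := exists_extension hg hc hτ (hmc.div_const 3) (hmc.div_const 2)
    (fun m => by have := hm0 m; linarith) (ρ := fun m => min (ρ m) b)
    (fun m => by have := hm0 m; linarith) hA.isClosed hf
    (fun a ha => (min_le_right _ _).trans (hb a ha)) (fun m => by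
      obtain ⟨y, hy⟩ := hρs m
      exact ⟨y, (min_le_left _ _).trans hy⟩)
  exact ⟨F, hF, hFA, fun m => lt_of_lt_of_le (by have := hm0 m; positivity) (hFs m)⟩

end

/-- Fibrewise radial rescaling of open balls. -/
noncomputable def ballHomeo {W E : Type*} [TopologicalSpace W] [NormedAddCommGroup E] [NormedSpace ℝ E]
    {β : W → ℝ} (hβ : Continuous β) (hβ0 : ∀ w, 0 < β w) :
    {q : W × E // ‖q.2‖ < β q.1} ≃ₜ W × E where
  toFun q := (q.1.1, (β q.1.1 - ‖q.1.2‖)⁻¹ • q.1.2)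
  invFun q := ⟨(q.1, (β q.1 * (1 + ‖q.2‖)⁻¹) • q.2), by
    have h := hβ0 q.1
    have h2 : 0 < 1 + ‖q.2‖ := by positivity
    simp only [norm_smul, norm_mul, norm_inv, Real.norm_of_nonneg h.le, Real.norm_of_nonneg h2.le]
    rw [mul_assoc, mul_lt_iff_lt_one_right h, inv_mul_lt_iff₀ h2]
    linarith⟩
  left_inv q := by
    refine Subtype.ext (Prod.ext rfl ?_)
    have h := sub_pos.2 q.2
    simp only [norm_smul, norm_inv, Real.norm_of_nonneg h.le, smul_smul]
    have h3 := hβ0 q.1.1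
    have : β q.1.1 * (1 + (β q.1.1 - ‖q.1.2‖)⁻¹ * ‖q.1.2‖)⁻¹ * (β q.1.1 - ‖q.1.2‖)⁻¹ = 1 := by
      have h4 : 1 + (β q.1.1 - ‖q.1.2‖)⁻¹ * ‖q.1.2‖ = (β q.1.1 - ‖q.1.2‖)⁻¹ * β q.1.1 := by
        field_simp; ring
      rw [h4]; field_simp
    rw [this, one_smul]
  right_inv q := by
    refine Prod.ext rfl ?_
    have h := hβ0 q.1
    have h2 : 0 < 1 + ‖q.2‖ := by positivity
    simp only [norm_smul, norm_mul, norm_inv, Real.norm_of_nonneg h.le, Real.norm_of_nonneg h2.le,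
      smul_smul]
    have : (β q.1 - β q.1 * (1 + ‖q.2‖)⁻¹ * ‖q.2‖)⁻¹ * (β q.1 * (1 + ‖q.2‖)⁻¹) = 1 := by
      have h4 : β q.1 - β q.1 * (1 + ‖q.2‖)⁻¹ * ‖q.2‖ = β q.1 * (1 + ‖q.2‖)⁻¹ := by
        field_simp; ring
      rw [h4]; field_simp
    rw [this, one_smul]
  continuous_toFun := by
    refine (continuous_fst.comp continuous_subtype_val).prodMk (Continuous.smul (Continuous.inv₀ ?_ ?_)
      (continuous_snd.comp continuous_subtype_val))
    · exact (hβ.comp (continuous_fst.comp continuous_subtype_val)).sub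
        (continuous_snd.comp continuous_subtype_val).norm
    · exact fun q => (sub_pos.2 q.2).ne'
  continuous_invFun := by
    refine (continuous_fst.prodMk (Continuous.smul ((hβ.comp continuous_fst).mul
      (Continuous.inv₀ ?_ ?_)) continuous_snd)).subtype_mk _
    · exact continuous_const.add continuous_snd.norm
    · exact fun q => by positivity

/-- Exchanging the last two of three factors. -/
def prodSwapRight (A B C : Type*) [TopologicalSpace A] [TopologicalSpace B] [TopologicalSpace C] :
    (A × B) × C ≃ₜ (A × C) × B where
  toFun q := ((q.1.1, q.2), q.1.2)
  invFun q := ((q.1.1, q.2), q.1.2)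
  left_inv _ := rfl
  right_inv _ := rfl
  continuous_toFun := by fun_prop
  continuous_invFun := by fun_prop

/-- Fibrewise translation. -/
def shear {A B E : Type*} [TopologicalSpace A] [TopologicalSpace B] [NormedAddCommGroup E]
    {ζ : A → E} (hζ : Continuous ζ) : (A × B) × E ≃ₜ A × (B × E) where
  toFun q := (q.1.1, q.1.2, q.2 - ζ q.1.1)
  invFun q := ((q.1, q.2.1), q.2.2 + ζ q.1)
  left_inv q := by simp
  right_inv q := by simp
  continuous_toFun := by fun_prop
  continuous_invFun := by fun_prop

section

variable {Y : Type*} [MetricSpace Y] [SemilatticeSup Y] [SupMetric Y]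
  {V : Type*} [NormedAddCommGroup V] [NormedSpace ℝ V]

/-- A homeomorphism absorbing one factor which is close to the projection and flattens a compact
set. -/
theorem exists_step (hY : GoodSpace Y) {i : Y → V} (hi : Isometry i) (hcl : IsClosed (range i))
    {B : Set Y} (hB : IsCompact B) {D : Set (Y × L1 ℕ V)} (hD : EmbCompact D)
    (hBD : ∀ b ∈ B, (b, (0 : L1 ℕ V)) ∈ D) {ε κ : ℝ} (hε : 0 < ε) (hκ : 0 < κ) :
    ∃ Ψ : (Y × L1 ℕ V) × L1 ℕ V ≃ₜ Y × L1 ℕ V,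
      (∀ d ∈ D, (Ψ (d, 0)).2 = 0) ∧ (∀ b ∈ B, Ψ ((b, 0), 0) = (b, 0)) ∧
      (∀ q, dist (Ψ q).1 q.1.1 < ε) ∧
      ∃ η > 0, ∀ q, ∀ b ∈ B, dist (Ψ q).1 b < η → ‖q.1.2‖ < κ := by
  obtain ⟨g, hg⟩ := hY.gauge ε hε
  haveI := hY.nonempty
  obtain ⟨c₀, hc₀, hgB⟩ : ∃ c₀ > 0, ∀ b ∈ B, c₀ < g b := by
    rcases B.eq_empty_or_nonempty with rfl | hne
    · exact ⟨1, one_pos, fun _ h => h.elim⟩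
    · obtain ⟨b, hb, hmin⟩ := hB.exists_isMinOn hne hg.continuous.continuousOn
      exact ⟨g b / 2, half_pos (hg.pos b), fun b' hb' =>
        (half_lt_self (hg.pos b)).trans_le (hmin hb')⟩
  have hκc : 0 < κ * c₀ := mul_pos hκ hc₀
  -- the fibred space over `Y × E`
  set τ : Y × L1 ℕ V → ℝ := fun m => κ * c₀ / max ‖m.2‖ (κ * c₀ / 2) with hτ_def
  have hmax : ∀ m : Y × L1 ℕ V, 0 < max ‖m.2‖ (κ * c₀ / 2) := fun m =>
    lt_max_of_lt_right (half_pos hκc)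
  have hτ : Continuous τ :=
    continuous_const.div ((continuous_snd.norm).max continuous_const) fun m => (hmax m).ne'
  have hτ0 : ∀ m, 0 < τ m := fun m => div_pos hκc (hmax m)
  have hτ2 : ∀ y, τ (y, 0) = 2 := fun y => by
    simp only [hτ_def, norm_zero]
    rw [max_eq_right (half_pos hκc).le]; field_simp
  have hτβ : ∀ m y, g y < τ m ↔ ‖m.2‖ < κ * c₀ / g y := fun m y => by
    simp only [hτ_def]
    rw [lt_div_iff₀ (hmax m), lt_div_iff₀ (hg.pos y), mul_max_of_nonneg _ _ (hg.pos y).le,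
      max_lt_iff, mul_comm]
    refine and_iff_left ?_
    have := hg.le_one y
    nlinarith
  have hDc := hD.1
  -- an injective choice on `D`
  obtain ⟨F₀, hF₀, hF₀B, hF₀s⟩ := exists_slack_extension (M := Y × L1 ℕ V) (c := Prod.fst) hε hg
    continuous_fst hτ hτ0 (A := (fun b => (b, (0 : L1 ℕ V))) '' B)
    (hB.image (by fun_prop)) (f := Prod.fst) continuous_fst.continuousOn (by
      rintro _ ⟨b, hb, rfl⟩
      refine lt_slack.2 ⟨by simpa using hε, ?_⟩
      rw [hτ2]; linarith [hg.le_one b])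
  obtain ⟨e, he, heD, heB, hes⟩ : ∃ e : Y × L1 ℕ V → Y, ContinuousOn e D ∧ InjOn e D ∧
      (∀ b ∈ B, e (b, 0) = b) ∧ ∀ d ∈ D, 0 < slack ε Prod.fst τ g d (e d) := by
    have hgraph : IsCompact ((fun d => (d, F₀ d)) '' D) := hDc.image (by fun_prop)
    have hopen : IsOpen {q : (Y × L1 ℕ V) × Y | 0 < slack ε Prod.fst τ g q.1 q.2} :=
      isOpen_lt continuous_const (continuous_slack continuous_fst hτ hg.continuous)
    obtain ⟨δ, hδ, hth⟩ := hgraph.exists_thickening_subset_open hopen (by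
      rintro _ ⟨d, -, rfl⟩; exact hF₀s d)
    obtain ⟨e, h1, h2, h3, h4⟩ := hY.embApprox.of_embCompact hD
      (hB.image (show Continuous fun b => (b, (0 : L1 ℕ V)) by fun_prop)).isClosed (by
        rintro _ ⟨b, hb, rfl⟩; exact hBD b hb) hF₀.continuousOn (by
        rintro _ ⟨b, hb, rfl⟩ _ ⟨b', hb', rfl⟩ h
        rw [hF₀B ⟨b, hb, rfl⟩, hF₀B ⟨b', hb', rfl⟩] at h
        simp only at h
        rw [h]) hδ
    refine ⟨e, h1, h2, fun b hb => ?_, fun d hd => ?_⟩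
    · rw [h3 ⟨b, hb, rfl⟩, hF₀B ⟨b, hb, rfl⟩]
    · refine hth (show (d, e d) ∈ _ from mem_thickening_iff.2 ⟨_, ⟨d, hd, rfl⟩, ?_⟩)
      rw [Prod.dist_eq, dist_self]
      exact max_lt hδ (h4 d hd)
  obtain ⟨σ, hσ, hσD, hσs⟩ := exists_slack_extension (M := Y × L1 ℕ V) (c := Prod.fst) hε hg
    continuous_fst hτ hτ0 hDc he hes
  obtain ⟨h₁, h₁fib, h₁zero⟩ := exists_stable_product hg continuous_fst hτ hi hcl hσ hσs
  -- the second fibration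
  have h2τ : ∀ {y y' : Y}, 0 < slack ε id (fun _ => 2) g y y' ↔ dist y' y < ε := fun {y y'} => by
    rw [lt_slack, sub_zero, sub_zero]
    exact and_iff_left (by linarith [hg.le_one y'])
  obtain ⟨σ', hσ', hσ'D, hσ's⟩ := exists_slack_extension (M := Y) (c := id) (τ := fun _ => 2) hε hg
    continuous_id continuous_const (fun _ => two_pos) (hDc.image_of_continuousOn he)
    (f := fun y => (Function.invFunOn e D y).1)
    (continuousOn_comp_invFunOn hDc he heD continuous_fst.continuousOn) (by
      rintro _ ⟨d, hd, rfl⟩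
      rw [heD.leftInvOn_invFunOn hd, h2τ, dist_comm]
      have := (lt_slack.1 (hes d hd)).1
      rwa [sub_zero] at this)
  obtain ⟨h₂, h₂fib, h₂zero⟩ := exists_stable_product hg continuous_id continuous_const hi hcl hσ'
    hσ's
  have hβ0 : ∀ q : {q : Y × Y // 0 < slack ε id (fun _ => (2 : ℝ)) g q.1 q.2},
    0 < κ * c₀ / g q.1.1 := fun q => div_pos hκc (hg.pos _)
  have hβ : Continuous fun q : {q : Y × Y // 0 < slack ε id (fun _ => (2 : ℝ)) g q.1 q.2} =>
      κ * c₀ / g q.1.1 :=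
    continuous_const.div (hg.continuous.comp (continuous_fst.comp continuous_subtype_val))
      fun q => (hg.pos _).ne'
  let R₀ : {q : (Y × L1 ℕ V) × Y // 0 < slack ε Prod.fst τ g q.1 q.2} ≃ₜ
      {q : {q : Y × Y // 0 < slack ε id (fun _ => (2 : ℝ)) g q.1 q.2} × L1 ℕ V //
        ‖q.2‖ < κ * c₀ / g q.1.1.1} :=
    { toFun := fun o => ⟨(⟨(o.1.2, o.1.1.1), h2τ.2 (by
          have := (lt_slack.1 o.2).1
          rwa [sub_zero, dist_comm] at this)⟩, o.1.1.2), (hτβ _ _).1 (by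
          have := (lt_slack.1 o.2).2
          rwa [sub_zero] at this)⟩
      invFun := fun q => ⟨((q.1.1.1.2, q.1.2), q.1.1.1.1), lt_slack.2 ⟨by
          have := h2τ.1 q.1.1.2
          rwa [sub_zero, dist_comm], by
          rw [sub_zero, hτβ]; exact q.2⟩⟩
      left_inv := fun _ => rfl
      right_inv := fun _ => rfl
      continuous_toFun := by fun_prop
      continuous_invFun := by fun_prop }
  let R := R₀.trans (ballHomeo hβ hβ0)
  have hR1 : ∀ o, (R o).1.1 = (o.1.2, o.1.1.1) := fun o => rfl
  have hRB : ∀ o, o.1.1.2 = 0 → (R o).2 = 0 := fun o ho => by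
    change (_ : ℝ) • o.1.1.2 = 0
    rw [ho, smul_zero]
  obtain ⟨ζ, hζ, hζD⟩ := exists_dugundji_extension (hDc.image_of_continuousOn he).isClosed
    (continuousOn_comp_invFunOn hDc he heD (φ := fun d => (R ⟨(d, σ d), hσs d⟩).2) (by fun_prop))
  let Ψ : (Y × L1 ℕ V) × L1 ℕ V ≃ₜ Y × L1 ℕ V :=
    h₁.trans <| (R.prodCongr (Homeomorph.refl _)).trans <| (prodSwapRight _ _ _).trans <|
      (h₂.symm.prodCongr (Homeomorph.refl _)).trans <| (shear hζ).trans <|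
      (Homeomorph.refl _).prodCongr L1.sqEquiv
  have hsymm1 : ∀ q, (h₂.symm q).1 = q.1.1.1 := fun q => by
    rw [← h₂fib (h₂.symm q), h₂.apply_symm_apply]
  have hΨ1 : ∀ q, (Ψ q).1 = (h₁ q).1.1.2 := fun q => hsymm1 _
  have hΨD : ∀ d ∈ D, Ψ (d, 0) = (e d, 0) := fun d hd => by
    have e1 : h₁ (d, 0) = (⟨(d, σ d), hσs d⟩, 0) := h₁zero d
    have e2 : h₂.symm ((R ⟨(d, σ d), hσs d⟩).1, 0) = (e d, 0) := by
      rw [h₂.symm_apply_eq, h₂zero]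
      refine Prod.ext (Subtype.ext ?_) rfl
      rw [hR1]
      refine Prod.ext (hσD hd) ?_
      simp only
      rw [hσ'D ⟨d, hd, rfl⟩]
      simp only
      rw [heD.leftInvOn_invFunOn hd]
    have e3 : ζ (e d) = (R ⟨(d, σ d), hσs d⟩).2 := by
      rw [hζD ⟨d, hd, rfl⟩]
      simp only
      rw [heD.leftInvOn_invFunOn hd]
    change ((h₂.symm ((R (h₁ (d, 0)).1).1, (h₁ (d, 0)).2)).1, L1.sqEquiv
      ((h₂.symm ((R (h₁ (d, 0)).1).1, (h₁ (d, 0)).2)).2, (R (h₁ (d, 0)).1).2 -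
        ζ (h₂.symm ((R (h₁ (d, 0)).1).1, (h₁ (d, 0)).2)).1)) = _
    rw [e1]
    simp only
    rw [e2]
    simp only
    rw [e3, sub_self, L1.sqEquiv_zero]
  refine ⟨Ψ, fun d hd => by rw [hΨD d hd], fun b hb => by rw [hΨD _ (hBD b hb), heB b hb],
    fun q => ?_, ?_⟩
  · have := (lt_slack.1 (h₁ q).1.2).1
    rwa [sub_zero, h₁fib, ← hΨ1] at this
  · obtain ⟨η, hη, hth⟩ := hB.exists_thickening_subset_open
      (isOpen_lt continuous_const hg.continuous : IsOpen {y | c₀ < g y}) hgB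
    refine ⟨η, hη, fun q b hb hqb => ?_⟩
    have h3 : c₀ < g (Ψ q).1 := hth (mem_thickening_iff.2 ⟨b, hb, hqb⟩)
    have h4 := (lt_slack.1 (h₁ q).1.2).2
    rw [sub_zero, h₁fib, ← hΨ1, hτβ, lt_div_iff₀ (hg.pos _)] at h4
    nlinarith [norm_nonneg q.1.2]

end

end CurtisNhu

namespace CurtisNhu

section

variable {Y : Type*} [MetricSpace Y] {E : Type*} [NormedAddCommGroup E]

/-- A stage in the construction of a homeomorphism `Y × FS E ≃ₜ Y`. -/
structure Stage (Y : Type*) [MetricSpace Y] (E : Type*) [NormedAddCommGroup E] (n : ℕ) where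
  Φ : Y × FS E ≃ₜ (Y × E) × FS E
  tail : ∀ p k, (Φ p).2.1 k = p.2.1 (n + 1 + k)
  dep : ∀ p p', (Φ p).1 = (Φ p').1 → p.1 = p'.1 ∧ ∀ k ≤ n, p.2.1 k = p'.2.1 k
  B : Set Y
  hB : EmbCompact B
  e : ℝ
  he : 0 < e

/-- Distance of the initial coordinates of two points. -/
def headDist (n : ℕ) (p q : Y × FS E) : ℝ :=
  dist p.1 q.1 + ∑ k ∈ Finset.range (n + 1), ‖p.2.1 k - q.2.1 k‖

theorem continuous_headDist (n : ℕ) :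
    Continuous fun r : (Y × FS E) × (Y × FS E) => headDist n r.1 r.2 := by
  refine Continuous.add (by fun_prop) (continuous_finsetSum _ fun k _ => Continuous.norm ?_)
  have h : Continuous fun x : FS E => x.1 k := (continuous_apply k).comp continuous_subtype_val
  exact (h.comp (continuous_snd.comp continuous_fst)).sub
    (h.comp (continuous_snd.comp continuous_snd))

theorem dist_le_headDist (n : ℕ) (p q : Y × FS E) : dist p.1 q.1 ≤ headDist n p q :=
  le_add_of_nonneg_right (Finset.sum_nonneg fun _ _ => norm_nonneg _)

theorem norm_le_headDist {n k : ℕ} (hk : k ≤ n) (p q : Y × FS E) :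
    ‖p.2.1 k - q.2.1 k‖ ≤ headDist n p q :=
  (Finset.single_le_sum (f := fun k => ‖p.2.1 k - q.2.1 k‖) (fun _ _ => norm_nonneg _)
    (Finset.mem_range.2 (Nat.lt_succ_of_le hk))).trans (le_add_of_nonneg_left dist_nonneg)

/-- The relation between consecutive stages. -/
structure Stage.Next {n : ℕ} (C : Set (Y × FS E)) (Z : Set Y) (s : Stage Y E n)
    (s' : Stage Y E (n + 1)) : Prop where
  close : ∀ p, dist (s'.Φ p).1.1 (s.Φ p).1.1 ≤ s.e / 2
  e_le : s'.e ≤ s.e / 2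
  keep : ∀ b ∈ s.B, s'.Φ (s.Φ.symm ((b, 0), 0)) = ((b, 0), 0)
  subset : s.B ⊆ s'.B
  subset' : Z ⊆ s'.B
  catch_ : ∀ p ∈ C, ∃ b ∈ s'.B, s'.Φ p = ((b, 0), 0)
  control : ∃ γ > 0, ∀ p, ∀ b ∈ s.B, ∀ y, dist y (s'.Φ p).1.1 ≤ s'.e → dist y b < γ →
    headDist n p (s.Φ.symm ((b, 0), 0)) < 2⁻¹ ^ n

end

section

variable {Y : Type*} [MetricSpace Y] [SemilatticeSup Y] [SupMetric Y]
  {V : Type*} [NormedAddCommGroup V] [NormedSpace ℝ V]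

theorem Stage.exists_next (hY : GoodSpace Y) {i : Y → V} (hi : Isometry i)
    (hcl : IsClosed (range i)) {n : ℕ} {C : Set (Y × FS (L1 ℕ V))} (hC : EmbCompact C)
    (hCn : ∀ p ∈ C, ∀ k > n, p.2.1 k = 0) {Z : Set Y} (hZ : EmbCompact Z)
    (s : Stage Y (L1 ℕ V) n) : ∃ s' : Stage Y (L1 ℕ V) (n + 1), Stage.Next C Z s s' := by
  have hC0 : ∀ p ∈ C, (s.Φ p).2 = 0 := fun p hp => Subtype.ext (funext fun k => by
    rw [s.tail]; exact hCn p hp _ (by omega))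
  set D : Set (Y × L1 ℕ V) := (fun b => (b, 0)) '' s.B ∪ (fun p => (s.Φ p).1) '' C with hD_def
  have hD : EmbCompact D := by
    refine (s.hB.image (by fun_prop) ?_).union (hC.image (by fun_prop) ?_)
    · intro a _ b _ h; exact congrArg Prod.fst h
    · intro a ha b hb h
      exact s.Φ.injective (Prod.ext h ((hC0 a ha).trans (hC0 b hb).symm))
  -- uniform continuity of the inverse chart along `B`
  obtain ⟨γ₀, hγ₀, hG⟩ : ∃ γ₀ > 0, ∀ b ∈ s.B, ∀ w : Y × L1 ℕ V, dist w (b, 0) < γ₀ →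
      headDist n (s.Φ.symm (w, 0)) (s.Φ.symm ((b, 0), 0)) < 2⁻¹ ^ n := by
    have hcont : Continuous fun r : (Y × L1 ℕ V) × (Y × L1 ℕ V) =>
        headDist n (s.Φ.symm (r.1, 0)) (s.Φ.symm (r.2, 0)) :=
      (continuous_headDist n).comp (f := fun r : (Y × L1 ℕ V) × (Y × L1 ℕ V) =>
        (s.Φ.symm (r.1, 0), s.Φ.symm (r.2, 0))) (by fun_prop)
    obtain ⟨γ₀, hγ₀, hth⟩ := (s.hB.1.image (f := fun b => ((b, (0 : L1 ℕ V)), (b, (0 : L1 ℕ V))))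
      (by fun_prop)).exists_thickening_subset_open
      (isOpen_lt hcont (continuous_const (y := (2⁻¹ : ℝ) ^ n))) (by
        rintro _ ⟨b, -, rfl⟩
        simp [headDist])
    refine ⟨γ₀, hγ₀, fun b hb w hw => ?_⟩
    refine hth (show (w, (b, 0)) ∈ _ from mem_thickening_iff.2 ⟨_, ⟨b, hb, rfl⟩, ?_⟩)
    rw [Prod.dist_eq, dist_self]
    exact max_lt hw hγ₀
  set ε := min (s.e / 2) (γ₀ / 4) with hε_def
  have hε : 0 < ε := lt_min (half_pos s.he) (by positivity)
  obtain ⟨Ψ, hΨD, hΨB, hΨε, η, hη, hΨη⟩ := exists_step hY hi hcl s.hB.1 hD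
    (fun b hb => Or.inl ⟨b, hb, rfl⟩) hε hγ₀
  set e' := min ε (η / 2) with he'_def
  have he' : 0 < e' := lt_min hε (half_pos hη)
  let Φ' : Y × FS (L1 ℕ V) ≃ₜ (Y × L1 ℕ V) × FS (L1 ℕ V) :=
    s.Φ.trans <| ((Homeomorph.refl _).prodCongr FS.uncons).trans <|
      (Homeomorph.prodAssoc _ _ _).symm.trans (Ψ.prodCongr (Homeomorph.refl _))
  have hΦ'1 : ∀ p, (Φ' p).1 = Ψ ((s.Φ p).1, (s.Φ p).2.1 0) := fun p => rfl
  have hΦ'2 : ∀ p k, (Φ' p).2.1 k = (s.Φ p).2.1 (k + 1) := fun p k => rfl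
  have hΦ'0 : ∀ p, (s.Φ p).2 = 0 → Φ' p = (Ψ ((s.Φ p).1, 0), 0) := fun p hp => by
    refine Prod.ext ?_ (Subtype.ext (funext fun k => ?_))
    · rw [hΦ'1, hp]; rfl
    · rw [hΦ'2, hp]; rfl
  refine ⟨{ Φ := Φ', tail := fun p k => ?_, dep := fun p p' h => ?_,
            B := (fun d => (Ψ (d, 0)).1) '' D ∪ Z, hB := ?_, e := e', he := he' }, ?_⟩
  · rw [hΦ'2, s.tail]; exact congrArg p.2.1 (by omega)
  · rw [hΦ'1, hΦ'1] at h
    have h1 := Ψ.injective h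
    obtain ⟨h2, h3⟩ := Prod.ext_iff.1 h1
    obtain ⟨h4, h5⟩ := s.dep p p' h2
    refine ⟨h4, fun k hk => ?_⟩
    rcases Nat.lt_or_ge n k with hk' | hk'
    · obtain rfl : k = n + 1 := by omega
      simpa [s.tail] using h3
    · exact h5 k hk'
  · refine EmbCompact.union (hD.image (by fun_prop) fun a ha b hb h => ?_) hZ
    have := Ψ.injective (Prod.ext h ((hΨD a ha).trans (hΨD b hb).symm))
    exact congrArg Prod.fst this
  · have hsub : ∀ b ∈ s.B, b ∈ (fun d => (Ψ (d, 0)).1) '' D := fun b hb =>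
      ⟨(b, 0), Or.inl ⟨b, hb, rfl⟩, by simp only [hΨB b hb]⟩
    refine { close := fun p => ?_, e_le := ?_, keep := fun b hb => ?_, subset := ?_, subset' := ?_,
             catch_ := fun p hp => ?_, control := ?_ }
    · exact (hΨε _).le.trans (min_le_left _ _)
    · exact (min_le_left _ _).trans (min_le_left _ _)
    · change Φ' _ = _
      rw [hΦ'0 _ (by rw [s.Φ.apply_symm_apply]), s.Φ.apply_symm_apply, hΨB b hb]
    · exact fun b hb => Or.inl (hsub b hb)
    · exact subset_union_right
    · refine ⟨_, Or.inl ⟨_, Or.inr ⟨p, hp, rfl⟩, rfl⟩, ?_⟩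
      change Φ' p = _
      rw [hΦ'0 p (hC0 p hp)]
      refine Prod.ext (Prod.ext rfl ?_) rfl
      exact hΨD _ (Or.inr ⟨p, hp, rfl⟩)
    · refine ⟨min (η / 2) (γ₀ / 4), by positivity, fun p b hb y hy hyb => ?_⟩
      change dist y (Ψ ((s.Φ p).1, (s.Φ p).2.1 0)).1 ≤ e' at hy
      have h1 : e' ≤ η / 2 := min_le_right _ _
      have h2 : e' ≤ γ₀ / 4 := (min_le_left _ _).trans (min_le_right _ _)
      have h3 : ε ≤ γ₀ / 4 := min_le_right _ _
      have h4 := min_le_left (η / 2) (γ₀ / 4)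
      have h5 := min_le_right (η / 2) (γ₀ / 4)
      have h6 := dist_triangle_left (Ψ ((s.Φ p).1, (s.Φ p).2.1 0)).1 b y
      have h7 := hΨη _ b hb (show dist (Ψ ((s.Φ p).1, (s.Φ p).2.1 0)).1 b < η by linarith)
      have h8 := hΨε ((s.Φ p).1, (s.Φ p).2.1 0)
      have h9 := dist_triangle_left (s.Φ p).1.1 b (Ψ ((s.Φ p).1, (s.Φ p).2.1 0)).1
      simp only at h7 h8
      have h10 := hG b hb (s.Φ p).1 (by
        rw [Prod.dist_eq]
        refine max_lt (by linarith) ?_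
        simpa using h7)
      obtain ⟨h11, h12⟩ := s.dep (s.Φ.symm ((s.Φ p).1, 0)) p (by rw [s.Φ.apply_symm_apply])
      refine lt_of_eq_of_lt ?_ h10
      unfold headDist
      rw [h11]
      congr 1
      refine Finset.sum_congr rfl fun k hk => ?_
      rw [h12 k (by have := Finset.mem_range.1 hk; omega)]

/-- A good space absorbs the finitely supported sequences. -/
theorem GoodSpace.absorb (hY : GoodSpace Y) {i : Y → V} (hi : Isometry i)
    (hcl : IsClosed (range i)) (hV : SFD V) : Nonempty (Y × FS (L1 ℕ V) ≃ₜ Y) := by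
  classical
  obtain ⟨Z, hZm, hZ, hZU⟩ := hY.sfd.exists_monotone
  obtain ⟨C₀, hC₀m, hC₀, hC₀U⟩ := (hY.sfd.prod (FS.sfd (L1.sfd hV))).exists_monotone
  have hcoord : ∀ k, Continuous fun x : Y × FS (L1 ℕ V) => x.2.1 k := fun k =>
    (continuous_apply k).comp (continuous_subtype_val.comp continuous_snd)
  set C : ℕ → Set (Y × FS (L1 ℕ V)) := fun n => C₀ n ∩ {p | ∀ k > n, p.2.1 k = 0} with hC_def
  have hC : ∀ n, EmbCompact (C n) := fun n => by
    refine (hC₀ n).mono ((hC₀ n).1.inter_right ?_) inter_subset_left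
    have : {p : Y × FS (L1 ℕ V) | ∀ k > n, p.2.1 k = 0} = ⋂ k, ⋂ _ : k > n, {p | p.2.1 k = 0} := by
      ext; simp
    rw [this]
    exact isClosed_iInter fun k => isClosed_iInter fun _ =>
      isClosed_eq (hcoord k) continuous_const
  have hCU : ∀ p, ∃ n, p ∈ C n := fun p => by
    obtain ⟨m, hm⟩ := mem_iUnion.1 (hC₀U ▸ mem_univ p)
    obtain ⟨N, hN⟩ := p.2.2.bddAbove
    refine ⟨max m N, hC₀m (le_max_left _ _) hm, fun k hk => ?_⟩
    by_contra h
    have := hN h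
    have := le_max_right m N
    omega
  choose nxt hnxt using fun n (s : Stage Y (L1 ℕ V) n) =>
    Stage.exists_next hY hi hcl (hC n) (fun p hp => hp.2) (hZ n) s
  let s₀ : Stage Y (L1 ℕ V) 0 :=
    { Φ := ((Homeomorph.refl _).prodCongr FS.uncons).trans (Homeomorph.prodAssoc _ _ _).symm
      tail := fun p k => by
        change p.2.1 (k + 1) = _
        exact congrArg p.2.1 (by omega)
      dep := fun p p' h => by
        obtain ⟨h1, h2⟩ := Prod.ext_iff.1 h
        refine ⟨h1, fun k hk => ?_⟩
        obtain rfl : k = 0 := by omega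
        exact h2
      B := ∅
      hB := embCompact_empty
      e := 1
      he := one_pos }
  let S : ∀ n, Stage Y (L1 ℕ V) n := fun n => Nat.rec s₀ nxt n
  have hS : ∀ n, Stage.Next (C n) (Z n) (S n) (S (n + 1)) := fun n => hnxt n (S n)
  have he : ∀ n, (S n).e ≤ 2⁻¹ ^ n := fun n => by
    induction n with
    | zero => simp [S, s₀]
    | succ n ih => have := (hS n).e_le; rw [pow_succ]; linarith
  have hstay : ∀ {m n p b}, m ≤ n → b ∈ (S m).B → (S m).Φ p = ((b, 0), 0) →
      b ∈ (S n).B ∧ (S n).Φ p = ((b, 0), 0) := fun {m n p b} hmn hb hp => by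
    induction n, hmn using Nat.le_induction with
    | base => exact ⟨hb, hp⟩
    | succ n hn ih =>
      refine ⟨(hS n).subset ih.1, ?_⟩
      rw [← (S n).Φ.symm_apply_apply p, ih.2]
      exact (hS n).keep b ih.1
  have hlim : ∀ p, ∃ b m, ∀ n ≥ m, b ∈ (S n).B ∧ (S n).Φ p = ((b, 0), 0) := fun p => by
    obtain ⟨n, hn⟩ := hCU p
    obtain ⟨b, hb, h⟩ := (hS n).catch_ p hn
    exact ⟨b, n + 1, fun k hk => hstay hk hb h⟩
  choose h M hM using hlim
  have hdist : ∀ p m n, m ≤ n →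
      dist ((S n).Φ p).1.1 ((S m).Φ p).1.1 ≤ (S m).e - (S n).e := fun p m n hmn => by
    induction n, hmn using Nat.le_induction with
    | base => simp
    | succ n hn ih =>
      have h1 := (hS n).close p
      have h2 := (hS n).e_le
      have h3 := dist_triangle ((S (n + 1)).Φ p).1.1 ((S n).Φ p).1.1 ((S m).Φ p).1.1
      linarith
  have hh : ∀ p n, dist (h p) ((S n).Φ p).1.1 ≤ (S n).e := fun p n => by
    have h1 := hdist p n (max n (M p)) (le_max_left _ _)
    rw [(hM p _ (le_max_right _ _)).2] at h1
    linarith [(S (max n (M p))).he]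
  have hpow : ∀ r > 0, ∀ N, ∃ n ≥ N, (2⁻¹ : ℝ) ^ n < r := fun r hr N => by
    obtain ⟨k, hk⟩ := exists_pow_lt_of_lt_one hr (show (2⁻¹ : ℝ) < 1 by norm_num)
    exact ⟨max k N, le_max_right _ _, (pow_le_pow_of_le_one (by norm_num) (by norm_num)
      (le_max_left _ _)).trans_lt hk⟩
  have hcont : Continuous h := by
    refine continuous_iff_continuousAt.2 fun p => ?_
    rw [ContinuousAt, Metric.tendsto_nhds]
    intro r hr
    obtain ⟨n, -, hn⟩ := hpow (r / 3) (by positivity) 0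
    have hc : Continuous fun p => ((S n).Φ p).1.1 := by fun_prop
    filter_upwards [hc.continuousAt.eventually
      (Metric.ball_mem_nhds _ (show 0 < r / 3 by positivity))] with p' hp'
    have h1 : dist ((S n).Φ p').1.1 ((S n).Φ p).1.1 < r / 3 := hp'
    have h2 := hh p n
    have h3 := hh p' n
    have h4 := he n
    have h5 := dist_triangle4_right (h p') (h p) ((S n).Φ p').1.1 ((S n).Φ p).1.1
    have h6 := dist_triangle4 (h p') ((S n).Φ p').1.1 ((S n).Φ p).1.1 (h p)
    rw [dist_comm _ (h p)] at h6
    linarith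
  have hctl : ∀ p, ∀ n ≥ M p, ∃ γ > 0, ∀ p', dist (h p') (h p) < γ →
      headDist n p' p < 2⁻¹ ^ n := fun p n hn => by
    obtain ⟨γ, hγ, hc⟩ := (hS n).control
    refine ⟨γ, hγ, fun p' hp' => ?_⟩
    obtain ⟨h1, h2⟩ := hM p n hn
    have := hc p' _ h1 (h p') (hh p' (n + 1)) hp'
    rwa [← h2, (S n).Φ.symm_apply_apply] at this
  have hinj : Function.Injective h := fun p p' hpp => by
    have key : ∀ n ≥ M p', headDist n p p' < 2⁻¹ ^ n := fun n hn => by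
      obtain ⟨γ, hγ, hc⟩ := hctl p' n hn
      exact hc p (by rw [hpp, dist_self]; exact hγ)
    refine Prod.ext (dist_le_zero.1 (le_of_forall_pos_lt_add fun r hr => ?_))
      (Subtype.ext (funext fun k => ?_))
    · obtain ⟨n, hn, hnr⟩ := hpow r hr (M p')
      linarith [dist_le_headDist n p p', key n hn]
    · rw [← sub_eq_zero, ← norm_le_zero_iff]
      refine le_of_forall_pos_lt_add fun r hr => ?_
      obtain ⟨n, hn, hnr⟩ := hpow r hr (max (M p') k)
      linarith [norm_le_headDist ((le_max_right _ _).trans hn) p p',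
        key n ((le_max_left _ _).trans hn)]
  have hsurj : Function.Surjective h := fun y => by
    obtain ⟨n, hn⟩ := mem_iUnion.1 (hZU ▸ mem_univ y)
    have hy := (hS n).subset' hn
    refine ⟨(S (n + 1)).Φ.symm ((y, 0), 0), ?_⟩
    set p := (S (n + 1)).Φ.symm ((y, 0), 0)
    have h1 := hstay (n := max (n + 1) (M p)) (le_max_left _ _) hy
      ((S (n + 1)).Φ.apply_symm_apply ((y, 0), 0))
    have h2 := hM p _ (le_max_right (n + 1) (M p))
    have h3 := h2.2.symm.trans h1.2
    exact congrArg (fun q => q.1.1) h3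
  let eqv := Equiv.ofBijective h ⟨hinj, hsurj⟩
  refine ⟨⟨eqv, hcont, ?_⟩⟩
  refine continuous_iff_continuousAt.2 fun y => ?_
  obtain ⟨p, rfl⟩ := hsurj y
  have hsymm : ∀ y, h (eqv.symm y) = y := fun y => eqv.apply_symm_apply y
  have hp : eqv.symm (h p) = p := eqv.symm_apply_apply p
  have hev : ∀ r > 0, ∀ k, ∀ᶠ y in 𝓝 (h p), dist (eqv.symm y).1 p.1 < r ∧
      ‖(eqv.symm y).2.1 k - p.2.1 k‖ < r := fun r hr k => by
    obtain ⟨n, hn, hnr⟩ := hpow r hr (max (M p) k)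
    obtain ⟨γ, hγ, hc⟩ := hctl p n ((le_max_left _ _).trans hn)
    filter_upwards [Metric.ball_mem_nhds (h p) hγ] with y hy
    have h1 := hc (eqv.symm y) (by rw [hsymm]; exact hy)
    exact ⟨(dist_le_headDist n _ _).trans_lt (h1.trans hnr),
      (norm_le_headDist ((le_max_right _ _).trans hn) _ _).trans_lt (h1.trans hnr)⟩
  change Tendsto eqv.symm (𝓝 (h p)) (𝓝 (eqv.symm (h p)))
  rw [hp]
  refine Prod.tendsto_iff _ _ |>.2 ⟨?_, ?_⟩
  · rw [Metric.tendsto_nhds]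
    exact fun r hr => (hev r hr 0).mono fun y hy => hy.1
  · refine (Topology.IsInducing.tendsto_nhds_iff (show Topology.IsInducing
      (Subtype.val : FS (L1 ℕ V) → _) from Topology.IsInducing.subtypeVal)).2 ?_
    rw [tendsto_pi_nhds]
    intro k
    rw [Metric.tendsto_nhds]
    exact fun r hr => (hev r hr k).mono fun y hy => by rw [dist_eq_norm]; exact hy.2

/-- A bounded good space is homeomorphic to a space of finitely supported sequences. -/
theorem GoodSpace.homeomorph_FS (hY : GoodSpace Y) (hd : ∀ a b : Y, dist a b ≤ 1) {i : Y → V}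
    (hi : Isometry i) (hcl : IsClosed (range i)) (hV : SFD V) :
    Nonempty (Y ≃ₜ FS (L1 ℕ V)) := by
  obtain ⟨h⟩ := hY.absorb hi hcl hV
  obtain ⟨y₀⟩ := hY.nonempty
  obtain ⟨g, hg⟩ := hY.gauge 2 two_pos
  have hs : ∀ t y, 0 < slack 2 (fun _ : Unit => y₀) (fun _ => 2) g t y := fun t y =>
    lt_slack.2 ⟨by linarith [hd y y₀], by linarith [hg.le_one y]⟩
  obtain ⟨S, -⟩ := exists_stable_product hg (T := Unit) (c := fun _ => y₀) (τ := fun _ => 2)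
    continuous_const continuous_const hi hcl (σ := fun _ => y₀) continuous_const
    (fun t => hs t y₀)
  let e₁ : {q : Unit × Y // 0 < slack 2 (fun _ => y₀) (fun _ => 2) g q.1 q.2} ≃ₜ Y :=
    (Homeomorph.setCongr (s := {q : Unit × Y | _}) (t := univ)
      (eq_univ_of_forall fun q => hs q.1 q.2)).trans
      ((Homeomorph.Set.univ _).trans (Homeomorph.punitProd Y))
  let e₂ : Y × L1 ℕ V ≃ₜ L1 ℕ V :=
    ((e₁.symm.prodCongr (Homeomorph.refl _)).trans S.symm).trans (Homeomorph.punitProd _)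
  exact ⟨h.symm.trans <| ((Homeomorph.refl Y).prodCongr FS.uncons).trans <|
    (Homeomorph.prodAssoc _ _ _).symm.trans <| (e₂.prodCongr (Homeomorph.refl _)).trans
    FS.uncons.symm⟩

end

end CurtisNhu

namespace CurtisNhu

/-- Finitely supported points of the Hilbert cube `∏ n, [0, 2⁻ⁿ]`, with the supremum metric. -/
def FinCube : Type :=
  {w : BoundedContinuousFunction ℕ ℝ // (Function.support w).Finite ∧
    ∀ n, 0 ≤ w n ∧ w n ≤ 2⁻¹ ^ n}

namespace FinCube

noncomputable instance : MetricSpace FinCube := Subtype.metricSpace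

noncomputable instance : SemilatticeSup FinCube :=
  Subtype.semilatticeSup fun {w w'} hw hw' => ⟨(hw.1.union hw'.1).subset fun n hn => by
      by_contra h
      simp only [mem_union, Function.mem_support, not_or, not_not] at h
      exact hn (by simp [h.1, h.2]),
    fun n => ⟨(hw.2 n).1.trans le_sup_left, sup_le (hw.2 n).2 (hw'.2 n).2⟩⟩

instance : CoeFun FinCube fun _ => ℕ → ℝ := ⟨fun w => w.1⟩

theorem sup_apply (w w' : FinCube) (n : ℕ) : (w ⊔ w') n = max (w n) (w' n) := rfl

theorem nonneg (w : FinCube) (n : ℕ) : 0 ≤ w n := (w.2.2 n).1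

theorem le_pow (w : FinCube) (n : ℕ) : w n ≤ 2⁻¹ ^ n := (w.2.2 n).2

theorem le_one (w : FinCube) (n : ℕ) : w n ≤ 1 :=
  (w.le_pow n).trans (pow_le_one₀ (by norm_num) (by norm_num))

@[ext]
theorem ext {w w' : FinCube} (h : ∀ n, w n = w' n) : w = w' :=
  Subtype.ext (BoundedContinuousFunction.ext h)

theorem dist_le {w w' : FinCube} {r : ℝ} (hr : 0 ≤ r) : dist w w' ≤ r ↔ ∀ n, |w n - w' n| ≤ r :=
  BoundedContinuousFunction.dist_le hr

theorem abs_sub_le_dist (w w' : FinCube) (n : ℕ) : |w n - w' n| ≤ dist w w' :=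
  BoundedContinuousFunction.dist_coe_le_dist (f := w.1) (g := w'.1) n

/-- The point of the cube with given coordinates. -/
def mk (x : ℕ → ℝ) (hf : (Function.support x).Finite) (h : ∀ n, 0 ≤ x n ∧ x n ≤ 2⁻¹ ^ n) :
    FinCube :=
  ⟨BoundedContinuousFunction.ofNormedAddCommGroup x continuous_of_discreteTopology 1 fun n => by
    rw [Real.norm_eq_abs, abs_of_nonneg (h n).1]
    exact (h n).2.trans (pow_le_one₀ (by norm_num) (by norm_num)), hf, h⟩

@[simp]
theorem mk_apply (x : ℕ → ℝ) (hf h) (n : ℕ) : mk x hf h n = x n := rfl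

theorem dist_le_one (w w' : FinCube) : dist w w' ≤ 1 :=
  (dist_le zero_le_one).2 fun n => abs_le.2
    ⟨by linarith [w.nonneg n, w'.le_one n], by linarith [w'.nonneg n, w.le_one n]⟩

instance : SupMetric FinCube := ⟨fun a b c d => by
  refine (dist_le (dist_nonneg.trans (le_max_left _ _))).2 fun n => ?_
  rw [sup_apply, sup_apply]
  exact (abs_max_sub_max_le_max _ _ _ _).trans
    (max_le_max (abs_sub_le_dist _ _ _) (abs_sub_le_dist _ _ _))⟩

instance : Nonempty FinCube :=
  ⟨mk (fun _ => 0) (by simp) fun n => ⟨le_rfl, by positivity⟩⟩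

theorem continuous_apply (n : ℕ) : Continuous fun w : FinCube => w n :=
  (LipschitzWith.of_dist_le_mul (K := 1) fun w w' => by
    rw [NNReal.coe_one, one_mul, Real.dist_eq]; exact abs_sub_le_dist _ _ _).continuous

theorem exists_pow_lt {ε : ℝ} (hε : 0 < ε) : ∃ N : ℕ, (2⁻¹ : ℝ) ^ N < ε :=
  exists_pow_lt_of_lt_one hε (by norm_num)

theorem tendsto_iff {A : Type*} {l : Filter A} {f : A → FinCube} {w : FinCube} :
    Tendsto f l (𝓝 w) ↔ ∀ n, Tendsto (fun a => f a n) l (𝓝 (w n)) := by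
  refine ⟨fun h n => ((continuous_apply n).tendsto w).comp h, fun h => ?_⟩
  rw [Metric.tendsto_nhds]
  intro ε hε
  obtain ⟨N, hN⟩ := exists_pow_lt (half_pos hε)
  have h1 : ∀ᶠ a in l, ∀ n ∈ Finset.range N, dist (f a n) (w n) < ε / 2 :=
    (Filter.eventually_all_finset _).2 fun n _ => Metric.tendsto_nhds.1 (h n) _ (half_pos hε)
  filter_upwards [h1] with a ha
  refine lt_of_le_of_lt ((dist_le (half_pos hε).le).2 fun n => ?_) (half_lt_self hε)
  rcases lt_or_ge n N with hn | hn
  · exact (ha n (Finset.mem_range.2 hn)).le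
  · have : (2⁻¹ : ℝ) ^ n ≤ 2⁻¹ ^ N := pow_le_pow_of_le_one (by norm_num) (by norm_num) hn
    exact abs_le.2 ⟨by linarith [(f a).nonneg n, w.le_pow n],
      by linarith [w.nonneg n, (f a).le_pow n]⟩

theorem continuous_iff {A : Type*} [TopologicalSpace A] {f : A → FinCube} :
    Continuous f ↔ ∀ n, Continuous fun a => f a n := by
  simp only [continuous_iff_continuousAt, ContinuousAt]
  exact ⟨fun h n a => tendsto_iff.1 (h a) n, fun h a => tendsto_iff.2 fun n => h n a⟩

theorem continuousOn_iff {A : Type*} [TopologicalSpace A] {f : A → FinCube} {s : Set A} :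
    ContinuousOn f s ↔ ∀ n, ContinuousOn (fun a => f a n) s :=
  ⟨fun h n a ha => tendsto_iff.1 (h a ha) n, fun h a ha => tendsto_iff.2 fun n => h n a ha⟩

theorem sfd : SFD FinCube := by
  have hC : ∀ m : ℕ, IsClosed {x : Fin m → ℝ | ∀ n, 0 ≤ x n ∧ x n ≤ 2⁻¹ ^ (n : ℕ)} := fun m => by
    simp only [ofPred_forall, ofPred_and]
    exact isClosed_iInter fun n => (isClosed_le continuous_const (_root_.continuous_apply n)).inter
      (isClosed_le (_root_.continuous_apply n) continuous_const)
  refine SFD.of_images (fun m => (SFD.pi sfd_real).subtype (hC m))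
    (fun m x => mk (fun n => if h : n < m then x.1 ⟨n, h⟩ else 0)
      ((finite_lt_nat m).subset fun n hn => by
        by_contra h; exact hn (dif_neg h)) fun n => ?_) (fun m => ?_) (fun m x x' hx => ?_)
      fun w => ?_
  · split_ifs with h
    · exact x.2 ⟨n, h⟩
    · exact ⟨le_rfl, by positivity⟩
  · refine continuous_iff.2 fun n => ?_
    simp only [mk_apply]
    split_ifs with h
    · exact (_root_.continuous_apply _).comp continuous_subtype_val
    · exact continuous_const
  · refine Subtype.ext (funext fun n => ?_)
    have := congrArg (fun w : FinCube => w n) hx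
    simpa using this
  · obtain ⟨m, hm⟩ := w.2.1.bddAbove
    refine ⟨m + 1, ⟨fun n => w n, fun n => w.2.2 n⟩, ext fun n => ?_⟩
    simp only [mk_apply]
    split_ifs with h
    · rfl
    · by_contra h'
      have := hm (show n ∈ Function.support w.1 from fun h0 => h' h0.symm)
      omega

theorem bddAbove (N : ℕ) (w : FinCube) :
    BddAbove (range fun n : ℕ => (2⁻¹ : ℝ) ^ (N + n) - w (N + n)) :=
  ⟨1, by
    rintro _ ⟨n, rfl⟩
    have : (2⁻¹ : ℝ) ^ (N + n) ≤ 1 := pow_le_one₀ (by norm_num) (by norm_num)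
    change _ - w (N + n) ≤ 1
    linarith [w.nonneg (N + n)]⟩

/-- The straight path from `a` through `a ⊔ b` to `b`. -/
noncomputable def path (a b : FinCube) (t : ℝ) : FinCube :=
  mk (fun n => max (min 1 (max 0 (2 - 2 * t)) * a n) (min 1 (max 0 (2 * t)) * b n))
    ((a.2.1.union b.2.1).subset fun n hn => by
      by_contra h
      simp only [mem_union, Function.mem_support, not_or, not_not] at h
      exact hn (by simp [h.1, h.2]))
    fun n => by
      have h1 : ∀ s : ℝ, 0 ≤ min 1 (max 0 s) ∧ min 1 (max 0 s) ≤ 1 := fun s =>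
        ⟨le_min zero_le_one (le_max_left _ _), min_le_left _ _⟩
      exact ⟨le_max_of_le_left (mul_nonneg (h1 _).1 (a.nonneg n)),
        max_le ((mul_le_of_le_one_left (a.nonneg n) (h1 _).2).trans (a.le_pow n))
          ((mul_le_of_le_one_left (b.nonneg n) (h1 _).2).trans (b.le_pow n))⟩

theorem path_spec (a b : FinCube) (t : ℝ) :
    (∀ n, a n ≤ path a b t n ∧ path a b t n ≤ max (a n) (b n)) ∨
      ∀ n, b n ≤ path a b t n ∧ path a b t n ≤ max (a n) (b n) := by
  rcases le_total t (1 / 2) with h | h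
  · refine Or.inl fun n => ?_
    have h1 : min 1 (max 0 (2 - 2 * t)) = 1 := min_eq_left (le_max_of_le_right (by linarith))
    simp only [path, mk_apply, h1, one_mul]
    exact ⟨le_max_left _ _, max_le_max le_rfl
      (mul_le_of_le_one_left (b.nonneg n) (min_le_left _ _))⟩
  · refine Or.inr fun n => ?_
    have h1 : min 1 (max 0 (2 * t)) = 1 := min_eq_left (le_max_of_le_right (by linarith))
    simp only [path, mk_apply, h1, one_mul]
    exact ⟨le_max_right _ _, max_le_max
      (mul_le_of_le_one_left (a.nonneg n) (min_le_left _ _)) le_rfl⟩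

theorem exists_gauge {ε : ℝ} (hε : 0 < ε) : ∃ g : FinCube → ℝ, Gauge ε g := by
  obtain ⟨N, hN⟩ := exists_pow_lt hε
  have hp : ∀ n : ℕ, (2⁻¹ : ℝ) ^ (N + n) ≤ 1 := fun n => pow_le_one₀ (by norm_num) (by norm_num)
  refine ⟨fun w => ⨆ n : ℕ, ((2⁻¹ : ℝ) ^ (N + n) - w (N + n)), ?_, fun w => ?_, fun w => ?_,
    fun a b => ?_, fun y τ hτ => ?_, fun y₀ R τ a b ha hb hga hgb => ?_⟩
  · refine (LipschitzWith.of_le_add fun w w' => ciSup_le fun n => ?_).continuous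
    have h1 := le_ciSup (bddAbove N w') n
    have h2 := (abs_le.1 (abs_sub_le_dist w w' (N + n))).1
    linarith
  · obtain ⟨m, hm⟩ := w.2.1.bddAbove
    have h0 : w (N + (m + 1)) = 0 := by
      by_contra h
      have := hm (show N + (m + 1) ∈ Function.support w.1 from h)
      omega
    have := le_ciSup (bddAbove N w) (m + 1)
    simp only [h0, sub_zero] at this
    exact lt_of_lt_of_le (by positivity) this
  · exact ciSup_le fun n => by linarith [w.nonneg (N + n), hp n]
  · refine ciSup_le fun n => le_max_of_le_left (le_trans ?_ (le_ciSup (bddAbove N a) n))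
    linarith [le_max_left (a (N + n)) (b (N + n)), sup_apply a b (N + n)]
  · obtain ⟨M, hM⟩ := exists_pow_lt hτ
    refine ⟨mk (fun n => if N ≤ n ∧ n < M then 2⁻¹ ^ n else y n)
      ((y.2.1.union (finite_lt_nat M)).subset fun n hn => ?_) (fun n => ?_), ?_, ?_⟩
    · by_contra h
      simp only [mem_union, Function.mem_support, not_or, not_not, mem_ofPred_eq] at h
      exact hn (by simp [h.1, h.2])
    · split_ifs
      · exact ⟨by positivity, le_rfl⟩
      · exact y.2.2 n
    · refine lt_of_le_of_lt ((dist_le (r := 2⁻¹ ^ N) (by positivity)).2 fun n => ?_) hN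
      simp only [mk_apply]
      split_ifs with h
      · have : (2⁻¹ : ℝ) ^ n ≤ 2⁻¹ ^ N := pow_le_pow_of_le_one (by norm_num) (by norm_num) h.1
        exact abs_le.2 ⟨by linarith [y.le_pow n, pow_nonneg (show (0 : ℝ) ≤ 2⁻¹ by norm_num) N],
          by linarith [y.nonneg n]⟩
      · rw [sub_self, abs_zero]; positivity
    · refine lt_of_le_of_lt (ciSup_le fun n => ?_) hM
      simp only [mk_apply]
      split_ifs with h
      · rw [sub_self]; positivity
      · have : M ≤ N + n := by omega
        have : (2⁻¹ : ℝ) ^ (N + n) ≤ 2⁻¹ ^ M := pow_le_pow_of_le_one (by norm_num) (by norm_num) this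
        linarith [y.nonneg (N + n)]
  · refine ⟨path a b, continuous_iff.2 fun n => ?_, ext fun n => ?_, ext fun n => ?_, fun t => ?_⟩
    · simp only [path, mk_apply]
      fun_prop
    · simp only [path, mk_apply]; norm_num [a.nonneg n]
    · simp only [path, mk_apply]; norm_num [b.nonneg n]
    · have hd : ∀ n, path a b t n ≤ max (a n) (b n) ∧ min (a n) (b n) ≤ path a b t n := fun n => by
        rcases path_spec a b t with h | h
        · exact ⟨(h n).2, (min_le_left _ _).trans (h n).1⟩
        · exact ⟨(h n).2, (min_le_right _ _).trans (h n).1⟩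
      constructor
      · refine lt_of_le_of_lt ((dist_le (dist_nonneg.trans (le_max_left (dist a y₀) (dist b y₀)))).2
          fun n => ?_) (max_lt ha hb)
        have h1 := abs_le.1 ((abs_sub_le_dist a y₀ n).trans (le_max_left _ (dist b y₀)))
        have h2 := abs_le.1 ((abs_sub_le_dist b y₀ n).trans (le_max_right (dist a y₀) _))
        refine abs_le.2 ⟨?_, ?_⟩
        · rcases min_choice (a n) (b n) with h | h <;> linarith [(hd n).2]
        · rcases max_choice (a n) (b n) with h | h <;> linarith [(hd n).1]
      · rcases path_spec a b t with h | h
        · exact lt_of_le_of_lt (ciSup_le fun n => (by linarith [(h (N + n)).1] : _ ≤ _).trans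
            (le_ciSup (bddAbove N a) n)) hga
        · exact lt_of_le_of_lt (ciSup_le fun n => (by linarith [(h (N + n)).1] : _ ≤ _).trans
            (le_ciSup (bddAbove N b) n)) hgb

end FinCube

end CurtisNhu

namespace CurtisNhu

namespace FinCube

theorem exists_block_bound {Z : Type*} [TopologicalSpace Z] {L : Set Z} (hL : IsCompact L)
    {F : Z → FinCube} (hF : ContinuousOn F L) (s : ℕ) :
    ∃ m, ∀ l ∈ L, ∃ n, s ≤ n ∧ n < m ∧ F l n < 4⁻¹ * 2⁻¹ ^ n := by
  refine hL.induction_on (p := fun S => ∃ m, ∀ l ∈ S, ∃ n, s ≤ n ∧ n < m ∧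
    F l n < 4⁻¹ * 2⁻¹ ^ n) ⟨0, by simp⟩ (fun S S' h ⟨m, hm⟩ => ⟨m, fun l hl => hm l (h hl)⟩)
    (fun S S' ⟨m, hm⟩ ⟨m', hm'⟩ => ⟨max m m', fun l hl => ?_⟩) fun l hl => ?_
  · rcases hl with hl | hl
    · obtain ⟨n, h1, h2, h3⟩ := hm l hl
      exact ⟨n, h1, lt_max_of_lt_left h2, h3⟩
    · obtain ⟨n, h1, h2, h3⟩ := hm' l hl
      exact ⟨n, h1, lt_max_of_lt_right h2, h3⟩
  · obtain ⟨m, hm⟩ := (F l).2.1.bddAbove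
    have h0 : F l (s + m + 1) = 0 := by
      by_contra h
      have := hm (show s + m + 1 ∈ Function.support (F l).1 from h)
      omega
    have h1 : ∀ᶠ x in 𝓝[L] l, F x (s + m + 1) < 4⁻¹ * 2⁻¹ ^ (s + m + 1) :=
      (continuousOn_iff.1 hF (s + m + 1) l hl).eventually_lt_const (by
        change F l (s + m + 1) < _; rw [h0]; positivity)
    exact ⟨_, h1, s + m + 2, fun x hx => ⟨s + m + 1, by omega, by omega, hx⟩⟩

/-- A ramp from `0` to `1`. -/
def ramp (s : ℝ) : ℝ := min 1 (max 0 s)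

/-- A tent supported on `(j, j + 2)`. -/
def tent (j : ℕ) (s : ℝ) : ℝ := max 0 (min (s - j) (j + 2 - s))

theorem ramp_nonneg (s : ℝ) : 0 ≤ ramp s := le_min zero_le_one (le_max_left _ _)

theorem ramp_le_one (s : ℝ) : ramp s ≤ 1 := min_le_left _ _

theorem ramp_eq_one {s : ℝ} (h : 1 ≤ s) : ramp s = 1 := min_eq_left (le_max_of_le_right h)

theorem ramp_eq_zero {s : ℝ} (h : s ≤ 0) : ramp s = 0 := by
  rw [ramp, max_eq_left h, min_eq_right zero_le_one]

theorem tent_nonneg (j : ℕ) (s : ℝ) : 0 ≤ tent j s := le_max_left _ _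

theorem tent_le_one (j : ℕ) (s : ℝ) : tent j s ≤ 1 := by
  refine max_le zero_le_one ?_
  rcases le_total s (j + 1) with h | h
  · exact (min_le_left _ _).trans (by linarith)
  · exact (min_le_right _ _).trans (by linarith)

theorem tent_pos {j : ℕ} {s : ℝ} (h1 : (j : ℝ) < s) (h2 : s < j + 2) : 0 < tent j s :=
  lt_max_of_lt_right (lt_min (by linarith) (by linarith))

theorem tent_eq_zero_of_le {j : ℕ} {s : ℝ} (h : s ≤ j) : tent j s = 0 :=
  max_eq_left ((min_le_left _ _).trans (by linarith))

theorem tent_eq_zero_of_ge {j : ℕ} {s : ℝ} (h : (j : ℝ) + 2 ≤ s) : tent j s = 0 :=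
  max_eq_left ((min_le_right _ _).trans (by linarith))

/-- The encoding of a point of `[-R, R]^k` by numbers between `1/2` and `1`. -/
noncomputable def code {k : ℕ} (R : ℝ) (x : Fin k → ℝ) (m : ℕ) : ℝ :=
  if h : m < k then (1 + (x ⟨m, h⟩ + R) / (2 * R)) / 2 else 1

theorem code_mem {k : ℕ} {R : ℝ} (hR : 0 < R) {x : Fin k → ℝ} (hx : ∀ c, |x c| ≤ R) (m : ℕ) :
    1 / 2 ≤ code R x m ∧ code R x m ≤ 1 := by
  unfold code
  split_ifs with h
  · have h1 := abs_le.1 (hx ⟨m, h⟩)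
    have h2 : 0 ≤ (x ⟨m, h⟩ + R) / (2 * R) := div_nonneg (by linarith) (by linarith)
    have h3 : (x ⟨m, h⟩ + R) / (2 * R) ≤ 1 := (div_le_one (by linarith)).2 (by linarith)
    constructor <;> linarith
  · norm_num

theorem continuous_code {k : ℕ} (R : ℝ) (m : ℕ) : Continuous fun x : Fin k → ℝ => code R x m := by
  unfold code
  split_ifs with h
  · exact ((continuous_const.add (((_root_.continuous_apply _).add
      continuous_const).div_const _)).div_const _)
  · exact continuous_const

theorem embApprox_aux {k : ℕ} {K L : Set (Fin k → ℝ)} {F : (Fin k → ℝ) → FinCube} {δ : ℝ}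
    (hK : IsCompact K) (hL : IsClosed L) (hLK : L ⊆ K) (hF : ContinuousOn F K) (hFL : InjOn F L)
    (hδ : 0 < δ) (hne : L.Nonempty) :
    ∃ F' : (Fin k → ℝ) → FinCube, ContinuousOn F' K ∧ InjOn F' K ∧ EqOn F' F L ∧
      ∀ x ∈ K, dist (F' x) (F x) < δ := by
  classical
  have hLc : IsCompact L := hK.of_isClosed_subset hL hLK
  obtain ⟨R, hR, hKR⟩ : ∃ R > 0, ∀ x ∈ K, ∀ c, |x c| ≤ R := by
    obtain ⟨R, hR⟩ := hK.isBounded.exists_norm_le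
    exact ⟨max R 1, by positivity, fun x hx c =>
      (norm_le_pi_norm x c).trans ((hR x hx).trans (le_max_left _ _))⟩
  obtain ⟨a₀, ha₀⟩ := exists_pow_lt hδ
  choose nxt hnxt using exists_block_bound hLc (hF.mono hLK)
  let a : ℕ → ℕ := fun j => Nat.rec a₀ (fun _ s => max (nxt s) (s + k + 1)) j
  have ha_zero : a 0 = a₀ := rfl
  have ha_succ : ∀ j, a (j + 1) = max (nxt (a j)) (a j + k + 1) := fun j => rfl
  have ha_lt : ∀ j, a j + k < a (j + 1) := fun j => by
    rw [ha_succ]; exact lt_of_lt_of_le (by omega) (le_max_right _ _)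
  have ha_mono : StrictMono a := strictMono_nat_of_lt_succ fun j => by have := ha_lt j; omega
  have ha_avoid : ∀ j, ∀ l ∈ L, ∃ n, a j ≤ n ∧ n < a (j + 1) ∧ F l n < 4⁻¹ * 2⁻¹ ^ n :=
    fun j l hl => by
      obtain ⟨n, h1, h2, h3⟩ := hnxt (a j) l hl
      exact ⟨n, h1, h2.trans_le (by rw [ha_succ]; exact le_max_left _ _), h3⟩
  have hblk : ∀ n, ∃ j, a₀ ≤ n → a j ≤ n ∧ n < a (j + 1) := fun n => by
    by_cases hn : a₀ ≤ n
    · refine ⟨Nat.findGreatest (fun j => a j ≤ n) n, fun _ => ⟨?_, ?_⟩⟩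
      · exact Nat.findGreatest_spec (P := fun j => a j ≤ n) (Nat.zero_le n) hn
      · by_contra h
        push Not at h
        have h1 := ha_mono.le_apply (x := Nat.findGreatest (fun j => a j ≤ n) n + 1)
        have h2 := Nat.le_findGreatest (P := fun j => a j ≤ n) (h1.trans h) h
        omega
    · exact ⟨0, fun h => absurd h hn⟩
  choose blk hblk using hblk
  have hblk_eq : ∀ j n, a j ≤ n → n < a (j + 1) → a₀ ≤ n ∧ blk n = j := fun j n h1 h2 => by
    have h0 : a₀ ≤ n := (ha_mono.monotone (Nat.zero_le j)).trans h1
    obtain ⟨h3, h4⟩ := hblk n h0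
    refine ⟨h0, le_antisymm ?_ ?_⟩
    · exact Nat.lt_succ_iff.1 (ha_mono.lt_iff_lt.1 (h3.trans_lt h2))
    · exact Nat.lt_succ_iff.1 (ha_mono.lt_iff_lt.1 (h1.trans_lt h4))
  set ν : (Fin k → ℝ) → ℝ := fun x => 1 + (infDist x L)⁻¹ with hν
  have hd : ∀ x, x ∉ L → 0 < infDist x L := fun x hx => (hL.notMem_iff_infDist_pos hne).1 hx
  have hν1 : ∀ x, x ∉ L → 1 < ν x := fun x hx => by
    have := inv_pos.2 (hd x hx)
    simp only [hν]; linarith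
  -- the coordinates off `L`
  set G : (Fin k → ℝ) → ℕ → ℝ := fun x n => if n < a₀ then F x n else
    max (ramp (ν x - blk n - 2) * F x n)
      (2⁻¹ ^ n * (tent (blk n) (ν x) * code R x (n - a (blk n)))) with hG
  have hG_mem : ∀ x ∈ K, ∀ n, 0 ≤ G x n ∧ G x n ≤ 2⁻¹ ^ n := fun x hx n => by
    have hcode := code_mem hR (hKR x hx) (n - a (blk n))
    simp only [hG]
    split_ifs with h
    · exact ⟨nonneg _ _, le_pow _ _⟩
    · refine ⟨le_max_of_le_left (mul_nonneg (ramp_nonneg _) (nonneg _ _)), max_le ?_ ?_⟩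
      · exact (mul_le_of_le_one_left (nonneg _ _) (ramp_le_one _)).trans (le_pow _ _)
      · refine mul_le_of_le_one_right (by positivity) ?_
        exact mul_le_one₀ (tent_le_one _ _) (by linarith) hcode.2
  have hG_zero : ∀ x (j : ℕ) n, ν x ≤ j → a j ≤ n → G x n = 0 := fun x j n h1 h2 => by
    have h0 : a₀ ≤ n := (ha_mono.monotone (Nat.zero_le j)).trans h2
    have h3 : j ≤ blk n := Nat.lt_succ_iff.1 (ha_mono.lt_iff_lt.1 (h2.trans_lt (hblk n h0).2))
    have h4 : (j : ℝ) ≤ blk n := by exact_mod_cast h3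
    simp only [hG, if_neg (not_lt.2 h0), ramp_eq_zero (show ν x - blk n - 2 ≤ 0 by linarith),
      tent_eq_zero_of_le (show ν x ≤ blk n by linarith), zero_mul, mul_zero, max_self]
  have hG_far : ∀ x n, (blk n : ℝ) + 3 ≤ ν x → G x n = F x n := fun x n h => by
    simp only [hG]
    split_ifs
    · rfl
    · rw [ramp_eq_one (by linarith), tent_eq_zero_of_ge (by linarith), zero_mul, mul_zero, one_mul,
        max_eq_left (nonneg _ _)]
  have hG_code : ∀ x (j : ℕ) n, a j ≤ n → n < a (j + 1) → ν x < j + 2 →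
      G x n = max 0 (2⁻¹ ^ n * (tent j (ν x) * code R x (n - a j))) := fun x j n h1 h2 h3 => by
    obtain ⟨h4, h5⟩ := hblk_eq j n h1 h2
    simp only [hG, if_neg (not_lt.2 h4), h5, ramp_eq_zero (show ν x - j - 2 ≤ 0 by linarith),
      zero_mul]
  have hG_code' : ∀ x ∈ K, ∀ (j : ℕ) n, a j ≤ n → n < a (j + 1) → ν x < j + 2 →
      G x n = 2⁻¹ ^ n * (tent j (ν x) * code R x (n - a j)) := fun x hx j n h1 h2 h3 => by
    rw [hG_code x j n h1 h2 h3, max_eq_right]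
    have := (code_mem hR (hKR x hx) (n - a j)).1
    exact mul_nonneg (by positivity) (mul_nonneg (tent_nonneg _ _) (by linarith))
  have hG_fin : ∀ x, (Function.support (G x)).Finite := fun x => by
    obtain ⟨j, hj⟩ := exists_nat_ge (ν x)
    refine (finite_lt_nat (a j)).subset fun n hn => ?_
    by_contra h
    exact hn (hG_zero x j n hj (not_lt.1 h))
  set F' : (Fin k → ℝ) → FinCube := fun x =>
    if h : x ∈ K ∧ x ∉ L then mk (G x) (hG_fin x) (hG_mem x h.1) else F x with hF'
  have hF'G : ∀ x ∈ K, x ∉ L → ∀ n, F' x n = G x n := fun x hx hxL n => by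
    simp only [hF', dif_pos (⟨hx, hxL⟩ : x ∈ K ∧ x ∉ L), mk_apply]
  have hF'L : ∀ x ∈ L, F' x = F x := fun x hx => dif_neg fun h => h.2 hx
  have hlow : ∀ x ∈ K, ∀ n < a₀, F' x n = F x n := fun x hx n hn => by
    by_cases hxL : x ∈ L
    · rw [hF'L x hxL]
    · rw [hF'G x hx hxL]; simp only [hG, if_pos hn]
  have hνc : ∀ x, x ∉ L → ContinuousAt ν x := fun x hx =>
    continuousAt_const.add ((continuous_infDist_pt L).continuousAt.inv₀ (hd x hx).ne')
  have hlast : ∀ x, x ∉ L → ∃ j : ℕ, (j : ℝ) + 1 < ν x ∧ ν x ≤ j + 2 := fun x hx => by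
    have h1 := hν1 x hx
    have h2 : 1 < ⌈ν x⌉₊ := Nat.lt_ceil.2 (by exact_mod_cast h1)
    obtain ⟨j, hj⟩ := Nat.exists_eq_add_of_le h2
    have h3 := Nat.ceil_lt_add_one (show 0 ≤ ν x by linarith)
    have h4 := Nat.le_ceil (ν x)
    rw [hj] at h3 h4
    push_cast at h3 h4
    exact ⟨j, by linarith, by linarith⟩
  refine ⟨F', continuousOn_iff.2 fun n x hx => ?_, ?_, hF'L, fun x hx => ?_⟩
  · by_cases hn : n < a₀
    · exact (continuousOn_iff.1 hF n x hx).congr (fun y hy => hlow y hy n hn) (hlow x hx n hn)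
    by_cases hxL : x ∈ L
    · have h1 : ∀ᶠ y in 𝓝[K] x, infDist y L < ((blk n : ℝ) + 3)⁻¹ :=
        ((continuous_infDist_pt L).continuousAt.eventually_lt_const (by
          change infDist x L < _; rw [infDist_zero_of_mem hxL]; positivity)).filter_mono nhdsWithin_le_nhds
      refine (continuousOn_iff.1 hF n x hx).congr_of_eventuallyEq ?_ (by rw [hF'L x hxL])
      filter_upwards [h1, self_mem_nhdsWithin] with y hy hyK
      by_cases hyL : y ∈ L
      · rw [hF'L y hyL]
      · rw [hF'G y hyK hyL]
        refine hG_far y n ?_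
        have := (lt_inv_comm₀ (hd y hyL) (by positivity)).1 hy
        simp only [hν]; linarith
    · have h1 : ∀ᶠ y in 𝓝[K] x, y ∉ L := nhdsWithin_le_nhds (hL.isOpen_compl.mem_nhds hxL)
      have h2 : ContinuousWithinAt (fun y => G y n) K x := by
        simp only [hG, if_neg hn]
        have h3 : ContinuousWithinAt ν K x := (hνc x hxL).continuousWithinAt
        have h4 : Continuous ramp := by unfold ramp; fun_prop
        have h5 : Continuous (tent (blk n)) := by unfold tent; fun_prop
        refine ContinuousWithinAt.sup ((h4.continuousAt.comp_continuousWithinAt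
          ((h3.sub continuousWithinAt_const).sub continuousWithinAt_const)).mul
          (continuousOn_iff.1 hF n x hx)) (continuousWithinAt_const.mul
          ((h5.continuousAt.comp_continuousWithinAt h3).mul
          (continuous_code R _).continuousWithinAt))
      refine h2.congr_of_eventuallyEq ?_ (hF'G x hx hxL n)
      filter_upwards [h1, self_mem_nhdsWithin] with y hy hyK using hF'G y hyK hy n
  · -- separation of `L` from its complement
    have hsep : ∀ x ∈ K, x ∉ L → ∀ l ∈ L, F' x ≠ F' l := fun x hx hxL l hl heq => by
      obtain ⟨j, hj1, hj2⟩ := hlast x hxL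
      have key : ∀ i : ℕ, ν x < i + 2 → 1 / 2 ≤ tent i (ν x) → False := fun i hi ht => by
        obtain ⟨n, h1, h2, h3⟩ := ha_avoid i l hl
        have h4 := hG_code' x hx i n h1 h2 hi
        rw [← hF'G x hx hxL, heq, hF'L l hl] at h4
        have h5 := (code_mem hR (hKR x hx) (n - a i)).1
        have h6 : (4⁻¹ : ℝ) ≤ tent i (ν x) * code R x (n - a i) := by nlinarith
        have h7 : (0 : ℝ) < 2⁻¹ ^ n := by positivity
        nlinarith
      rcases le_total (ν x) (j + 3 / 2) with h | h
      · exact key j (by linarith) (le_max_of_le_right (le_min (by linarith) (by linarith)))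
      · refine key (j + 1) (by push_cast; linarith) (le_max_of_le_right (le_min ?_ ?_)) <;>
          push_cast <;> linarith
    intro x hx y hy hxy
    by_cases hxL : x ∈ L <;> by_cases hyL : y ∈ L
    · exact hFL hxL hyL (by rw [← hF'L x hxL, ← hF'L y hyL, hxy])
    · exact absurd hxy.symm (hsep y hy hyL x hxL)
    · exact absurd hxy (hsep x hx hxL y hyL)
    · have hGxy : ∀ n, G x n = G y n := fun n => by
        rw [← hF'G x hx hxL, ← hF'G y hy hyL, hxy]
      obtain ⟨i, hi1, hi2⟩ := hlast x hxL
      obtain ⟨j, hj1, hj2⟩ := hlast y hyL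
      have hle : ∀ x ∈ K, ∀ y ∈ K, (∀ n, G x n = G y n) → ∀ i j : ℕ, (i : ℝ) + 1 < ν x →
          ν x ≤ i + 2 → ν y ≤ j + 2 → i ≤ j := fun x hx y hy hxy i j h1 h2 h3 => by
        by_contra h
        push Not at h
        have h4 : (j : ℝ) + 1 ≤ i := by exact_mod_cast h
        have h5 := hG_zero y (i + 1) (a (i + 1)) (by push_cast; linarith) le_rfl
        have h6 := hG_code' x hx (i + 1) (a (i + 1)) le_rfl (ha_mono (Nat.lt_succ_self (i + 1)))
          (by push_cast; linarith)
        rw [hxy, h5] at h6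
        have h7 := (code_mem hR (hKR x hx) (a (i + 1) - a (i + 1))).1
        have h8 : 0 < tent (i + 1) (ν x) := tent_pos (by push_cast; linarith) (by push_cast; linarith)
        have : (0 : ℝ) < 2⁻¹ ^ a (i + 1) * (tent (i + 1) (ν x) * code R x (a (i + 1) - a (i + 1))) :=
          mul_pos (by positivity) (mul_pos h8 (by linarith))
        linarith
      obtain rfl : i = j := le_antisymm (hle x hx y hy hGxy i j hi1 hi2 hj2)
        (hle y hy x hx (fun n => (hGxy n).symm) j i hj1 hj2 hi2)
      have hcode : ∀ m ≤ k, tent (i + 1) (ν x) * code R x m = tent (i + 1) (ν y) * code R y m :=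
        fun m hm => by
          have h1 := ha_lt (i + 1)
          have h2 := hG_code' x hx (i + 1) (a (i + 1) + m) (by omega) (by omega)
            (by push_cast; linarith)
          have h3 := hG_code' y hy (i + 1) (a (i + 1) + m) (by omega) (by omega)
            (by push_cast; linarith)
          rw [← hGxy, h2] at h3
          rw [Nat.add_sub_cancel_left] at h3
          exact mul_left_cancel₀ (by positivity) h3
      have ht : tent (i + 1) (ν x) = tent (i + 1) (ν y) := by
        simpa [code] using hcode k le_rfl
      have h8 : 0 < tent (i + 1) (ν y) := tent_pos (by push_cast; linarith) (by push_cast; linarith)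
      refine funext fun c => ?_
      have h9 := hcode c c.2.le
      rw [ht] at h9
      have h10 := mul_left_cancel₀ h8.ne' h9
      simp only [code, c.2, dif_pos, Fin.eta] at h10
      have h11 : (x c + R) / (2 * R) = (y c + R) / (2 * R) := by linarith
      have h12 := (div_left_inj' (by positivity)).1 h11
      linarith
  · refine lt_of_le_of_lt ((dist_le (r := 2⁻¹ ^ a₀) (by positivity)).2 fun n => ?_) ha₀
    rcases lt_or_ge n a₀ with hn | hn
    · rw [hlow x hx n hn, sub_self, abs_zero]; positivity
    · have : (2⁻¹ : ℝ) ^ n ≤ 2⁻¹ ^ a₀ := pow_le_pow_of_le_one (by norm_num) (by norm_num) hn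
      exact abs_le.2 ⟨by linarith [(F' x).nonneg n, (F x).le_pow n],
        by linarith [(F x).nonneg n, (F' x).le_pow n]⟩

theorem embApprox : EmbApprox FinCube := by
  intro k K L F δ hK hL hLK hF hFL hδ
  rcases L.eq_empty_or_nonempty with rfl | hne
  · rcases K.eq_empty_or_nonempty with rfl | ⟨x, hx⟩
    · exact ⟨F, hF, injOn_empty _, fun x hx => rfl, fun x hx => hx.elim⟩
    · obtain ⟨F', h1, h2, -, h4⟩ := embApprox_aux hK isClosed_singleton
        (singleton_subset_iff.2 hx) hF (injOn_singleton _ _) hδ (singleton_nonempty x)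
      exact ⟨F', h1, h2, fun x hx => hx.elim, h4⟩
  · exact embApprox_aux hK hL hLK hF hFL hδ hne

theorem goodSpace : GoodSpace FinCube :=
  ⟨inferInstance, sfd, embApprox, fun _ => exists_gauge⟩

end FinCube

end CurtisNhu

namespace CurtisNhu

namespace L1

variable {ι V W : Type*} [NormedAddCommGroup V] [NormedAddCommGroup W]

theorem norm_le_mul_norm {x : L1 ι V} {y : L1 ι W} {C : ℝ} (h : ∀ i, ‖x i‖ ≤ C * ‖y i‖) :
    ‖x‖ ≤ C * ‖y‖ := by
  rw [norm_eq_sum x (s := y.supp), norm_eq_sum_supp y, Finset.mul_sum]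
  · exact Finset.sum_le_sum fun i _ => h i
  · intro i hi
    have := h i
    rwa [notMem_supp.1 hi, norm_zero, mul_zero, norm_le_zero_iff] at this

/-- A nonexpanding coordinatewise map. -/
noncomputable def map (f : V → W) (hf : f 0 = 0) (x : L1 ι V) : L1 ι W :=
  mk (fun i => f (x i)) (x.finite_support.subset fun i hi h => hi (by
    change f (x i) = 0
    rw [show x i = 0 from h, hf]))

theorem map_apply (f : V → W) (hf : f 0 = 0) (x : L1 ι V) (i : ι) : map f hf x i = f (x i) := rfl

theorem continuous_map (f : V → W) (hf : f 0 = 0) (h : LipschitzWith 1 f) :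
    Continuous (map (ι := ι) f hf) := by
  refine (LipschitzWith.of_dist_le_mul (K := 1) fun x y => ?_).continuous
  rw [NNReal.coe_one, dist_eq_norm, dist_eq_norm]
  refine norm_le_mul_norm fun i => ?_
  rw [sub_apply, sub_apply, map_apply, map_apply, ← dist_eq_norm, ← dist_eq_norm]
  exact h.dist_le_mul _ _

/-- Families in a product are pairs of families. -/
noncomputable def prodValue : L1 ι (V × W) ≃ₜ L1 ι V × L1 ι W where
  toFun x := (map Prod.fst rfl x, map Prod.snd rfl x)
  invFun p := map (fun v => (v, 0)) rfl p.1 + map (fun w => (0, w)) rfl p.2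
  left_inv x := L1.ext fun i => by simp [add_apply, map_apply]
  right_inv p := Prod.ext (L1.ext fun i => by simp [add_apply, map_apply])
    (L1.ext fun i => by simp [add_apply, map_apply])
  continuous_toFun := (continuous_map _ _ LipschitzWith.prod_fst).prodMk
    (continuous_map _ _ LipschitzWith.prod_snd)
  continuous_invFun := by
    refine ((continuous_map _ _ ?_).comp continuous_fst).add
      ((continuous_map _ _ ?_).comp continuous_snd)
    · exact LipschitzWith.of_dist_le_mul fun a b => by simp [Prod.dist_eq]
    · exact LipschitzWith.of_dist_le_mul fun a b => by simp [Prod.dist_eq]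

/-- A summand `ℝ` of the space of values absorbs `L1 ℕ ℝ`. -/
theorem prod_real_absorb : Nonempty (L1 ℕ (V × ℝ) × L1 ℕ ℝ ≃ₜ L1 ℕ (V × ℝ)) :=
  ⟨(prodValue.prodCongr (Homeomorph.refl _)).trans <| (Homeomorph.prodAssoc _ _ _).trans <|
    ((Homeomorph.refl _).prodCongr sqEquiv).trans prodValue.symm⟩

end L1

namespace FinCube

/-- Coordinates of a point of the cube as a finitely supported family. -/
noncomputable def toL1 (w : FinCube) : L1 ℕ ℝ := L1.mk w w.2.1

theorem toL1_apply (w : FinCube) (n : ℕ) : toL1 w n = w n := rfl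

/-- The coordinatewise retraction onto the cube. -/
noncomputable def clamp (x : L1 ℕ ℝ) : FinCube :=
  mk (fun n => max 0 (min (x n) (2⁻¹ ^ n))) (x.finite_support.subset fun n hn h => hn (by
    have h' : x n = 0 := h
    have : (0 : ℝ) ≤ 2⁻¹ ^ n := by positivity
    simp [h', this]))
    fun n => ⟨le_max_left _ _, max_le (by positivity) (min_le_right _ _)⟩

theorem clamp_toL1 (w : FinCube) : clamp (toL1 w) = w := ext fun n => by
  simp only [clamp, mk_apply, toL1_apply]
  rw [min_eq_left (w.le_pow n), max_eq_right (w.nonneg n)]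

theorem continuous_clamp : Continuous clamp := continuous_iff.2 fun n =>
  continuous_const.max ((L1.continuous_apply n).min continuous_const)

theorem sum_pow_le (N : ℕ) (t : Finset ℕ) (h : Disjoint (Finset.range N) t) :
    ∑ n ∈ t, (2⁻¹ : ℝ) ^ n ≤ 2 * 2⁻¹ ^ N := by
  have h1 : Summable fun n : ℕ => (2⁻¹ : ℝ) ^ (n + N) := by
    simp_rw [pow_add]
    exact (summable_geometric_of_lt_one (by norm_num) (by norm_num)).mul_right _
  have h2 : ∑' n : ℕ, (2⁻¹ : ℝ) ^ (n + N) = 2 * 2⁻¹ ^ N := by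
    simp_rw [pow_add]
    rw [tsum_mul_right, tsum_geometric_of_lt_one (by norm_num) (by norm_num)]
    norm_num
  have h3 : ∀ n ∈ t, N ≤ n := fun n hn => by
    by_contra h'
    exact Finset.disjoint_left.1 h (Finset.mem_range.2 (not_le.1 h')) hn
  rw [← h2]
  refine le_trans (le_of_eq ?_) (h1.sum_le_tsum (t.image fun n => n - N) fun _ _ => by positivity)
  rw [Finset.sum_image fun a ha b hb hab => by
    have := h3 a ha; have := h3 b hb; change a - N = b - N at hab; omega]
  exact Finset.sum_congr rfl fun n hn => by rw [Nat.sub_add_cancel (h3 n hn)]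

theorem continuous_toL1 : Continuous toL1 := continuous_iff_continuousAt.2 fun w => by
  refine L1.continuousAt_of_tail (fun n => (continuous_apply n).continuousAt) fun ε hε => ?_
  obtain ⟨N, hN⟩ := exists_pow_lt (half_pos hε)
  refine ⟨Finset.range N, Eventually.of_forall fun w' t ht => ?_⟩
  calc ∑ n ∈ t, ‖toL1 w' n‖ ≤ ∑ n ∈ t, (2⁻¹ : ℝ) ^ n := Finset.sum_le_sum fun n _ => by
        rw [Real.norm_eq_abs, toL1_apply, abs_of_nonneg (w'.nonneg n)]; exact w'.le_pow n
    _ ≤ 2 * 2⁻¹ ^ N := sum_pow_le N t ht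
    _ ≤ ε := by linarith

theorem stableData : StableData (fun _ : FinCube => ()) toL1 (fun _ p => clamp p.2)
    (fun _ => clamp 0) where
  ind := (Function.LeftInverse.isEmbedding (f := fun p : Unit × L1 ℕ ℝ => clamp p.2)
    (fun w => clamp_toL1 w) (continuous_clamp.comp continuous_snd)
    (continuous_const.prodMk continuous_toL1)).isInducing
  inj := Function.LeftInverse.injective (g := fun p : Unit × L1 ℕ ℝ => clamp p.2)
    fun w => clamp_toL1 w
  cont _ := continuous_clamp.comp continuous_snd
  fib _ _ _ := rfl
  step _ _ _ := clamp_toL1 _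
  local_bound o := ⟨1, 0, 1, one_pos, zero_le_one, Eventually.of_forall fun o' _ _ x _ =>
    L1.norm_le_mul_norm fun n => by
      rw [L1.sub_apply, toL1_apply, toL1_apply, one_mul, Real.norm_eq_abs, Real.norm_eq_abs]
      change |max 0 (min ((toL1 o' + x) n) (2⁻¹ ^ n)) - o' n| ≤ _
      rw [L1.add_apply, toL1_apply]
      have h1 := o'.nonneg n
      have h2 := o'.le_pow n
      have h3 := abs_le.1 (le_refl |x n|)
      refine abs_le.2 ⟨?_, ?_⟩
      · have : o' n - |x n| ≤ min (o' n + x n) (2⁻¹ ^ n) :=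
          le_min (by linarith) (by linarith [abs_nonneg (x n)])
        linarith [le_max_right 0 (min (o' n + x n) (2⁻¹ ^ n))]
      · have : max 0 (min (o' n + x n) (2⁻¹ ^ n)) ≤ o' n + |x n| :=
          max_le (by linarith [abs_nonneg (x n)]) ((min_le_left _ _).trans (by linarith))
        linarith⟩
  sec _ := rfl
  sec_cont := continuous_const
  start _ := clamp_toL1 _

/-- The cube is a factor of the finitely supported absolutely summable sequences. -/
theorem prod_homeomorph : Nonempty (FinCube × L1 ℕ ℝ ≃ₜ L1 ℕ ℝ) := by
  let e : L1 ℕ (L1 ℕ ℝ) ≃ₜ L1 ℕ ℝ := L1.prodEquiv.trans (L1.congr Nat.pairEquiv)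
  exact ⟨((Homeomorph.refl _).prodCongr e.symm).trans <| stableData.homeo.symm.trans <|
    (Homeomorph.punitProd _).trans e⟩

end FinCube

/-- The signed square root. -/
noncomputable def signedSqrt (a : ℝ) : ℝ := √a - √(-a)

theorem signedSqrt_mul_abs (a : ℝ) : signedSqrt a * |signedSqrt a| = a := by
  unfold signedSqrt
  rcases le_total 0 a with h | h
  · rw [Real.sqrt_eq_zero_of_nonpos (by linarith : -a ≤ 0), sub_zero,
      abs_of_nonneg (Real.sqrt_nonneg _), Real.mul_self_sqrt h]
  · rw [Real.sqrt_eq_zero_of_nonpos h, zero_sub, abs_neg, abs_of_nonneg (Real.sqrt_nonneg _),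
      neg_mul, Real.mul_self_sqrt (by linarith), neg_neg]

theorem signedSqrt_of_mul_abs (b : ℝ) : signedSqrt (b * |b|) = b := by
  unfold signedSqrt
  rcases le_total 0 b with h | h
  · rw [abs_of_nonneg h, Real.sqrt_mul_self h,
      Real.sqrt_eq_zero_of_nonpos (by nlinarith), sub_zero]
  · rw [abs_of_nonpos h, Real.sqrt_eq_zero_of_nonpos (by nlinarith),
      show -(b * -b) = -b * -b by ring, Real.sqrt_mul_self (by linarith)]
    ring

theorem sq_signedSqrt_sub_le (a b : ℝ) : (signedSqrt a - signedSqrt b) ^ 2 ≤ 2 * |a - b| := by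
  have h1 := signedSqrt_mul_abs a
  have h2 := signedSqrt_mul_abs b
  generalize signedSqrt a = u at *
  generalize signedSqrt b = v at *
  rw [← h1, ← h2]
  rcases le_total 0 u with hu | hu <;> rcases le_total 0 v with hv | hv <;>
    simp only [abs_of_nonneg, abs_of_nonpos, hu, hv]
  · rcases le_total u v with h | h
    · rw [abs_of_nonpos (by nlinarith)]; nlinarith
    · rw [abs_of_nonneg (by nlinarith)]; nlinarith
  · rw [abs_of_nonneg (by nlinarith)]; nlinarith [sq_nonneg (u + v)]
  · rw [abs_of_nonpos (by nlinarith)]; nlinarith [sq_nonneg (u + v)]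
  · rcases le_total u v with h | h
    · rw [abs_of_nonpos (by nlinarith)]; nlinarith
    · rw [abs_of_nonneg (by nlinarith)]; nlinarith

theorem abs_mul_abs_sub_le (a b : ℝ) :
    abs (a * |a| - b * |b|) ≤ (a - b) ^ 2 + 2 * (|b| * |a - b|) := by
  have h : a * |a| - b * |b| = (a - b) * |a| + b * (|a| - |b|) := by ring
  have h1 : |a| ≤ |b| + |a - b| := by
    have := abs_add_le b (a - b); rwa [add_sub_cancel] at this
  have h2 : abs (|a| - |b|) ≤ |a - b| := abs_abs_sub_abs_le _ _
  rw [h]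
  refine (abs_add_le _ _).trans ?_
  rw [abs_mul, abs_mul, abs_abs, ← sq_abs (a - b)]
  nlinarith [abs_nonneg (a - b), abs_nonneg b]

namespace l2Fin

theorem norm_sq_eq_sum {ι : Type*} (f : lp (fun _ : ι => ℝ) 2) {s : Finset ι}
    (hs : ∀ i ∉ s, f i = 0) : ‖f‖ ^ 2 = ∑ i ∈ s, (f i) ^ 2 := by
  have h := lp.norm_rpow_eq_tsum (p := 2) (by norm_num) f
  simp only [ENNReal.toReal_ofNat, Real.rpow_ofNat, Real.norm_eq_abs, sq_abs] at h
  rw [h, tsum_eq_sum fun i hi => by rw [hs i hi]; simp]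

/-- A finitely supported family as an element of `l2Fin`. -/
noncomputable def mk {ι : Type*} (x : ι → ℝ) (h : (Function.support x).Finite) : l2Fin ι :=
  ⟨⟨x, memℓp_gen (summable_of_hasFiniteSupport (h.subset fun i hi h0 => hi (by
    simp [show x i = 0 from h0])))⟩, h⟩

/-- The Mazur homeomorphism. -/
noncomputable def mazur {ι : Type*} : L1 ι ℝ ≃ₜ l2Fin ι where
  toFun x := mk (fun i => signedSqrt (x i)) (x.finite_support.subset fun i hi h => hi (by
    simp [show x i = 0 from h, signedSqrt]))
  invFun y := L1.mk (fun i => y.1 i * |y.1 i|) (y.2.subset fun i hi h => hi (by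
    simp [show y.1 i = 0 from h]))
  left_inv x := L1.ext fun i => signedSqrt_mul_abs (x i)
  right_inv y := Subtype.ext (lp.ext (funext fun i => signedSqrt_of_mul_abs (y.1 i)))
  continuous_toFun := by
    classical
    refine continuous_induced_rng.2 (continuous_iff_continuousAt.2 fun x => ?_)
    rw [ContinuousAt, Metric.tendsto_nhds_nhds]
    intro ε hε
    refine ⟨ε ^ 2 / 2, by positivity, fun {x'} hx => ?_⟩
    rw [dist_eq_norm] at hx ⊢
    refine lt_of_pow_lt_pow_left₀ 2 hε.le ?_
    rw [norm_sq_eq_sum _ (s := x'.supp ∪ x.supp)]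
    · calc _ ≤ ∑ i ∈ x'.supp ∪ x.supp, 2 * ‖(x' - x) i‖ :=
            Finset.sum_le_sum fun i _ => sq_signedSqrt_sub_le _ _
        _ ≤ 2 * ‖x' - x‖ := by
            rw [← Finset.mul_sum]
            exact mul_le_mul_of_nonneg_left (L1.sum_norm_le _ _) two_pos.le
        _ < ε ^ 2 := by linarith
    · intro i hi
      rw [Finset.notMem_union] at hi
      change signedSqrt (x' i) - signedSqrt (x i) = 0
      rw [L1.notMem_supp.1 hi.1, L1.notMem_supp.1 hi.2, sub_self]
  continuous_invFun := by
    classical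
    refine continuous_iff_continuousAt.2 fun y => ?_
    have hcont : Continuous fun y' : l2Fin ι => ‖y'.1 - y.1‖ :=
      (continuous_subtype_val.sub continuous_const).norm
    refine tendsto_iff_norm_sub_tendsto_zero.2 (squeeze_zero (fun _ => norm_nonneg _)
      (g := fun y' => ‖y'.1 - y.1‖ ^ 2 + 2 * (‖y.1‖ * ‖y'.1 - y.1‖)) (fun y' => ?_) ?_)
    · obtain ⟨s, hs⟩ : ∃ s : Finset ι, ∀ i ∉ s, y'.1 i = 0 ∧ y.1 i = 0 :=
        ⟨y'.2.toFinset ∪ y.2.toFinset, fun i hi => by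
          simpa [Finset.notMem_union] using hi⟩
      have hn := norm_sq_eq_sum (y'.1 - y.1) (s := s) fun i hi => by
        change y'.1 i - y.1 i = 0
        rw [(hs i hi).1, (hs i hi).2, sub_self]
      have hn' := norm_sq_eq_sum y.1 (s := s) fun i hi => (hs i hi).2
      rw [L1.norm_eq_sum _ (s := s) fun i hi => by
        change y'.1 i * |y'.1 i| - y.1 i * |y.1 i| = 0
        rw [(hs i hi).1, (hs i hi).2, sub_self]]
      have hcs := Real.sum_mul_le_sqrt_mul_sqrt s (fun i => |y.1 i|) (fun i => |y'.1 i - y.1 i|)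
      simp only [sq_abs] at hcs
      have hn2 : ‖y'.1 - y.1‖ ^ 2 = ∑ i ∈ s, (y'.1 i - y.1 i) ^ 2 := hn
      rw [← hn', ← hn2, Real.sqrt_sq (norm_nonneg _), Real.sqrt_sq (norm_nonneg _)] at hcs
      calc _ ≤ ∑ i ∈ s, ((y'.1 i - y.1 i) ^ 2 + 2 * (|y.1 i| * |y'.1 i - y.1 i|)) :=
            Finset.sum_le_sum fun i _ => abs_mul_abs_sub_le _ _
        _ = ‖y'.1 - y.1‖ ^ 2 + 2 * ∑ i ∈ s, |y.1 i| * |y'.1 i - y.1 i| := by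
            rw [Finset.sum_add_distrib, ← Finset.mul_sum, hn2]
        _ ≤ _ := by linarith
    · have h : Continuous fun y' : l2Fin ι =>
          ‖y'.1 - y.1‖ ^ 2 + 2 * (‖y.1‖ * ‖y'.1 - y.1‖) := by fun_prop
      have h2 := h.tendsto y
      simpa using h2

end l2Fin

end CurtisNhu

namespace CurtisNhu

theorem SFD.secondCountable {Y : Type*} [MetricSpace Y] (h : SFD Y) :
    SecondCountableTopology Y := by
  obtain ⟨K, hK, hU⟩ := h
  have : SigmaCompactSpace Y := ⟨⟨K, fun n => (hK n).1, hU⟩⟩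
  exact inferInstance

theorem exists_pos_le_dist {ι Y : Type*} [Finite ι] [MetricSpace Y] {y : ι → Y}
    (hy : Function.Injective y) : ∃ ρ > 0, ∀ k l, k ≠ l → ρ ≤ dist (y k) (y l) := by
  rcases ({p : ι × ι | p.1 ≠ p.2}).eq_empty_or_nonempty with h0 | h0
  · exact ⟨1, one_pos, fun k l hkl => absurd (show (k, l) ∈ {p : ι × ι | p.1 ≠ p.2} from hkl)
      (by rw [h0]; exact notMem_empty _)⟩
  · obtain ⟨p, hp, hmin⟩ := exists_min_image _ (fun p : ι × ι => dist (y p.1) (y p.2))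
      (Set.toFinite {p : ι × ι | p.1 ≠ p.2}) h0
    exact ⟨dist (y p.1) (y p.2), dist_pos.2 fun h => hp (hy h), fun k l hkl => hmin (k, l) hkl⟩

/-- Countably many families of disjoint closed sets separate the points of every `n`-point
configuration. -/
theorem exists_configurations (Y : Type*) [MetricSpace Y] [SecondCountableTopology Y] (n : ℕ) :
    ∃ (ι : Type) (_ : Countable ι) (C : ι → Fin n → Set Y), (∀ i k, IsClosed (C i k)) ∧
      (∀ i k l, k ≠ l → Disjoint (C i k) (C i l)) ∧
      ∀ y : Fin n → Y, Function.Injective y → ∃ i, ∀ k, y k ∈ C i k := by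
  rcases isEmpty_or_nonempty Y with hY | hY
  · refine ⟨Unit, inferInstance, fun _ _ => ∅, fun _ _ => isClosed_empty,
      fun _ _ _ _ => disjoint_bot_left, fun y _ => ⟨(), fun k => (hY.false (y k)).elim⟩⟩
  · refine ⟨{p : (Fin n → ℕ) × ℕ // ∀ k l, k ≠ l → Disjoint
      (closedBall (denseSeq Y (p.1 k)) (1 / (p.2 + 1)))
      (closedBall (denseSeq Y (p.1 l)) (1 / (p.2 + 1)))}, inferInstance,
      fun p k => closedBall (denseSeq Y (p.1.1 k)) (1 / (p.1.2 + 1)),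
      fun _ _ => isClosed_closedBall, fun p => p.2, fun y hy => ?_⟩
    obtain ⟨ρ, hρ, hd⟩ := exists_pos_le_dist hy
    obtain ⟨m, hm⟩ := exists_nat_one_div_lt (show 0 < ρ / 4 by linarith)
    have hex : ∀ k, ∃ j, dist (y k) (denseSeq Y j) < 1 / (m + 1) := fun k => by
      obtain ⟨_, h1, j, rfl⟩ := (Metric.dense_iff.1 (denseRange_denseSeq Y)) (y k)
        (1 / (m + 1)) (by positivity)
      exact ⟨j, by rwa [dist_comm]⟩
    choose j hj using hex
    refine ⟨⟨(j, m), fun k l hkl => Set.disjoint_left.2 fun z hz hz' => ?_⟩, fun k => (hj k).le⟩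
    have h1 := hd k l hkl
    have h2 := mem_closedBall.1 hz
    have h3 := mem_closedBall.1 hz'
    have h4 := hj k
    have h5 := hj l
    have h6 := dist_triangle4 (y k) (denseSeq Y (j k)) (denseSeq Y (j l)) (y l)
    have h7 := dist_triangle_left (denseSeq Y (j k)) (denseSeq Y (j l)) z
    rw [dist_comm (denseSeq Y (j l)) (y l)] at h6
    simp only at h2 h3
    linarith

section Hat

variable {Y : Type*} [MetricSpace Y]

/-- The hat function of a point. -/
noncomputable def hat (y : Y) : BoundedContinuousFunction (Y × ℝ) ℝ :=
  BoundedContinuousFunction.ofNormedAddCommGroup (fun q => max 0 (min 1 q.2 - dist y q.1))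
    (by fun_prop) 1 fun q => by
      rw [Real.norm_eq_abs, abs_of_nonneg (le_max_left _ _)]
      exact max_le zero_le_one (by linarith [min_le_left 1 q.2, dist_nonneg (x := y) (y := q.1)])

theorem hat_apply (y : Y) (q : Y × ℝ) : hat y q = max 0 (min 1 q.2 - dist y q.1) := rfl

theorem hat_self {y : Y} {r : ℝ} (h0 : 0 ≤ r) (h1 : r ≤ 1) : hat y (y, r) = r := by
  rw [hat_apply, dist_self, sub_zero, min_eq_right h1, max_eq_right h0]

theorem hat_far {y z : Y} {r : ℝ} (h : r ≤ dist y z) : hat y (z, r) = 0 := by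
  rw [hat_apply]
  exact max_eq_left (by linarith [min_le_right 1 r])

theorem isometry_hat (hd : ∀ a b : Y, dist a b ≤ 1) : Isometry (hat (Y := Y)) := by
  refine Isometry.of_dist_eq fun y y' => le_antisymm ?_ ?_
  · refine (BoundedContinuousFunction.dist_le dist_nonneg).2 fun q => ?_
    rw [Real.dist_eq, hat_apply, hat_apply]
    have h1 := abs_max_sub_max_le_max 0 (min 1 q.2 - dist y q.1) 0 (min 1 q.2 - dist y' q.1)
    rw [sub_self, abs_zero] at h1
    refine h1.trans (max_le dist_nonneg ?_)
    rw [show min 1 q.2 - dist y q.1 - (min 1 q.2 - dist y' q.1) =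
      dist y' q.1 - dist y q.1 by ring, dist_comm y y']
    exact abs_dist_sub_le _ _ _
  · have h := (hat y).dist_coe_le_dist (g := hat y') (y, dist y y')
    rwa [hat_self dist_nonneg (hd _ _), hat_far (dist_comm _ _).le, Real.dist_eq, sub_zero,
      abs_of_nonneg dist_nonneg] at h

theorem linearCombination_hat_apply {n : ℕ} {y : Fin n → Y} {r : ℝ} (h0 : 0 ≤ r) (h1 : r ≤ 1)
    (hr : ∀ k l, k ≠ l → r ≤ dist (y k) (y l)) (a : Fin n → ℝ) (k : Fin n) :
    (∑ l, a l • hat (y l)) (y k, r) = a k * r := by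
  rw [BoundedContinuousFunction.sum_apply, Finset.sum_eq_single k]
  · simp [hat_self h0 h1]
  · intro l _ hl
    simp [hat_far (hr l k hl)]
  · simp

theorem linearIndependent_hat : LinearIndependent ℝ (hat (Y := Y)) := by
  rw [linearIndependent_iff_finset_linearIndependent]
  intro s
  let e := s.equivFin
  rw [← linearIndependent_equiv e.symm, Fintype.linearIndependent_iff]
  intro a ha k
  obtain ⟨ρ, hρ, hd⟩ := exists_pos_le_dist
    (Subtype.val_injective.comp e.symm.injective : Function.Injective fun k => (e.symm k : Y))
  have h := linearCombination_hat_apply (r := min ρ 1) (y := fun k => (e.symm k : Y))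
    (by positivity) (min_le_right _ _) (fun k l hkl => (min_le_left _ _).trans (hd k l hkl)) a k
  simp only [Function.comp_apply] at ha
  rw [ha] at h
  have h2 : (0 : ℝ) < min ρ 1 := lt_min hρ one_pos
  rcases mul_eq_zero.1 h.symm with h3 | h3
  · exact h3
  · exact absurd h3 h2.ne'

variable (Y) in
/-- The span of the hat functions. -/
def HatSpan : Type _ :=
  ↥(Submodule.span ℝ (range (hat (Y := Y))))

noncomputable instance : NormedAddCommGroup (HatSpan Y) :=
  inferInstanceAs (NormedAddCommGroup ↥(Submodule.span ℝ (range (hat (Y := Y)))))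

noncomputable instance : NormedSpace ℝ (HatSpan Y) :=
  inferInstanceAs (NormedSpace ℝ ↥(Submodule.span ℝ (range (hat (Y := Y)))))

/-- The hat function of a point as an element of the span. -/
noncomputable def toHatSpan (y : Y) : HatSpan Y := ⟨hat y, Submodule.subset_span ⟨y, rfl⟩⟩

theorem isometry_toHatSpan (hd : ∀ a b : Y, dist a b ≤ 1) : Isometry (toHatSpan (Y := Y)) :=
  isometry_hat hd

theorem val_sum_toHatSpan {n : ℕ} (y : Fin n → Y) (a : Fin n → ℝ) :
    (∑ k, a k • toHatSpan (y k) : HatSpan Y).1 = ∑ k, a k • hat (y k) :=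
  (map_sum (Submodule.span ℝ (range (hat (Y := Y)))).subtype
    (fun k => a k • (⟨hat (y k), Submodule.subset_span ⟨y k, rfl⟩⟩ :
      Submodule.span ℝ (range (hat (Y := Y))))) Finset.univ :)

theorem exists_eq_sum (v : HatSpan Y) : ∃ (n : ℕ) (y : Fin n → Y) (a : Fin n → ℝ),
    Function.Injective y ∧ (∀ k, a k ≠ 0) ∧ v = ∑ k, a k • toHatSpan (y k) := by
  obtain ⟨f, hf⟩ := (Finsupp.mem_span_range_iff_exists_finsupp (R := ℝ)).1 v.2
  let e := f.support.equivFin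
  refine ⟨_, fun k => (e.symm k : Y), fun k => f (e.symm k),
    Subtype.val_injective.comp e.symm.injective,
    fun k => Finsupp.mem_support_iff.1 (e.symm k).2, Subtype.ext ?_⟩
  rw [← hf, Finsupp.sum, ← Finset.sum_coe_sort, ← e.symm.sum_comp, val_sum_toHatSpan]

theorem isClosed_range_toHatSpan (hd : ∀ a b : Y, dist a b ≤ 1) :
    IsClosed (range (toHatSpan (Y := Y))) := by
  refine isClosed_of_closure_subset fun v hv => ?_
  obtain ⟨n, y, a, hy, ha, rfl⟩ := exists_eq_sum v
  set v : HatSpan Y := ∑ k, a k • toHatSpan (y k) with hv_def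
  by_contra hne
  obtain ⟨ρ, hρ, hρd⟩ := exists_pos_le_dist hy
  have hpos : ∀ k, 0 < dist v (toHatSpan (y k)) ∧ 0 < |a k| := fun k =>
    ⟨dist_pos.2 fun h => hne ⟨y k, h.symm⟩, abs_pos.2 (ha k)⟩
  obtain ⟨c, hc, hcd⟩ : ∃ c > 0, ∀ k, c ≤ dist v (toHatSpan (y k)) ∧ c ≤ |a k| := by
    rcases isEmpty_or_nonempty (Fin n) with h | h
    · exact ⟨1, one_pos, fun k => (h.false k).elim⟩
    · obtain ⟨k, hk⟩ := Finite.exists_min fun k => min (dist v (toHatSpan (y k))) |a k|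
      exact ⟨_, lt_min (hpos k).1 (hpos k).2, fun l => le_min_iff.1 (hk l)⟩
  set r := min (min ρ 1) (c / 2) with hr
  have hr0 : 0 < r := by positivity
  have hr1 : r ≤ 1 := (min_le_left _ _).trans (min_le_right _ _)
  have hr2 : r ≤ c / 2 := min_le_right _ _
  have hη : 0 < min (min (c * r) (c / 2)) 1 := by positivity
  obtain ⟨_, ⟨z, rfl⟩, hz⟩ := Metric.mem_closure_iff.1 hv _ hη
  have hz1 := hz.trans_le ((min_le_left _ _).trans (min_le_left _ _))
  have hz2 := hz.trans_le ((min_le_left _ _).trans (min_le_right _ _))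
  have hz3 := hz.trans_le (min_le_right _ _)
  have heval : ∀ q, dist (v.1 q) (hat z q) ≤ dist v (toHatSpan z) := fun q =>
    v.1.dist_coe_le_dist (g := hat z) q
  have hvc : v.1 = ∑ k, a k • hat (y k) := val_sum_toHatSpan y a
  rcases isEmpty_or_nonempty (Fin n) with h | ⟨⟨k⟩⟩
  · have h1 := heval (z, 1)
    rw [hvc, hat_self zero_le_one le_rfl] at h1
    simp at h1
    linarith
  · have h1 := heval (y k, r)
    have h2 : r ≤ dist z (y k) := by
      rw [← (isometry_toHatSpan hd).dist_eq]
      have := dist_triangle v (toHatSpan z) (toHatSpan (y k))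
      linarith [(hcd k).1]
    rw [hvc, linearCombination_hat_apply hr0.le hr1 (fun k l hkl => (min_le_left _ _).trans
      ((min_le_left _ _).trans (hρd k l hkl))), hat_far h2, Real.dist_eq, sub_zero, abs_mul,
      abs_of_pos hr0] at h1
    nlinarith [(hcd k).2]

theorem SFD.hatSpan (hY : SFD Y) (hd : ∀ a b : Y, dist a b ≤ 1) : SFD (HatSpan Y) := by
  have := hY.secondCountable
  choose ι hι C hCc hCd hC using exists_configurations Y
  have hclosed : ∀ n (i : ι n) (m : ℕ), IsClosed {p : (Fin n → Y) × (Fin n → ℝ) |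
      ∀ k, p.1 k ∈ C n i k ∧ 1 / ((m : ℝ) + 1) ≤ |p.2 k|} := fun n i m => by
    simp only [ofPred_forall, ofPred_and]
    exact isClosed_iInter fun k => ((hCc n i k).preimage (by fun_prop)).inter
      (isClosed_le continuous_const (by fun_prop))
  refine SFD.of_images (ι := Σ n, ι n × ℕ) (fun p => ((SFD.pi (ι := Fin p.1) hY).prod
    (SFD.pi (ι := Fin p.1) sfd_real)).subtype (hclosed p.1 p.2.1 p.2.2))
    (fun p q => ∑ k, q.1.2 k • toHatSpan (q.1.1 k)) (fun p => ?_) (fun p q q' hqq => ?_)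
    fun v => ?_
  · have := (isometry_toHatSpan hd).continuous
    refine continuous_finsetSum _ fun k _ => ?_
    have h1 : Continuous fun q : {q : (Fin p.1 → Y) × (Fin p.1 → ℝ) |
      ∀ k, q.1 k ∈ C p.1 p.2.1 k ∧ 1 / ((p.2.2 : ℝ) + 1) ≤ |q.2 k|} => q.1.1 k := by fun_prop
    have h2 : Continuous fun q : {q : (Fin p.1 → Y) × (Fin p.1 → ℝ) |
      ∀ k, q.1 k ∈ C p.1 p.2.1 k ∧ 1 / ((p.2.2 : ℝ) + 1) ≤ |q.2 k|} => q.1.2 k := by fun_prop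
    exact h2.smul (this.comp h1)
  · obtain ⟨n, i, m⟩ := p
    obtain ⟨⟨y, a⟩, hq⟩ := q
    obtain ⟨⟨z, b⟩, hq'⟩ := q'
    simp only [mem_ofPred_eq] at hq hq'
    have hsame : ∀ k l w, w ∈ C n i k → w ∈ C n i l → k = l := fun k l w h1 h2 => by
      by_contra h
      exact Set.disjoint_left.1 (hCd n i k l h) h1 h2
    have hsum : Finsupp.linearCombination ℝ hat (∑ k, Finsupp.single (y k) (a k)) =
        Finsupp.linearCombination ℝ hat (∑ k, Finsupp.single (z k) (b k)) := by
      have h1 := congrArg Subtype.val hqq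
      rw [val_sum_toHatSpan, val_sum_toHatSpan] at h1
      simpa [map_sum] using h1
    have hfs := linearIndependent_hat hsum
    have hpos : ∀ k, a k ≠ 0 := fun k h => by
      have h1 := (hq k).2
      rw [h, abs_zero] at h1
      exact absurd h1 (not_le.2 (by positivity))
    have key : ∀ k, z k = y k ∧ a k = b k := fun k => by
      have h1 := DFunLike.congr_fun hfs (y k)
      rw [Finsupp.finset_sum_apply, Finsupp.finset_sum_apply,
        Finset.sum_eq_single k, Finset.sum_eq_single k] at h1
      · rw [Finsupp.single_eq_same] at h1
        by_cases h : z k = y k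
        · rw [h, Finsupp.single_eq_same] at h1
          exact ⟨h, h1⟩
        · rw [Finsupp.single_eq_of_ne (Ne.symm h)] at h1
          exact absurd h1 (hpos k)
      · intro l _ hl
        refine Finsupp.single_eq_of_ne fun h => hl ?_
        exact hsame l k (z l) (hq' l).1 (h ▸ (hq k).1)
      · simp
      · intro l _ hl
        refine Finsupp.single_eq_of_ne fun h => hl ?_
        exact hsame l k (y l) (hq l).1 (h ▸ (hq k).1)
      · simp
    exact Subtype.ext (Prod.ext (funext fun k => (key k).1.symm) (funext fun k => (key k).2))
  · obtain ⟨n, y, a, hy, ha, rfl⟩ := exists_eq_sum v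
    obtain ⟨i, hi⟩ := hC n y hy
    obtain ⟨m, hm⟩ : ∃ m : ℕ, ∀ k, 1 / ((m : ℝ) + 1) ≤ |a k| := by
      rcases isEmpty_or_nonempty (Fin n) with h | h
      · exact ⟨0, fun k => (h.false k).elim⟩
      · obtain ⟨k, hk⟩ := Finite.exists_min fun k => |a k|
        obtain ⟨m, hm⟩ := exists_nat_one_div_lt (abs_pos.2 (ha k))
        exact ⟨m, fun l => hm.le.trans (hk l)⟩
    exact ⟨⟨n, i, m⟩, ⟨(y, a), fun k => ⟨hi k, hm k⟩⟩, rfl⟩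

end Hat

/-- A bounded good space is homeomorphic to the space of finitely supported sequences. -/
theorem GoodSpace.homeomorph_l2Fin {Y : Type*} [MetricSpace Y] [SemilatticeSup Y] [SupMetric Y]
    (hY : GoodSpace Y) (hd : ∀ a b : Y, dist a b ≤ 1) : Nonempty (Y ≃ₜ l2Fin ℕ) := by
  have hVY := hY.sfd.hatSpan hd
  have hVZ := FinCube.sfd.hatSpan FinCube.dist_le_one
  have hV : SFD ((HatSpan Y × HatSpan FinCube) × ℝ) := (hVY.prod hVZ).prod sfd_real
  have hi₁ : Isometry fun y : Y => ((toHatSpan y, (0 : HatSpan FinCube)), (0 : ℝ)) :=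
    Isometry.of_dist_eq fun a b => by
      simp [Prod.dist_eq, (isometry_toHatSpan hd).dist_eq]
  have hi₂ : Isometry fun z : FinCube => (((0 : HatSpan Y), toHatSpan z), (0 : ℝ)) :=
    Isometry.of_dist_eq fun a b => by
      simp [Prod.dist_eq, (isometry_toHatSpan FinCube.dist_le_one).dist_eq]
  have hc₁ : IsClosed (range fun y : Y => ((toHatSpan y, (0 : HatSpan FinCube)), (0 : ℝ))) := by
    convert ((isClosed_range_toHatSpan hd).prod
      (isClosed_singleton (x := (0 : HatSpan FinCube)))).prod (isClosed_singleton (x := (0 : ℝ)))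
    ext ⟨⟨a, b⟩, c⟩
    simp [Prod.ext_iff, eq_comm, and_assoc]
  have hc₂ : IsClosed (range fun z : FinCube => (((0 : HatSpan Y), toHatSpan z), (0 : ℝ))) := by
    convert ((isClosed_singleton (x := (0 : HatSpan Y))).prod
      (isClosed_range_toHatSpan FinCube.dist_le_one)).prod (isClosed_singleton (x := (0 : ℝ)))
    ext ⟨⟨a, b⟩, c⟩
    simp only [mem_range, Prod.ext_iff, mem_prod, mem_singleton_iff]
    exact ⟨fun ⟨z, ⟨h1, h2⟩, h3⟩ => ⟨⟨h1.symm, z, h2⟩, h3.symm⟩,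
      fun ⟨⟨h1, z, h2⟩, h3⟩ => ⟨z, ⟨h1.symm, h2⟩, h3.symm⟩⟩
  obtain ⟨e₁⟩ := hY.homeomorph_FS hd hi₁ hc₁ hV
  obtain ⟨e₂⟩ := FinCube.goodSpace.homeomorph_FS FinCube.dist_le_one hi₂ hc₂ hV
  obtain ⟨e₃⟩ := L1.prod_real_absorb (V := HatSpan Y × HatSpan FinCube)
  obtain ⟨e₄⟩ := FinCube.prod_homeomorph
  let E := L1 ℕ ((HatSpan Y × HatSpan FinCube) × ℝ)
  let e₅ : FS E × L1 ℕ ℝ ≃ₜ FS E :=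
    (FS.uncons.prodCongr (Homeomorph.refl _)).trans <| (prodSwapRight _ _ _).trans <|
      (e₃.prodCongr (Homeomorph.refl _)).trans FS.uncons.symm
  exact ⟨e₁.trans <| e₅.symm.trans <| (e₂.symm.prodCongr (Homeomorph.refl _)).trans <|
    e₄.trans l2Fin.mazur⟩

end CurtisNhu

namespace CurtisNhu

/-- Points at distance less than `r` are joined by a path of diameter at most `r`. -/
def PathMetric (X : Type*) [MetricSpace X] : Prop :=
  ∀ (x y : X) (r : ℝ), dist x y < r → ∃ γ : ℝ → X, Continuous γ ∧ γ 0 = x ∧ γ 1 = y ∧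
    ∀ s t, dist (γ s) (γ t) < r

section PathDist

variable {X : Type*} [MetricSpace X]

/-- The spreads of the paths joining two points. -/
def spreads (x y : X) : Set ℝ :=
  {r | 0 ≤ r ∧ ∃ γ : Path x y, ∀ s t, min 1 (dist (γ s) (γ t)) ≤ r}

theorem bddBelow_spreads (x y : X) : BddBelow (spreads x y) := ⟨0, fun _ h => h.1⟩

theorem one_mem_spreads [PathConnectedSpace X] (x y : X) : (1 : ℝ) ∈ spreads x y :=
  ⟨zero_le_one, (PathConnectedSpace.joined x y).somePath, fun _ _ => min_le_left _ _⟩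

variable (X) in
/-- A type synonym for a path-connected metric space, carrying the bounded path metric. -/
def PathDist : Type _ := X

/-- The identity map onto the synonym. -/
def toPathDist : X ≃ PathDist X := Equiv.refl X

noncomputable instance [PathConnectedSpace X] : MetricSpace (PathDist X) where
  dist x y := sInf (spreads (toPathDist.symm x) (toPathDist.symm y))
  dist_self x := le_antisymm (csInf_le (bddBelow_spreads _ _) ⟨le_rfl, Path.refl _, by simp⟩)
    (le_csInf ⟨1, one_mem_spreads _ _⟩ fun _ h => h.1)
  dist_comm x y := by
    congr 1
    ext r
    exact ⟨fun ⟨h, γ, hγ⟩ => ⟨h, γ.symm, fun s t => hγ _ _⟩,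
      fun ⟨h, γ, hγ⟩ => ⟨h, γ.symm, fun s t => hγ _ _⟩⟩
  dist_triangle x y z := by
    refine le_of_forall_pos_lt_add fun ε hε => ?_
    obtain ⟨r, ⟨hr, γ, hγ⟩, h1⟩ := exists_lt_of_csInf_lt ⟨1, one_mem_spreads _ _⟩
      (lt_add_of_pos_right (sInf (spreads (toPathDist.symm x) (toPathDist.symm y))) (half_pos hε))
    obtain ⟨r', ⟨hr', γ', hγ'⟩, h2⟩ := exists_lt_of_csInf_lt ⟨1, one_mem_spreads _ _⟩
      (lt_add_of_pos_right (sInf (spreads (toPathDist.symm y) (toPathDist.symm z))) (half_pos hε))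
    refine lt_of_le_of_lt (csInf_le (bddBelow_spreads _ _)
      (show r + r' ∈ _ from ⟨by positivity, γ.trans γ', fun s t => ?_⟩)) (by linarith)
    have hmem : ∀ s, (γ.trans γ') s ∈ range γ ∪ range γ' := fun s => by
      rw [← Path.trans_range]; exact mem_range_self s
    have mix : ∀ u v, min 1 (dist (γ u) (γ' v)) ≤ r + r' := fun u v => by
      have h3 := hγ u 1
      have h4 := hγ' 0 v
      have h5 := dist_triangle (γ u) (γ 1) (γ' v)
      rw [γ.target] at h3 h5
      rw [γ'.source] at h4
      rw [min_le_iff] at *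
      rcases h3 with h3 | h3
      · left; linarith
      rcases h4 with h4 | h4
      · left; linarith
      · right; linarith
    rcases hmem s with ⟨u, hu⟩ | ⟨u, hu⟩ <;> rcases hmem t with ⟨v, hv⟩ | ⟨v, hv⟩ <;>
      rw [← hu, ← hv]
    · linarith [hγ u v]
    · exact mix u v
    · rw [dist_comm]; exact mix v u
    · linarith [hγ' u v]
  eq_of_dist_eq_zero {x y} h := by
    by_contra hne
    have hpos : 0 < min 1 (dist (toPathDist.symm x) (toPathDist.symm y)) :=
      lt_min one_pos (dist_pos.2 hne)
    obtain ⟨r, ⟨_, γ, hγ⟩, h1⟩ := exists_lt_of_csInf_lt ⟨1, one_mem_spreads _ _⟩ (h.trans_lt hpos)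
    have := hγ 0 1
    rw [γ.source, γ.target] at this
    linarith

variable [PathConnectedSpace X]

theorem PathDist.dist_le_one (x y : PathDist X) : dist x y ≤ 1 :=
  csInf_le (bddBelow_spreads _ _) (one_mem_spreads _ _)

theorem PathDist.exists_path_of_dist_lt {x y : PathDist X} {r : ℝ} (h : dist x y < r) :
    ∃ r' < r, 0 ≤ r' ∧ ∃ γ : Path (toPathDist.symm x) (toPathDist.symm y),
      ∀ s t, min 1 (dist (γ s) (γ t)) ≤ r' := by
  obtain ⟨r', ⟨h1, γ, hγ⟩, h2⟩ := exists_lt_of_csInf_lt ⟨1, one_mem_spreads _ _⟩ h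
  exact ⟨r', h2, h1, γ, hγ⟩

/-- The path metric is compatible with the topology of a locally path-connected space. -/
def PathDist.homeomorph [LocallyPathConnectedSpace X] : X ≃ₜ PathDist X where
  toEquiv := toPathDist
  continuous_toFun := by
    refine continuous_iff_continuousAt.2 fun x => Metric.tendsto_nhds.2 fun ε hε => ?_
    obtain ⟨U, ⟨hU, hUp⟩, hUb⟩ := (path_connected_basis x).mem_iff.1
      (ball_mem_nhds x (show 0 < ε / 4 by positivity))
    filter_upwards [hU] with y hy
    obtain ⟨γ, hγ⟩ := hUp.joinedIn y hy x (mem_of_mem_nhds hU)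
    refine lt_of_le_of_lt (csInf_le (bddBelow_spreads _ _)
      (show ε / 2 ∈ _ from ⟨by positivity, γ, fun s t => ?_⟩)) (by linarith)
    have h1 := mem_ball.1 (hUb (hγ s))
    have h2 := mem_ball.1 (hUb (hγ t))
    have h3 := dist_triangle_right (γ s) (γ t) x
    have h4 : dist (γ s) (γ t) ≤ ε / 2 := by linarith
    exact (min_le_right _ _).trans h4
  continuous_invFun := by
    refine continuous_iff_continuousAt.2 fun x => Metric.tendsto_nhds.2 fun ε hε => ?_
    filter_upwards [ball_mem_nhds x (lt_min one_pos hε)] with y hy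
    obtain ⟨r, h1, h0, γ, hγ⟩ := PathDist.exists_path_of_dist_lt (mem_ball.1 hy)
    have h2 := hγ 0 1
    rw [γ.source, γ.target, min_le_iff] at h2
    rw [lt_min_iff] at h1
    rcases h2 with h2 | h2
    · linarith
    · exact h2.trans_lt h1.2

theorem PathDist.pathMetric [LocallyPathConnectedSpace X] : PathMetric (PathDist X) := by
  intro x y r h
  obtain ⟨r', h1, h0, γ, hγ⟩ := PathDist.exists_path_of_dist_lt h
  refine ⟨fun t => toPathDist (γ.extend t), PathDist.homeomorph.continuous.comp
    γ.continuous_extend, by simp, by simp, fun s t => ?_⟩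
  refine lt_of_le_of_lt (csInf_le (bddBelow_spreads _ _) ⟨h0, γ.subpath
    (projIcc 0 1 zero_le_one s) (projIcc 0 1 zero_le_one t), fun u v => hγ _ _⟩) h1

end PathDist

end CurtisNhu

namespace FinHyp

open CurtisNhu

variable {X : Type*} [MetricSpace X]

theorem toSet_finite (A : FinHyp X) : A.toSet.Finite := A.2

theorem toSet_nonempty (A : FinHyp X) : A.toSet.Nonempty := A.1.nonempty

theorem ext {A B : FinHyp X} (h : A.toSet = B.toSet) : A = B :=
  Subtype.ext (SetLike.coe_injective h)

/-- The member of the hyperspace with given underlying set. -/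
def ofSet (s : Set X) (hs : s.Finite) (hn : s.Nonempty) : FinHyp X :=
  ⟨⟨⟨s, hs.isCompact⟩, hn⟩, hs⟩

@[simp]
theorem toSet_ofSet (s : Set X) (hs : s.Finite) (hn : s.Nonempty) : (ofSet s hs hn).toSet = s := rfl

instance : SemilatticeSup (FinHyp X) where
  le A B := A.toSet ⊆ B.toSet
  le_refl _ := Subset.rfl
  le_trans _ _ _ h h' := h.trans h'
  le_antisymm _ _ h h' := ext (h.antisymm h')
  sup A B := ofSet (A.toSet ∪ B.toSet) (A.toSet_finite.union B.toSet_finite) A.toSet_nonempty.inl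
  le_sup_left _ _ := subset_union_left
  le_sup_right _ _ := subset_union_right
  sup_le _ _ _ h h' := union_subset h h'

@[simp]
theorem toSet_sup (A B : FinHyp X) : (A ⊔ B).toSet = A.toSet ∪ B.toSet := rfl

/-- Singletons. -/
def pt (x : X) : FinHyp X := ofSet {x} (finite_singleton x) (singleton_nonempty x)

@[simp]
theorem toSet_pt (x : X) : (pt x).toSet = {x} := rfl

theorem toSet_sup' {ι : Type*} {s : Finset ι} (hs : s.Nonempty) (f : ι → FinHyp X) :
    (s.sup' hs f).toSet = ⋃ i ∈ s, (f i).toSet := by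
  induction hs using Finset.Nonempty.cons_induction with
  | singleton a => simp
  | cons a s h hs ih => rw [Finset.sup'_cons hs, toSet_sup, ih]; simp

theorem mem_sup' {ι : Type*} {s : Finset ι} {hs : s.Nonempty} {f : ι → FinHyp X} {x : X} :
    x ∈ (s.sup' hs f).toSet ↔ ∃ i ∈ s, x ∈ (f i).toSet := by
  rw [toSet_sup']; simp

theorem dist_eq (A B : FinHyp X) : dist A B = hausdorffDist A.toSet B.toSet := rfl

theorem hausdorffEDist_ne_top (A B : FinHyp X) : hausdorffEDist A.toSet B.toSet ≠ ⊤ :=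
  hausdorffEDist_ne_top_of_nonempty_of_bounded A.toSet_nonempty B.toSet_nonempty
    A.toSet_finite.isBounded B.toSet_finite.isBounded

theorem dist_le_iff {A B : FinHyp X} {r : ℝ} (hr : 0 ≤ r) : dist A B ≤ r ↔
    (∀ a ∈ A.toSet, ∃ b ∈ B.toSet, dist a b ≤ r) ∧ ∀ b ∈ B.toSet, ∃ a ∈ A.toSet, dist a b ≤ r := by
  refine ⟨fun h => ⟨fun a ha => ?_, fun b hb => ?_⟩, fun h => hausdorffDist_le_of_mem_dist hr h.1
    fun b hb => ?_⟩
  · obtain ⟨b, hb, hmin⟩ := exists_min_image _ (dist a) B.toSet_finite B.toSet_nonempty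
    refine ⟨b, hb, le_of_forall_pos_lt_add fun ε hε => ?_⟩
    obtain ⟨c, hc, hac⟩ := exists_dist_lt_of_hausdorffDist_lt ha (lt_of_le_of_lt h
      (lt_add_of_pos_right r hε)) (hausdorffEDist_ne_top A B)
    exact (hmin c hc).trans_lt hac
  · obtain ⟨a, ha, hmin⟩ := exists_min_image _ (fun a => dist a b) A.toSet_finite A.toSet_nonempty
    refine ⟨a, ha, le_of_forall_pos_lt_add fun ε hε => ?_⟩
    obtain ⟨c, hc, hac⟩ := exists_dist_lt_of_hausdorffDist_lt' hb (lt_of_le_of_lt h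
      (lt_add_of_pos_right r hε)) (hausdorffEDist_ne_top A B)
    exact (hmin c hc).trans_lt hac
  · obtain ⟨a, ha, hab⟩ := h.2 b hb
    exact ⟨a, ha, by rwa [dist_comm]⟩

theorem dist_lt_iff {A B : FinHyp X} {r : ℝ} (hr : 0 < r) : dist A B < r ↔
    (∀ a ∈ A.toSet, ∃ b ∈ B.toSet, dist a b < r) ∧ ∀ b ∈ B.toSet, ∃ a ∈ A.toSet, dist a b < r := by
  refine ⟨fun h => ?_, fun h => ?_⟩
  · obtain ⟨h1, h2⟩ := (dist_le_iff dist_nonneg).1 (le_refl (dist A B))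
    exact ⟨fun a ha => (h1 a ha).imp fun b hb => ⟨hb.1, hb.2.trans_lt h⟩,
      fun b hb => (h2 b hb).imp fun a ha => ⟨ha.1, ha.2.trans_lt h⟩⟩
  · choose! f hf hf' using h.1
    choose! g hg hg' using h.2
    obtain ⟨a, ha, hmax⟩ := exists_max_image _ (fun a => dist a (f a)) A.toSet_finite
      A.toSet_nonempty
    obtain ⟨b, hb, hmax'⟩ := exists_max_image _ (fun b => dist (g b) b) B.toSet_finite
      B.toSet_nonempty
    refine lt_of_le_of_lt ((dist_le_iff (le_max_of_le_left dist_nonneg)).2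
      ⟨fun x hx => ⟨f x, hf x hx, le_max_of_le_left (hmax x hx)⟩,
        fun x hx => ⟨g x, hg x hx, le_max_of_le_right (hmax' x hx)⟩⟩) (max_lt (hf' a ha) (hg' b hb))

instance : SupMetric (FinHyp X) where
  dist_sup_le A B C D := by
    obtain ⟨h1, h2⟩ := (dist_le_iff dist_nonneg).1 (le_refl (dist A C))
    obtain ⟨h3, h4⟩ := (dist_le_iff dist_nonneg).1 (le_refl (dist B D))
    refine (dist_le_iff (le_max_of_le_left dist_nonneg)).2 ⟨?_, ?_⟩
    · rintro x (hx | hx)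
      · obtain ⟨y, hy, h⟩ := h1 x hx
        exact ⟨y, Or.inl hy, le_max_of_le_left h⟩
      · obtain ⟨y, hy, h⟩ := h3 x hx
        exact ⟨y, Or.inr hy, le_max_of_le_right h⟩
    · rintro x (hx | hx)
      · obtain ⟨y, hy, h⟩ := h2 x hx
        exact ⟨y, Or.inl hy, le_max_of_le_left h⟩
      · obtain ⟨y, hy, h⟩ := h4 x hx
        exact ⟨y, Or.inr hy, le_max_of_le_right h⟩

theorem isometry_pt : Isometry (pt : X → FinHyp X) := Isometry.of_dist_eq fun x y => by
  rw [dist_eq, toSet_pt, toSet_pt, hausdorffDist_singleton]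

theorem continuous_pt : Continuous (pt : X → FinHyp X) := isometry_pt.continuous

theorem dist_le_of_dist_le {c : ℝ} (h : ∀ x y : X, dist x y ≤ c) (A B : FinHyp X) :
    dist A B ≤ c := by
  obtain ⟨a, ha⟩ := A.toSet_nonempty
  obtain ⟨b, hb⟩ := B.toSet_nonempty
  exact (dist_le_iff (dist_nonneg.trans (h a a))).2
    ⟨fun x _ => ⟨b, hb, h x b⟩, fun y _ => ⟨a, ha, h a y⟩⟩

/-- The image of a finite set under a homeomorphism. -/
def map {Y : Type*} [MetricSpace Y] (f : X → Y) (hf : Continuous f) (A : FinHyp X) : FinHyp Y :=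
  ⟨A.1.map f hf, by simpa using A.2.image f⟩

@[simp]
theorem toSet_map {Y : Type*} [MetricSpace Y] (f : X → Y) (hf : Continuous f) (A : FinHyp X) :
    (map f hf A).toSet = f '' A.toSet := by simp [map, FinHyp.toSet]

theorem continuous_map {Y : Type*} [MetricSpace Y] (f : X → Y) (hf : Continuous f) :
    Continuous (map f hf) :=
  (hf.nonemptyCompacts_map.comp continuous_subtype_val).subtype_mk _

/-- Homeomorphic spaces have homeomorphic hyperspaces. -/
def congr {Y : Type*} [MetricSpace Y] (e : X ≃ₜ Y) : FinHyp X ≃ₜ FinHyp Y where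
  toFun := map e e.continuous
  invFun := map e.symm e.symm.continuous
  left_inv A := ext (by simp [image_image])
  right_inv A := ext (by simp [image_image])
  continuous_toFun := continuous_map _ _
  continuous_invFun := continuous_map _ _

end FinHyp

namespace CurtisNhu

section Isolation

variable {X : Type*} [MetricSpace X]

/-- `A` has a nonempty part of diameter at most `s - τ` which is `τ`-far from the rest of `A`. -/
def Isolated (s : ℝ) (A : FinHyp X) (τ : ℝ) : Prop :=
  0 ≤ τ ∧ τ ≤ s ∧ ∃ S ⊆ A.toSet, S.Nonempty ∧ (∀ x ∈ S, ∀ y ∈ S, dist x y ≤ s - τ) ∧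
    ∀ x ∈ S, ∀ a ∈ A.toSet \ S, τ ≤ dist x a

/-- The largest scale at which a finite set has an isolated small part. -/
noncomputable def isolation (s : ℝ) (A : FinHyp X) : ℝ := sSup {τ | Isolated s A τ}

variable {s : ℝ} {A B : FinHyp X}

theorem Isolated.le_isolation {τ : ℝ} (h : Isolated s A τ) : τ ≤ isolation s A :=
  le_csSup ⟨s, fun _ h => h.2.1⟩ h

theorem isolated_zero (hs : 0 ≤ s) (A : FinHyp X) : Isolated s A 0 := by
  obtain ⟨a, ha⟩ := A.toSet_nonempty
  refine ⟨le_rfl, hs, {a}, singleton_subset_iff.2 ha, singleton_nonempty a, ?_,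
    fun _ _ _ _ => dist_nonneg⟩
  rintro x rfl y rfl
  simpa using hs

theorem isolation_le {c : ℝ} (hs : 0 ≤ s) (h : ∀ τ, Isolated s A τ → τ ≤ c) : isolation s A ≤ c :=
  csSup_le ⟨0, isolated_zero hs A⟩ h

theorem isolation_le_self (hs : 0 ≤ s) : isolation s A ≤ s := isolation_le hs fun _ h => h.2.1

theorem isolation_pos (hs : 0 < s) : 0 < isolation s A := by
  obtain ⟨a, ha⟩ := A.toSet_nonempty
  obtain ⟨r, hr, hra⟩ : ∃ r > 0, ∀ b ∈ A.toSet \ {a}, r ≤ dist a b := by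
    rcases (A.toSet \ {a}).eq_empty_or_nonempty with h | h
    · exact ⟨1, one_pos, by simp [h]⟩
    · obtain ⟨b, hb, hmin⟩ := exists_min_image _ (dist a) A.toSet_finite.diff h
      exact ⟨dist a b, dist_pos.2 fun h => hb.2 h.symm, hmin⟩
  refine (lt_min hs hr).trans_le (Isolated.le_isolation ⟨(lt_min hs hr).le, min_le_left _ _, {a},
    singleton_subset_iff.2 ha, singleton_nonempty a, ?_, ?_⟩)
  · rintro x rfl y rfl
    simp
  · rintro x rfl b hb
    exact (min_le_right _ _).trans (hra b hb)

theorem isolation_sup_le (hs : 0 ≤ s) :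
    isolation s (A ⊔ B) ≤ max (isolation s A) (isolation s B) := by
  refine isolation_le hs fun τ ⟨h0, h1, S, hS, ⟨x, hx⟩, hd, hf⟩ => ?_
  rcases hS hx with h | h
  · exact le_max_of_le_left (Isolated.le_isolation ⟨h0, h1, S ∩ A.toSet, inter_subset_right,
      ⟨x, hx, h⟩, fun x hx y hy => hd x hx.1 y hy.1,
      fun x hx a ha => hf x hx.1 a ⟨Or.inl ha.1, fun h => ha.2 ⟨h, ha.1⟩⟩⟩)
  · exact le_max_of_le_right (Isolated.le_isolation ⟨h0, h1, S ∩ B.toSet, inter_subset_right,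
      ⟨x, hx, h⟩, fun x hx y hy => hd x hx.1 y hy.1,
      fun x hx a ha => hf x hx.1 a ⟨Or.inr ha.1, fun h => ha.2 ⟨h, ha.1⟩⟩⟩)

theorem isolation_le_add (hs : 0 ≤ s) {δ : ℝ} (hδ : dist A B < δ) :
    isolation s A ≤ isolation s B + 2 * δ := by
  have hδ0 := dist_nonneg.trans_lt hδ
  obtain ⟨hAB, hBA⟩ := (FinHyp.dist_lt_iff hδ0).1 hδ
  refine isolation_le hs fun τ ⟨h0, h1, S, hS, ⟨x, hx⟩, hd, hf⟩ => ?_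
  rcases le_or_gt τ (2 * δ) with h | h
  · linarith [(isolated_zero hs B).le_isolation]
  rw [← sub_le_iff_le_add]
  refine Isolated.le_isolation ⟨by linarith, by linarith,
    {b ∈ B.toSet | ∃ x ∈ S, dist x b < δ}, fun b hb => hb.1, ?_, ?_, ?_⟩
  · obtain ⟨b, hb, hxb⟩ := hAB x (hS hx)
    exact ⟨b, hb, x, hx, hxb⟩
  · rintro b ⟨hb, y, hy, hyb⟩ c ⟨hc, z, hz, hzc⟩
    have h3 := dist_triangle4 b y z c
    rw [dist_comm b y] at h3
    linarith [hd y hy z hz]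
  · rintro b ⟨hb, y, hy, hyb⟩ c ⟨hc, hcS⟩
    obtain ⟨a, ha, hac⟩ := hBA c hc
    have h3 := hf y hy a ⟨ha, fun haS => hcS ⟨hc, a, haS, hac⟩⟩
    have h4 := dist_triangle4 y b c a
    rw [dist_comm c a] at h4
    linarith

theorem continuous_isolation (hs : 0 ≤ s) : Continuous (isolation s : FinHyp X → ℝ) := by
  refine (LipschitzWith.of_le_add_mul (2 : NNReal) fun A B => ?_).continuous
  refine le_of_forall_pos_le_add fun ε hε => ?_
  have := isolation_le_add hs (lt_add_of_pos_right (dist A B) (half_pos hε))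
  rw [NNReal.coe_ofNat]
  linarith

/-- Adding points linked by small steps to `A` does not increase the isolation. -/
theorem isolation_le_of_subset {μ : ℝ} (hs : 0 ≤ s) (hAB : A ≤ B)
    (h : ∀ b ∈ B.toSet, ∃ (n : ℕ) (c : ℕ → X), c n = b ∧ c 0 ∈ A.toSet ∧ (∀ j ≤ n, c j ∈ B.toSet) ∧
      ∀ j < n, dist (c (j + 1)) (c j) < μ) :
    isolation s B ≤ max (isolation s A) μ := by
  refine isolation_le hs fun τ ⟨h0, h1, S, hS, ⟨x, hx⟩, hd, hf⟩ => ?_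
  rcases le_or_gt τ μ with hτ | hτ
  · exact le_max_of_le_right hτ
  obtain ⟨n, c, rfl, hc0, hcB, hcd⟩ := h x (hS hx)
  have key : ∀ j, j ≤ n → c (n - j) ∈ S := fun j => by
    induction j with
    | zero => exact fun _ => hx
    | succ j ih =>
      intro hj
      by_contra hne
      have h2 := hf _ (ih (by omega)) (c (n - (j + 1))) ⟨hcB _ (by omega), hne⟩
      have h3 := hcd (n - (j + 1)) (by omega)
      rw [show n - (j + 1) + 1 = n - j by omega] at h3
      linarith
  have h0S := key n le_rfl
  rw [Nat.sub_self] at h0S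
  exact le_max_of_le_left (Isolated.le_isolation ⟨h0, h1, S ∩ A.toSet, inter_subset_right,
      ⟨_, h0S, hc0⟩, fun x hx y hy => hd x hx.1 y hy.1,
      fun x hx a ha => hf x hx.1 a ⟨hAB ha.1, fun h => ha.2 ⟨h, ha.1⟩⟩⟩)

end Isolation

section Trails

variable {X : Type*} [MetricSpace X] {ι : Type*} [Fintype ι] [Nonempty ι]

/-- Parameters of the sample points of a path run up to time `t`. -/
noncomputable def trailTime (N : ℕ) (t : ℝ) (j : ℕ) : ℝ := max 0 (min t (j / N))

theorem trailTime_zero (N : ℕ) (t : ℝ) : trailTime N t 0 = 0 := by simp [trailTime]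

theorem trailTime_time_zero (N j : ℕ) : trailTime N 0 j = 0 := by
  simp only [trailTime, max_eq_left_iff]
  exact min_le_left _ _

theorem trailTime_one {N j : ℕ} (hj : j ≤ N) : trailTime N 1 j = j / N := by
  have : (j : ℝ) / N ≤ 1 := div_le_one_of_le₀ (by exact_mod_cast hj) (by positivity)
  rw [trailTime, min_eq_right this, max_eq_right (by positivity)]

theorem trailTime_mem {N j : ℕ} (t : ℝ) (hj : j ≤ N) : trailTime N t j ∈ Icc (0 : ℝ) 1 :=
  ⟨le_max_left _ _, max_le zero_le_one ((min_le_right _ _).trans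
    (div_le_one_of_le₀ (by exact_mod_cast hj) (by positivity)))⟩

theorem abs_trailTime_succ_sub (N : ℕ) (t : ℝ) (j : ℕ) :
    |trailTime N t (j + 1) - trailTime N t j| ≤ 1 / N := by
  have h1 := abs_max_sub_max_le_max 0 (min t ((j + 1 : ℕ) / N)) 0 (min t (j / N))
  have h2 := abs_min_sub_min_le_max t ((j + 1 : ℕ) / N) t (j / N)
  have h3 : (((j + 1 : ℕ) : ℝ) / N - j / N) = 1 / N := by push_cast; ring
  rw [sub_self, abs_zero] at h1 h2
  rw [h3, abs_of_nonneg (by positivity : (0 : ℝ) ≤ 1 / N)] at h2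
  exact h1.trans (max_le (by positivity) (h2.trans (max_le (by positivity) le_rfl)))

/-- The finite set `A` together with the sample points of a family of paths run up to time `t`. -/
noncomputable def trail (A : FinHyp X) (γ : ι → ℝ → X) (N : ℕ) (t : ℝ) : FinHyp X :=
  A ⊔ (Finset.univ ×ˢ Finset.range (N + 1)).sup' (by simp)
    fun p : ι × ℕ => FinHyp.pt (γ p.1 (trailTime N t p.2))

theorem mem_trail {A : FinHyp X} {γ : ι → ℝ → X} {N : ℕ} {t : ℝ} {x : X} :
    x ∈ (trail A γ N t).toSet ↔ x ∈ A.toSet ∨ ∃ k, ∃ j ≤ N, x = γ k (trailTime N t j) := by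
  simp [trail, FinHyp.mem_sup', Nat.lt_succ_iff]

theorem continuous_trail {A : FinHyp X} {γ : ι → ℝ → X} (hγ : ∀ k, Continuous (γ k)) (N : ℕ) :
    Continuous (trail A γ N) := by
  refine continuous_const.sup (Continuous.finset_sup'_apply _ fun p _ =>
    FinHyp.continuous_pt.comp ((hγ p.1).comp ?_))
  unfold trailTime
  fun_prop

theorem trail_zero {A : FinHyp X} {γ : ι → ℝ → X} (h0 : ∀ k, γ k 0 ∈ A.toSet) (N : ℕ) :
    trail A γ N 0 = A := by
  refine FinHyp.ext (Set.ext fun x => mem_trail.trans ⟨?_, Or.inl⟩)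
  rintro (h | ⟨k, j, _, rfl⟩)
  · exact h
  · rw [trailTime_time_zero]; exact h0 k

theorem mem_trail_one {A : FinHyp X} {γ : ι → ℝ → X} {N : ℕ} {x : X} :
    x ∈ (trail A γ N 1).toSet ↔ x ∈ A.toSet ∨ ∃ k, ∃ j ≤ N, x = γ k (j / N) := by
  rw [mem_trail]
  refine or_congr_right (exists_congr fun k => exists_congr fun j => and_congr_right fun hj => ?_)
  rw [trailTime_one hj]

theorem isolation_trail_le {A : FinHyp X} {γ : ι → ℝ → X} {N : ℕ} {s μ : ℝ} (hs : 0 ≤ s)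
    (h0 : ∀ k, γ k 0 ∈ A.toSet)
    (hμ : ∀ k, ∀ u ∈ Icc (0 : ℝ) 1, ∀ v ∈ Icc (0 : ℝ) 1, |u - v| ≤ 1 / N →
      dist (γ k u) (γ k v) < μ) (t : ℝ) :
    isolation s (trail A γ N t) ≤ max (isolation s A) μ := by
  refine isolation_le_of_subset hs (fun x hx => mem_trail.2 (Or.inl hx)) fun b hb => ?_
  rcases mem_trail.1 hb with h | ⟨k, j, hj, rfl⟩
  · exact ⟨0, fun _ => b, rfl, h, fun _ _ => hb, fun j hj => absurd hj (Nat.not_lt_zero j)⟩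
  · refine ⟨j, fun i => γ k (trailTime N t i), rfl, ?_, fun i hi =>
      mem_trail.2 (Or.inr ⟨k, i, hi.trans hj, rfl⟩), fun i hi => hμ k _ (trailTime_mem t (by omega))
      _ (trailTime_mem t (by omega)) (abs_trailTime_succ_sub N t i)⟩
    simpa only [trailTime_zero] using h0 k

omit [Nonempty ι] in
theorem exists_mesh {γ : ι → ℝ → X} (hγ : ∀ k, Continuous (γ k)) {μ : ℝ} (hμ : 0 < μ) :
    ∃ N₀ : ℕ, ∀ N ≥ N₀, ∀ k, ∀ u ∈ Icc (0 : ℝ) 1, ∀ v ∈ Icc (0 : ℝ) 1, |u - v| ≤ 1 / N →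
      dist (γ k u) (γ k v) < μ := by
  have h : ∀ k, ∃ δ > 0, ∀ u ∈ Icc (0 : ℝ) 1, ∀ v ∈ Icc (0 : ℝ) 1, dist u v < δ →
      dist (γ k u) (γ k v) < μ := fun k => by
    exact Metric.uniformContinuousOn_iff.1
      ((isCompact_Icc (a := (0 : ℝ)) (b := 1)).uniformContinuousOn_of_continuous
        (hγ k).continuousOn) μ hμ
  choose δ hδ h using h
  obtain ⟨d, hd, hdk⟩ : ∃ d > 0, ∀ k, d ≤ δ k := by
    rcases isEmpty_or_nonempty ι with h | h
    · exact ⟨1, one_pos, fun k => (h.false k).elim⟩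
    · obtain ⟨k, hk⟩ := Finite.exists_min δ
      exact ⟨δ k, hδ k, hk⟩
  obtain ⟨n, hn⟩ := exists_nat_one_div_lt hd
  refine ⟨n + 1, fun N hN k u hu v hv huv => h k u hu v hv ((huv.trans_lt ?_).trans_le (hdk k))⟩
  refine lt_of_le_of_lt (one_div_le_one_div_of_le (by positivity) ?_) hn
  exact_mod_cast hN

end Trails

section GaugeFinHyp

universe u

variable {X : Type*} [MetricSpace X]

theorem joinedIn_trail {ι : Type*} [Fintype ι] [Nonempty ι] {A : FinHyp X} {γ : ι → ℝ → X} {N : ℕ}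
    {U : Set (FinHyp X)} (hγ : ∀ k, Continuous (γ k)) (h0 : ∀ k, γ k 0 ∈ A.toSet)
    (hU : ∀ t, trail A γ N t ∈ U) : JoinedIn U A (trail A γ N 1) :=
  JoinedIn.ofLine (continuous_trail hγ N).continuousOn (trail_zero h0 N) rfl
    (image_subset_iff.2 fun t _ => hU t)

theorem dist_trail_lt {ι : Type*} [Fintype ι] [Nonempty ι] {A C : FinHyp X} {γ : ι → ℝ → X} {N : ℕ}
    {R : ℝ} (h : dist A C < R) (hγ : ∀ k t, ∃ c ∈ C.toSet, dist (γ k t) c < R) (t : ℝ) :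
    dist (trail A γ N t) C < R := by
  have hR := dist_nonneg.trans_lt h
  rw [FinHyp.dist_lt_iff hR] at *
  refine ⟨fun x hx => ?_, fun c hc => ?_⟩
  · rcases mem_trail.1 hx with hx | ⟨k, j, _, rfl⟩
    · exact h.1 x hx
    · exact hγ k _
  · obtain ⟨a, ha, hac⟩ := h.2 c hc
    exact ⟨a, mem_trail.2 (Or.inl ha), hac⟩

theorem PathMetric.exists_paths {X : Type u} [MetricSpace X] (hX : PathMetric X) {A C : FinHyp X} {R : ℝ} (h : dist A C < R) :
    ∃ (ι : Type u) (_ : Fintype ι) (_ : Nonempty ι) (γ : ι → ℝ → X), (∀ k, Continuous (γ k)) ∧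
      (∀ k, γ k 0 ∈ A.toSet) ∧ (∀ k, γ k 1 ∈ C.toSet) ∧ (∀ a ∈ A.toSet, ∃ k, γ k 0 = a) ∧
      (∀ c ∈ C.toSet, ∃ k, γ k 1 = c) ∧ ∀ k t, ∃ c ∈ C.toSet, dist (γ k t) c < R := by
  rw [FinHyp.dist_lt_iff (dist_nonneg.trans_lt h)] at h
  let T := {p : X × X | p ∈ A.toSet ×ˢ C.toSet ∧ dist p.1 p.2 < R}
  have hT : T.Finite := (A.toSet_finite.prod C.toSet_finite).subset fun p hp => hp.1
  have := hT.fintype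
  have hne : Nonempty T := by
    obtain ⟨a, ha⟩ := A.toSet_nonempty
    obtain ⟨c, hc, hac⟩ := h.1 a ha
    exact ⟨⟨(a, c), ⟨ha, hc⟩, hac⟩⟩
  have hp : ∀ p : T, ∃ γ : ℝ → X, Continuous γ ∧ γ 0 = p.1.1 ∧ γ 1 = p.1.2 ∧
    ∀ s t, dist (γ s) (γ t) < R := fun p => hX _ _ _ p.2.2
  choose γ h1 h2 h3 h4 using hp
  refine ⟨T, inferInstance, hne, γ, h1, fun p => ?_, fun p => ?_, fun a ha => ?_, fun c hc => ?_,
    fun p t => ⟨p.1.2, p.2.1.2, ?_⟩⟩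
  · rw [h2]; exact p.2.1.1
  · rw [h3]; exact p.2.1.2
  · obtain ⟨c, hc, hac⟩ := h.1 a ha
    exact ⟨⟨(a, c), ⟨ha, hc⟩, hac⟩, h2 _⟩
  · obtain ⟨a, ha, hac⟩ := h.2 c hc
    exact ⟨⟨(a, c), ⟨ha, hc⟩, hac⟩, h3 _⟩
  · rw [← h3]; exact h4 p t 1

theorem joinedIn_two_trails {ι κ : Type*} [Fintype ι] [Nonempty ι] [Fintype κ] [Nonempty κ]
    {A C : FinHyp X} {α : ι → ℝ → X} {β : κ → ℝ → X} {N : ℕ} {R s τ μ : ℝ} (hs : 0 ≤ s)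
    (hN : N ≠ 0) (hA : dist A C < R) (hτ : isolation s A < τ) (hμτ : μ < τ)
    (a1 : ∀ k, Continuous (α k)) (a2 : ∀ k, α k 0 ∈ A.toSet)
    (a5 : ∀ c ∈ C.toSet, ∃ k, α k 1 = c) (a6 : ∀ k t, ∃ c ∈ C.toSet, dist (α k t) c < R)
    (hα : ∀ k, ∀ u ∈ Icc (0 : ℝ) 1, ∀ v ∈ Icc (0 : ℝ) 1, |u - v| ≤ 1 / N →
      dist (α k u) (α k v) < μ)
    (b1 : ∀ k, Continuous (β k)) (b3 : ∀ k, β k 1 ∈ C.toSet)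
    (b6 : ∀ k t, ∃ c ∈ C.toSet, dist (β k t) c < R)
    (hβ : ∀ k, ∀ u ∈ Icc (0 : ℝ) 1, ∀ v ∈ Icc (0 : ℝ) 1, |u - v| ≤ 1 / N →
      dist (β k u) (β k v) < μ) :
    ∃ M : FinHyp X, JoinedIn {Z | dist Z C < R ∧ isolation s Z < τ} A M ∧
      ∀ x, x ∈ M.toSet ↔ x ∈ A.toSet ∨ (∃ k, ∃ j ≤ N, x = α k (j / N)) ∨
        ∃ k, ∃ j ≤ N, x = β k (j / N) := by
  have hiso : ∀ t, isolation s (trail A α N t) < τ := fun t =>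
    (isolation_trail_le hs a2 hα t).trans_lt (max_lt hτ hμτ)
  have hdist : ∀ t, dist (trail A α N t) C < R := dist_trail_lt hA a6
  have hN' : (N : ℝ) ≠ 0 := by exact_mod_cast hN
  have hβ0 : ∀ k, β k (1 - 0) ∈ (trail A α N 1).toSet := fun k => by
    obtain ⟨i, hi⟩ := a5 _ (b3 k)
    rw [sub_zero, ← hi]
    exact mem_trail_one.2 (Or.inr ⟨i, N, le_rfl, by rw [div_self hN']⟩)
  have hβ' : ∀ k, ∀ u ∈ Icc (0 : ℝ) 1, ∀ v ∈ Icc (0 : ℝ) 1, |u - v| ≤ 1 / N →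
      dist (β k (1 - u)) (β k (1 - v)) < μ := fun k u hu v hv huv =>
    hβ k _ ⟨by linarith [hu.2], by linarith [hu.1]⟩ _ ⟨by linarith [hv.2], by linarith [hv.1]⟩
      (by rwa [sub_sub_sub_cancel_left, abs_sub_comm])
  have hstep₁ : JoinedIn {Z | dist Z C < R ∧ isolation s Z < τ} A (trail A α N 1) :=
    joinedIn_trail a1 a2 fun t => ⟨hdist t, hiso t⟩
  have hstep₂ : JoinedIn {Z | dist Z C < R ∧ isolation s Z < τ} (trail A α N 1)
      (trail (trail A α N 1) (fun k t => β k (1 - t)) N 1) :=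
    joinedIn_trail (fun k => (b1 k).comp (by fun_prop)) hβ0 fun t =>
      ⟨dist_trail_lt (hdist 1) (fun k t => b6 k _) t,
        (isolation_trail_le hs hβ0 hβ' t).trans_lt (max_lt (hiso 1) hμτ)⟩
  refine ⟨trail (trail A α N 1) (fun k t => β k (1 - t)) N 1, hstep₁.trans hstep₂,
    fun x => ?_⟩
  rw [mem_trail_one, mem_trail_one, or_assoc]
  refine or_congr_right (or_congr_right (exists_congr fun k => ?_))
  have hflip : ∀ j ≤ N, (1 : ℝ) - j / N = (N - j : ℕ) / N := fun j hj => by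
    rw [Nat.cast_sub hj]; field_simp
  constructor
  · rintro ⟨j, hj, rfl⟩
    exact ⟨N - j, Nat.sub_le _ _, by rw [hflip j hj]⟩
  · rintro ⟨j, hj, rfl⟩
    exact ⟨N - j, Nat.sub_le _ _, by
      rw [hflip _ (Nat.sub_le _ _), Nat.sub_sub_self hj]⟩

theorem PathMetric.exists_gauge [Nontrivial X] (hX : PathMetric X)
    {ε : ℝ} (hε : 0 < ε) : ∃ g : FinHyp X → ℝ, Gauge ε g := by
  obtain ⟨p, q, hpq⟩ := exists_pair_ne X
  have hD := dist_pos.2 hpq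
  set s := min (min (ε / 2) (dist p q / 2)) 1 with hs_def
  have hs : 0 < s := by positivity
  have hsε : s < ε := ((min_le_left _ _).trans (min_le_left _ _)).trans_lt (by linarith)
  have hsD : s ≤ dist p q / 2 := (min_le_left _ _).trans (min_le_right _ _)
  have hfar : ∀ x : X, ∃ y, dist x y = s := fun x => by
    obtain ⟨z, hz⟩ : ∃ z, s ≤ dist x z := by
      by_contra! h
      have := dist_triangle_left p q x
      linarith [h p, h q]
    obtain ⟨γ, hγ, h0, h1, _⟩ := hX x z (dist x z + 1) (lt_add_one _)
    obtain ⟨t, _, ht⟩ := intermediate_value_Icc (zero_le_one' ℝ)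
      (continuous_const.dist hγ : Continuous fun t => dist x (γ t)).continuousOn
      (show s ∈ Icc (dist x (γ 0)) (dist x (γ 1)) by rw [h0, h1, dist_self]; exact ⟨hs.le, hz⟩)
    exact ⟨γ t, ht⟩
  refine ⟨isolation s, continuous_isolation hs.le, fun A => isolation_pos hs,
    fun A => (isolation_le_self hs.le).trans (min_le_right _ _), fun A B => isolation_sup_le hs.le,
    fun A τ hτ => ?_, fun C R τ A B hA hB hgA hgB => ?_⟩
  · choose y hy using hfar
    have hp : ∀ x : A.toSet, ∃ γ : ℝ → X, Continuous γ ∧ γ 0 = x ∧ γ 1 = y x ∧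
      ∀ s t, dist (γ s) (γ t) < ε := fun x => hX _ _ _ (by rw [hy]; exact hsε)
    choose γ h1 h2 h3 h4 using hp
    have := A.toSet_finite.fintype
    have := A.toSet_nonempty.to_subtype
    obtain ⟨N₀, hN⟩ := exists_mesh h1 (half_pos hτ)
    have hN := hN (N₀ + 1) (by omega)
    have h0A : ∀ k, γ k 0 ∈ A.toSet := fun k => by rw [h2]; exact k.2
    refine ⟨trail A γ (N₀ + 1) 1, dist_trail_lt (by rwa [dist_self]) (fun k t =>
      ⟨γ k 0, h0A k, h4 k t 0⟩) 1, (isolation_le hs.le (c := τ / 2) ?_).trans_lt (half_lt_self hτ)⟩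
    rintro r ⟨hr0, hrs, S, hS, ⟨x, hx⟩, hd, hf⟩
    by_contra! hr
    have hstep : ∀ (k : A.toSet) (i j : ℕ), i ≤ N₀ + 1 → j ≤ N₀ + 1 →
        |((i : ℝ) / (N₀ + 1 : ℕ)) - j / (N₀ + 1 : ℕ)| ≤ 1 / (N₀ + 1 : ℕ) →
        γ k (i / (N₀ + 1 : ℕ)) ∈ S → γ k (j / (N₀ + 1 : ℕ)) ∈ S := by
      intro k i j hi hj hij hiS
      by_contra hne
      have h5 := hf _ hiS _ ⟨mem_trail_one.2 (Or.inr ⟨k, j, hj, rfl⟩), hne⟩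
      have h6 := hN k (i / (N₀ + 1 : ℕ)) ⟨by positivity,
        div_le_one_of_le₀ (by exact_mod_cast hi) (by positivity)⟩ (j / (N₀ + 1 : ℕ))
        ⟨by positivity, div_le_one_of_le₀ (by exact_mod_cast hj) (by positivity)⟩ hij
      linarith
    have hd1 : ∀ j : ℕ, (((j + 1 : ℕ) : ℝ) / (N₀ + 1 : ℕ) - j / (N₀ + 1 : ℕ)) =
      1 / (N₀ + 1 : ℕ) := fun j => by push_cast; ring
    obtain ⟨k, j, hj, hjS⟩ : ∃ k, ∃ j ≤ N₀ + 1, γ k ((j : ℕ) / (N₀ + 1 : ℕ)) ∈ S := by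
      rcases mem_trail_one.1 (hS hx) with h | ⟨k, j, hj, rfl⟩
      · exact ⟨⟨x, h⟩, 0, by omega, by simpa [h2] using hx⟩
      · exact ⟨k, j, hj, hx⟩
    have hup : ∀ i, j + i ≤ N₀ + 1 → γ k ((j + i : ℕ) / (N₀ + 1 : ℕ)) ∈ S := fun i => by
      induction i with
      | zero => exact fun _ => hjS
      | succ i ih =>
        intro hi
        refine hstep k (j + i) (j + i + 1) (by omega) hi ?_ (ih (by omega))
        rw [abs_sub_comm, hd1, abs_of_nonneg (by positivity)]
    have hdown : ∀ i, i ≤ j → γ k ((j - i : ℕ) / (N₀ + 1 : ℕ)) ∈ S := fun i => by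
      induction i with
      | zero => exact fun _ => hjS
      | succ i ih =>
        intro hi
        have h5 := hd1 (j - (i + 1))
        rw [show j - (i + 1) + 1 = j - i by omega] at h5
        refine hstep k (j - i) (j - (i + 1)) (by omega) (by omega) ?_ (ih (by omega))
        rw [h5, abs_of_nonneg (by positivity)]
    have h5 := hup (N₀ + 1 - j) (by omega)
    have h6 := hdown j le_rfl
    rw [show j + (N₀ + 1 - j) = N₀ + 1 by omega, div_self (by positivity)] at h5
    rw [Nat.sub_self, Nat.cast_zero, zero_div] at h6
    have h7 := hd _ h6 _ h5
    rw [h2, h3, hy] at h7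
    linarith
  · obtain ⟨ι, _, _, α, a1, a2, a3, a4, a5, a6⟩ := hX.exists_paths hA
    obtain ⟨κ, _, _, β, b1, b2, b3, b4, b5, b6⟩ := hX.exists_paths hB
    have hτ : 0 < τ := (isolation_pos hs).trans hgA
    obtain ⟨N₁, hN₁⟩ := exists_mesh a1 (half_pos hτ)
    obtain ⟨N₂, hN₂⟩ := exists_mesh b1 (half_pos hτ)
    set N := N₁ + N₂ + 1 with hN_def
    have hα := hN₁ N (by omega)
    have hβ := hN₂ N (by omega)
    obtain ⟨M, hAM, hM⟩ := joinedIn_two_trails hs.le (Nat.succ_ne_zero _) hA hgA (half_lt_self hτ)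
      a1 a2 a5 a6 hα b1 b3 b6 hβ
    obtain ⟨M', hBM, hM'⟩ := joinedIn_two_trails hs.le (Nat.succ_ne_zero _) hB hgB (half_lt_self hτ)
      b1 b2 b5 b6 hβ a1 a3 a6 hα
    have hMM : M = M' := by
      refine FinHyp.ext (Set.ext fun x => ?_)
      rw [hM, hM']
      constructor
      · rintro (h | h | h)
        · obtain ⟨k, rfl⟩ := a4 x h
          exact Or.inr (Or.inr ⟨k, 0, Nat.zero_le _, by simp⟩)
        · exact Or.inr (Or.inr h)
        · exact Or.inr (Or.inl h)
      · rintro (h | h | h)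
        · obtain ⟨k, rfl⟩ := b4 x h
          exact Or.inr (Or.inr ⟨k, 0, Nat.zero_le _, by simp⟩)
        · exact Or.inr (Or.inr h)
        · exact Or.inr (Or.inl h)
    subst hMM
    obtain ⟨γ, hγ⟩ := hAM.trans hBM.symm
    exact ⟨γ.extend, γ.continuous_extend, γ.extend_zero, γ.extend_one, fun t => hγ _⟩

end GaugeFinHyp

end CurtisNhu

namespace CurtisNhu

theorem SFD.finHyp {X : Type*} [MetricSpace X] (hX : SFD X) : SFD (FinHyp X) := by
  have := hX.secondCountable
  choose ι hι C hCc hCd hC using exists_configurations X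
  have hclosed : ∀ n (i : ι n), IsClosed {y : Fin n → X | ∀ k, y k ∈ C n i k} := fun n i => by
    simp only [ofPred_forall]
    exact isClosed_iInter fun k => (hCc n i k).preimage (by fun_prop)
  refine SFD.of_images (ι := Σ n, ι (n + 1)) (fun p =>
    (SFD.pi (ι := Fin (p.1 + 1)) hX).subtype (hclosed _ p.2))
    (fun p y => Finset.univ.sup' Finset.univ_nonempty fun k => FinHyp.pt (y.1 k)) (fun p => ?_)
    (fun p y z hyz => ?_) fun A => ?_
  · exact Continuous.finset_sup'_apply _ fun k _ =>
      FinHyp.continuous_pt.comp ((continuous_apply k).comp continuous_subtype_val)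
  · refine Subtype.ext (funext fun k => ?_)
    have h1 : y.1 k ∈ (Finset.univ.sup' Finset.univ_nonempty fun k => FinHyp.pt (y.1 k)).toSet :=
      FinHyp.mem_sup'.2 ⟨k, Finset.mem_univ _, rfl⟩
    rw [show (Finset.univ.sup' Finset.univ_nonempty fun k => FinHyp.pt (y.1 k)) = _ from hyz] at h1
    obtain ⟨l, _, hl⟩ := FinHyp.mem_sup'.1 h1
    have hl : y.1 k = z.1 l := hl
    have : l = k := by
      by_contra h
      exact Set.disjoint_left.1 (hCd _ p.2 l k h) (z.2 l) (hl ▸ y.2 k)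
    rw [hl, this]
  · obtain ⟨n, hn⟩ : ∃ n, A.toSet.ncard = n + 1 :=
      Nat.exists_eq_succ_of_ne_zero ((Set.ncard_pos A.toSet_finite).2 A.toSet_nonempty).ne'
    have := A.toSet_finite.fintype
    let e : Fin (n + 1) ≃ A.toSet := (Fintype.equivFinOfCardEq (by
      rw [← hn, Set.ncard_eq_toFinset_card', Set.toFinset_card])).symm
    obtain ⟨i, hi⟩ := hC (n + 1) (fun k => (e k : X)) (Subtype.val_injective.comp e.injective)
    refine ⟨⟨n, i⟩, ⟨fun k => (e k : X), hi⟩, FinHyp.ext (Set.ext fun x => ?_)⟩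
    refine FinHyp.mem_sup'.trans ⟨?_, fun hx => ⟨e.symm ⟨x, hx⟩, Finset.mem_univ _, by simp⟩⟩
    rintro ⟨k, _, hk⟩
    have hk : x = e k := hk
    rw [hk]
    exact (e k).2

end CurtisNhu

namespace CurtisNhu

section Skeleton

variable {X : Type*} [MetricSpace X]

theorem exists_greatest_le {C : Set ℝ} (hC : IsClosed C) {a m : ℝ} (ha : a ∈ C) (h : a ≤ m) :
    ∃ p ∈ C, a ≤ p ∧ p ≤ m ∧ ∀ x ∈ C, x ≤ m → x ≤ p := by
  obtain ⟨p, hp, hmax⟩ := (isCompact_Icc.inter_right hC).exists_isGreatest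
    (⟨a, ⟨le_rfl, h⟩, ha⟩ : (Icc a m ∩ C).Nonempty)
  refine ⟨p, hp.2, hp.1.1, hp.1.2, fun x hx hxm => ?_⟩
  rcases le_total a x with hax | hax
  · exact hmax ⟨⟨hax, hxm⟩, hx⟩
  · exact hax.trans hp.1.1

theorem exists_least_ge {C : Set ℝ} (hC : IsClosed C) {b m : ℝ} (hb : b ∈ C) (h : m ≤ b) :
    ∃ q ∈ C, q ≤ b ∧ m ≤ q ∧ ∀ x ∈ C, m ≤ x → q ≤ x := by
  obtain ⟨q, hq, hmin⟩ := (isCompact_Icc.inter_right hC).exists_isLeast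
    (⟨b, ⟨h, le_rfl⟩, hb⟩ : (Icc m b ∩ C).Nonempty)
  refine ⟨q, hq.2, hq.1.2, hq.1.1, fun x hx hxm => ?_⟩
  rcases le_total x b with hax | hax
  · exact hmin ⟨⟨hxm, hax⟩, hx⟩
  · exact hq.1.2.trans hax

/-- A closed set of parameters such that the path closes up over the complementary gaps. -/
def Skeleton (γ : ℝ → X) (C : Set ℝ) : Prop :=
  IsClosed C ∧ C ⊆ Icc 0 1 ∧ 0 ∈ C ∧ 1 ∈ C ∧
    ∀ a ∈ C, ∀ b ∈ C, a < b → (∀ x ∈ C, x ≤ a ∨ b ≤ x) → γ a = γ b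

theorem skeleton_sInter {γ : ℝ → X} (hγ : Continuous γ) {c : Set (Set ℝ)}
    (hc : ∀ C ∈ c, Skeleton γ C) (hchain : IsChain (· ⊆ ·) c) (hne : c.Nonempty) :
    Skeleton γ (⋂₀ c) := by
  refine ⟨isClosed_sInter fun C hC => (hc C hC).1, ?_, fun C hC => (hc C hC).2.2.1,
    fun C hC => (hc C hC).2.2.2.1, fun a ha b hb hab hgap => ?_⟩
  · obtain ⟨C, hC⟩ := hne
    exact (sInter_subset_of_mem hC).trans (hc C hC).2.1
  refine eq_of_forall_dist_le fun ε hε => ?_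
  obtain ⟨δ₁, hδ₁, h1⟩ := Metric.continuousAt_iff.1 (hγ.continuousAt (x := a)) (ε / 2) (half_pos hε)
  obtain ⟨δ₂, hδ₂, h2⟩ := Metric.continuousAt_iff.1 (hγ.continuousAt (x := b)) (ε / 2) (half_pos hε)
  set δ := min (min δ₁ δ₂) (b - a) / 3 with hδ_def
  have hba : 0 < b - a := sub_pos.2 hab
  have hδ : 0 < δ := by positivity
  have hd1 : δ < δ₁ := by
    have : min (min δ₁ δ₂) (b - a) ≤ δ₁ := (min_le_left _ _).trans (min_le_left _ _)
    linarith
  have hd2 : δ < δ₂ := by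
    have : min (min δ₁ δ₂) (b - a) ≤ δ₂ := (min_le_left _ _).trans (min_le_right _ _)
    linarith
  have hd3 : δ ≤ (b - a) / 3 := by
    have : min (min δ₁ δ₂) (b - a) ≤ b - a := min_le_right _ _
    linarith
  have := hne.to_subtype
  obtain ⟨⟨C, hC⟩, hCe⟩ := (isCompact_Icc (a := a + δ) (b := b - δ)).elim_directed_family_closed
    (fun C : c => C.1) (fun C => (hc _ C.2).1) (by
      rw [← sInter_eq_iInter]
      ext x
      simp only [mem_inter_iff, mem_Icc, mem_empty_iff_false, iff_false, not_and]
      intro hx hxc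
      rcases hgap x hxc with h | h <;> linarith) (fun C D => by
      rcases hchain.total C.2 D.2 with h | h
      · exact ⟨C, Subset.rfl, h⟩
      · exact ⟨D, h, Subset.rfl⟩)
  have hCe : ∀ x ∈ C, a + δ ≤ x → b - δ ≤ x → x ≤ b - δ → False := fun x hx h1 _ h2 => by
    have : x ∈ Icc (a + δ) (b - δ) ∩ C := ⟨⟨h1, h2⟩, hx⟩
    rw [hCe] at this
    exact this
  have hCe : ∀ x ∈ C, x < a + δ ∨ b - δ < x := fun x hx => by
    by_contra! h
    have : x ∈ Icc (a + δ) (b - δ) ∩ C := ⟨h, hx⟩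
    rw [‹Icc (a + δ) (b - δ) ∩ C = ∅›] at this
    exact this
  obtain ⟨hCc, _, _, _, hCg⟩ := hc C hC
  obtain ⟨p, hp, hap, hpm, hpmax⟩ := exists_greatest_le hCc (ha C hC)
    (show a ≤ (a + b) / 2 by linarith)
  obtain ⟨q, hq, hqb, hmq, hqmin⟩ := exists_least_ge hCc (hb C hC)
    (show (a + b) / 2 ≤ b by linarith)
  have hp' : p < a + δ := by
    rcases hCe p hp with h | h <;> linarith
  have hq' : b - δ < q := by
    rcases hCe q hq with h | h <;> linarith
  have hpq := hCg p hp q hq (by linarith) fun x hx => by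
    rcases le_total x ((a + b) / 2) with h | h
    · exact Or.inl (hpmax x hx h)
    · exact Or.inr (hqmin x hx h)
  have h3 := h1 (x := p) (by rw [Real.dist_eq, abs_of_nonneg (by linarith)]; linarith)
  have h4 := h2 (x := q) (by rw [Real.dist_eq, abs_of_nonpos (by linarith)]; linarith)
  rw [hpq] at h3
  exact (dist_triangle_left _ _ (γ q)).trans (by linarith)

theorem exists_minimal_skeleton {γ : ℝ → X} (hγ : Continuous γ) :
    ∃ C, Skeleton γ C ∧ ∀ p ∈ C, ∀ q ∈ C, p < q → γ p = γ q → ∀ x ∈ C, x ≤ p ∨ q ≤ x := by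
  obtain ⟨C, hC, hmin⟩ := zorn_superset {C | Skeleton γ C} fun c hc hchain => by
    rcases c.eq_empty_or_nonempty with rfl | hne
    · refine ⟨Icc 0 1, ⟨isClosed_Icc, Subset.rfl, ⟨le_rfl, zero_le_one⟩, ⟨zero_le_one, le_rfl⟩,
        fun a ha b hb hab h => ?_⟩, fun s hs => hs.elim⟩
      rcases h ((a + b) / 2) ⟨by linarith [ha.1, hb.1], by linarith [ha.2, hb.2]⟩ with h | h <;>
        linarith
    · exact ⟨⋂₀ c, skeleton_sInter hγ (fun C hC => hc hC) hchain hne,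
        fun s hs => sInter_subset_of_mem hs⟩
  refine ⟨C, hC, fun p hp q hq hpq hγpq x hx => ?_⟩
  have hC' : Skeleton γ (C \ Ioo p q) := by
    obtain ⟨h1, h2, h3, h4, h5⟩ := hC
    have hp0 := h2 hp
    have hq1 := h2 hq
    refine ⟨h1.inter isOpen_Ioo.isClosed_compl, diff_subset.trans h2,
      ⟨h3, fun h => by linarith [h.1, hp0.1]⟩, ⟨h4, fun h => by linarith [h.2, hq1.2]⟩, ?_⟩
    intro a ha b hb hab hgap
    have hpgap := hgap p ⟨hp, fun h => lt_irrefl _ h.1⟩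
    have hqgap := hgap q ⟨hq, fun h => lt_irrefl _ h.2⟩
    by_cases hall : ∀ x ∈ C, x ≤ a ∨ b ≤ x
    · exact h5 a ha.1 b hb.1 hab hall
    push Not at hall
    obtain ⟨x, hx, hax, hxb⟩ := hall
    have hxI : x ∈ Ioo p q := by
      by_contra h
      rcases hgap x ⟨hx, h⟩ with h | h <;> linarith
    have hpa : p ≤ a := hpgap.resolve_right fun h => by linarith [hxI.1]
    have hbq : b ≤ q := hqgap.resolve_left fun h => by linarith [hxI.2]
    have e1 : a = p := by
      by_contra hne
      exact ha.2 ⟨lt_of_le_of_ne hpa (Ne.symm hne), by linarith [hxI.2]⟩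
    have e2 : b = q := by
      by_contra hne
      exact hb.2 ⟨by linarith [hxI.1], lt_of_le_of_ne hbq hne⟩
    rw [e1, e2, hγpq]
  by_contra! h
  exact (hmin hC' diff_subset hx).2 h

/-- Every path can be reparametrized to be monotone, in the sense of having convex fibres. -/
theorem exists_monotone_path {γ : ℝ → X} (hγ : Continuous γ) :
    ∃ γ' : ℝ → X, ContinuousOn γ' (Icc 0 1) ∧ γ' 0 = γ 0 ∧ γ' 1 = γ 1 ∧
      (∀ t ∈ Icc (0 : ℝ) 1, γ' t ∈ γ '' Icc 0 1) ∧
      ∀ s u t, 0 ≤ s → s ≤ u → u ≤ t → t ≤ 1 → γ' s = γ' t → γ' u = γ' s := by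
  obtain ⟨C, ⟨hCc, hC01, h0, h1, hgap⟩, hmin⟩ := exists_minimal_skeleton hγ
  have hpred : ∀ t : ℝ, ∃ p, 0 ≤ t → p ∈ C ∧ 0 ≤ p ∧ p ≤ t ∧ ∀ x ∈ C, x ≤ t → x ≤ p := fun t => by
    by_cases ht : 0 ≤ t
    · obtain ⟨p, h⟩ := exists_greatest_le hCc h0 ht
      exact ⟨p, fun _ => h⟩
    · exact ⟨0, fun h => absurd h ht⟩
  choose π hπ using hpred
  have hmono : ∀ s t, 0 ≤ s → s ≤ t → π s ≤ π t := fun s t hs hst =>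
    (hπ t (hs.trans hst)).2.2.2 _ (hπ s hs).1 ((hπ s hs).2.2.1.trans hst)
  have hπC : ∀ t, 0 ≤ t → t ∈ C → π t = t := fun t ht htC =>
    le_antisymm (hπ t ht).2.2.1 ((hπ t ht).2.2.2 t htC le_rfl)
  have key : ∀ s t, 0 ≤ s → s ≤ t → t ≤ 1 → γ (π s) = γ (π t) ∨
      ∃ s' ∈ Icc s t, ∃ t' ∈ Icc s t, γ (π s) = γ s' ∧ γ (π t) = γ t' := by
    intro s t hs hst ht
    obtain ⟨hp, hp0, hps, hpmax⟩ := hπ s hs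
    obtain ⟨hr, hr0, hrt, hrmax⟩ := hπ t (hs.trans hst)
    obtain ⟨q, hq, hq1, hsq, hqmin⟩ := exists_least_ge hCc h1 (hst.trans ht)
    rcases le_or_gt q t with hqt | hqt
    · refine Or.inr ⟨q, ⟨hsq, hqt⟩, π t, ⟨hsq.trans (hrmax q hq hqt), hrt⟩, ?_, rfl⟩
      rcases (hps.trans hsq).eq_or_lt with h | h
      · rw [h]
      · refine hgap _ hp _ hq h fun x hx => ?_
        rcases le_total x s with h | h
        · exact Or.inl (hpmax x hx h)
        · exact Or.inr (hqmin x hx h)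
    · refine Or.inl ?_
      have h3 : π t ≤ s := by
        by_contra! h
        linarith [hqmin _ hr h.le]
      rw [le_antisymm (hmono s t hs hst) (hpmax _ hr h3)]
  refine ⟨fun t => γ (π t), ?_, by simp only [hπC 0 le_rfl h0], by
    simp only [hπC 1 zero_le_one h1], fun t ht => ⟨π t, hC01 (hπ t ht.1).1, rfl⟩, ?_⟩
  · refine UniformContinuousOn.continuousOn (Metric.uniformContinuousOn_iff.2 fun ε hε => ?_)
    obtain ⟨δ, hδ, h⟩ := Metric.uniformContinuousOn_iff.1
      ((isCompact_Icc (a := (0 : ℝ)) (b := 1)).uniformContinuousOn_of_continuous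
        hγ.continuousOn) ε hε
    refine ⟨δ, hδ, fun s hs t ht hst => ?_⟩
    wlog hle : s ≤ t generalizing s t
    · rw [dist_comm]
      exact this t ht s hs (by rwa [dist_comm]) (le_of_not_ge hle)
    rw [Real.dist_eq, abs_sub_comm, abs_of_nonneg (by linarith)] at hst
    rcases key s t hs.1 hle ht.2 with h' | ⟨s', hs', t', ht', e1, e2⟩
    · simpa [h'] using hε
    · simp only [e1, e2]
      refine h s' ⟨hs.1.trans hs'.1, hs'.2.trans ht.2⟩ t' ⟨hs.1.trans ht'.1, ht'.2.trans ht.2⟩ ?_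
      rw [Real.dist_eq, abs_lt]
      constructor <;> linarith [hs'.1, hs'.2, ht'.1, ht'.2]
  · intro s u t hs hsu hut ht hst
    have h3 := hmono s u hs hsu
    have h4 := hmono u t (hs.trans hsu) hut
    rcases (h3.trans h4).eq_or_lt with h | h
    · simp only [le_antisymm (h4.trans h.ge) h3]
    · rcases hmin _ (hπ s hs).1 _ (hπ t (hs.trans (hsu.trans hut))).1 h hst _
        (hπ u (hs.trans hsu)).1 with h5 | h5
      · simp only [le_antisymm h5 h3]
      · simp only [le_antisymm h4 h5]
        exact hst.symm

end Skeleton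

end CurtisNhu

namespace CurtisNhu

section Arc

variable {X : Type*} [MetricSpace X]

/-- A path whose point preimages are intervals factors through an injective path. -/
theorem exists_arc_of_monotone {g : ℝ → X} (hg : Continuous g) (hne : g 0 ≠ g 1)
    (hmono : ∀ s u t, 0 ≤ s → s ≤ u → u ≤ t → t ≤ 1 → g s = g t → g u = g s) :
    ∃ J : ℝ → X, Continuous J ∧ InjOn J (Icc 0 1) ∧ J 0 = g 0 ∧ J 1 = g 1 ∧
      ∀ t, J t ∈ g '' Icc 0 1 := by
  let r : ℕ → ℝ := denseSeq ℝ
  let f : ℕ → ℝ → ℝ := fun k u => min 1 (dist (g (max u (r k))) (g (r k)))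
  have hf : ∀ k, Continuous (f k) := fun k => by fun_prop
  have hf0 : ∀ k u, 0 ≤ f k u := fun k u => le_min zero_le_one dist_nonneg
  have hf1 : ∀ k u, f k u ≤ 1 := fun k u => min_le_left _ _
  let S : ℕ → ℝ → ℝ := fun k t => sSup ((fun u => f k (u * t)) '' Icc (0 : ℝ) 1)
  have hS : ∀ k, Continuous (S k) := fun k =>
    isCompact_Icc.continuous_sSup (f := fun t u => f k (u * t))
      ((hf k).comp (continuous_snd.mul continuous_fst))
  have hbdd : ∀ k t, BddAbove ((fun u => f k (u * t)) '' Icc (0 : ℝ) 1) := fun k t =>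
    ⟨1, by rintro _ ⟨u, -, rfl⟩; exact hf1 k _⟩
  have hnon : ∀ k t, ((fun u => f k (u * t)) '' Icc (0 : ℝ) 1).Nonempty := fun k t =>
    ⟨_, 0, ⟨le_rfl, zero_le_one⟩, rfl⟩
  have hle : ∀ k t v, 0 ≤ v → v ≤ t → f k v ≤ S k t := fun k t v h0 hv => by
    rcases (h0.trans hv).eq_or_lt with h | h
    · refine le_csSup (hbdd k t) ⟨0, ⟨le_rfl, zero_le_one⟩, ?_⟩
      have : v = 0 := by linarith
      simp [this]
    · refine le_csSup (hbdd k t) ⟨v / t, ⟨by positivity, (div_le_one h).2 hv⟩, ?_⟩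
      change f k (v / t * t) = _
      rw [div_mul_cancel₀ _ h.ne']
  have hge : ∀ k t c, 0 ≤ t → (∀ v, 0 ≤ v → v ≤ t → f k v ≤ c) → S k t ≤ c := fun k t c ht h => by
    refine csSup_le (hnon k t) ?_
    rintro _ ⟨u, hu, rfl⟩
    exact h _ (mul_nonneg hu.1 ht) (mul_le_of_le_one_left ht hu.2)
  have hS0 : ∀ k t, 0 ≤ S k t := fun k t =>
    (hf0 k _).trans (le_csSup (hbdd k t) ⟨0, ⟨le_rfl, zero_le_one⟩, rfl⟩)
  have hS1 : ∀ k t, S k t ≤ 1 := fun k t => csSup_le (hnon k t) (by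
    rintro _ ⟨u, -, rfl⟩; exact hf1 k _)
  have hSm : ∀ k s t, 0 ≤ s → s ≤ t → S k s ≤ S k t := fun k s t hs hst =>
    hge k s _ hs fun v h0 hv => hle k t v h0 (hv.trans hst)
  let φ : ℝ → ℝ := fun t => ∑' k, (1 / 2 : ℝ) ^ k * S k t
  have hsum : ∀ t, Summable fun k => (1 / 2 : ℝ) ^ k * S k t := fun t =>
    Summable.of_nonneg_of_le (fun k => mul_nonneg (by positivity) (hS0 k t))
      (fun k => mul_le_of_le_one_right (by positivity) (hS1 k t)) summable_geometric_two
  have hφ : Continuous φ := continuous_tsum (fun k => continuous_const.mul (hS k))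
    summable_geometric_two fun k t => by
      rw [Real.norm_of_nonneg (mul_nonneg (by positivity) (hS0 k t))]
      exact mul_le_of_le_one_right (by positivity) (hS1 k t)
  have hφm : ∀ s t, 0 ≤ s → s ≤ t → φ s ≤ φ t := fun s t hs hst =>
    (hsum s).tsum_le_tsum (fun k => mul_le_mul_of_nonneg_left (hSm k s t hs hst) (by positivity))
      (hsum t)
  have hlt : ∀ s t, 0 ≤ s → s ≤ t → t ≤ 1 → g s ≠ g t → φ s < φ t := by
    intro s t hs hst ht hgst
    have hst' : s < t := lt_of_le_of_ne hst fun h => hgst (by rw [h])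
    obtain ⟨u, ⟨hsu, hut⟩, hgu⟩ : ∃ u ∈ Ioo s t, g u ≠ g t := by
      by_contra! h
      have : g =ᶠ[𝓝[>] s] fun _ => g t := by
        filter_upwards [Ioo_mem_nhdsGT hst'] with u hu using h u hu
      exact hgst (tendsto_nhds_unique (hg.continuousAt.tendsto.mono_left nhdsWithin_le_nhds)
        (tendsto_const_nhds.congr' this.symm))
    have hopen : IsOpen (Ioo s t ∩ g ⁻¹' {g t}ᶜ) :=
      isOpen_Ioo.inter (isOpen_compl_singleton.preimage hg)
    obtain ⟨k, ⟨hk1, hk2⟩, hk3⟩ := (denseRange_denseSeq ℝ).exists_mem_open hopen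
      ⟨u, ⟨hsu, hut⟩, hgu⟩
    have h0 : S k s ≤ 0 := hge k s 0 hs fun v _ hv => by
      have : max v (r k) = r k := max_eq_right (hv.trans hk1.le)
      simp [f, this]
    have h1 : 0 < S k t := lt_of_lt_of_le (lt_min zero_lt_one (dist_pos.2 (by
      rw [max_eq_left hk2.le]; exact fun h => hk3 h.symm))) (hle k t t (hs.trans hst) le_rfl)
    exact (hsum s).tsum_lt_tsum (i := k) (fun i =>
      mul_le_mul_of_nonneg_left (hSm i s t hs hst) (by positivity))
      (mul_lt_mul_of_pos_left (h0.trans_lt h1) (by positivity)) (hsum t)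
  have heq : ∀ s t, 0 ≤ s → s ≤ t → t ≤ 1 → g s = g t → φ s = φ t := by
    intro s t hs hst ht hgst
    have : ∀ k, S k s = S k t := fun k => le_antisymm (hSm k s t hs hst)
      (hge k t _ (hs.trans hst) fun v h0 hv => by
        rcases le_total v s with hvs | hsv
        · exact hle k s v h0 hvs
        · refine le_trans (le_of_eq ?_) (hle k s s hs le_rfl)
          have h2 := hmono s v t hs hsv hv ht hgst
          simp only [f]
          rcases le_total (r k) s with h3 | h3
          · rw [max_eq_left h3, max_eq_left (h3.trans hsv), h2]
          · rcases le_total (r k) v with h4 | h4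
            · rw [max_eq_left h4, max_eq_right h3, h2,
                hmono s (r k) t hs h3 (h4.trans hv) ht hgst]
            · rw [max_eq_right h4, max_eq_right h3])
    simp only [φ, this]
  have h01 : 0 < φ 1 - φ 0 := sub_pos.2 (hlt 0 1 le_rfl zero_le_one le_rfl hne)
  let P : ℝ → ℝ := fun t => (φ t - φ 0) / (φ 1 - φ 0)
  have hP : Continuous P := (hφ.sub continuous_const).div_const _
  have hPiff : ∀ s ∈ Icc (0 : ℝ) 1, ∀ t ∈ Icc (0 : ℝ) 1, (P s = P t ↔ g s = g t) := by
    intro s hs t ht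
    wlog hst : s ≤ t generalizing s t
    · rw [eq_comm, this t ht s hs (le_of_not_ge hst), eq_comm]
    simp only [P, div_left_inj' h01.ne', sub_left_inj]
    refine ⟨fun h => ?_, heq s t hs.1 hst ht.2⟩
    by_contra hne
    exact (hlt s t hs.1 hst ht.2 hne).ne h
  have hPmem : ∀ t ∈ Icc (0 : ℝ) 1, P t ∈ Icc (0 : ℝ) 1 := fun t ht =>
    ⟨div_nonneg (sub_nonneg.2 (hφm 0 t le_rfl ht.1)) h01.le,
      (div_le_one h01).2 (sub_le_sub_right (hφm t 1 ht.1 ht.2) _)⟩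
  have hP0 : P 0 = 0 := by simp [P]
  have hP1 : P 1 = 1 := div_self h01.ne'
  let Q : Icc (0 : ℝ) 1 → Icc (0 : ℝ) 1 := fun t => ⟨P t, hPmem t t.2⟩
  have hQ : Continuous Q := (hP.comp continuous_subtype_val).subtype_mk _
  have hQs : Function.Surjective Q := fun y => by
    have h := intermediate_value_Icc zero_le_one hP.continuousOn
    rw [hP0, hP1] at h
    obtain ⟨t, ht, h⟩ := h y.2
    exact ⟨⟨t, ht⟩, Subtype.ext h⟩
  have hquot : Topology.IsQuotientMap Q := .of_surjective_continuous hQs hQ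
  choose R hR using hQs
  have hRP : ∀ y, P (R y) = y := fun y => congrArg Subtype.val (hR y)
  have hgR : ∀ t : Icc (0 : ℝ) 1, g (R (Q t)) = g t := fun t =>
    (hPiff _ (R (Q t)).2 _ t.2).1 (hRP (Q t))
  have hJ : Continuous fun y => g (R y) := hquot.continuous_iff.2
    ((hg.comp continuous_subtype_val).congr fun t => (hgR t).symm)
  refine ⟨IccExtend zero_le_one fun y => g (R y), hJ.Icc_extend', ?_, ?_, ?_, fun t =>
    ⟨_, (R _).2, rfl⟩⟩
  · intro s hs t ht h
    rw [IccExtend_of_mem _ _ hs, IccExtend_of_mem _ _ ht, ← hPiff _ (R _).2 _ (R _).2, hRP,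
      hRP] at h
    exact h
  · rw [IccExtend_of_mem _ _ ⟨le_rfl, zero_le_one⟩, ← hPiff _ (R _).2 _ ⟨le_rfl, zero_le_one⟩,
      hRP, hP0]
  · rw [IccExtend_of_mem _ _ ⟨zero_le_one, le_rfl⟩, ← hPiff _ (R _).2 _ ⟨zero_le_one, le_rfl⟩,
      hRP, hP1]

/-- Distinct points of a path are joined by an arc inside the path. -/
theorem exists_arc {γ : ℝ → X} (hγ : Continuous γ) (hne : γ 0 ≠ γ 1) :
    ∃ J : ℝ → X, Continuous J ∧ InjOn J (Icc 0 1) ∧ J 0 = γ 0 ∧ J 1 = γ 1 ∧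
      ∀ t, J t ∈ γ '' Icc 0 1 := by
  obtain ⟨g, hg, h0, h1, hsub, hmono⟩ := exists_monotone_path hγ
  let G : ℝ → X := IccExtend zero_le_one fun t : Icc (0 : ℝ) 1 => g t
  have hGe : ∀ t ∈ Icc (0 : ℝ) 1, G t = g t := fun t ht => IccExtend_of_mem _ _ ht
  have i0 : (0 : ℝ) ∈ Icc (0 : ℝ) 1 := ⟨le_rfl, zero_le_one⟩
  have i1 : (1 : ℝ) ∈ Icc (0 : ℝ) 1 := ⟨zero_le_one, le_rfl⟩
  have hG : Continuous G := (continuousOn_iff_continuous_domRestrict.1 hg).Icc_extend'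
  obtain ⟨J, hJ, hJi, hJ0, hJ1, hJs⟩ := exists_arc_of_monotone hG
    (by rwa [hGe 0 i0, hGe 1 i1, h0, h1]) fun s u t hs hsu hut ht h => by
      rw [hGe s ⟨hs, by linarith⟩, hGe t ⟨by linarith, ht⟩] at h
      rw [hGe s ⟨hs, by linarith⟩, hGe u ⟨by linarith, by linarith⟩]
      exact hmono s u t hs hsu hut ht h
  refine ⟨J, hJ, hJi, by rw [hJ0, hGe 0 i0, h0], by rw [hJ1, hGe 1 i1, h1], fun t => ?_⟩
  obtain ⟨s, hs, h⟩ := hJs t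
  rw [← h, hGe s hs]
  exact hsub s hs

/-- Every point of a nontrivial path metric space starts an arc inside a given ball. -/
theorem PathMetric.exists_arc [Nontrivial X] (hX : PathMetric X) (x : X) {r : ℝ} (hr : 0 < r) :
    ∃ J : ℝ → X, Continuous J ∧ InjOn J (Icc 0 1) ∧ J 0 = x ∧ ∀ t, dist (J t) x < r := by
  obtain ⟨y, hy, hyr⟩ : ∃ y, y ≠ x ∧ dist x y < r := by
    obtain ⟨z, hz⟩ := exists_ne x
    obtain ⟨γ, hγ, h0, h1, -⟩ := hX x z (dist x z + 1) (by linarith)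
    by_contra! h
    have hc : IsClopen (γ ⁻¹' {x}) := by
      refine ⟨isClosed_singleton.preimage hγ, ?_⟩
      have : γ ⁻¹' {x} = γ ⁻¹' ball x r := by
        ext t
        refine ⟨fun h' => ?_, fun h' => ?_⟩
        · rw [mem_preimage, mem_singleton_iff] at h'
          simp [h', hr]
        · by_contra h2
          exact (h (γ t) h2).not_gt (mem_ball'.1 h')
      rw [this]
      exact isOpen_ball.preimage hγ
    have := (hc.eq_univ ⟨0, h0⟩ ▸ mem_univ (1 : ℝ) : (1 : ℝ) ∈ γ ⁻¹' {x})
    exact hz (h1 ▸ this)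
  obtain ⟨γ, hγ, h0, h1, hd⟩ := hX x y r hyr
  obtain ⟨J, hJ, hJi, hJ0, -, hJs⟩ := CurtisNhu.exists_arc hγ (by rw [h0, h1]; exact hy.symm)
  refine ⟨J, hJ, hJi, hJ0.trans h0, fun t => ?_⟩
  obtain ⟨s, -, h⟩ := hJs t
  rw [← h, ← h0]
  exact hd s 0

end Arc

end CurtisNhu

namespace CurtisNhu

section Beads

variable {X : Type*} [MetricSpace X]

/-- Disjoint arcs parametrized by `[0, 1]`. -/
structure ArcFamily {n : ℕ} (p : Fin n → ℝ → X) : Prop where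
  continuous : ∀ c, Continuous (p c)
  inj : ∀ c c' s s', s ∈ Icc (0 : ℝ) 1 → s' ∈ Icc (0 : ℝ) 1 → p c s = p c' s' → c = c' ∧ s = s'

theorem PathMetric.exists_arcFamily [Nontrivial X] (hX : PathMetric X) (n : ℕ) (x : X) {r : ℝ}
    (hr : 0 < r) : ∃ p : Fin n → ℝ → X, ArcFamily p ∧ ∀ c s, dist (p c s) x < r := by
  obtain ⟨J, hJ, hJi, -, hJd⟩ := hX.exists_arc x hr
  have hmem : ∀ (c : Fin n) (s : ℝ), s ∈ Icc (0 : ℝ) 1 → (c + s / 2) / n ∈ Icc (0 : ℝ) 1 := by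
    intro c s hs
    have h1 : (c : ℝ) + 1 ≤ n := by exact_mod_cast c.2
    have h2 : (0 : ℝ) ≤ c := by positivity
    refine ⟨div_nonneg (by linarith [hs.1]) (by linarith), (div_le_one (by linarith)).2 ?_⟩
    linarith [hs.2]
  refine ⟨fun c s => J ((c + s / 2) / n), ⟨fun c => by fun_prop, fun c c' s s' hs hs' h => ?_⟩,
    fun c s => hJd _⟩
  have hn : (0 : ℝ) < n := by exact_mod_cast c.pos
  have h1 := (div_left_inj' hn.ne').1 (hJi (hmem c s hs) (hmem c' s' hs') h)
  have h2 : c = c' := by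
    refine le_antisymm ?_ ?_
    · rw [Fin.le_def]
      have : ((c : ℕ) : ℝ) < (c' : ℕ) + 1 := by linarith [hs.1, hs'.2]
      have : (c : ℕ) < c' + 1 := by exact_mod_cast this
      omega
    · rw [Fin.le_def]
      have : ((c' : ℕ) : ℝ) < (c : ℕ) + 1 := by linarith [hs'.1, hs.2]
      have : (c' : ℕ) < c + 1 := by exact_mod_cast this
      omega
  subst h2
  exact ⟨rfl, by linarith⟩

/-- The points `p c (α c * r / M)`, for `r ≤ M`. -/
noncomputable def beads {k : ℕ} (p : Fin (k + 1) → ℝ → X) (M : ℕ) (α : Fin (k + 1) → ℝ) :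
    FinHyp X :=
  ((Finset.univ : Finset (Fin (k + 1))) ×ˢ Finset.range (M + 1)).sup' (by simp)
    fun c => FinHyp.pt (p c.1 (α c.1 * (c.2 / M)))

variable {k : ℕ} {p : Fin (k + 1) → ℝ → X} {M : ℕ} {α : Fin (k + 1) → ℝ}

theorem mem_beads {x : X} : x ∈ (beads p M α).toSet ↔ ∃ c, ∃ r ≤ M, p c (α c * (r / M)) = x := by
  simp only [beads, FinHyp.mem_sup', Finset.mem_product, Finset.mem_univ, true_and,
    Finset.mem_range, FinHyp.toSet_pt, mem_singleton_iff, Prod.exists, Nat.lt_succ_iff]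
  simp only [eq_comm]

theorem continuous_beads (hp : ∀ c, Continuous (p c)) (M : ℕ) :
    Continuous fun α => beads p M α := by
  refine Continuous.finset_sup'_apply _ fun c _ => FinHyp.continuous_pt.comp ((hp c.1).comp ?_)
  fun_prop

theorem exists_beads_subset [DecidableEq X] (p : Fin (k + 1) → ℝ → X) (M : ℕ)
    (α : Fin (k + 1) → ℝ) :
    ∃ N : Finset X, N.card ≤ (k + 1) * (M + 1) ∧ (beads p M α).toSet ⊆ N := by
  refine ⟨((Finset.univ : Finset (Fin (k + 1))) ×ˢ Finset.range (M + 1)).image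
    fun c => p c.1 (α c.1 * (c.2 / M)), Finset.card_image_le.trans (by simp), fun x hx => ?_⟩
  obtain ⟨c, r, hr, h⟩ := mem_beads.1 hx
  simp only [Finset.coe_image, mem_image, Finset.mem_coe, Finset.mem_product, Finset.mem_univ,
    true_and, Finset.mem_range, Prod.exists]
  exact ⟨c, r, Nat.lt_succ_iff.2 hr, h⟩

theorem ratio_mem {r M : ℕ} (h : r ≤ M) : (r / M : ℝ) ∈ Icc (0 : ℝ) 1 :=
  ⟨by positivity, div_le_one_of_le₀ (by exact_mod_cast h) (by positivity)⟩

/-- Beads can be compared in the presence of noise of small cardinality. -/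
theorem ArcFamily.le_of_noise [DecidableEq X] (hp : ArcFamily p) {m : ℕ} {β : Fin (k + 1) → ℝ}
    (hα : ∀ c, α c ∈ Icc (0 : ℝ) 1) (hβ : ∀ c, β c ∈ Icc (0 : ℝ) 1) {N : Finset X}
    (hN : N.card < m) (h : ∀ x ∈ (beads p (2 * m) α).toSet, x ∈ N ∨ x ∈ (beads p (2 * m) β).toSet)
    (c : Fin (k + 1)) (hc : 0 < α c) : 0 < β c ∧ β c ≤ α c := by
  have hm : (0 : ℝ) < (2 * m : ℕ) := by
    have : 0 < m := by omega
    exact_mod_cast (by omega : 0 < 2 * m)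
  have hmul : ∀ (γ : Fin (k + 1) → ℝ), (∀ c, γ c ∈ Icc (0 : ℝ) 1) → ∀ c, ∀ r ≤ 2 * m,
      γ c * (r / (2 * m : ℕ)) ∈ Icc (0 : ℝ) 1 := fun γ hγ c r hr =>
    ⟨mul_nonneg (hγ c).1 (ratio_mem hr).1, mul_le_one₀ (hγ c).2 (ratio_mem hr).1 (ratio_mem hr).2⟩
  obtain ⟨j, hj, h1, h2⟩ : ∃ j < m, p c (α c * ((2 * j + 1 : ℕ) / (2 * m : ℕ))) ∉ N ∧
      p c (α c * ((2 * j + 2 : ℕ) / (2 * m : ℕ))) ∉ N := by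
    by_contra! hcon
    have : ∀ j < m, ∃ e, (e = 2 * j + 1 ∨ e = 2 * j + 2) ∧
        p c (α c * ((e : ℕ) / (2 * m : ℕ))) ∈ N := fun j hj => by
      by_cases h1 : p c (α c * ((2 * j + 1 : ℕ) / (2 * m : ℕ))) ∈ N
      · exact ⟨_, Or.inl rfl, h1⟩
      · exact ⟨_, Or.inr rfl, hcon j hj h1⟩
    choose! e he heN using this
    refine hN.not_ge ?_
    rw [← Finset.card_range m]
    refine Finset.card_le_card_of_injOn (fun j => p c (α c * ((e j : ℕ) / (2 * m : ℕ))))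
      (fun j hj => heN j (by simpa using hj)) fun i hi j hj hij => ?_
    simp only [Finset.coe_range, mem_Iio] at hi hj
    have h3 := (hp.inj _ _ _ _ (hmul α hα c _ (by have := he i hi; omega))
      (hmul α hα c _ (by have := he j hj; omega)) hij).2
    have h4 := (div_left_inj' hm.ne').1 (mul_left_cancel₀ hc.ne' h3)
    have h5 : e i = e j := by exact_mod_cast h4
    have := he i hi
    have := he j hj
    omega
  have key : ∀ r ≤ 2 * m, p c (α c * ((r : ℕ) / (2 * m : ℕ))) ∉ N → ∃ a : ℕ,
      α c * r = β c * a := fun r hr hrN => by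
    obtain ⟨c', a, ha, hca⟩ := mem_beads.1 ((h _ (mem_beads.2 ⟨c, r, hr, rfl⟩)).resolve_left hrN)
    obtain ⟨rfl, h3⟩ := hp.inj _ _ _ _ (hmul β hβ c' a ha) (hmul α hα c r hr) hca
    refine ⟨a, ?_⟩
    rw [← mul_div_assoc, ← mul_div_assoc, div_left_inj' hm.ne'] at h3
    exact h3.symm
  obtain ⟨a, ha⟩ := key _ (by omega) h1
  obtain ⟨b, hb⟩ := key _ (by omega) h2
  push_cast at ha hb
  have hab : α c = β c * ((b : ℤ) - (a : ℤ) : ℤ) := by push_cast; linarith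
  have hβ0 : 0 < β c := lt_of_le_of_ne (hβ c).1 fun h0 => by
    rw [← h0, zero_mul] at hab; exact hc.ne' hab
  have h6 : (0 : ℝ) < ((b : ℤ) - (a : ℤ) : ℤ) := by
    by_contra! h7
    have := mul_nonpos_of_nonneg_of_nonpos hβ0.le h7
    linarith
  have h7 : (1 : ℝ) ≤ ((b : ℤ) - (a : ℤ) : ℤ) := by
    have : (1 : ℤ) ≤ (b : ℤ) - a := by
      have : (0 : ℤ) < (b : ℤ) - (a : ℤ) := by exact_mod_cast h6
      omega
    exact_mod_cast this
  exact ⟨hβ0, by rw [hab]; exact le_mul_of_one_le_right hβ0.le h7⟩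

/-- Finite sets encoded by beads with rapidly growing cardinalities, up to noise, can be decoded. -/
theorem decode_beads {M : Type*} {p : ℕ → Fin (k + 1) → ℝ → X} (hp : ∀ i, ArcFamily (p i))
    {q B : ℕ → ℕ} (hq : ∀ i, ∑ j ∈ Finset.range (i + 1), B j +
      ∑ j ∈ Finset.range i, (k + 1) * (2 * 2 ^ q j + 1) < 2 ^ q i)
    {α : ℕ → M → Fin (k + 1) → ℝ} (hα : ∀ i m c, α i m c ∈ Icc (0 : ℝ) 1)
    (hα0 : ∀ i m c c', 0 < α i m c → 0 < α i m c')
    {F : M → FinHyp X} {W : M → Finset X} (hW : ∀ i m, 0 < α i m 0 → (W m).card ≤ B i)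
    (hfin : ∀ m, {i | 0 < α i m 0}.Finite) (hne : ∀ m, ∃ i, 0 < α i m 0)
    (hF : ∀ m, ∀ x ∈ (F m).toSet, x ∈ W m ∨
      ∃ j, 0 < α j m 0 ∧ x ∈ (beads (p j) (2 * 2 ^ q j) (α j m)).toSet)
    (hF' : ∀ m i, 0 < α i m 0 → beads (p i) (2 * 2 ^ q i) (α i m) ≤ F m) {x y : M}
    (hxy : F x = F y) : ∃ i, 0 < α i x 0 ∧ α i x = α i y := by
  classical
  have hmax : ∀ m, ∃ i, 0 < α i m 0 ∧ ∀ j, 0 < α j m 0 → j ≤ i := fun m => by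
    obtain ⟨i, hi, h⟩ := exists_max_image _ id (hfin m) (hne m)
    exact ⟨i, hi, h⟩
  have hnoise : ∀ m i, (∀ j, 0 < α j m 0 → j ≤ i) → ∃ N : Finset X, N.card < 2 ^ q i ∧
      ∀ z ∈ (F m).toSet, z ∈ N ∨ z ∈ (beads (p i) (2 * 2 ^ q i) (α i m)).toSet := by
    intro m i hi
    choose D hD hD' using fun j => exists_beads_subset (p j) (2 * 2 ^ q j) (α j m)
    refine ⟨W m ∪ (Finset.range i).biUnion D, ?_, fun z hz => ?_⟩
    · obtain ⟨l, hl⟩ := hne m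
      refine lt_of_le_of_lt ((Finset.card_union_le _ _).trans (add_le_add ?_ ?_)) (hq i)
      · exact (hW l m hl).trans (Finset.single_le_sum (f := B) (fun _ _ => Nat.zero_le _)
          (Finset.mem_range.2 (Nat.lt_succ_iff.2 (hi l hl))))
      · exact Finset.card_biUnion_le.trans (Finset.sum_le_sum fun j _ => hD j)
    · rcases hF m z hz with h | ⟨j, hj, h⟩
      · exact Or.inl (Finset.mem_union_left _ h)
      · rcases (hi j hj).eq_or_lt with rfl | hlt
        · exact Or.inr h
        · exact Or.inl (Finset.mem_union_right _ (Finset.mem_biUnion.2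
            ⟨j, Finset.mem_range.2 hlt, hD' j h⟩))
  have hle : ∀ x y, F x = F y → ∀ i, 0 < α i x 0 → (∀ j, 0 < α j y 0 → j ≤ i) → ∀ c,
      0 < α i y c ∧ α i y c ≤ α i x c := by
    intro x y hxy i hi hiy c
    obtain ⟨N, hN, hz⟩ := hnoise y i hiy
    refine (hp i).le_of_noise (hα i x) (hα i y) hN (fun z h => hz z ?_) c (hα0 i x 0 c hi)
    rw [← hxy]
    exact hF' x i hi h
  obtain ⟨i, hi, himax⟩ := hmax x
  obtain ⟨j, hj, hjmax⟩ := hmax y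
  wlog hji : j ≤ i generalizing x y i j
  · obtain ⟨l, h1, h2⟩ := this hxy.symm j hj hjmax i hi himax (le_of_not_ge hji)
    exact ⟨l, h2 ▸ h1, h2.symm⟩
  have h1 := hle x y hxy i hi fun l hl => (hjmax l hl).trans hji
  have h2 := hle y x hxy.symm i (h1 0).1 himax
  exact ⟨i, hi, funext fun c => le_antisymm (h2 c).2 (h1 c).2⟩

/-- Sufficiently fine beads are not contained in any of a compact family of finite sets. -/
theorem ArcFamily.exists_not_mem (hp : ArcFamily p) {Z : Type*} [TopologicalSpace Z] {L : Set Z}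
    (hL : IsCompact L) {F : Z → FinHyp X} (hF : ContinuousOn F L) (c : Fin (k + 1)) :
    ∃ q₀, ∀ q ≥ q₀, ∀ l ∈ L, ∃ r : ℕ, r ≤ 2 * 2 ^ q ∧ p c (r / (2 * 2 ^ q : ℕ)) ∉ (F l).toSet := by
  refine hL.induction_on (p := fun S => ∃ q₀, ∀ q ≥ q₀, ∀ l ∈ S, ∃ r : ℕ, r ≤ 2 * 2 ^ q ∧
    p c (r / (2 * 2 ^ q : ℕ)) ∉ (F l).toSet) ⟨0, by simp⟩
    (fun S S' h ⟨m, hm⟩ => ⟨m, fun q hq l hl => hm q hq l (h hl)⟩)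
    (fun S S' ⟨m, hm⟩ ⟨m', hm'⟩ => ⟨max m m', fun q hq l hl => ?_⟩) fun l hl => ?_
  · rcases hl with hl | hl
    · exact hm q (le_of_max_le_left hq) l hl
    · exact hm' q (le_of_max_le_right hq) l hl
  · obtain ⟨q₀, r₀, hr₀, hpr⟩ : ∃ q₀, ∃ r : ℕ, r ≤ 2 * 2 ^ q₀ ∧
        p c (r / (2 * 2 ^ q₀ : ℕ)) ∉ (F l).toSet := by
      by_contra! hcon
      set n := (F l).toSet_finite.toFinset.card with hn
      have h1 : n < 2 * 2 ^ n + 1 := by have := n.lt_two_pow_self; omega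
      refine h1.not_ge ?_
      rw [← Finset.card_range (2 * 2 ^ n + 1), hn]
      refine Finset.card_le_card_of_injOn (fun r : ℕ => p c (r / (2 * 2 ^ n : ℕ)))
        (fun r hr => by
          simpa using hcon n r (by simpa [Nat.lt_succ_iff] using hr)) fun r hr s hs h => ?_
      have h2 := (hp.inj _ _ _ _ (ratio_mem (Nat.lt_succ_iff.1 (Finset.mem_range.1 hr)))
        (ratio_mem (Nat.lt_succ_iff.1 (Finset.mem_range.1 hs))) h).2
      have h3 := (div_left_inj' (by positivity)).1 h2
      exact_mod_cast h3
    set w := p c (r₀ / (2 * 2 ^ q₀ : ℕ))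
    obtain ⟨ρ, hρ, hρd⟩ := Metric.isOpen_iff.1 (F l).toSet_finite.isClosed.isOpen_compl w hpr
    have h1 : ∀ᶠ x in 𝓝[L] l, dist (F x) (F l) < ρ := (hF l hl).eventually (ball_mem_nhds _ hρ)
    refine ⟨_, h1, q₀, fun q hq x hx => ⟨r₀ * 2 ^ (q - q₀), ?_, fun hmem => ?_⟩⟩
    · calc r₀ * 2 ^ (q - q₀) ≤ 2 * 2 ^ q₀ * 2 ^ (q - q₀) := Nat.mul_le_mul_right _ hr₀
        _ = 2 * 2 ^ q := by rw [mul_assoc, ← pow_add, Nat.add_sub_cancel' hq]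
    · have e : ((r₀ * 2 ^ (q - q₀) : ℕ) : ℝ) / (2 * 2 ^ q : ℕ) = r₀ / (2 * 2 ^ q₀ : ℕ) := by
        rw [← Nat.add_sub_cancel' hq, Nat.add_sub_cancel_left, pow_add]
        push_cast
        field_simp
      rw [e] at hmem
      obtain ⟨b, hb, hbd⟩ := ((FinHyp.dist_lt_iff hρ).1 hx).1 w hmem
      exact hρd (mem_ball'.2 hbd) hb

end Beads

end CurtisNhu

namespace CurtisNhu

section

variable {X : Type*} [MetricSpace X]

theorem ncard_trail_le {ι : Type*} [Fintype ι] [Nonempty ι] (A : FinHyp X) (γ : ι → ℝ → X) (N : ℕ)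
    (t : ℝ) : (trail A γ N t).toSet.ncard ≤ A.toSet.ncard + Fintype.card ι * (N + 1) := by
  classical
  have h : (trail A γ N t).toSet = A.toSet ∪ (((Finset.univ ×ˢ Finset.range (N + 1)).image
      fun p : ι × ℕ => γ p.1 (trailTime N t p.2) : Finset X) : Set X) := by
    ext x
    simp only [mem_trail, mem_union, Finset.coe_image, mem_image, Finset.mem_coe,
      Finset.mem_product, Finset.mem_univ, true_and, Finset.mem_range, Prod.exists,
      Nat.lt_succ_iff, eq_comm]
  rw [h]
  refine (ncard_union_le _ _).trans (add_le_add_right ?_ _)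
  rw [ncard_coe_finset]
  exact Finset.card_image_le.trans (by simp)

/-- Close finite sets are joined by a small path of finite sets of bounded cardinality. -/
theorem PathMetric.exists_path_ncard_le (hX : PathMetric X) {A C : FinHyp X} {R : ℝ}
    (h : dist A C < R) : ∃ (n : ℕ) (γ : ℝ → FinHyp X), Continuous γ ∧ γ 0 = A ∧ γ 1 = C ∧
      ∀ t, dist (γ t) C < R ∧ (γ t).toSet.ncard ≤ n := by
  obtain ⟨ι, _, _, γ, g1, g2, g3, g4, g5, g6⟩ := hX.exists_paths h
  set n := A.toSet.ncard + C.toSet.ncard + Fintype.card ι * (1 + 1)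
  have h1 : JoinedIn {Z : FinHyp X | dist Z C < R ∧ Z.toSet.ncard ≤ n} A (trail A γ 1 1) :=
    joinedIn_trail g1 g2 fun t => ⟨dist_trail_lt h g6 t, (ncard_trail_le _ _ _ _).trans (by omega)⟩
  have h2 : JoinedIn {Z : FinHyp X | dist Z C < R ∧ Z.toSet.ncard ≤ n} C
      (trail C (fun k t => γ k (1 - t)) 1 1) :=
    joinedIn_trail (fun k => (g1 k).comp (by fun_prop)) (fun k => by simpa using g3 k) fun t =>
      ⟨dist_trail_lt (by simpa using dist_nonneg.trans_lt h) (fun k t => g6 k _) t,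
        (ncard_trail_le _ _ _ _).trans (by omega)⟩
  have h3 : trail A γ 1 1 = trail C (fun k t => γ k (1 - t)) 1 1 := by
    refine FinHyp.ext (Set.ext fun x => ?_)
    simp only [mem_trail_one]
    constructor
    · rintro (hx | ⟨k, j, hj, rfl⟩)
      · obtain ⟨k, rfl⟩ := g4 x hx
        exact Or.inr ⟨k, 1, le_rfl, by simp⟩
      · exact Or.inr ⟨k, 1 - j, Nat.sub_le _ _, by rw [Nat.cast_sub hj]; simp⟩
    · rintro (hx | ⟨k, j, hj, rfl⟩)
      · obtain ⟨k, rfl⟩ := g5 x hx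
        exact Or.inr ⟨k, 1, le_rfl, by simp⟩
      · exact Or.inr ⟨k, 1 - j, Nat.sub_le _ _, by rw [Nat.cast_sub hj]; simp⟩
  have h4 := h1.trans (h3 ▸ h2.symm)
  refine ⟨n, h4.somePath.extend, h4.somePath.continuous_extend, h4.somePath.extend_zero,
    h4.somePath.extend_one, fun t => ?_⟩
  exact h4.somePath_mem _

theorem exists_rapid (k : ℕ) (B q₀ : ℕ → ℕ) : ∃ q : ℕ → ℕ, (∀ i, q₀ i ≤ q i) ∧
    ∀ i, ∑ j ∈ Finset.range (i + 1), B j +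
      ∑ j ∈ Finset.range i, (k + 1) * (2 * 2 ^ q j + 1) < 2 ^ q i := by
  let Q : ℕ → ℕ → ℕ := fun i t => q₀ i + (∑ j ∈ Finset.range (i + 1), B j + t)
  let T : ℕ → ℕ := fun i => Nat.rec 0 (fun i t => t + (k + 1) * (2 * 2 ^ Q i t + 1)) i
  have hT : ∀ i, T i = ∑ j ∈ Finset.range i, (k + 1) * (2 * 2 ^ Q j (T j) + 1) := fun i => by
    induction i with
    | zero => rfl
    | succ i ih => rw [Finset.sum_range_succ, ← ih]
  refine ⟨fun i => Q i (T i), fun i => Nat.le_add_right _ _, fun i => ?_⟩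
  rw [← hT]
  refine lt_of_lt_of_le Nat.lt_two_pow_self (Nat.pow_le_pow_right two_pos ?_)
  exact Nat.le_add_left _ _

theorem beads_zero {k : ℕ} (p : Fin (k + 1) → ℝ → X) (M : ℕ) : beads p M 0 = beads p 0 0 := by
  refine FinHyp.ext (Set.ext fun x => ?_)
  simp only [mem_beads, Pi.zero_apply, zero_mul]
  exact exists_congr fun c => ⟨fun ⟨r, _, h⟩ => ⟨0, le_rfl, h⟩, fun ⟨r, _, h⟩ => ⟨0, Nat.zero_le _, h⟩⟩

theorem dist_sup_beads_lt {k : ℕ} {p : Fin (k + 1) → ℝ → X} {A : FinHyp X} {a : X}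
    (ha : a ∈ A.toSet) {r : ℝ} (hr : 0 < r) (hp : ∀ c s, dist (p c s) a < r) (M : ℕ)
    (α : Fin (k + 1) → ℝ) : dist (A ⊔ beads p M α) A < r := by
  rw [FinHyp.dist_lt_iff hr]
  refine ⟨?_, fun b hb => ⟨b, Or.inl hb, by simpa using hr⟩⟩
  rintro x (hx | hx)
  · exact ⟨x, hx, by simpa using hr⟩
  · obtain ⟨c, s, -, rfl⟩ := mem_beads.1 hx
    exact ⟨a, ha, hp _ _⟩

end

end CurtisNhu

namespace CurtisNhu

section

variable {X : Type*} [MetricSpace X]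

theorem PathMetric.exists_bead_map [Nontrivial X] (hX : PathMetric X) {M Z : Type*} [MetricSpace M]
    [SecondCountableTopology M] [Nonempty M] {k : ℕ} {code : M → Fin (k + 1) → ℝ}
    (hcode : Continuous code) (hcode' : ∀ m c, 1 / 2 ≤ code m c ∧ code m c ≤ 1)
    (hlast : ∀ m, code m (Fin.last k) = 1) {F : M → FinHyp X} (hF : Continuous F) {e : M → ℝ}
    (he : Continuous e) (he0 : ∀ m, 0 < e m) (hC : ∀ r > 0, IsCompact {y | r ≤ e y})
    [TopologicalSpace Z] {L : Set Z} (hL : IsCompact L) {F₀ : Z → FinHyp X}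
    (hF₀ : ContinuousOn F₀ L) :
    ∃ G : M → FinHyp X, Continuous G ∧ (∀ m, dist (G m) (F m) < e m) ∧
      (∀ x y, G x = G y → code x = code y) ∧ ∀ x, ∀ l ∈ L, G x ≠ F₀ l := by
  classical
  let U : M → Set M := fun x => {y | dist (F y) (F x) < e x / 16 ∧ e x / 2 < e y}
  have hUo : ∀ x, IsOpen (U x) := fun x =>
    (isOpen_lt (hF.dist continuous_const) continuous_const).inter (isOpen_lt continuous_const he)
  have hUx : ∀ x, x ∈ U x := fun x => ⟨by simpa using he0 x, by linarith [he0 x]⟩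
  obtain ⟨s, hs, hsU⟩ := TopologicalSpace.countable_cover_nhds fun x => (hUo x).mem_nhds (hUx x)
  have hsne : s.Nonempty := by
    obtain ⟨m⟩ := ‹Nonempty M›
    obtain ⟨x, hx, -⟩ := mem_iUnion₂.1 (hsU ▸ mem_univ m : m ∈ ⋃ x ∈ s, U x)
    exact ⟨x, hx⟩
  obtain ⟨g, rfl⟩ := hs.exists_eq_range hsne
  obtain ⟨f, hf⟩ := PartitionOfUnity.exists_isSubordinate isClosed_univ (fun i => U (g i))
    (fun i => hUo _) (by rw [← hsU, biUnion_range])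
  have hfU : ∀ i m, 0 < f i m → m ∈ U (g i) := fun i m h =>
    hf i (subset_tsupport _ (Function.mem_support.2 h.ne'))
  have hnb : ∀ i, {j | (Function.support (f j) ∩ {y | e (g i) / 2 ≤ e y}).Nonempty}.Finite :=
    fun i => f.locallyFinite.finite_nonempty_inter_compact (hC _ (by linarith [he0 (g i)]))
  let Nb : ℕ → Finset ℕ := fun i => (hnb i).toFinset
  have hNb : ∀ i j m, 0 < f i m → 0 < f j m → j ∈ Nb i := fun i j m h1 h2 =>
    (hnb i).mem_toFinset.2 ⟨m, Function.mem_support.2 h2.ne', (hfU i m h1).2.le⟩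
  choose a ha using fun i => (F (g i)).toSet_nonempty
  have he16 : ∀ i, 0 < e (g i) / 16 := fun i => by linarith [he0 (g i)]
  choose p hp hpd using fun i => hX.exists_arcFamily (k + 1) (a i) (he16 i)
  let v : ℕ → FinHyp X := fun i => F (g i) ⊔ beads (p i) 0 0
  have hv : ∀ i, dist (v i) (F (g i)) < e (g i) / 16 := fun i =>
    dist_sup_beads_lt (ha i) (he16 i) (hpd i) _ _
  have hpath : ∀ i j, ∃ (n : ℕ) (γ : ℝ → FinHyp X), Continuous γ ∧ γ 0 = v i ∧ γ 1 = v j ∧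
      ∀ t, dist (γ t) (v j) < dist (v i) (v j) + e (g i) / 16 ∧ (γ t).toSet.ncard ≤ n :=
    fun i j => hX.exists_path_ncard_le (by linarith [he16 i])
  choose n γ hγ hγ0 hγ1 hγd using hpath
  let B : ℕ → ℕ := fun i => ∑ j ∈ Nb i, ((v j).toSet.ncard + ∑ l ∈ Nb i, n j l)
  choose q₀ hq₀ using fun i => (hp i).exists_not_mem hL hF₀ (Fin.last k)
  obtain ⟨q, hq, hqB⟩ := exists_rapid k B q₀
  let h : ℕ → ℝ → M → FinHyp X := fun i t m =>
    F (g i) ⊔ beads (p i) (2 * 2 ^ q i) (fun c => t * code m c)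
  have hh : ∀ i, Continuous fun z : ℝ × M => h i z.1 z.2 := fun i =>
    continuous_const.sup ((continuous_beads (hp i).continuous _).comp (continuous_pi fun c =>
      continuous_fst.mul ((continuous_apply c).comp (hcode.comp continuous_snd))))
  have hh0 : ∀ i m, h i 0 m = v i := fun i m => by
    have : (fun c => 0 * code m c) = 0 := funext fun c => zero_mul _
    simp only [h, v, this, beads_zero (p i) (2 * 2 ^ q i)]
  obtain ⟨G, μ, hG, hμ0, hμ1, -, hμe, hμf, hμG, hGP⟩ :=
    exists_nerve_map f v γ hγ hγ0 hγ1 h hh hh0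
  choose P Q hP hQ s hPf hQf hGeq using hGP
  let α : ℕ → M → Fin (k + 1) → ℝ := fun i m c => μ i m * code m c
  have hcode0 : ∀ m c, 0 < code m c := fun m c => by linarith [(hcode' m c).1]
  have hα : ∀ i m c, α i m c ∈ Icc (0 : ℝ) 1 := fun i m c =>
    ⟨mul_nonneg (hμ0 i m) (hcode0 m c).le, mul_le_one₀ (hμ1 i m) (hcode0 m c).le (hcode' m c).2⟩
  have hαμ : ∀ i m c, 0 < α i m c ↔ 0 < μ i m := fun i m c => mul_pos_iff_of_pos_right (hcode0 m c)
  have hbG : ∀ m i, 0 < α i m 0 → beads (p i) (2 * 2 ^ q i) (α i m) ≤ G m := fun m i hi =>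
    le_sup_right.trans (hμG i m ((hαμ i m 0).1 hi))
  refine ⟨G, hG, fun y => ?_, fun x y hxy => ?_, fun x l hl hxl => ?_⟩
  · have hnear : ∀ i, 0 < f i y → e (g i) / 16 < e y / 8 ∧ dist (F (g i)) (F y) < e y / 8 :=
      fun i hi => by
        obtain ⟨h1, h2⟩ := hfU i y hi
        rw [dist_comm] at h1
        constructor <;> linarith
    have hvy : ∀ i, 0 < f i y → dist (v i) (F y) < e y / 4 := fun i hi => by
      obtain ⟨h1, h2⟩ := hnear i hi
      linarith [dist_triangle (v i) (F (g i)) (F y), hv i]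
    rw [hGeq y]
    refine Finset.sup'_induction (hP y) _ (p := fun z => dist z (F y) < e y)
      (fun a ha b hb => dist_sup_lt ha hb) fun i hi => ?_
    have hi' := hPf y i hi
    obtain ⟨h1, h2⟩ := hnear i hi'
    have h3 := he0 y
    refine dist_sup_lt (dist_sup_lt (by linarith [hvy i hi']) ?_) ?_
    · have : dist (h i (μ i y) y) (F (g i)) < e (g i) / 16 :=
        dist_sup_beads_lt (ha i) (he16 i) (hpd i) _ _
      linarith [dist_triangle (h i (μ i y) y) (F (g i)) (F y)]
    · refine Finset.sup'_induction (hQ y) _ (p := fun z => dist z (F y) < e y)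
        (fun a ha b hb => dist_sup_lt ha hb) fun j hj => ?_
      have h4 := hvy i hi'
      have h5 := hvy j (hQf y j hj)
      have h6 := (hγd i j (s y i j)).1
      linarith [dist_triangle (γ i j (s y i j)) (v j) (F y), dist_triangle_right (v i) (v j) (F y)]
  · let W : M → Finset X := fun m => (P m).biUnion fun j => (v j).toSet_finite.toFinset ∪
      (Q m).biUnion fun l => (γ j l (s m j l)).toSet_finite.toFinset
    have hW : ∀ i m, 0 < α i m 0 → (W m).card ≤ B i := fun i m hi => by
      have hi' := hμf i m ((hαμ i m 0).1 hi)
      have hPN : P m ⊆ Nb i := fun j hj => hNb i j m hi' (hPf m j hj)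
      have hQN : Q m ⊆ Nb i := fun j hj => hNb i j m hi' (hQf m j hj)
      refine Finset.card_biUnion_le.trans ((Finset.sum_le_sum fun j _ => ?_).trans
        (Finset.sum_le_sum_of_subset hPN))
      refine (Finset.card_union_le _ _).trans (add_le_add ?_ ?_)
      · rw [ncard_eq_toFinset_card _ (v j).toSet_finite]
      · refine Finset.card_biUnion_le.trans ((Finset.sum_le_sum fun l _ => ?_).trans
          (Finset.sum_le_sum_of_subset hQN))
        rw [← ncard_eq_toFinset_card _ (γ j l (s m j l)).toSet_finite]
        exact (hγd j l _).2
    have hGW : ∀ m, ∀ z ∈ (G m).toSet, z ∈ W m ∨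
        ∃ j, 0 < α j m 0 ∧ z ∈ (beads (p j) (2 * 2 ^ q j) (α j m)).toSet := by
      intro m z hz
      rw [hGeq m] at hz
      obtain ⟨i, hi, (hz | hz) | hz⟩ := FinHyp.mem_sup'.1 hz
      · exact Or.inl (Finset.mem_biUnion.2 ⟨i, hi, Finset.mem_union_left _ (by simpa using hz)⟩)
      · rcases hz with hz | hz
        · exact Or.inl (Finset.mem_biUnion.2 ⟨i, hi, Finset.mem_union_left _
            ((Finite.mem_toFinset _).2 (Or.inl hz))⟩)
        · rcases (hμ0 i m).eq_or_lt with h0 | h0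
          · refine Or.inl (Finset.mem_biUnion.2 ⟨i, hi, Finset.mem_union_left _ ?_⟩)
            rw [Finite.mem_toFinset, ← hh0 i m, h0]
            exact Or.inr hz
          · exact Or.inr ⟨i, (hαμ i m 0).2 h0, hz⟩
      · obtain ⟨j, hj, hz⟩ := FinHyp.mem_sup'.1 hz
        exact Or.inl (Finset.mem_biUnion.2 ⟨i, hi, Finset.mem_union_right _
          (Finset.mem_biUnion.2 ⟨j, hj, by simpa using hz⟩)⟩)
    obtain ⟨i, hi, hxy⟩ := decode_beads hp hqB hα
      (fun i m c c' h => (hαμ i m c').2 ((hαμ i m c).1 h)) hW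
      (fun m => (f.locallyFinite.point_finite m).subset fun i hi =>
        Function.mem_support.2 (hμf i m ((hαμ i m 0).1 hi)).ne')
      (fun m => let ⟨i, hi⟩ := hμe m; ⟨i, (hαμ i m 0).2 (hi ▸ one_pos)⟩) hGW hbG hxy
    have h1 : μ i x = μ i y := by
      simpa only [α, hlast, mul_one] using congrFun hxy (Fin.last k)
    refine funext fun c => mul_left_cancel₀ ((hαμ i x 0).1 hi).ne' ?_
    have := congrFun hxy c
    simp only [α] at this
    rw [this, h1]
  · obtain ⟨i, hi⟩ := hμe x
    obtain ⟨r, hr, hrl⟩ := hq₀ i (q i) (hq i) l hl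
    refine hrl ?_
    rw [← hxl]
    refine hbG x i ((hαμ i x 0).2 (hi ▸ one_pos)) (mem_beads.2 ⟨Fin.last k, r, hr, ?_⟩)
    simp only [α, hi, hlast, one_mul]

theorem PathMetric.embApprox_aux [Nontrivial X] (hX : PathMetric X) {k : ℕ}
    {K L : Set (Fin k → ℝ)} {F : (Fin k → ℝ) → FinHyp X} {δ : ℝ} (hK : IsCompact K)
    (hL : IsClosed L) (hLK : L ⊆ K) (hF : ContinuousOn F K) (hFL : InjOn F L) (hδ : 0 < δ)
    (hne : L.Nonempty) :
    ∃ F' : (Fin k → ℝ) → FinHyp X, ContinuousOn F' K ∧ InjOn F' K ∧ EqOn F' F L ∧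
      ∀ x ∈ K, dist (F' x) (F x) < δ := by
  classical
  have hLc : IsCompact L := hK.of_isClosed_subset hL hLK
  rcases (K \ L).eq_empty_or_nonempty with hKL | hKL
  · have : K = L := (diff_eq_empty.1 hKL).antisymm hLK
    exact ⟨F, hF, this ▸ hFL, fun x _ => rfl, fun x _ => by simpa using hδ⟩
  have := hKL.to_subtype
  obtain ⟨R, hR, hKR⟩ : ∃ R > 0, ∀ x ∈ K, ∀ c, |x c| ≤ R := by
    obtain ⟨R, hR⟩ := hK.isBounded.exists_norm_le
    exact ⟨max R 1, by positivity, fun x hx c =>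
      (norm_le_pi_norm x c).trans ((hR x hx).trans (le_max_left _ _))⟩
  let e : (Fin k → ℝ) → ℝ := fun x => min δ (infDist x L)
  have he : Continuous e := continuous_const.min (continuous_infDist_pt L)
  have he0 : ∀ x : ↥(K \ L), 0 < e x := fun x =>
    lt_min hδ ((hL.notMem_iff_infDist_pos hne).1 x.2.2)
  have heL : ∀ x ∈ L, e x = 0 := fun x hx => by simp [e, infDist_zero_of_mem hx, hδ.le]
  obtain ⟨G, hG, hGd, hGi, hGL⟩ := hX.exists_bead_map (M := ↥(K \ L)) (k := k)
    (code := fun (x : ↥(K \ L)) c => FinCube.code R (x : Fin k → ℝ) c)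
    (continuous_pi fun c => (FinCube.continuous_code R c).comp continuous_subtype_val)
    (fun x c => FinCube.code_mem hR (hKR x x.2.1) c) (fun x => by simp [FinCube.code])
    (F := fun x => F x) (continuousOn_iff_continuous_domRestrict.1 (hF.mono diff_subset))
    (he.comp continuous_subtype_val) he0 (fun r hr => by
      rw [Subtype.isCompact_iff]
      have : Subtype.val '' {y : ↥(K \ L) | r ≤ (e ∘ Subtype.val) y} = K ∩ {y | r ≤ e y} := by
        ext y
        constructor
        · rintro ⟨z, hz, rfl⟩
          exact ⟨z.2.1, hz⟩
        · rintro ⟨h1, h2⟩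
          refine ⟨⟨y, h1, fun h3 => ?_⟩, h2, rfl⟩
          have : r ≤ e y := h2
          rw [heL y h3] at this
          linarith
      rw [this]
      exact hK.inter_right (isClosed_le continuous_const he)) hLc (hF.mono hLK)
  let F' : (Fin k → ℝ) → FinHyp X := fun x => if h : x ∈ K \ L then G ⟨x, h⟩ else F x
  have hF'G : ∀ x : ↥(K \ L), F' x = G x := fun x => dif_pos x.2
  have hF'L : ∀ x ∈ L, F' x = F x := fun x hx => dif_neg fun h => h.2 hx
  have hF'e : ∀ x ∈ K, dist (F' x) (F x) ≤ e x := fun x hx => by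
    by_cases hxL : x ∈ L
    · rw [hF'L x hxL, dist_self, heL x hxL]
    · rw [hF'G ⟨x, hx, hxL⟩]
      exact (hGd ⟨x, hx, hxL⟩).le
  refine ⟨F', fun x hx => ?_, fun x hx y hy hxy => ?_, hF'L, fun x hx => ?_⟩
  · by_cases hxL : x ∈ L
    · change Tendsto F' (𝓝[K] x) (𝓝 (F' x))
      rw [hF'L x hxL]
      refine (hF x hx).congr_dist ?_
      refine squeeze_zero' (g := e) (Eventually.of_forall fun _ => dist_nonneg) ?_ ?_
      · filter_upwards [self_mem_nhdsWithin] with y hy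
        rw [dist_comm]
        exact hF'e y hy
      · rw [← heL x hxL]
        exact he.continuousAt.tendsto.mono_left nhdsWithin_le_nhds
    · have h1 : ContinuousOn F' (K \ L) := by
        rw [continuousOn_iff_continuous_domRestrict]
        exact hG.congr fun z => (hF'G z).symm
      refine (h1 x ⟨hx, hxL⟩).mono_of_mem_nhdsWithin ?_
      exact inter_mem self_mem_nhdsWithin (mem_nhdsWithin_of_mem_nhds (hL.isOpen_compl.mem_nhds hxL))
  · by_cases hxL : x ∈ L <;> by_cases hyL : y ∈ L
    · rw [hF'L x hxL, hF'L y hyL] at hxy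
      exact hFL hxL hyL hxy
    · rw [hF'L x hxL, hF'G ⟨y, hy, hyL⟩] at hxy
      exact (hGL _ x hxL hxy.symm).elim
    · rw [hF'L y hyL, hF'G ⟨x, hx, hxL⟩] at hxy
      exact (hGL _ y hyL hxy).elim
    · rw [hF'G ⟨x, hx, hxL⟩, hF'G ⟨y, hy, hyL⟩] at hxy
      have h1 := hGi _ _ hxy
      refine funext fun c => ?_
      have h10 := congrFun h1 c.castSucc
      simp only [FinCube.code, Fin.val_castSucc, c.2, dif_pos, Fin.eta] at h10
      have h11 : (x c + R) / (2 * R) = (y c + R) / (2 * R) := by linarith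
      have h12 := (div_left_inj' (by positivity)).1 h11
      linarith
  · by_cases hxL : x ∈ L
    · rw [hF'L x hxL, dist_self]; exact hδ
    · rw [hF'G ⟨x, hx, hxL⟩]
      exact (hGd ⟨x, hx, hxL⟩).trans_le (min_le_left _ _)

theorem PathMetric.embApprox [Nontrivial X] (hX : PathMetric X) : EmbApprox (FinHyp X) := by
  intro k K L F δ hK hL hLK hF hFL hδ
  rcases L.eq_empty_or_nonempty with rfl | hne
  · rcases K.eq_empty_or_nonempty with rfl | ⟨x, hx⟩
    · exact ⟨F, hF, injOn_empty _, fun x hx => rfl, fun x hx => hx.elim⟩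
    · obtain ⟨F', h1, h2, -, h4⟩ := hX.embApprox_aux hK isClosed_singleton
        (singleton_subset_iff.2 hx) hF (injOn_singleton _ _) hδ (singleton_nonempty x)
      exact ⟨F', h1, h2, fun x hx => hx.elim, h4⟩
  · exact hX.embApprox_aux hK hL hLK hF hFL hδ hne

/-- The hyperspace of finite subsets of a good path metric space satisfies the hypotheses of the
characterization theorem. -/
theorem PathMetric.goodSpace_finHyp [Nontrivial X] (hX : PathMetric X) (hS : SFD X) :
    GoodSpace (FinHyp X) where
  nonempty := ⟨FinHyp.pt (Classical.arbitrary X)⟩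
  sfd := hS.finHyp
  embApprox := hX.embApprox
  gauge _ hε := hX.exists_gauge hε

end

end CurtisNhu

namespace CurtisNhu

section

theorem exists_linearIndependent_near {ι : Type*} [Fintype ι] {N : ℕ} (u : ι → Fin N → ℝ) {η : ℝ}
    (hη : 0 < η) : ∃ w : ι → Fin N → ℝ, (∀ i, dist (w i) (u i) < η) ∧
      ∀ s : Fin N → ι, Function.Injective s → LinearIndependent ℝ (w ∘ s) := by
  classical
  let τ : ι → ℝ := fun i => (Fintype.equivFin ι i : ℕ) / (Fintype.card ι : ℝ)
  have hτi : Function.Injective τ := fun i j hij => by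
    have hc : (Fintype.card ι : ℝ) ≠ 0 := by
      have : Nonempty ι := ⟨i⟩
      exact_mod_cast Fintype.card_ne_zero
    have := (div_left_inj' hc).1 hij
    exact (Fintype.equivFin ι).injective (Fin.ext (by exact_mod_cast this))
  have hτ0 : ∀ i, 0 ≤ τ i := fun i => by positivity
  have hτ1 : ∀ i, τ i ≤ 1 := fun i =>
    div_le_one_of_le₀ (by exact_mod_cast (Fintype.equivFin ι i).2.le) (by positivity)
  let p : (Fin N → ι) → Polynomial ℝ := fun s => Matrix.det
    ((Polynomial.X : Polynomial ℝ) • (Matrix.vandermonde (τ ∘ s)).map Polynomial.C +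
      (Matrix.of (u ∘ s)).map Polynomial.C)
  have hp : ∀ s, Function.Injective s → p s ≠ 0 := fun s hs h => by
    have h1 := Polynomial.coeff_det_X_add_C_card (Matrix.vandermonde (τ ∘ s)) (Matrix.of (u ∘ s))
    have h2 : (p s).coeff (Fintype.card (Fin N)) = 0 := by rw [h, Polynomial.coeff_zero]
    exact Matrix.det_vandermonde_ne_zero_iff.2 (hτi.comp hs) (h1 ▸ h2)
  obtain ⟨δ, hδ, hδp⟩ : ∃ δ ∈ Ioo (0 : ℝ) η, ∀ s, Function.Injective s → ¬ (p s).IsRoot δ := by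
    have hfin : (⋃ s ∈ {s : Fin N → ι | Function.Injective s}, {x | (p s).IsRoot x}).Finite :=
      (toFinite _).biUnion fun s hs => Polynomial.finite_setOf_isRoot (hp s hs)
    obtain ⟨δ, hδ, hn⟩ := ((Ioo_infinite hη).diff hfin).nonempty
    exact ⟨δ, hδ, fun s hs hr => hn (mem_biUnion hs hr)⟩
  refine ⟨fun i c => u i c + δ * τ i ^ (c : ℕ), fun i => (dist_pi_lt_iff hη).2 fun c => ?_,
    fun s hs => ?_⟩
  · rw [Real.dist_eq, add_sub_cancel_left, abs_of_nonneg (mul_nonneg hδ.1.le (pow_nonneg (hτ0 i) _))]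
    exact (mul_le_of_le_one_right hδ.1.le (pow_le_one₀ (hτ0 i) (hτ1 i))).trans_lt hδ.2
  · have h1 : (Matrix.of fun j c => u (s j) c + δ * τ (s j) ^ (c : ℕ)).det ≠ 0 := by
      intro h
      refine hδp s hs ?_
      rw [Polynomial.IsRoot, ← Polynomial.coe_evalRingHom, RingHom.map_det, ← h]
      congr 1
      ext j c
      simp [Matrix.vandermonde_apply, add_comm]
    exact Matrix.linearIndependent_rows_of_det_ne_zero h1

theorem exists_generalPosition_near {ι : Type*} [Fintype ι] {N : ℕ} (u : ι → Fin N → ℝ) {η : ℝ}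
    (hη : 0 < η) : ∃ w : ι → Fin N → ℝ, (∀ i, dist (w i) (u i) < η) ∧
      ∀ c : ι → ℝ, (Function.support c).ncard ≤ N → ∑ i, c i • w i = 0 → c = 0 := by
  classical
  obtain ⟨w, hw, hwi⟩ := exists_linearIndependent_near (Sum.elim u fun _ : Fin N => 0) hη
  refine ⟨w ∘ Sum.inl, fun i => hw (Sum.inl i), fun c hc h0 => ?_⟩
  let c' : ι ⊕ Fin N → ℝ := Sum.elim c 0
  have hc' : ((Function.support c).toFinset.map Function.Embedding.inl :
      Finset (ι ⊕ Fin N)).card ≤ N := by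
    rwa [Finset.card_map, ← ncard_eq_toFinset_card']
  obtain ⟨t, hst, htN⟩ := Finset.exists_superset_card_eq hc' (by simp)
  let s : Fin N → ι ⊕ Fin N := fun j => (t.equivFinOfCardEq htN).symm j
  have hs : Function.Injective s := Subtype.val_injective.comp (Equiv.injective _)
  have h1 : ∑ j, c' (s j) • (w ∘ s) j = 0 := by
    have e1 : ∑ j, c' (s j) • (w ∘ s) j = ∑ i : t, c' i • w i :=
      (t.equivFinOfCardEq htN).symm.sum_comp fun i : t => c' i • w i
    rw [e1, Finset.sum_coe_sort t fun i => c' i • w i, ← h0]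
    rw [Finset.sum_subset (Finset.subset_univ t), Fintype.sum_sum_type]
    · simp [c']
    · intro x _ hx
      have : c' x = 0 := by
        rcases x with x | x
        · by_contra h
          exact hx (hst (Finset.mem_map.2 ⟨x, mem_toFinset.2 h, rfl⟩))
        · rfl
      rw [this, zero_smul]
  have h2 := Fintype.linearIndependent_iff.1 (hwi s hs) _ h1
  funext i
  by_contra h
  have h3 : Sum.inl i ∈ t := hst (Finset.mem_map.2 ⟨i, by simpa using h, rfl⟩)
  have h4 := h2 (t.equivFinOfCardEq htN ⟨_, h3⟩)
  simp [s, c'] at h4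
  exact h h4

/-- The Menger-Nöbeling embedding theorem, with a generous dimension bound. -/
theorem exists_injective_of_covDimLE {K : Type*} [MetricSpace K] [CompactSpace K] {n : ℕ}
    (hK : CovDimLE K n) : ∃ (N : ℕ) (ψ : K → Fin N → ℝ), Continuous ψ ∧ Function.Injective ψ := by
  classical
  let N := 2 * (n + 1)
  let O : ℕ → Set C(K, Fin N → ℝ) := fun j =>
    (Prod.snd '' {z : (K × K) × C(K, Fin N → ℝ) |
      1 / ((j : ℝ) + 1) ≤ dist z.1.1 z.1.2 ∧ z.2 z.1.1 = z.2 z.1.2})ᶜ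
  have hO : ∀ j, IsOpen (O j) := fun j => by
    refine (isClosedMap_snd_of_compactSpace _ ?_).isOpen_compl
    refine (isClosed_le continuous_const
      (continuous_dist.comp continuous_fst)).inter (isClosed_eq ?_ ?_)
    · exact continuous_eval.comp (continuous_snd.prodMk (continuous_fst.comp continuous_fst))
    · exact continuous_eval.comp (continuous_snd.prodMk (continuous_snd.comp continuous_fst))
  have hD : ∀ j, Dense (O j) := fun j => by
    rw [Metric.dense_iff]
    intro f r hr
    have hε : 0 < 1 / ((j : ℝ) + 1) := by positivity
    let U : K → Set K := fun x => {y | dist y x < 1 / ((j : ℝ) + 1) / 2 ∧ dist (f y) (f x) < r / 4}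
    have hU : ∀ x, IsOpen (U x) := fun x =>
      (isOpen_lt (continuous_id.dist continuous_const) continuous_const).inter
        (isOpen_lt (f.continuous.dist continuous_const) continuous_const)
    obtain ⟨t, ht⟩ := isCompact_univ.elim_finite_subcover U hU fun x _ =>
      mem_iUnion.2 ⟨x, by simpa [U] using ⟨by positivity, hr⟩⟩
    obtain ⟨𝒱, h𝒱o, h𝒱c, h𝒱r, h𝒱n⟩ := hK (t.image U)
      (fun V hV => by obtain ⟨x, -, rfl⟩ := Finset.mem_image.1 hV; exact hU x)
      (by simpa [sUnion_image] using eq_univ_of_univ_subset ht)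
    have h1 : ∀ V : 𝒱, ∃ x, V.1 ⊆ U x := fun V => by
      obtain ⟨W, hW, hVW⟩ := h𝒱r V V.2
      obtain ⟨x, -, rfl⟩ := Finset.mem_image.1 hW
      exact ⟨x, hVW⟩
    choose x hx using h1
    obtain ⟨w, hw, hwi⟩ := exists_generalPosition_near (fun V : 𝒱 => f (x V))
      (show 0 < r / 4 by positivity)
    obtain ⟨l, hl⟩ := PartitionOfUnity.exists_isSubordinate (isClosed_univ (X := K))
      (fun V : 𝒱 => V.1) (fun V => h𝒱o V V.2) (by
        rw [← h𝒱c, sUnion_eq_iUnion]; exact subset_rfl)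
    have hlV : ∀ V z, l V z ≠ 0 → z ∈ V.1 := fun V z h => hl V (subset_tsupport _ h)
    have hl1 : ∀ z, ∑ V, l V z = 1 := fun z => by
      rw [← finsum_eq_sum_of_fintype]; exact l.sum_eq_one (mem_univ z)
    let g : C(K, Fin N → ℝ) := ⟨fun z => ∑ V, l V z • w V, by fun_prop⟩
    refine ⟨g, ?_, ?_⟩
    · refine (ContinuousMap.dist_lt_iff hr).2 fun z => ?_
      have h2 : ∀ V, l V z ≠ 0 → w V ∈ ball (f z) (r / 2) := fun V hV => by
        have h3 := (hx V (hlV V z hV)).2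
        rw [dist_comm] at h3
        rw [mem_ball]
        linarith [dist_triangle (w V) (f (x V)) (f z), hw V]
      have h4 : g z ∈ ball (f z) (r / 2) := by
        have := (convex_ball (f z) (r / 2)).finsum_mem (fun V => l.nonneg V z)
          (l.sum_eq_one (mem_univ z)) h2
        rwa [finsum_eq_sum_of_fintype] at this
      exact (mem_ball.1 h4).trans (half_lt_self hr)
    · rintro ⟨⟨⟨y, z⟩, _⟩, ⟨hyz, h2⟩, rfl⟩
      have h3 : ∑ V, (l V y - l V z) • w V = 0 := by
        simp only [sub_smul, Finset.sum_sub_distrib]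
        exact sub_eq_zero.2 h2
      have hcard : ∀ z, {V : 𝒱 | z ∈ V.1}.ncard ≤ n + 1 := fun z => by
        refine le_trans (le_of_eq ?_) (h𝒱n z)
        rw [← ncard_image_of_injective _ Subtype.val_injective]
        congr 1
        ext V
        simp [and_comm]
      have h4 := hwi _ (le_trans (ncard_le_ncard (t := {V : 𝒱 | y ∈ V.1} ∪ {V : 𝒱 | z ∈ V.1})
        (fun V hV => ?_) (toFinite _)) ((ncard_union_le _ _).trans
          (by have := hcard y; have := hcard z; omega))) h3
      · obtain ⟨V, hV⟩ : ∃ V, l V y ≠ 0 := by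
          by_contra! h
          simpa [h] using hl1 y
        have h5 : l V y - l V z = 0 := congrFun h4 V
        have h6 : l V z ≠ 0 := by rwa [← sub_eq_zero.1 h5]
        have h7 := (hx V (hlV V y hV)).1
        have h8 := (hx V (hlV V z h6)).1
        have : dist y z < 1 / ((j : ℝ) + 1) := by
          linarith [dist_triangle_right y z (x V)]
        exact this.not_ge hyz
      · by_contra h
        rw [mem_union, not_or] at h
        have h5 : l V y = 0 := by_contra fun h' => h.1 (hlV V y h')
        have h6 : l V z = 0 := by_contra fun h' => h.2 (hlV V z h')
        exact hV (by simp [h5, h6])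
  obtain ⟨ψ, hψ⟩ := (dense_iInter_of_isOpen_nat hO hD).nonempty
  refine ⟨N, ψ, ψ.continuous, fun y z hyz => ?_⟩
  by_contra hne
  obtain ⟨j, hj⟩ := exists_nat_one_div_lt (dist_pos.2 hne)
  exact mem_iInter.1 hψ j ⟨((y, z), ψ), ⟨hj.le, hyz⟩, rfl⟩

theorem covDimLE_of_isClosedEmbedding {Z Y : Type*} [TopologicalSpace Z] [TopologicalSpace Y]
    {e : Z → Y} (he : Topology.IsClosedEmbedding e) {n : ℕ} (hY : CovDimLE Y n) : CovDimLE Z n := by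
  classical
  intro 𝒰 h𝒰o h𝒰c
  have h1 : ∀ U : Set Z, ∃ W : Set Y, U ∈ 𝒰 → IsOpen W ∧ e ⁻¹' W = U := fun U => by
    by_cases hU : U ∈ 𝒰
    · obtain ⟨W, hW⟩ := he.isInducing.isOpen_iff.1 (h𝒰o U hU)
      exact ⟨W, fun _ => hW⟩
    · exact ⟨univ, fun h => (hU h).elim⟩
  choose W hW using h1
  obtain ⟨𝒱, h𝒱o, h𝒱c, h𝒱r, h𝒱n⟩ := hY (insert (range e)ᶜ (𝒰.image W))
    (fun V hV => by
      rcases Finset.mem_insert.1 hV with rfl | hV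
      · exact he.isClosed_range.isOpen_compl
      · obtain ⟨U, hU, rfl⟩ := Finset.mem_image.1 hV
        exact (hW U hU).1)
    (by
      refine eq_univ_of_forall fun y => ?_
      by_cases hy : y ∈ range e
      · obtain ⟨z, rfl⟩ := hy
        obtain ⟨U, hU, hz⟩ := mem_sUnion.1 (h𝒰c ▸ mem_univ z)
        refine mem_sUnion.2 ⟨W U, Finset.mem_coe.2 (Finset.mem_insert_of_mem
          (Finset.mem_image_of_mem _ hU)), ?_⟩
        rw [← (hW U hU).2] at hz
        exact hz
      · exact mem_sUnion.2 ⟨_, Finset.mem_coe.2 (Finset.mem_insert_self _ _), hy⟩)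
  refine ⟨(𝒱.filter fun V => (e ⁻¹' V).Nonempty).image fun V => e ⁻¹' V, fun V hV => ?_, ?_,
    fun V hV => ?_, fun z => ?_⟩
  · obtain ⟨V, hV', rfl⟩ := Finset.mem_image.1 hV
    exact (h𝒱o V (Finset.mem_filter.1 hV').1).preimage he.continuous
  · refine eq_univ_of_forall fun z => ?_
    obtain ⟨V, hV, hz⟩ := mem_sUnion.1 (h𝒱c ▸ mem_univ (e z))
    exact mem_sUnion.2 ⟨e ⁻¹' V, Finset.mem_coe.2 (Finset.mem_image.2
      ⟨V, Finset.mem_filter.2 ⟨hV, z, hz⟩, rfl⟩), hz⟩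
  · obtain ⟨V, hV', rfl⟩ := Finset.mem_image.1 hV
    obtain ⟨hV, z, hz⟩ := Finset.mem_filter.1 hV'
    obtain ⟨U, hU, hVU⟩ := h𝒱r V hV
    rcases Finset.mem_insert.1 hU with rfl | hU
    · exact (hVU hz ⟨z, rfl⟩).elim
    · obtain ⟨U, hU', rfl⟩ := Finset.mem_image.1 hU
      exact ⟨U, hU', (preimage_mono hVU).trans (hW U hU').2.subset⟩
  · have hfin : {V : Set Y | V ∈ 𝒱 ∧ e z ∈ V}.Finite := 𝒱.finite_toSet.subset fun V hV => hV.1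
    refine (ncard_le_ncard (fun V hV => ?_) (hfin.image fun V => e ⁻¹' V)).trans
      ((ncard_image_le hfin).trans (h𝒱n (e z)))
    obtain ⟨V, hV', rfl⟩ := Finset.mem_image.1 hV.1
    exact ⟨V, ⟨(Finset.mem_filter.1 hV').1, hV.2⟩, rfl⟩

theorem EmbCompact.of_covDimLE {X : Type*} [MetricSpace X] {K : Set X} (hK : IsCompact K) {n : ℕ}
    (hn : CovDimLE K n) : EmbCompact K := by
  classical
  have := isCompact_iff_compactSpace.1 hK
  obtain ⟨N, ψ, hψ, hi⟩ := exists_injective_of_covDimLE hn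
  have h1 : ∀ x : K, (fun x => if h : x ∈ K then ψ ⟨x, h⟩ else 0) (x : X) = ψ x :=
    fun x => dif_pos x.2
  refine ⟨hK, N, fun x => if h : x ∈ K then ψ ⟨x, h⟩ else 0, ?_, fun x hx y hy hxy => ?_⟩
  · rw [continuousOn_iff_continuous_domRestrict]
    exact hψ.congr fun z => (h1 z).symm
  · exact congrArg Subtype.val (hi ((h1 ⟨x, hx⟩).symm.trans (hxy.trans (h1 ⟨y, hy⟩))))

theorem SFD.of_stronglyCountableDimensional {X : Type*} [MetricSpace X] [SigmaCompactSpace X]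
    (h : StronglyCountableDimensional X) : SFD X := by
  obtain ⟨C, hC, hd, hU⟩ := h
  refine ⟨fun i => C i.unpair.1 ∩ compactCovering X i.unpair.2, fun i => ?_,
    eq_univ_of_forall fun x => ?_⟩
  · obtain ⟨m, hm⟩ := hd i.unpair.1
    refine EmbCompact.of_covDimLE ((isCompact_compactCovering X _).inter_left (hC _)) (n := m)
      (covDimLE_of_isClosedEmbedding (e := inclusion inter_subset_left) ?_ hm)
    refine ⟨Topology.IsEmbedding.inclusion _, ?_⟩
    rw [range_inclusion]
    exact (((hC _).inter (isCompact_compactCovering X _).isClosed)).preimage continuous_subtype_val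
  · obtain ⟨n, hn⟩ := mem_iUnion.1 (hU ▸ mem_univ x : x ∈ ⋃ n, C n)
    obtain ⟨m, hm⟩ := mem_iUnion.1 (iUnion_compactCovering X ▸ mem_univ x : x ∈ ⋃ m, _)
    exact mem_iUnion.2 ⟨Nat.pair n m, by simpa using ⟨hn, hm⟩⟩

end

end CurtisNhu

namespace CurtisNhu

section

theorem _root_.FinHyp.exists_chain {X : Type*} [MetricSpace X] (A : ℕ → FinHyp X) {x : X}
    (hx : x ∈ (A 0).toSet) : ∃ c : ℕ → X, c 0 = x ∧ (∀ i, c i ∈ (A i).toSet) ∧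
      ∀ i, dist (c i) (c (i + 1)) ≤ dist (A i) (A (i + 1)) := by
  have h : ∀ i, ∀ y : (A i).toSet, ∃ z : (A (i + 1)).toSet,
      dist (y : X) z ≤ dist (A i) (A (i + 1)) := fun i y => by
    obtain ⟨z, hz, hyz⟩ := ((FinHyp.dist_le_iff (B := A (i + 1)) dist_nonneg).1 le_rfl).1 y y.2
    exact ⟨⟨z, hz⟩, hyz⟩
  choose f hf using h
  let c : ∀ i, (A i).toSet :=
    fun i => Nat.rec (motive := fun i => (A i).toSet) ⟨x, hx⟩ (fun i y => f i y) i
  refine ⟨fun i => (c i : X), rfl, fun i => (c i).2, fun i => ?_⟩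
  exact hf i (c i)

theorem exists_separation {X : Type*} [MetricSpace X] {s : Set X} (hs : s.Finite) {ρ : ℝ}
    (hρ : 0 < ρ) : ∃ r, 0 < r ∧ r ≤ ρ ∧ ∀ p ∈ s, ∀ q ∈ s, dist p q < 3 * r → p = q := by
  have h : ∀ᶠ r : ℝ in 𝓝[>] 0, ∀ z ∈ s ×ˢ s, dist z.1 z.2 < 3 * r → z.1 = z.2 := by
    refine (hs.prod hs).eventually_all.2 fun z _ => ?_
    by_cases hz : z.1 = z.2
    · exact Eventually.of_forall fun _ _ => hz
    · have h0 := dist_pos.2 hz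
      filter_upwards [Ioo_mem_nhdsGT (show 0 < dist z.1 z.2 / 3 by positivity)] with r hr h1
      linarith [hr.2]
  obtain ⟨r, hr, h1⟩ := (h.and (Ioc_mem_nhdsGT hρ)).exists
  exact ⟨r, h1.1, h1.2, fun p hp q hq => hr (p, q) ⟨hp, hq⟩⟩

/-- Every point of a continuously moving finite set can be followed continuously. -/
theorem _root_.FinHyp.exists_selection {X : Type*} [MetricSpace X] {A : ℝ → FinHyp X} (hA : Continuous A)
    {x : X} (hx : x ∈ (A 0).toSet) : ∃ γ : ℝ → X, ContinuousOn γ (Ici 0) ∧ γ 0 = x ∧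
      ∀ t, 0 ≤ t → γ t ∈ (A t).toSet := by
  choose c hc0 hcA hcd using fun n : ℕ =>
    FinHyp.exists_chain (fun i : ℕ => A (i / ((n : ℝ) + 1))) (x := x) (by simpa using hx)
  let g : ℕ → ℝ → X := fun n t => c n ⌊t * ((n : ℝ) + 1)⌋₊
  have hloc : ∀ t₀, 0 ≤ t₀ → ∀ ρ > 0, ∃ η > 0, ∀ᶠ n in atTop, ∃ p ∈ (A t₀).toSet,
      ∀ t, 0 ≤ t → dist t t₀ < η → dist (g n t) p < ρ := by
    intro t₀ ht₀ ρ hρ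
    obtain ⟨r, hr, hrρ, hsep⟩ := exists_separation (A t₀).toSet_finite hρ
    obtain ⟨η, hη, hAη⟩ := Metric.continuous_iff.1 hA t₀ (r / 2) (by positivity)
    refine ⟨η / 2, by positivity, ?_⟩
    obtain ⟨n₀, hn₀⟩ := exists_nat_one_div_lt (show 0 < η / 2 by positivity)
    filter_upwards [eventually_ge_atTop n₀] with n hn
    have hn1 : (0 : ℝ) < n + 1 := by positivity
    have hnη : 1 / ((n : ℝ) + 1) < η / 2 := lt_of_le_of_lt
      (one_div_le_one_div_of_le (by positivity) (by simpa using hn)) hn₀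
    have hfl : ∀ t, 0 ≤ t → dist t t₀ < η / 2 →
        dist ((⌊t * ((n : ℝ) + 1)⌋₊ : ℝ) / (n + 1)) t₀ < η := fun t ht htt => by
      have h1 := Nat.floor_le (mul_nonneg ht hn1.le)
      have h2 := Nat.lt_floor_add_one (t * ((n : ℝ) + 1))
      have h3 : dist ((⌊t * ((n : ℝ) + 1)⌋₊ : ℝ) / (n + 1)) t ≤ 1 / (n + 1) := by
        rw [Real.dist_eq, abs_le]
        constructor
        · rw [neg_le_sub_iff_le_add, ← add_div, le_div_iff₀ hn1]
          exact h2.le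
        · have : (⌊t * ((n : ℝ) + 1)⌋₊ : ℝ) / (n + 1) ≤ t := (div_le_iff₀ hn1).2 h1
          have := one_div_pos.2 hn1
          linarith
      linarith [dist_triangle ((⌊t * ((n : ℝ) + 1)⌋₊ : ℝ) / (n + 1)) t t₀]
    have hnear : ∀ i : ℕ, dist ((i : ℝ) / (n + 1)) t₀ < η → ∃ p ∈ (A t₀).toSet,
        dist (c n i) p < r / 2 := fun i hi =>
      ((FinHyp.dist_lt_iff (by positivity)).1 (hAη _ hi)).1 _ (hcA n i)
    classical
    have hW : ∃ i : ℕ, dist ((i : ℝ) / (n + 1)) t₀ < η :=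
      ⟨_, hfl t₀ ht₀ (by simpa using hη)⟩
    obtain ⟨p, hp, hpi⟩ := hnear _ (Nat.find_spec hW)
    have hind : ∀ i, Nat.find hW ≤ i → dist ((i : ℝ) / (n + 1)) t₀ < η → dist (c n i) p < r / 2 := by
      intro i hi
      induction i, hi using Nat.le_induction with
      | base => exact fun _ => hpi
      | succ i hi ih =>
        intro hi1
        have h0 := Nat.find_spec hW
        have hi0 : dist ((i : ℝ) / (n + 1)) t₀ < η := by
          rw [Real.dist_eq, abs_lt] at h0 hi1 ⊢
          have h2 : ((Nat.find hW : ℕ) : ℝ) / (n + 1) ≤ (i : ℝ) / (n + 1) := by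
            gcongr
          have h3 : (i : ℝ) / (n + 1) ≤ ((i + 1 : ℕ) : ℝ) / (n + 1) := by
            gcongr
            exact i.le_succ
          exact ⟨by linarith, by linarith⟩
        have h4 := ih hi0
        obtain ⟨q, hq, hqi⟩ := hnear _ hi1
        have h5 := hcd n i
        have h6 := dist_triangle_right (A ((i : ℝ) / (n + 1))) (A (((i + 1 : ℕ) : ℝ) / (n + 1)))
          (A t₀)
        have h7 := hAη _ hi0
        have h8 := hAη _ hi1
        have : p = q := by
          refine hsep p hp q hq ?_
          have h9 := dist_triangle4_left (c n i) (c n (i + 1)) p q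
          linarith
        rwa [this]
    refine ⟨p, hp, fun t ht htt => ?_⟩
    have := hind _ (Nat.find_min' hW (hfl t ht htt)) (hfl t ht htt)
    linarith
  let 𝒰 : Ultrafilter ℕ := hyperfilter ℕ
  have hU : (𝒰 : Filter ℕ) ≤ atTop := Nat.hyperfilter_le_atTop
  have hsel : ∀ t₀, ∃ p, 0 ≤ t₀ → p ∈ (A t₀).toSet ∧ ∀ ρ > 0, ∃ η > 0, ∀ᶠ n in 𝒰,
      ∀ t, 0 ≤ t → dist t t₀ < η → dist (g n t) p < ρ := by
    intro t₀
    by_cases ht₀ : 0 ≤ t₀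
    swap
    · exact ⟨x, fun h => (ht₀ h).elim⟩
    by_contra! hcon
    choose! r hr using fun p => (hcon p).2
    have h1 : ∀ᶠ ρ : ℝ in 𝓝[>] 0, ∀ p ∈ (A t₀).toSet, ρ ≤ r p :=
      (A t₀).toSet_finite.eventually_all.2 fun p hp =>
        Filter.mem_of_superset (Ioc_mem_nhdsGT (hr p hp).1) fun ρ hρ => hρ.2
    obtain ⟨ρ, h2, hρ⟩ := (h1.and self_mem_nhdsWithin).exists
    obtain ⟨η, hη, h3⟩ := hloc t₀ ht₀ ρ hρ
    obtain ⟨p, hp, h4⟩ := (Ultrafilter.eventually_exists_mem_iff (A t₀).toSet_finite).1 (hU h3)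
    obtain ⟨n, h5, t, ht, htt, h6⟩ := (h4.and ((hr p hp).2 η hη)).exists
    exact ((h5 t ht htt).trans_le (h2 p hp)).not_ge h6
  choose γ hγ using hsel
  refine ⟨γ, fun t₀ ht₀ => ?_, ?_, fun t ht => (hγ t ht).1⟩
  · refine Metric.continuousWithinAt_iff.2 fun ε hε => ?_
    obtain ⟨η, hη, h1⟩ := (hγ t₀ ht₀).2 (ε / 2) (by positivity)
    refine ⟨η, hη, fun t ht htt => ?_⟩
    obtain ⟨η', hη', h2⟩ := (hγ t ht).2 (ε / 2) (by positivity)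
    obtain ⟨n, h3, h4⟩ := (h1.and h2).exists
    have h5 := h3 t ht htt
    have h6 := h4 t ht (by simpa using hη')
    linarith [dist_triangle_left (γ t) (γ t₀) (g n t)]
  · refine eq_of_forall_dist_le fun ε hε => ?_
    obtain ⟨η, hη, h1⟩ := (hγ 0 le_rfl).2 ε hε
    obtain ⟨n, h2⟩ := h1.exists
    have h3 := h2 0 le_rfl (by simpa using hη)
    rw [dist_comm]
    simpa [g, hc0] using h3.le

theorem _root_.FinHyp.joinedIn_of_joinedIn {X : Type*} [MetricSpace X] {F : Set X} {𝓕 : Set (FinHyp X)}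
    (hF : ∀ A ∈ 𝓕, A.toSet ⊆ F) {x y : X} (h : JoinedIn 𝓕 (FinHyp.pt x) (FinHyp.pt y)) :
    JoinedIn F x y := by
  obtain ⟨p, hp⟩ := h
  obtain ⟨γ, hγ, h0, hγA⟩ := FinHyp.exists_selection p.continuous_extend (x := x)
    (by rw [p.extend_zero]; exact rfl)
  have h1 : γ 1 = y := by
    have := hγA 1 zero_le_one
    rwa [p.extend_one] at this
  refine ⟨⟨⟨fun t => γ t, hγ.comp_continuous continuous_subtype_val fun t => t.2.1⟩,
    by simpa using h0, by simpa using h1⟩, fun t => ?_⟩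
  have h2 := hγA t t.2.1
  rw [p.extend_apply t.2] at h2
  exact hF _ (hp t) h2

theorem _root_.FinHyp.pathConnectedSpace {X : Type*} [MetricSpace X] [PathConnectedSpace (FinHyp X)] :
    PathConnectedSpace X where
  nonempty := (PathConnectedSpace.nonempty (X := FinHyp X)).elim fun A =>
    A.toSet_nonempty.to_type
  joined x y := by
    rw [← joinedIn_univ]
    exact FinHyp.joinedIn_of_joinedIn (𝓕 := univ) (fun _ _ => subset_univ _)
      (joinedIn_univ.2 (PathConnectedSpace.joined _ _))

theorem _root_.FinHyp.locallyPathConnectedSpace {X : Type*} [MetricSpace X]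
    [LocallyPathConnectedSpace (FinHyp X)] : LocallyPathConnectedSpace X := by
  rw [locallyPathConnectedSpace_iff_pathComponentIn_mem_nhds]
  intro x u hu hxu
  obtain ⟨r, hr, hru⟩ := Metric.isOpen_iff.1 hu x hxu
  have h1 := FinHyp.continuous_pt.continuousAt.preimage_mem_nhds
    (pathComponentIn_mem_nhds (ball_mem_nhds (FinHyp.pt x) hr))
  filter_upwards [h1] with y hy
  refine FinHyp.joinedIn_of_joinedIn (fun A hA a ha => hru ?_) hy
  obtain ⟨b, hb, hab⟩ := ((FinHyp.dist_lt_iff hr).1 hA).1 a ha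
  rw [FinHyp.toSet_pt, mem_singleton_iff] at hb
  exact hb ▸ hab

theorem _root_.FinHyp.isClosedEmbedding_pt {X : Type*} [MetricSpace X] :
    Topology.IsClosedEmbedding (FinHyp.pt : X → FinHyp X) := by
  refine ⟨FinHyp.isometry_pt.isEmbedding, isClosed_of_closure_subset fun A hA => ?_⟩
  obtain ⟨a, ha⟩ := A.toSet_nonempty
  refine ⟨a, FinHyp.ext ?_⟩
  rw [FinHyp.toSet_pt, eq_comm, eq_singleton_iff_unique_mem]
  refine ⟨ha, fun b hb => ?_⟩
  refine eq_of_forall_dist_le fun ε hε => ?_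
  obtain ⟨_, ⟨x, rfl⟩, hx⟩ := Metric.mem_closure_iff.1 hA (ε / 2) (by positivity)
  have h1 := ((FinHyp.dist_lt_iff (by positivity)).1 hx).1
  obtain ⟨_, rfl, hax⟩ := h1 a ha
  obtain ⟨_, rfl, hbx⟩ := h1 b hb
  exact (dist_triangle_right b a _).trans (by linarith)

theorem covDimLE_of_isCompact {k : ℕ} {T : Set (Fin k → ℝ)} (hT : IsCompact T) :
    CovDimLE T (2 ^ k) := by
  classical
  have := isCompact_iff_compactSpace.1 hT
  intro 𝒰 h𝒰o h𝒰c
  obtain ⟨δ, hδ, hδ𝒰⟩ := lebesgue_number_lemma_of_metric_sUnion (isCompact_univ (X := T))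
    (c := 𝒰) (fun U hU => h𝒰o U hU) h𝒰c.ge
  let s : ℝ := δ / 3
  have hs : 0 < s := by positivity
  let V : (Fin k → ℤ) → Set T := fun q => {x | ∀ c, |x.1 c / s - q c| < 1}
  have hVo : ∀ q, IsOpen (V q) := fun q => by
    simp only [V, ofPred_forall]
    exact isOpen_iInter_of_finite fun c => isOpen_lt
      (continuous_abs.comp (((continuous_apply c).comp (continuous_subtype_val (p := (· ∈ T)))
        |>.div_const s).sub continuous_const)) continuous_const
  have hVd : ∀ q, ∀ x ∈ V q, V q ⊆ ball x δ := fun q x hx y hy => by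
    rw [mem_ball, Subtype.dist_eq, dist_pi_lt_iff hδ]
    intro c
    have h1 := abs_lt.1 (hx c)
    have h2 := abs_lt.1 (hy c)
    have h3 : y.1 c / s - x.1 c / s < 2 := by linarith
    have h4 : -2 < y.1 c / s - x.1 c / s := by linarith
    rw [← sub_div] at h3 h4
    rw [div_lt_iff₀ hs] at h3
    rw [lt_div_iff₀ hs] at h4
    rw [Real.dist_eq, abs_lt]
    simp only [s] at h3 h4
    constructor <;> linarith
  obtain ⟨t, ht⟩ := isCompact_univ.elim_finite_subcover V hVo fun x _ =>
    mem_iUnion.2 ⟨fun c => ⌊x.1 c / s⌋, fun c => by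
      rw [abs_lt]
      constructor <;> linarith [Int.floor_le (x.1 c / s), Int.lt_floor_add_one (x.1 c / s)]⟩
  refine ⟨(t.filter fun q => (V q).Nonempty).image V, fun W hW => ?_, ?_, fun W hW => ?_,
    fun x => ?_⟩
  · obtain ⟨q, -, rfl⟩ := Finset.mem_image.1 hW
    exact hVo q
  · refine eq_univ_of_forall fun x => ?_
    obtain ⟨q, hq, hx⟩ := mem_iUnion₂.1 (ht (mem_univ x))
    exact mem_sUnion.2 ⟨V q, Finset.mem_coe.2 (Finset.mem_image.2
      ⟨q, Finset.mem_filter.2 ⟨hq, x, hx⟩, rfl⟩), hx⟩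
  · obtain ⟨q, hq, rfl⟩ := Finset.mem_image.1 hW
    obtain ⟨-, x, hx⟩ := Finset.mem_filter.1 hq
    obtain ⟨U, hU, hxU⟩ := hδ𝒰 x (mem_univ x)
    exact ⟨U, hU, (hVd q x hx).trans hxU⟩
  · let Q : Finset (Fin k → ℤ) :=
      Fintype.piFinset fun c => {⌊x.1 c / s⌋, ⌊x.1 c / s⌋ + 1}
    have hQ : Q.card ≤ 2 ^ k := by
      rw [Fintype.card_piFinset]
      refine (Finset.prod_le_pow_card _ _ 2 fun c _ => Finset.card_le_two).trans (by simp)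
    refine (ncard_le_ncard (t := ((Q.image V : Finset (Set T)) : Set (Set T))) ?_
      (Finset.finite_toSet _)).trans ?_
    · rintro W ⟨hW, hxW⟩
      obtain ⟨q, -, rfl⟩ := Finset.mem_image.1 hW
      refine Finset.mem_coe.2 (Finset.mem_image_of_mem _ (Fintype.mem_piFinset.2 fun c => ?_))
      have h1 := abs_lt.1 (hxW c)
      have h2 : ⌊x.1 c / s⌋ < q c + 1 := Int.floor_lt.2 (by push_cast; linarith)
      have h3 : q c - 1 ≤ ⌊x.1 c / s⌋ := Int.le_floor.2 (by push_cast; linarith)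
      rw [Finset.mem_insert, Finset.mem_singleton]
      omega
    · rw [ncard_coe_finset]
      exact (Finset.card_image_le.trans hQ).trans (Nat.le_succ _)

theorem EmbCompact.exists_covDimLE {Z : Type*} [TopologicalSpace Z] {K : Set Z}
    (hK : EmbCompact K) : ∃ m, CovDimLE K m := by
  obtain ⟨hc, k, ψ, hψ, hi⟩ := hK
  have := isCompact_iff_compactSpace.1 hc
  have h1 : Continuous fun x : K => (⟨ψ x, mem_image_of_mem ψ x.2⟩ : ψ '' K) :=
    (continuousOn_iff_continuous_domRestrict.1 hψ).subtype_mk _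
  refine ⟨2 ^ k, covDimLE_of_isClosedEmbedding (h1.isClosedEmbedding fun x y hxy => ?_)
    (covDimLE_of_isCompact (hc.image_of_continuousOn hψ))⟩
  exact Subtype.ext (hi x.2 y.2 (congrArg Subtype.val hxy))

theorem SFD.stronglyCountableDimensional {Z : Type*} [TopologicalSpace Z] [T2Space Z]
    (hZ : SFD Z) : StronglyCountableDimensional Z := by
  obtain ⟨K, hK, hU⟩ := hZ
  exact ⟨K, fun n => (hK n).1.isClosed, fun n => (hK n).exists_covDimLE, hU⟩

theorem SFD.sigmaCompactSpace {Z : Type*} [TopologicalSpace Z] (hZ : SFD Z) :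
    SigmaCompactSpace Z := by
  obtain ⟨K, hK, hU⟩ := hZ
  exact ⟨⟨K, fun n => (hK n).1, hU⟩⟩

theorem _root_.FinHyp.of_homeomorph_L1 {X : Type*} [MetricSpace X] (e : L1 ℕ ℝ ≃ₜ FinHyp X) :
    Nontrivial X ∧ ConnectedSpace X ∧ LocallyPathConnectedSpace X ∧
      StronglyCountableDimensional X ∧ SigmaCompactSpace X := by
  have h1 : PathConnectedSpace (FinHyp X) := e.surjective.pathConnectedSpace e.continuous
  have h2 : LocallyPathConnectedSpace (FinHyp X) := e.symm.isOpenEmbedding.locallyPathConnectedSpace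
  have h3 : PathConnectedSpace X := FinHyp.pathConnectedSpace
  have h4 : SFD X := ((L1.sfd sfd_real).homeomorph e |>.subtype
    FinHyp.isClosedEmbedding_pt.isClosed_range).homeomorph
      FinHyp.isometry_pt.isEmbedding.toHomeomorph.symm
  refine ⟨?_, inferInstance, FinHyp.locallyPathConnectedSpace, h4.stronglyCountableDimensional,
    h4.sigmaCompactSpace⟩
  by_contra h
  rw [not_nontrivial_iff_subsingleton] at h
  have h5 : Subsingleton (FinHyp X) := ⟨fun A B => FinHyp.ext
    ((A.toSet_nonempty.eq_univ).trans B.toSet_nonempty.eq_univ.symm)⟩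
  have h6 := e.injective (Subsingleton.elim (e (Finsupp.single 0 (1 : ℝ) : ℕ →₀ ℝ)) (e 0))
  have h7 : (Finsupp.single 0 (1 : ℝ) : ℕ →₀ ℝ) 0 = 0 := DFunLike.congr_fun (F := L1 ℕ ℝ) h6 0
  simp at h7

theorem goodSpace_homeomorph {X : Type*} [MetricSpace X] [Nontrivial X] [ConnectedSpace X]
    [LocallyPathConnectedSpace X] [SigmaCompactSpace X] (h : StronglyCountableDimensional X) :
    Nonempty (FinHyp X ≃ₜ l2Fin ℕ) := by
  have : PathConnectedSpace X := pathConnectedSpace_iff_connectedSpace.2 inferInstance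
  let e : X ≃ₜ PathDist X := PathDist.homeomorph
  have : Nontrivial (PathDist X) := e.toEquiv.symm.nontrivial
  obtain ⟨φ⟩ := (PathDist.pathMetric.goodSpace_finHyp
    ((SFD.of_stronglyCountableDimensional h).homeomorph e)).homeomorph_l2Fin
      (FinHyp.dist_le_of_dist_le PathDist.dist_le_one)
  exact ⟨(FinHyp.congr e).trans φ⟩

end

end CurtisNhu

/-- (Curtis–Nhu) For a metrizable space `X`, the hyperspace `Fin(X)` is homeomorphic to
`ℓ₂^f(ℵ₀)` (the space of finitely supported square-summable sequences) if and only if `X`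
is non-degenerate, connected, locally path-connected, strongly countable-dimensional and
`σ`-compact. -/
theorem finHyp_homeomorph_l2Fin_iff (X : Type*) [MetricSpace X] :
    Nonempty (FinHyp X ≃ₜ l2Fin ℕ) ↔
      Nontrivial X ∧ ConnectedSpace X ∧ LocPathConnectedSpace X ∧
        StronglyCountableDimensional X ∧ SigmaCompactSpace X := by
  constructor
  · rintro ⟨e⟩
    exact FinHyp.of_homeomorph_L1 (CurtisNhu.l2Fin.mazur.trans e.symm)
  · rintro ⟨h1, h2, h3, h4, h5⟩
    have : LocallyPathConnectedSpace X := h3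
    exact CurtisNhu.goodSpace_homeomorph h4
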